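/- For each integer n ≥ 3 and any non-empty perfect compact space X that is homeomorphic to a polyhedron and admits a topological embedding into ℝ^{n−1}, there exists a topological embedding 𝔸 : X × 𝒞 → ℝⁿ such that the images 𝔸(X × {s}), s ∈ 𝒞, are pairwise ambiently incomparable, and moreover each image 𝔸(X × {s}) is wild: no homeomorphism of ℝⁿ onto itself maps 𝔸(X × {s}) onto a polyhedron in ℝⁿ. -/

import Mathlib

open Set Topology Metric

noncomputable section

/-- The coordinate line `ℝ × {0}^{n-1}` in `ℝⁿ`. -/
def coordLine (n : ℕ) : Set (EuclideanSpace ℝ (Fin n)) :=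
  {x | ∀ i : Fin n, (i : ℕ) ≠ 0 → x i = 0}

/-- The coordinate hyperplane `ℝ^{n-1} × {0}` in `ℝⁿ`. -/
def coordHyperplane (n : ℕ) : Set (EuclideanSpace ℝ (Fin n)) :=
  {x | ∀ i : Fin n, (i : ℕ) = n - 1 → x i = 0}

/-- `X` can be ambiently embedded in `Y`: some self-homeomorphism of `ℝⁿ` takes `X` into `Y`. -/
def AmbientlyEmbeds {n : ℕ} (X Y : Set (EuclideanSpace ℝ (Fin n))) : Prop :=
  ∃ h : EuclideanSpace ℝ (Fin n) ≃ₜ EuclideanSpace ℝ (Fin n), h '' X ⊆ Y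

/-- `X` and `Y` are ambiently incomparable. -/
def AmbientlyIncomparable {n : ℕ} (X Y : Set (EuclideanSpace ℝ (Fin n))) : Prop :=
  ¬ AmbientlyEmbeds X Y ∧ ¬ AmbientlyEmbeds Y X

/-- `X ⊆ ℝⁿ` is locally hyperplanar at `x ∈ X`. -/
def LocallyHyperplanarAt {n : ℕ} (X : Set (EuclideanSpace ℝ (Fin n)))
    (x : EuclideanSpace ℝ (Fin n)) : Prop :=
  ∃ U ∈ 𝓝 x, ∃ h : U → EuclideanSpace ℝ (Fin n), Topology.IsEmbedding h ∧
    ∀ y : U, (y : EuclideanSpace ℝ (Fin n)) ∈ X → h y ∈ coordHyperplane n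

/-- A compact zero-dimensional set `K ⊆ ℝⁿ` is tame if a self-homeomorphism of `ℝⁿ`
moves it into the coordinate line. -/
def TameSet {n : ℕ} (K : Set (EuclideanSpace ℝ (Fin n))) : Prop :=
  ∃ h : EuclideanSpace ℝ (Fin n) ≃ₜ EuclideanSpace ℝ (Fin n), h '' K ⊆ coordLine n

/-- `K` is locally tame at `x`. -/
def LocallyTameAt {n : ℕ} (K : Set (EuclideanSpace ℝ (Fin n)))
    (x : EuclideanSpace ℝ (Fin n)) : Prop :=
  ∃ U ∈ 𝓝 x, TameSet (K ∩ closure U)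

/-- `K` is everywhere wild: locally wild at each of its points. -/
def EverywhereWild {n : ℕ} (K : Set (EuclideanSpace ℝ (Fin n))) : Prop :=
  ∀ x ∈ K, ¬ LocallyTameAt K x

/-- `K` is a Cantor set: homeomorphic to the middle-thirds Cantor set. -/
def IsCantorSet {X : Type*} [TopologicalSpace X] (K : Set X) : Prop :=
  Nonempty (↥K ≃ₜ ↥cantorSet)

/-- The unit cube `Iⁿ = [0,1]ⁿ` in `ℝⁿ`. -/
def unitCube (n : ℕ) : Set (EuclideanSpace ℝ (Fin n)) :=
  {x | ∀ i, x i ∈ Set.Icc (0 : ℝ) 1}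

/-- The open face `(0,1)^{n-1} × {0}` of the unit cube. -/
def openFace (n : ℕ) : Set (EuclideanSpace ℝ (Fin n)) :=
  {x | (∀ i : Fin n, (i : ℕ) < n - 1 → x i ∈ Set.Ioo (0 : ℝ) 1) ∧
    ∀ i : Fin n, (i : ℕ) = n - 1 → x i = 0}

/-- A geometric simplex in `ℝᵐ`: the convex hull of an affinely independent finite family. -/
def IsSimplex {m : ℕ} (S : Set (EuclideanSpace ℝ (Fin m))) : Prop :=
  ∃ (d : ℕ) (v : Fin (d + 1) → EuclideanSpace ℝ (Fin m)),
    AffineIndependent ℝ v ∧ S = convexHull ℝ (Set.range v)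

/-- A polyhedron in `ℝᵐ`: a union of a finite collection of simplices. -/
def IsPolyhedron {m : ℕ} (P : Set (EuclideanSpace ℝ (Fin m))) : Prop :=
  ∃ (k : ℕ) (S : Fin k → Set (EuclideanSpace ℝ (Fin m))),
    (∀ i, IsSimplex (S i)) ∧ P = ⋃ i, S i

section Cocycles

variable {Y Z G : Type*} [TopologicalSpace Y] [TopologicalSpace Z] [Group G]

/-- `τ` is multiplicative near each point of `S`. -/
def CocycleOn (τ : Y → Y → G) (S : Set Y) : Prop :=
  ∀ x ∈ S, ∃ O ∈ 𝓝 x, ∀ a ∈ O, ∀ b ∈ O, ∀ c ∈ O, τ a b * τ b c = τ a c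

/-- `τ'` is, near each point of `S`, the twist of `τ` by one function `s`. -/
def CohomOn (τ τ' : Y → Y → G) (S : Set Y) : Prop :=
  ∃ s : Y → G, ∀ x ∈ S, ∃ O ∈ 𝓝 x, ∀ a ∈ O, ∀ b ∈ O, τ' a b = (s a)⁻¹ * τ a b * s b

/-- `τ` is a coboundary near each point of `S`. -/
def TrivOn (τ : Y → Y → G) (S : Set Y) : Prop :=
  ∃ σ : Y → G, ∀ x ∈ S, ∃ O ∈ 𝓝 x, ∀ a ∈ O, ∀ b ∈ O, τ a b = (σ a)⁻¹ * σ b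

theorem CocycleOn.mono {τ : Y → Y → G} {S T : Set Y} (h : CocycleOn τ T) (hST : S ⊆ T) :
    CocycleOn τ S := fun x hx => h x (hST hx)

theorem TrivOn.mono {τ : Y → Y → G} {S T : Set Y} (h : TrivOn τ T) (hST : S ⊆ T) :
    TrivOn τ S := by
  obtain ⟨σ, hσ⟩ := h
  exact ⟨σ, fun x hx => hσ x (hST hx)⟩

theorem CocycleOn.refl {τ : Y → Y → G} {S : Set Y} (h : CocycleOn τ S) {x : Y} (hx : x ∈ S) :
    τ x x = 1 := by
  obtain ⟨O, hO, h⟩ := h x hx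
  have hxO := mem_of_mem_nhds hO
  exact mul_eq_left.1 (h x hxO x hxO x hxO)

theorem CocycleOn.comp {τ : Z → Z → G} {S : Set Z} (h : CocycleOn τ S) {T : Set Y} {f : Y → Z}
    (hf : ∀ y ∈ T, ContinuousAt f y) (hT : MapsTo f T S) :
    CocycleOn (fun a b => τ (f a) (f b)) T := by
  intro x hx
  obtain ⟨O, hO, h⟩ := h (f x) (hT hx)
  exact ⟨f ⁻¹' O, hf x hx hO, fun a ha b hb c hc => h _ ha _ hb _ hc⟩

theorem TrivOn.comp {τ : Z → Z → G} {S : Set Z} (h : TrivOn τ S) {T : Set Y} {f : Y → Z}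
    (hf : ∀ y ∈ T, ContinuousAt f y) (hT : MapsTo f T S) :
    TrivOn (fun a b => τ (f a) (f b)) T := by
  obtain ⟨σ, hσ⟩ := h
  refine ⟨σ ∘ f, fun x hx => ?_⟩
  obtain ⟨O, hO, h⟩ := hσ (f x) (hT hx)
  exact ⟨f ⁻¹' O, hf x hx hO, fun a ha b hb => h _ ha _ hb⟩

theorem CohomOn.comp {τ τ' : Z → Z → G} {S : Set Z} (h : CohomOn τ τ' S) {T : Set Y} {f : Y → Z}
    (hf : ∀ y ∈ T, ContinuousAt f y) (hT : MapsTo f T S) :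
    CohomOn (fun a b => τ (f a) (f b)) (fun a b => τ' (f a) (f b)) T := by
  obtain ⟨σ, hσ⟩ := h
  refine ⟨σ ∘ f, fun x hx => ?_⟩
  obtain ⟨O, hO, h⟩ := hσ (f x) (hT hx)
  exact ⟨f ⁻¹' O, hf x hx hO, fun a ha b hb => h _ ha _ hb⟩

theorem CohomOn.symm {τ τ' : Y → Y → G} {S : Set Y} (h : CohomOn τ τ' S) : CohomOn τ' τ S := by
  obtain ⟨s, hs⟩ := h
  refine ⟨fun a => (s a)⁻¹, fun x hx => ?_⟩
  obtain ⟨O, hO, h⟩ := hs x hx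
  refine ⟨O, hO, fun a ha b hb => ?_⟩
  rw [h a ha b hb]; group

theorem CohomOn.of_eq {τ τ' : Y → Y → G} {S : Set Y}
    (h : ∀ x ∈ S, ∃ O ∈ 𝓝 x, ∀ a ∈ O, ∀ b ∈ O, τ' a b = τ a b) : CohomOn τ τ' S := by
  refine ⟨fun _ => 1, fun x hx => ?_⟩
  simpa using h x hx

theorem CohomOn.trans {τ τ' τ'' : Y → Y → G} {S : Set Y} (h : CohomOn τ τ' S)
    (h' : CohomOn τ' τ'' S) : CohomOn τ τ'' S := by
  obtain ⟨s, hs⟩ := h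
  obtain ⟨s', hs'⟩ := h'
  refine ⟨fun a => s a * s' a, fun x hx => ?_⟩
  obtain ⟨O, hO, h⟩ := hs x hx
  obtain ⟨O', hO', h'⟩ := hs' x hx
  refine ⟨O ∩ O', Filter.inter_mem hO hO', fun a ha b hb => ?_⟩
  rw [h' a ha.2 b hb.2, h a ha.1 b hb.1]; group

theorem CohomOn.cocycleOn {τ τ' : Y → Y → G} {S : Set Y} (h : CohomOn τ τ' S)
    (hτ : CocycleOn τ S) : CocycleOn τ' S := by
  obtain ⟨s, hs⟩ := h
  intro x hx
  obtain ⟨O, hO, h⟩ := hs x hx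
  obtain ⟨O', hO', h'⟩ := hτ x hx
  refine ⟨O ∩ O', Filter.inter_mem hO hO', fun a ha b hb c hc => ?_⟩
  rw [h a ha.1 b hb.1, h b hb.1 c hc.1, h a ha.1 c hc.1, ← h' a ha.2 b hb.2 c hc.2]; group

theorem CohomOn.trivOn {τ τ' : Y → Y → G} {S : Set Y} (h : CohomOn τ τ' S)
    (hτ : TrivOn τ S) : TrivOn τ' S := by
  obtain ⟨s, hs⟩ := h
  obtain ⟨σ, hσ⟩ := hτ
  refine ⟨fun a => σ a * s a, fun x hx => ?_⟩
  obtain ⟨O, hO, h⟩ := hs x hx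
  obtain ⟨O', hO', h'⟩ := hσ x hx
  refine ⟨O ∩ O', Filter.inter_mem hO hO', fun a ha b hb => ?_⟩
  rw [h a ha.1 b hb.1, h' a ha.2 b hb.2]; group

/-- A function that is locally constant along a preconnected set is constant on it. -/
theorem IsPreconnected.eq_of_locally_eq {T : Type*} {S : Set Y} (hS : IsPreconnected S)
    {f : Y → T} (hf : ∀ x ∈ S, ∃ O ∈ 𝓝 x, ∀ a ∈ O, a ∈ S → f a = f x) {x y : Y} (hx : x ∈ S)
    (hy : y ∈ S) : f x = f y := by
  refine hS.induction₂ (fun a b => f a = f b) (fun x hx => ?_) ?_ ?_ hx hy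
  · obtain ⟨O, hO, h⟩ := hf x hx
    filter_upwards [mem_nhdsWithin_of_mem_nhds hO, self_mem_nhdsWithin] with a ha haS
    exact (h a ha haS).symm
  · intro x y z _ _ _ h1 h2; exact h1.trans h2
  · intro x y _ _ h; exact h.symm

/-- A property that propagates locally along a preconnected set propagates along all of it. -/
theorem IsPreconnected.prop_of_locally {S : Set Y} (hS : IsPreconnected S)
    {p : Y → Prop} (hf : ∀ x ∈ S, ∃ O ∈ 𝓝 x, ∀ a ∈ O, ∀ b ∈ O, a ∈ S → b ∈ S → p a → p b)
    {x y : Y} (hx : x ∈ S) (hy : y ∈ S) (h : p x) : p y := by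
  have : p x = p y := by
    refine hS.eq_of_locally_eq (fun x hx => ?_) hx hy
    obtain ⟨O, hO, h⟩ := hf x hx
    exact ⟨O, hO, fun a ha haS => propext
      ⟨h _ ha _ (mem_of_mem_nhds hO) haS hx, h _ (mem_of_mem_nhds hO) _ ha hx haS⟩⟩
  exact this ▸ h

/-- Two trivializations over a preconnected set differ by a constant. -/
theorem IsPreconnected.trivialization_unique {τ : Y → Y → G} {S : Set Y} (hS : IsPreconnected S)
    {σ σ' : Y → G} (h : ∀ x ∈ S, ∃ O ∈ 𝓝 x, ∀ a ∈ O, ∀ b ∈ O, τ a b = (σ a)⁻¹ * σ b)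
    (h' : ∀ x ∈ S, ∃ O ∈ 𝓝 x, ∀ a ∈ O, ∀ b ∈ O, τ a b = (σ' a)⁻¹ * σ' b) {x y : Y}
    (hx : x ∈ S) (hy : y ∈ S) : σ' x * (σ x)⁻¹ = σ' y * (σ y)⁻¹ := by
  refine hS.eq_of_locally_eq (f := fun x => σ' x * (σ x)⁻¹) (fun x hx => ?_) hx hy
  obtain ⟨O, hO, h⟩ := h x hx
  obtain ⟨O', hO', h'⟩ := h' x hx
  refine ⟨O ∩ O', Filter.inter_mem hO hO', fun a ha _ => ?_⟩
  have e := (h a ha.1 x (mem_of_mem_nhds hO)).symm.trans (h' a ha.2 x (mem_of_mem_nhds hO'))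
  have e2 : σ x = σ a * ((σ' a)⁻¹ * σ' x) := by rw [← e]; group
  rw [e2]; group

/-- Parallel transport along the unit interval. -/
theorem CocycleOn.exists_transport {τ : ℝ → ℝ → G} (h : CocycleOn τ (Icc 0 1)) :
    ∃ P : ℝ → G, P 0 = 1 ∧ ∀ u ∈ Icc (0:ℝ) 1, ∃ O ∈ 𝓝 u, ∀ a ∈ O, ∀ b ∈ O,
      a ∈ Icc (0:ℝ) 1 → b ∈ Icc (0:ℝ) 1 → τ a b = (P a)⁻¹ * P b := by
  let p : ℝ → Prop := fun t => ∃ P : ℝ → G, ∀ u ∈ Icc (0:ℝ) t, ∃ O ∈ 𝓝 u, ∀ a ∈ O, ∀ b ∈ O,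
      a ∈ Icc (0:ℝ) t → b ∈ Icc (0:ℝ) t → τ a b = (P a)⁻¹ * P b
  have step : ∀ t t' : ℝ, ∀ O : Set ℝ, IsOpen O → 0 ≤ t → Icc t t' ⊆ O →
      (∀ a ∈ O, ∀ b ∈ O, ∀ c ∈ O, τ a b * τ b c = τ a c) → p t → p t' := by
    rintro t t' O hO h0 hsub hm ⟨P, hP⟩
    rcases le_or_gt t' t with htt | htt
    · refine ⟨P, fun u hu => ?_⟩
      obtain ⟨O, hO, h⟩ := hP u ⟨hu.1, hu.2.trans htt⟩
      exact ⟨O, hO, fun a ha b hb ha' hb' => h a ha b hb ⟨ha'.1, ha'.2.trans htt⟩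
        ⟨hb'.1, hb'.2.trans htt⟩⟩
    have htO : t ∈ O := hsub ⟨le_rfl, htt.le⟩
    have h1 : ∀ a ∈ O, τ a a = 1 := fun a ha => mul_eq_left.1 (hm a ha a ha a ha)
    refine ⟨fun u => if u ≤ t then P u else P t * τ t u, fun u hu => ?_⟩
    rcases lt_trichotomy u t with hut | hut | hut
    · obtain ⟨O', hO', h⟩ := hP u ⟨hu.1, hut.le⟩
      refine ⟨O' ∩ Iio t, Filter.inter_mem hO' (Iio_mem_nhds hut), fun a ha b hb ha' hb' => ?_⟩
      have := ha.2; have := hb.2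
      simp only [mem_Iio] at *
      rw [if_pos (by linarith), if_pos (by linarith)]
      exact h a ha.1 b hb.1 ⟨ha'.1, by linarith⟩ ⟨hb'.1, by linarith⟩
    · subst hut
      obtain ⟨O', hO', h⟩ := hP u ⟨hu.1, le_rfl⟩
      have huO' := mem_of_mem_nhds hO'
      refine ⟨O' ∩ O, Filter.inter_mem hO' (hO.mem_nhds htO), fun a ha b hb ha' hb' => ?_⟩
      dsimp only
      have key : ∀ a ∈ O' ∩ O, a ∈ Icc 0 t' →
          (if a ≤ u then P a else P u * τ u a) = P u * τ u a := by
        intro a ha ha'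
        split_ifs with hau
        · rw [h u huO' a ha.1 ⟨h0, le_rfl⟩ ⟨ha'.1, hau⟩]; group
        · rfl
      rw [key a ha ha', key b hb hb', ← hm a ha.2 u htO b hb.2]
      have := hm u htO a ha.2 u htO
      rw [h1 u htO, mul_eq_one_iff_eq_inv] at this
      rw [this]; group
    · refine ⟨O ∩ Ioi t, Filter.inter_mem (hO.mem_nhds (hsub ⟨hut.le, hu.2⟩)) (Ioi_mem_nhds hut),
        fun a ha b hb ha' hb' => ?_⟩
      have h3 := ha.2; have h4 := hb.2
      simp only [mem_Ioi] at h3 h4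
      dsimp only
      rw [if_neg (by linarith), if_neg (by linarith), ← hm a ha.1 t htO b hb.1]
      have := hm t htO a ha.1 t htO
      rw [h1 t htO, mul_eq_one_iff_eq_inv] at this
      rw [this]; group
  have p0 : p 0 := by
    obtain ⟨O, hO, hm⟩ := h 0 (by simp)
    have h0 := mem_of_mem_nhds hO
    refine ⟨fun _ => 1, fun u hu => ⟨univ, Filter.univ_mem, fun a _ b _ ha hb => ?_⟩⟩
    obtain rfl : a = 0 := le_antisymm ha.2 ha.1
    obtain rfl : b = 0 := le_antisymm hb.2 hb.1
    simpa using mul_eq_left.1 (hm 0 h0 0 h0 0 h0)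
  have p1 : p 1 := by
    refine isPreconnected_Icc.prop_of_locally (S := Icc (0:ℝ) 1) (fun x hx => ?_)
      (by simp : (0:ℝ) ∈ Icc (0:ℝ) 1) (by simp) p0
    obtain ⟨O, hO, hm⟩ := h x hx
    obtain ⟨ε, hε, hball⟩ := Metric.mem_nhds_iff.1 hO
    refine ⟨ball x ε, ball_mem_nhds x hε, fun a ha b hb ha' _ => ?_⟩
    refine step a b (ball x ε) isOpen_ball ha'.1 ?_ (fun a ha b hb c hc =>
      hm a (hball ha) b (hball hb) c (hball hc))
    exact (convex_ball x ε).ordConnected.out ha hb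
  obtain ⟨P, hP⟩ := p1
  refine ⟨fun u => (P 0)⁻¹ * P u, by simp, fun u hu => ?_⟩
  obtain ⟨O, hO, h⟩ := hP u hu
  refine ⟨O, hO, fun a ha b hb ha' hb' => ?_⟩
  rw [h a ha b hb ha' hb']; group

/-- Homotopic maps pull a cocycle back to cohomologous cocycles. -/
theorem CocycleOn.cohomOn_of_homotopy {τ : Z → Z → G} {S : Set Z} (hτ : CocycleOn τ S)
    {Y₀ : Set Y} (h : Y → ℝ → Z)
    (hc : ∀ y ∈ Y₀, ∀ t ∈ Icc (0:ℝ) 1, ContinuousAt (fun q : Y × ℝ => h q.1 q.2) (y, t))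
    (hS : ∀ y ∈ Y₀, ∀ t ∈ Icc (0:ℝ) 1, h y t ∈ S) (hY₀ : IsOpen Y₀) :
    CohomOn (fun a b => τ (h a 0) (h b 0)) (fun a b => τ (h a 1) (h b 1)) Y₀ := by
  have htr : ∀ y : Y, ∃ P : ℝ → G, y ∈ Y₀ → (P 0 = 1 ∧ ∀ u ∈ Icc (0:ℝ) 1, ∃ O ∈ 𝓝 u, ∀ a ∈ O,
      ∀ b ∈ O, a ∈ Icc (0:ℝ) 1 → b ∈ Icc (0:ℝ) 1 → τ (h y a) (h y b) = (P a)⁻¹ * P b) := by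
    intro y
    by_cases hy : y ∈ Y₀
    · have : CocycleOn (fun a b => τ (h y a) (h y b)) (Icc 0 1) :=
        hτ.comp (T := Icc (0:ℝ) 1) (f := h y)
          (fun t ht => (hc y hy t ht).comp (f := fun t => (y, t)) (by fun_prop))
          (fun t ht => hS y hy t ht)
      obtain ⟨P, hP⟩ := this.exists_transport
      exact ⟨P, fun _ => hP⟩
    · exact ⟨fun _ => 1, fun h => absurd h hy⟩
  choose P hP using htr
  refine ⟨fun y => P y 1, fun y hy => ?_⟩
  -- a neighbourhood of `y` over which the cocycle is multiplicative along the homotopy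
  have hO : ∃ O ∈ 𝓝 y, ∀ t ∈ Icc (0:ℝ) 1, ∃ I ∈ 𝓝 t, ∀ p ∈ O ×ˢ I, ∀ q ∈ O ×ˢ I, ∀ r ∈ O ×ˢ I,
      τ (h p.1 p.2) (h q.1 q.2) * τ (h q.1 q.2) (h r.1 r.2) = τ (h p.1 p.2) (h r.1 r.2) := by
    have key : ∀ T : Set ℝ, T ⊆ Icc (0:ℝ) 1 → IsCompact T → ∃ O ∈ 𝓝 y, ∀ t ∈ T,
      ∃ I ∈ 𝓝 t, ∀ p ∈ O ×ˢ I, ∀ q ∈ O ×ˢ I, ∀ r ∈ O ×ˢ I,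
      τ (h p.1 p.2) (h q.1 q.2) * τ (h q.1 q.2) (h r.1 r.2) = τ (h p.1 p.2) (h r.1 r.2) := by
      intro T hT hTc
      have hloc : ∀ t : ℝ, ∃ O ∈ 𝓝 y, ∃ I : Set ℝ, t ∈ Icc (0:ℝ) 1 → (I ∈ 𝓝 t ∧
          ∀ p ∈ O ×ˢ I, ∀ q ∈ O ×ˢ I, ∀ r ∈ O ×ˢ I,
          τ (h p.1 p.2) (h q.1 q.2) * τ (h q.1 q.2) (h r.1 r.2) =
            τ (h p.1 p.2) (h r.1 r.2)) := by
        intro t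
        by_cases ht : t ∈ Icc (0:ℝ) 1
        · obtain ⟨Q, hQ, hm⟩ := hτ (h y t) (hS y hy t ht)
          have := hc y hy t ht hQ
          rw [Filter.mem_map, mem_nhds_prod_iff] at this
          obtain ⟨O, hO, I, hI, hsub⟩ := this
          exact ⟨O, hO, I, fun _ => ⟨hI, fun p hp q hq r hr => hm _ (hsub hp) _ (hsub hq) _
            (hsub hr)⟩⟩
        · exact ⟨univ, Filter.univ_mem, ∅, fun h => absurd h ht⟩
      choose O hO I hI using hloc
      obtain ⟨F, hF, hcov⟩ := hTc.elim_nhds_subcover (fun t => interior (I t))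
        (fun t ht => interior_mem_nhds.2 (hI t (hT ht)).1)
      refine ⟨⋂ t ∈ F, O t, (Filter.biInter_finset_mem F).2 fun t _ => hO t, fun t ht => ?_⟩
      obtain ⟨t', ht', htI⟩ := mem_iUnion₂.1 (hcov ht)
      refine ⟨interior (I t'), isOpen_interior.mem_nhds htI, fun p hp q hq r hr => ?_⟩
      have hs : (⋂ t ∈ F, O t) ×ˢ interior (I t') ⊆ O t' ×ˢ I t' :=
        prod_mono (biInter_subset_of_mem ht') interior_subset
      exact (hI t' (hT (hF t' ht'))).2 p (hs hp) q (hs hq) r (hs hr)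
    exact key _ subset_rfl isCompact_Icc
  obtain ⟨O, hO, hm⟩ := hO
  refine ⟨O ∩ Y₀, Filter.inter_mem hO (hY₀.mem_nhds hy), fun a ha b hb => ?_⟩
  have hconst : P a 0 * τ (h a 0) (h b 0) * (P b 0)⁻¹ =
      P a 1 * τ (h a 1) (h b 1) * (P b 1)⁻¹ := by
    refine isPreconnected_Icc.eq_of_locally_eq (S := Icc (0:ℝ) 1)
      (f := fun t => P a t * τ (h a t) (h b t) * (P b t)⁻¹) (fun t ht => ?_)
      (by simp) (by simp)
    obtain ⟨I, hI, hm⟩ := hm t ht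
    obtain ⟨Ia, hIa, ha1⟩ := (hP a ha.2).2 t ht
    obtain ⟨Ib, hIb, hb1⟩ := (hP b hb.2).2 t ht
    refine ⟨I ∩ (Ia ∩ Ib), Filter.inter_mem hI (Filter.inter_mem hIa hIb), fun v hv hv' => ?_⟩
    have htI := mem_of_mem_nhds hI
    have e1 := ha1 v hv.2.1 t (mem_of_mem_nhds hIa) hv' ht
    have e2 := hb1 v hv.2.2 t (mem_of_mem_nhds hIb) hv' ht
    have e3 := hm (a, v) ⟨ha.1, hv.1⟩ (a, t) ⟨ha.1, htI⟩ (b, t) ⟨hb.1, htI⟩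
    have e4 := hm (a, v) ⟨ha.1, hv.1⟩ (b, v) ⟨hb.1, hv.1⟩ (b, t) ⟨hb.1, htI⟩
    dsimp only at e3 e4 ⊢
    rw [e1] at e3
    rw [e2, ← e3] at e4
    rw [← mul_inv_eq_iff_eq_mul.2 e4.symm]
    group
  rw [(hP a ha.2).1, (hP b hb.2).1] at hconst
  simp only [one_mul, inv_one, mul_one] at hconst
  dsimp only
  rw [hconst]; group

/-- Every cocycle on an open convex set is a coboundary. -/
theorem CocycleOn.trivOn_of_convex {E : Type*} [NormedAddCommGroup E] [NormedSpace ℝ E]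
    {τ : E → E → G} {U : Set E} (hτ : CocycleOn τ U) (hU : IsOpen U) (hconv : Convex ℝ U) :
    TrivOn τ U := by
  rcases U.eq_empty_or_nonempty with rfl | ⟨x₀, hx₀⟩
  · exact ⟨fun _ => 1, by simp⟩
  have := hτ.cohomOn_of_homotopy (Y₀ := U) (fun y t => x₀ + t • (y - x₀)) (by fun_prop)
    (fun y hy t ht => hconv.add_smul_sub_mem hx₀ hy ht) hU
  obtain ⟨s, hs⟩ := this
  refine ⟨s, fun x hx => ?_⟩
  obtain ⟨O, hO, h⟩ := hs x hx
  refine ⟨O, hO, fun a ha b hb => ?_⟩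
  have := h a ha b hb
  simpa [hτ.refl hx₀] using this

/-- Local agreement of two cocycles, one on each of two open sets, produces a glued cocycle. -/
theorem CocycleOn.congr {τ τ' : Y → Y → G} {S : Set Y} (hτ : CocycleOn τ S)
    (h : ∀ x ∈ S, ∃ O ∈ 𝓝 x, ∀ a ∈ O, ∀ b ∈ O, τ' a b = τ a b) : CocycleOn τ' S :=
  (CohomOn.of_eq h).cocycleOn hτ

end Cocycles


section NonSeparation

/-- A set on which locally constant functions are constant is preconnected. -/
theorem isPreconnected_of_forall_locally_const {Y : Type*} [TopologicalSpace Y] {S : Set Y}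
    (h : ∀ f : Y → ℤˣ, (∀ x ∈ S, ∃ O ∈ 𝓝 x, ∀ a ∈ O, a ∈ S → f a = f x) →
      ∀ x ∈ S, ∀ y ∈ S, f x = f y) : IsPreconnected S := by
  classical
  rintro u v hu hv hsub ⟨x, hxS, hxu⟩ ⟨y, hyS, hyv⟩
  by_contra hne
  have hne' : ∀ z ∈ S, z ∈ u → z ∉ v := fun z hz hzu hzv => hne ⟨z, hz, hzu, hzv⟩
  have := h (fun z => if z ∈ u then 1 else -1) (fun z hz => ?_) x hxS y hyS
  · have hyu : y ∉ u := fun hyu => hne' y hyS hyu hyv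
    simp only [if_pos hxu, if_neg hyu] at this
    exact absurd this (by decide)
  · rcases hsub hz with hzu | hzv
    · exact ⟨u, hu.mem_nhds hzu, fun a ha _ => by simp [ha, hzu]⟩
    · refine ⟨v, hv.mem_nhds hzv, fun a ha haS => ?_⟩
      have h1 : a ∉ u := fun hau => hne' a haS hau ha
      have h2 : z ∉ u := fun hzu => hne' z hz hzu hzv
      simp [h1, h2]

variable {E : Type*} [NormedAddCommGroup E] [NormedSpace ℝ E]

/-- Locally constant functions on `U \ A` take the same value at `p` and at `q`. -/
def NotSeparated (U : Set E) (p q : E) (A : Set E) : Prop :=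
  ∀ f : E → ℤˣ, (∀ x ∈ U, x ∉ A → ∃ O ∈ 𝓝 x, ∀ a ∈ O, f a = f x) → f p = f q

theorem NotSeparated.union {U : Set E} (hU : IsOpen U) (hconv : Convex ℝ U) {p q : E}
    {A B : Set E} (hA : IsClosed A) (hB : IsClosed B) (hAB : Disjoint A B)
    (h1 : NotSeparated U p q A) (h2 : NotSeparated U p q B) : NotSeparated U p q (A ∪ B) := by
  classical
  intro f hf
  obtain ⟨P, Q, hP, hQ, hAP, hBQ, hPQ⟩ := normal_separation hA hB hAB
  have hnP : ∀ x ∈ P, x ∉ Q := fun x hx hx' => disjoint_left.1 hPQ hx hx'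
  let τ : E → E → ℤˣ := fun a b => if (a ∈ Q ↔ b ∈ Q) then 1 else f a
  have hsq : ∀ u : ℤˣ, u * u = 1 := Int.units_mul_self
  have hτ : CocycleOn τ U := by
    intro x hxU
    by_cases hxQ : x ∈ Q
    · refine ⟨Q, hQ.mem_nhds hxQ, fun a ha b hb c hc => ?_⟩
      simp [τ, ha, hb, hc]
    by_cases hxP : x ∈ P
    · refine ⟨P, hP.mem_nhds hxP, fun a ha b hb c hc => ?_⟩
      simp [τ, hnP a ha, hnP b hb, hnP c hc]
    · obtain ⟨O, hO, h⟩ := hf x hxU (fun h => h.elim (fun h => hxP (hAP h)) fun h => hxQ (hBQ h))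
      refine ⟨O, hO, fun a ha b hb c hc => ?_⟩
      simp only [τ, h a ha, h b hb]
      by_cases h1 : a ∈ Q <;> by_cases h2 : b ∈ Q <;> by_cases h3 : c ∈ Q <;>
        simp [h1, h2, h3, hsq]
  obtain ⟨σ, hσ⟩ := hτ.trivOn_of_convex hU hconv
  have hloc : ∀ W : Set E, IsOpen W → (∀ a ∈ W, ∀ b ∈ W, τ a b = 1) → ∀ x ∈ W, x ∈ U →
      ∃ O ∈ 𝓝 x, O ⊆ W ∧ ∀ a ∈ O, σ a = σ x := by
    intro W hW hW1 x hx hxU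
    obtain ⟨O, hO, h⟩ := hσ x hxU
    refine ⟨O ∩ W, Filter.inter_mem hO (hW.mem_nhds hx), inter_subset_right, fun a ha => ?_⟩
    have := h a ha.1 x (mem_of_mem_nhds hO)
    rw [hW1 a ha.2 x hx] at this
    exact inv_mul_eq_one.1 this.symm
  have hτP : ∀ a ∈ P, ∀ b ∈ P, τ a b = 1 := fun a ha b hb => by simp [τ, hnP a ha, hnP b hb]
  have hτQ : ∀ a ∈ Q, ∀ b ∈ Q, τ a b = 1 := fun a ha b hb => by simp [τ, ha, hb]
  let g : E → ℤˣ := fun x => σ x * if x ∈ Q then f x else 1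
  have hg : ∀ x ∈ U, x ∉ B → ∃ O ∈ 𝓝 x, ∀ a ∈ O, g a = g x := by
    intro x hxU hxB
    by_cases hxP : x ∈ P
    · obtain ⟨O, hO, hOP, h⟩ := hloc P hP hτP x hxP hxU
      exact ⟨O, hO, fun a ha => by simp [g, h a ha, hnP a (hOP ha), hnP x hxP]⟩
    obtain ⟨O, hO, h⟩ := hf x hxU (fun h => h.elim (fun h => hxP (hAP h)) hxB)
    by_cases hxQ : x ∈ Q
    · obtain ⟨O', hO', hOQ, h'⟩ := hloc Q hQ hτQ x hxQ hxU
      exact ⟨O ∩ O', Filter.inter_mem hO hO', fun a ha => by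
        simp [g, h' a ha.2, hOQ ha.2, hxQ, h a ha.1]⟩
    · obtain ⟨O', hO', h'⟩ := hσ x hxU
      refine ⟨O ∩ O', Filter.inter_mem hO hO', fun a ha => ?_⟩
      have e := h' x (mem_of_mem_nhds hO') a ha.2
      have e' : σ a = σ x * τ x a := by rw [e]; group
      by_cases haQ : a ∈ Q
      · simp [g, e', haQ, hxQ, h a ha.1, τ, mul_assoc]
      · simp [g, e', haQ, hxQ, τ]
  have hfg : ∀ x ∈ U, x ∉ A → ∃ O ∈ 𝓝 x, ∀ a ∈ O, f a * g a = f x * g x := by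
    intro x hxU hxA
    by_cases hxB : x ∈ B
    · obtain ⟨O', hO', hOQ, h'⟩ := hloc Q hQ hτQ x (hBQ hxB) hxU
      refine ⟨O', hO', fun a ha => ?_⟩
      simp only [g, h' a ha, if_pos (hOQ ha), if_pos (hBQ hxB)]
      rw [mul_left_comm, hsq, mul_left_comm, hsq]
    · obtain ⟨O, hO, h⟩ := hf x hxU (fun h => h.elim hxA hxB)
      obtain ⟨O', hO', h'⟩ := hg x hxU hxB
      exact ⟨O ∩ O', Filter.inter_mem hO hO', fun a ha => by rw [h a ha.1, h' a ha.2]⟩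
  have e1 := h2 g hg
  have e2 := h1 (fun x => f x * g x) hfg
  rw [e1] at e2
  exact mul_right_cancel e2

theorem isPreconnected_shell (hE : 1 < Module.rank ℝ E) (x : E) {r R : ℝ} (hr : 0 ≤ r) :
    IsPreconnected {y : E | r < dist y x ∧ dist y x < R} := by
  have h := ((isPathConnected_sphere hE (0 : E) zero_le_one).isConnected.isPreconnected.prod
    (isPreconnected_Ioo (a := r) (b := R))).image (fun z => x + z.2 • z.1) (by fun_prop)
  convert h using 1
  ext y
  simp only [mem_ofPred_eq, mem_image, mem_prod, mem_sphere_iff_norm, sub_zero, mem_Ioo,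
    Prod.exists]
  constructor
  · rintro ⟨h1, h2⟩
    have hpos : 0 < ‖y - x‖ := by rw [← dist_eq_norm]; linarith
    refine ⟨‖y - x‖⁻¹ • (y - x), ‖y - x‖, ⟨?_, ?_⟩, ?_⟩
    · rw [norm_smul, norm_inv, norm_norm, inv_mul_cancel₀ hpos.ne']
    · rw [← dist_eq_norm]; exact ⟨h1, h2⟩
    · rw [smul_smul, mul_inv_cancel₀ hpos.ne']; simp
  · rintro ⟨s, t, ⟨hs, ht1, ht2⟩, rfl⟩
    have : dist (x + t • s) x = t := by
      rw [dist_eq_norm, add_sub_cancel_left, norm_smul, hs, mul_one, Real.norm_of_nonneg (by linarith)]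
    rw [this]; exact ⟨ht1, ht2⟩

theorem NotSeparated.of_subset_ball (hE : 1 < Module.rank ℝ E) {U : Set E} (hconv : Convex ℝ U)
    {p q x : E} (hp : p ∈ U) (hq : q ∈ U) {r R : ℝ} (hr : 0 < r) (hrR : r < R)
    (hRU : ball x R ⊆ U) (hpR : p ∉ ball x R) (hqR : q ∉ ball x R) {A : Set E}
    (hA : A ⊆ ball x r) : NotSeparated U p q A := by
  classical
  intro f hf
  have hout : ∀ y ∈ U, r < dist y x → ∃ O ∈ 𝓝 y, ∀ a ∈ O, f a = f y := fun y hy hd =>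
    hf y hy fun hyA => by have := hA hyA; rw [mem_ball] at this; linarith
  obtain ⟨v, hv⟩ : ∃ v, ∀ y, r < dist y x → dist y x < R → f y = v := by
    have hpre := isPreconnected_shell hE x (r := r) (R := R) hr.le
    rcases {y : E | r < dist y x ∧ dist y x < R}.eq_empty_or_nonempty with he | ⟨y₀, hy₀⟩
    · exact ⟨1, fun y h1 h2 => absurd (show y ∈ {y : E | r < dist y x ∧ dist y x < R} from ⟨h1, h2⟩)
        (by rw [he]; simp)⟩
    · refine ⟨f y₀, fun y h1 h2 => hpre.eq_of_locally_eq (fun z hz => ?_) ⟨h1, h2⟩ hy₀⟩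
      obtain ⟨O, hO, h⟩ := hout z (hRU hz.2) hz.1
      exact ⟨O, hO, fun a ha _ => h a ha⟩
  let g : E → ℤˣ := fun y => if y ∈ ball x R then v else f y
  have hg : g p = g q := by
    refine hconv.isPreconnected.eq_of_locally_eq (fun y hy => ?_) hp hq
    by_cases hyR : y ∈ ball x R
    · exact ⟨ball x R, isOpen_ball.mem_nhds hyR, fun a ha _ => by
        simp only [g, if_pos ha, if_pos hyR]⟩
    · have hy' : R ≤ dist y x := by simpa using hyR
      obtain ⟨O, hO, h⟩ := hout y hy (by linarith)
      refine ⟨O ∩ {z | r < dist z x}, Filter.inter_mem hO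
        ((isOpen_lt continuous_const (by fun_prop)).mem_nhds (show r < dist y x by linarith)),
        fun a ha _ => ?_⟩
      have hfa := h a ha.1
      by_cases haR : a ∈ ball x R
      · rw [hv a ha.2 haR] at hfa
        simp only [g, if_pos haR, if_neg hyR, hfa]
      · simp only [g, if_neg haR, if_neg hyR, hfa]
  simpa only [g, if_neg hpR, if_neg hqR] using hg

theorem NotSeparated.of_disjoint {U V : Set E} (hconv : Convex ℝ V) (hVU : V ⊆ U) {p q : E}
    (hp : p ∈ V) (hq : q ∈ V) {A : Set E} (hA : Disjoint A V) : NotSeparated U p q A := by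
  intro f hf
  refine hconv.isPreconnected.eq_of_locally_eq (fun y hy => ?_) hp hq
  obtain ⟨O, hO, h⟩ := hf y (hVU hy) (fun h => disjoint_left.1 hA h hy)
  exact ⟨O, hO, fun a ha _ => h a ha⟩

/-- A compact totally disconnected set does not separate an open convex set of dimension at
least two. -/
theorem Convex.isPreconnected_diff (hE : 1 < Module.rank ℝ E) {U : Set E} (hconv : Convex ℝ U)
    (hU : IsOpen U) {K : Set E} (hK : IsCompact K) (hKd : IsTotallyDisconnected K) :
    IsPreconnected (U \ K) := by
  classical
  refine isPreconnected_of_forall_locally_const fun f hf p hp q hq => ?_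
  have hf' : ∀ x ∈ U, x ∉ K → ∃ O ∈ 𝓝 x, ∀ a ∈ O, f a = f x := by
    intro x hx hxK
    obtain ⟨O, hO, h⟩ := hf x ⟨hx, hxK⟩
    exact ⟨O ∩ (U \ K), Filter.inter_mem hO ((hU.sdiff hK.isClosed).mem_nhds ⟨hx, hxK⟩),
      fun a ha => h a ha.1 ha.2⟩
  revert hf'
  suffices NotSeparated U p q K from this f
  have hseg : IsCompact (segment ℝ p q) := by
    rw [segment_eq_image_lineMap]
    exact isCompact_Icc.image AffineMap.lineMap_continuous
  obtain ⟨δ, hδ, hδU⟩ := hseg.exists_cthickening_subset_open hU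
    (hconv.segment_subset hp.1 hq.1)
  set V := Metric.thickening δ (segment ℝ p q) with hV
  have hVc : Convex ℝ V := (convex_segment p q).thickening δ
  have hVU : V ⊆ U := (thickening_subset_cthickening _ _).trans hδU
  have hpV : p ∈ V := self_subset_thickening hδ _ (left_mem_segment ℝ p q)
  have hqV : q ∈ V := self_subset_thickening hδ _ (right_mem_segment ℝ p q)
  have : CompactSpace K := isCompact_iff_compactSpace.1 hK
  have : TotallyDisconnectedSpace K := totallyDisconnectedSpace_subtype_iff.2 hKd
  have hpc : ∀ x : K, ∃ V : Set K, IsClopen V ∧ x ∈ V ∧ ∀ A ⊆ V,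
      NotSeparated U p q (Subtype.val '' A) := by
    intro x
    have hxp : (x : E) ≠ p := fun h => hp.2 (h ▸ x.2)
    have hxq : (x : E) ≠ q := fun h => hq.2 (h ▸ x.2)
    by_cases hxU : (x : E) ∈ U
    · have : U ∩ ({p}ᶜ ∩ {q}ᶜ) ∈ 𝓝 (x : E) := Filter.inter_mem (hU.mem_nhds hxU)
        (Filter.inter_mem (isOpen_compl_singleton.mem_nhds hxp)
          (isOpen_compl_singleton.mem_nhds hxq))
      obtain ⟨R, hR, hsub⟩ := Metric.mem_nhds_iff.1 this
      obtain ⟨W, hW, hxW, hWsub⟩ := compact_exists_isClopen_in_isOpen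
        (isOpen_ball.preimage continuous_subtype_val : IsOpen ((↑) ⁻¹' ball (x : E) (R / 2) : Set K))
        (by simp [hR] : x ∈ ((↑) ⁻¹' ball (x : E) (R / 2) : Set K))
      refine ⟨W, hW, hxW, fun A hA => NotSeparated.of_subset_ball hE hconv hp.1 hq.1
        (half_pos hR) (half_lt_self hR) (fun y hy => (hsub hy).1) (fun h => (hsub h).2.1 rfl)
        (fun h => (hsub h).2.2 rfl) ?_⟩
      rintro _ ⟨y, hy, rfl⟩
      exact hWsub (hA hy)
    · obtain ⟨W, hW, hxW, hWsub⟩ := compact_exists_isClopen_in_isOpen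
        ((isClosed_cthickening (δ := δ) (E := segment ℝ p q)).isOpen_compl.preimage
          continuous_subtype_val : IsOpen ((↑) ⁻¹' (Metric.cthickening δ (segment ℝ p q))ᶜ : Set K))
        (show x ∈ _ from fun h => hxU (hδU h))
      refine ⟨W, hW, hxW, fun A hA => NotSeparated.of_disjoint hVc hVU hpV hqV ?_⟩
      rw [disjoint_left]
      rintro _ ⟨y, hy, rfl⟩ hyV
      exact hWsub (hA hy) (thickening_subset_cthickening _ _ hyV)
  choose W hW hxW hWN using hpc
  obtain ⟨t, ht⟩ := isCompact_univ.elim_finite_subcover W (fun x => (hW x).isOpen)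
    (fun x _ => mem_iUnion.2 ⟨x, hxW x⟩)
  have hind : ∀ t : Finset K, ∀ A : Set K, IsClopen A → (A ⊆ ⋃ i ∈ t, W i) →
      NotSeparated U p q (Subtype.val '' A) := by
    intro t
    induction t using Finset.induction_on with
    | empty =>
      intro A hA hAs
      have : A = ∅ := by simpa using hAs
      subst this
      exact NotSeparated.of_disjoint hVc hVU hpV hqV (by simp)
    | insert x t hx ih =>
      intro A hA hAs
      have hsplit : A = (A ∩ W x) ∪ (A \ W x) := (inter_union_sdiff A (W x)).symm
      rw [hsplit, image_union]
      have hcl : ∀ B : Set K, IsClopen B → IsClosed (Subtype.val '' B) := fun B hB =>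
        (hB.isClosed.isCompact.image continuous_subtype_val).isClosed
      refine NotSeparated.union hU hconv (hcl _ (hA.inter (hW x))) (hcl _ (hA.diff (hW x)))
        ?_ (hWN x _ inter_subset_right) (ih _ (hA.diff (hW x)) ?_)
      · exact (disjoint_image_iff Subtype.val_injective).2
          (disjoint_left.2 fun y hy hy' => hy'.2 hy.2)
      · rintro y ⟨hy, hyW⟩
        have := hAs hy
        rw [Finset.set_biUnion_insert] at this
        exact this.resolve_left hyW
  have := hind t univ isClopen_univ (by simpa using ht)
  simpa using this

end NonSeparation

/-- Closed sets with empty interior that locally do not separate. -/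
structure ThinSet {M : Type*} [TopologicalSpace M] (F : Set M) : Prop where
  isClosed : IsClosed F
  interior_eq : interior F = ∅
  small : ∀ x ∈ F, ∀ V ∈ 𝓝 x, ∃ O ∈ 𝓝 x, O ⊆ V ∧ IsPreconnected (O \ F)

section Thin

variable {M N : Type*} [TopologicalSpace M] [TopologicalSpace N]

theorem ThinSet.exists_mem {F : Set M} (hF : ThinSet F) {x : M} {V : Set M} (hV : V ∈ 𝓝 x) :
    ∃ y ∈ V, y ∉ F := by
  by_contra! h
  have : x ∈ interior F := mem_interior_iff_mem_nhds.2 (Filter.mem_of_superset hV h)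
  simp [hF.interior_eq] at this

/-- A thin set does not separate connected open sets. -/
theorem ThinSet.isPreconnected_diff {F : Set M} (hF : ThinSet F) {U : Set M} (hU : IsOpen U)
    (hUc : IsPreconnected U) : IsPreconnected (U \ F) := by
  classical
  refine isPreconnected_of_forall_locally_const fun f hf p hp q hq => ?_
  have hO : ∀ x : M, ∃ O : Set M, x ∈ F → x ∈ U → (O ∈ 𝓝 x ∧ O ⊆ U ∧ ∃ v, ∀ y ∈ O \ F, f y = v) := by
    intro x
    by_cases hx : x ∈ F ∧ x ∈ U
    · obtain ⟨O, hO, hOU, hpre⟩ := hF.small x hx.1 U (hU.mem_nhds hx.2)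
      refine ⟨O, fun _ _ => ⟨hO, hOU, ?_⟩⟩
      obtain ⟨z, hzO, hzF⟩ := hF.exists_mem hO
      refine ⟨f z, fun y hy => hpre.eq_of_locally_eq (fun w hw => ?_) hy ⟨hzO, hzF⟩⟩
      obtain ⟨Q, hQ, h⟩ := hf w ⟨hOU hw.1, hw.2⟩
      exact ⟨Q, hQ, fun a ha haO => h a ha ⟨hOU haO.1, haO.2⟩⟩
    · exact ⟨∅, fun h1 h2 => absurd ⟨h1, h2⟩ hx⟩
  choose O hO using hO
  choose hOn hOU v hv using hO
  let g : M → ℤˣ := fun x => if h : x ∈ F ∧ x ∈ U then v x h.1 h.2 else f x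
  have hgf : ∀ x, x ∉ F → g x = f x := fun x hx => dif_neg fun h => hx h.1
  have hg : g p = g q := by
    refine hUc.eq_of_locally_eq (fun x hx => ?_) hp.1 hq.1
    by_cases hxF : x ∈ F
    · have hgx : g x = v x hxF hx := dif_pos ⟨hxF, hx⟩
      refine ⟨interior (O x), interior_mem_nhds.2 (hOn x hxF hx), fun a ha haU => ?_⟩
      by_cases haF : a ∈ F
      · obtain ⟨y, hy, hyF⟩ := hF.exists_mem
          (Filter.inter_mem (isOpen_interior.mem_nhds ha) (hOn a haF haU))
        have hga : g a = v a haF haU := dif_pos ⟨haF, haU⟩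
        rw [hga, hgx, ← hv x hxF hx y ⟨interior_subset hy.1, hyF⟩, ← hv a haF haU y ⟨hy.2, hyF⟩]
      · rw [hgf a haF, hgx, hv x hxF hx a ⟨interior_subset ha, haF⟩]
    · obtain ⟨Q, hQ, h⟩ := hf x ⟨hx, hxF⟩
      refine ⟨Q ∩ Fᶜ, Filter.inter_mem hQ (hF.isClosed.isOpen_compl.mem_nhds hxF),
        fun a ha haU => ?_⟩
      rw [hgf a ha.2, hgf x hxF, h a ha.1 ⟨haU, ha.2⟩]
  rwa [hgf p hp.2, hgf q hq.2] at hg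

theorem ThinSet.union {A B : Set M} (hA : ThinSet A) (hB : ThinSet B) (h : Disjoint A B) :
    ThinSet (A ∪ B) where
  isClosed := hA.isClosed.union hB.isClosed
  interior_eq := by rw [interior_union_isClosed_of_interior_empty hA.isClosed hB.interior_eq,
    hA.interior_eq]
  small := by
    have key : ∀ A B : Set M, ThinSet A → ThinSet B → Disjoint A B → ∀ x ∈ A, ∀ V ∈ 𝓝 x,
        ∃ O ∈ 𝓝 x, O ⊆ V ∧ IsPreconnected (O \ (A ∪ B)) := by
      intro A B hA hB h x hx V hV
      obtain ⟨O, hO, hOV, hpre⟩ := hA.small x hx (V ∩ Bᶜ) (Filter.inter_mem hV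
        (hB.isClosed.isOpen_compl.mem_nhds (disjoint_left.1 h hx)))
      refine ⟨O, hO, hOV.trans inter_subset_left, ?_⟩
      convert hpre using 1
      ext y
      simp only [mem_sdiff, mem_union, not_or]
      exact ⟨fun h => ⟨h.1, h.2.1⟩, fun h => ⟨h.1, h.2, (hOV h.1).2⟩⟩
    rintro x (hx | hx) V hV
    · exact key A B hA hB h x hx V hV
    · rw [union_comm]; exact key B A hB hA h.symm x hx V hV

theorem thinSet_empty : ThinSet (∅ : Set M) := ⟨isClosed_empty, interior_empty, by simp⟩

theorem ThinSet.biUnion {ι : Type*} (s : Finset ι) {A : ι → Set M} (hA : ∀ i ∈ s, ThinSet (A i))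
    (h : ∀ i ∈ s, ∀ j ∈ s, i ≠ j → Disjoint (A i) (A j)) : ThinSet (⋃ i ∈ s, A i) := by
  classical
  induction s using Finset.induction_on with
  | empty => simpa using thinSet_empty
  | insert x t hx ih =>
    rw [Finset.set_biUnion_insert]
    refine (hA x (by simp)).union (ih (fun i hi => hA i (by simp [hi])) fun i hi j hj =>
      h i (by simp [hi]) j (by simp [hj])) ?_
    simp only [disjoint_iUnion_right]
    exact fun i hi => h x (by simp) i (by simp [hi]) (by rintro rfl; exact hx hi)

theorem ThinSet.image {F : Set M} (hF : ThinSet F) (H : M ≃ₜ N) : ThinSet (H '' F) where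
  isClosed := H.isClosed_image.2 hF.isClosed
  interior_eq := by rw [← H.image_interior, hF.interior_eq, image_empty]
  small := by
    rintro _ ⟨x, hx, rfl⟩ V hV
    obtain ⟨O, hO, hOV, hpre⟩ := hF.small x hx (H ⁻¹' V) (H.continuous.continuousAt hV)
    refine ⟨H '' O, by
      rw [← H.map_nhds_eq]; exact Filter.image_mem_map hO, image_subset_iff.2 hOV, ?_⟩
    rw [← image_sdiff H.injective]
    exact hpre.image _ H.continuous.continuousOn

end Thin

section ThinExamples

variable {E : Type*} [NormedAddCommGroup E] [NormedSpace ℝ E]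

theorem IsTotallyDisconnected.interior_eq_empty (hE : 0 < Module.rank ℝ E) {K : Set E}
    (hKd : IsTotallyDisconnected K) : interior K = ∅ := by
  by_contra hne
  obtain ⟨x, hx⟩ := nonempty_iff_ne_empty.2 hne
  obtain ⟨ε, hε, hsub⟩ := Metric.mem_nhds_iff.1 (mem_interior_iff_mem_nhds.1 hx)
  have hss := hKd _ hsub (convex_ball x ε).isPreconnected
  have : Nontrivial E := rank_pos_iff_nontrivial.1 hE
  obtain ⟨v, hv⟩ := exists_ne (0 : E)
  have hn : 0 < ‖v‖ := norm_pos_iff.2 hv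
  have hmem : x + (ε / 2 / ‖v‖) • v ∈ ball x ε := by
    rw [mem_ball, dist_eq_norm, add_sub_cancel_left, norm_smul, Real.norm_of_nonneg (by positivity),
      div_mul_cancel₀ _ hn.ne']
    linarith
  have := hss hmem (mem_ball_self hε)
  simp [hv, hn.ne', hε.ne'] at this

theorem IsCompact.thinSet (hE : 1 < Module.rank ℝ E) {K : Set E} (hK : IsCompact K)
    (hKd : IsTotallyDisconnected K) : ThinSet K where
  isClosed := hK.isClosed
  interior_eq := hKd.interior_eq_empty (zero_lt_one.trans hE)
  small := by
    intro x _ V hV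
    obtain ⟨ε, hε, hsub⟩ := Metric.mem_nhds_iff.1 hV
    exact ⟨ball x ε, ball_mem_nhds x hε, hsub,
      (convex_ball x ε).isPreconnected_diff hE isOpen_ball hK hKd⟩

/-- A closed set inside a line `{x} × ℝ` is thin. -/
theorem thinSet_of_subset_line (hE : 1 < Module.rank ℝ E) {x : E} {F : Set (E × ℝ)}
    (hF : IsClosed F) (hFx : ∀ p ∈ F, p.1 = x) : ThinSet F := by
  have hcl : ∀ ε > 0, ball x ε ⊆ closure (ball x ε \ {x}) := by
    intro ε hε y hy
    have : Nontrivial E := rank_pos_iff_nontrivial.1 (zero_lt_one.trans hE)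
    have := Module.punctured_nhds_neBot ℝ E x
    by_cases h : y = x
    · subst h
      rw [mem_closure_iff_nhds]
      intro t ht
      obtain ⟨z, hz⟩ := (Filter.nonempty_of_mem (Filter.inter_mem
        (mem_nhdsWithin_of_mem_nhds (Filter.inter_mem ht (ball_mem_nhds y hε)))
          (self_mem_nhdsWithin (s := {y}ᶜ))))
      exact ⟨z, hz.1.1, hz.1.2, hz.2⟩
    · exact subset_closure ⟨hy, h⟩
  have hp : ∀ ε > 0, ∀ I : Set ℝ, IsPreconnected I → IsPreconnected ((ball x ε ×ˢ I) \ F) := by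
    intro ε hε I hI
    have h1 : IsPreconnected (ball x ε \ {x}) :=
      (convex_ball x ε).isPreconnected_diff hE isOpen_ball isCompact_singleton
        isTotallyDisconnected_singleton
    refine (h1.prod hI).subset_closure ?_ ?_
    · rintro ⟨a, b⟩ ⟨ha, hb⟩
      exact ⟨⟨ha.1, hb⟩, fun h => ha.2 (hFx _ h)⟩
    · rw [closure_prod_eq]
      exact fun p hp => ⟨hcl ε hε hp.1.1, subset_closure hp.1.2⟩
  refine ⟨hF, ?_, ?_⟩
  · by_contra hne
    obtain ⟨p, hp⟩ := nonempty_iff_ne_empty.2 hne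
    obtain ⟨ε, hε, hsub⟩ := Metric.mem_nhds_iff.1 (mem_interior_iff_mem_nhds.1 hp)
    have hpx := hFx p (interior_subset hp)
    obtain ⟨z, hz⟩ := closure_nonempty_iff.1 ⟨x, hcl ε hε (mem_ball_self hε)⟩
    refine hz.2 (hFx (z, p.2) (hsub ?_))
    rw [mem_ball, Prod.dist_eq]
    simpa [hpx, hε] using hz.1
  · rintro ⟨a, b⟩ hab V hV
    obtain ⟨ε, hε, hsub⟩ := Metric.mem_nhds_iff.1 hV
    have hax : a = x := hFx _ hab
    rw [hax] at hsub hab hV ⊢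
    refine ⟨ball (x, b) ε, ball_mem_nhds _ hε, hsub, ?_⟩
    rw [← ball_prod_same]
    exact hp ε hε _ (convex_ball b ε).isPreconnected

end ThinExamples


section Wildness

variable {M N G : Type*} [TopologicalSpace M] [TopologicalSpace N] [Group G]

/-- Some `G`-valued cocycle on the complement of `K` near `x` is nontrivial arbitrarily near `x`. -/
def WildAt (G : Type*) [Group G] (K : Set M) (x : M) : Prop :=
  ∃ U : Set M, IsOpen U ∧ x ∈ U ∧ ∃ τ : M → M → G, CocycleOn τ (U \ K) ∧
    ∀ V : Set M, IsOpen V → x ∈ V → V ⊆ U → ¬ TrivOn τ (V \ K)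

theorem WildAt.map {K : Set M} {L : Set N} {x : M} (h : WildAt G K x) (φ : OpenPartialHomeomorph M N)
    (hx : x ∈ φ.source) (hKL : ∀ y ∈ φ.source, y ∈ K ↔ φ y ∈ L) : WildAt G L (φ x) := by
  obtain ⟨U, hU, hxU, τ, hτ, hV⟩ := h
  have hsub : ∀ y ∈ φ.target ∩ φ.symm ⁻¹' U, φ.symm y ∈ U := fun y hy => hy.2
  refine ⟨φ.target ∩ φ.symm ⁻¹' U, φ.isOpen_inter_preimage_symm hU,
    ⟨φ.map_source hx, by simpa [φ.left_inv hx] using hxU⟩,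
    fun a b => τ (φ.symm a) (φ.symm b), ?_, fun V hVo hxV hVs ht => ?_⟩
  · refine hτ.comp (fun y hy => φ.continuousAt_symm hy.1.1) fun y hy => ⟨hy.1.2, fun h => hy.2 ?_⟩
    have := (hKL _ (φ.map_target hy.1.1)).1 h
    rwa [φ.right_inv hy.1.1] at this
  · have hW : IsOpen (φ.source ∩ φ ⁻¹' V) := φ.isOpen_inter_preimage hVo
    refine hV (φ.source ∩ φ ⁻¹' V) hW ⟨hx, hxV⟩ ?_ ?_
    · intro y hy
      have := (hVs hy.2).2
      rwa [mem_preimage, φ.left_inv hy.1] at this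
    · have h2 := ht.comp (T := (φ.source ∩ φ ⁻¹' V) \ K) (f := φ)
        (fun y hy => φ.continuousAt hy.1.1)
        (fun y hy => ⟨hy.1.2, fun h => hy.2 ((hKL y hy.1.1).2 h)⟩)
      refine (CohomOn.of_eq fun y hy => ⟨φ.source, φ.open_source.mem_nhds hy.1.1,
        fun a ha b hb => ?_⟩).trivOn h2
      simp only [φ.left_inv ha, φ.left_inv hb]

theorem WildAt.homeomorph {K : Set M} {x : M} (h : WildAt G K x) (H : M ≃ₜ N) :
    WildAt G (H '' K) (H x) :=
  h.map H.toOpenPartialHomeomorph (by simp) (by simp)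

theorem WildAt.mem {K : Set M} {x : M} (h : WildAt G K x) : x ∈ K := by
  by_contra hx
  obtain ⟨U, hU, hxU, τ, hτ, hV⟩ := h
  obtain ⟨O, hO, hm⟩ := hτ x ⟨hxU, hx⟩
  have hxO := mem_of_mem_nhds hO
  have h1 := mul_eq_left.1 (hm x hxO x hxO x hxO)
  refine hV (interior O ∩ U) (isOpen_interior.inter hU) ⟨mem_interior_iff_mem_nhds.2 hO, hxU⟩
    inter_subset_right ⟨fun a => τ x a, fun y hy => ⟨interior O, isOpen_interior.mem_nhds hy.1.1,
      fun a ha b hb => ?_⟩⟩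
  have e1 := hm x hxO a (interior_subset ha) b (interior_subset hb)
  dsimp only
  rw [← e1]; group

/-- Over a preconnected part of a set where `τ` is multiplicative, a trivialization is a constant
multiple of `τ z`. -/
theorem IsPreconnected.exists_trivialization_eq {τ : M → M → G} {σ : M → G} {S O : Set M}
    (hS : IsPreconnected S) (hSO : S ⊆ O)
    (hm : ∀ a ∈ O, ∀ b ∈ O, ∀ c ∈ O, τ a b * τ b c = τ a c)
    (hσ : ∀ x ∈ S, ∃ Q ∈ 𝓝 x, ∀ a ∈ Q, ∀ b ∈ Q, τ a b = (σ a)⁻¹ * σ b) {z : M} (hz : z ∈ O) :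
    ∃ c, ∀ a ∈ S, σ a = c * τ z a := by
  rcases S.eq_empty_or_nonempty with rfl | ⟨y, hy⟩
  · exact ⟨1, by simp⟩
  refine ⟨σ y * (τ z y)⁻¹, fun a ha => ?_⟩
  have := hS.eq_of_locally_eq (f := fun a => σ a * (τ z a)⁻¹) (fun x hx => ?_) ha hy
  · rw [← this]; group
  · obtain ⟨Q, hQ, h⟩ := hσ x hx
    refine ⟨Q, hQ, fun a ha haS => ?_⟩
    have e1 := h x (mem_of_mem_nhds hQ) a ha
    have e2 := hm z hz x (hSO hx) a (hSO haS)
    rw [← e2, e1]; group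

/-- Wildness is monotone. -/
theorem WildAt.mono {K K' : Set M} {x : M} (h : WildAt G K x) (hKK' : K ⊆ K') (hK : IsClosed K)
    (hK' : ThinSet K') : WildAt G K' x := by
  classical
  obtain ⟨U, hU, hxU, τ, hτ, hV⟩ := h
  refine ⟨U, hU, hxU, τ, hτ.mono (sdiff_subset_sdiff_right hKK'), fun V hVo hxV hVU ht => ?_⟩
  obtain ⟨σ, hσ⟩ := ht
  refine hV V hVo hxV hVU ?_
  have key : ∀ y : M, ∃ (O : Set M) (c : G), y ∈ V → y ∉ K → (O ∈ 𝓝 y ∧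
      (∀ a ∈ O, ∀ b ∈ O, ∀ c ∈ O, τ a b * τ b c = τ a c) ∧ ∀ a ∈ O \ K', σ a = c * τ y a) := by
    intro y
    by_cases hy : y ∈ V ∧ y ∉ K
    · obtain ⟨O, hO, hm⟩ := hτ y ⟨hVU hy.1, hy.2⟩
      by_cases hyK : y ∈ K'
      · obtain ⟨Q, hQ, hQs, hp⟩ :=
          hK'.small y hyK (O ∩ V) (Filter.inter_mem hO (hVo.mem_nhds hy.1))
        obtain ⟨c, hc⟩ := hp.exists_trivialization_eq (τ := τ) (σ := σ) (O := O)
          (fun a ha => (hQs ha.1).1) hm (fun a ha => hσ a ⟨(hQs ha.1).2, ha.2⟩)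
          (mem_of_mem_nhds hO)
        exact ⟨Q, c, fun _ _ => ⟨hQ, fun a ha b hb c hc => hm a (hQs ha).1 b (hQs hb).1
          c (hQs hc).1, hc⟩⟩
      · obtain ⟨Q, hQ, h⟩ := hσ y ⟨hy.1, hyK⟩
        refine ⟨O ∩ Q, σ y, fun _ _ => ⟨Filter.inter_mem hO hQ, fun a ha b hb c hc =>
          hm a ha.1 b hb.1 c hc.1, fun a ha => ?_⟩⟩
        rw [h y (mem_of_mem_nhds hQ) a ha.1.2]; group
    · exact ⟨∅, 1, fun h1 h2 => absurd ⟨h1, h2⟩ hy⟩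
  choose O c hOc using key
  refine ⟨c, fun y hy => ⟨interior (O y) ∩ (V ∩ Kᶜ), Filter.inter_mem (interior_mem_nhds.2 (hOc y hy.1 hy.2).1)
    (Filter.inter_mem (hVo.mem_nhds hy.1) (hK.isOpen_compl.mem_nhds hy.2)), ?_⟩⟩
  obtain ⟨hOy, hm, hcy⟩ := hOc y hy.1 hy.2
  have hyO := mem_of_mem_nhds hOy
  have hc : ∀ a ∈ interior (O y) ∩ (V ∩ Kᶜ), c a = c y * τ y a := by
    intro a ha
    obtain ⟨hOa, -, hca⟩ := hOc a ha.2.1 ha.2.2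
    obtain ⟨u, hu, huK⟩ := hK'.exists_mem
      (Filter.inter_mem hOa (isOpen_interior.mem_nhds ha.1))
    have e1 := hca u ⟨hu.1, huK⟩
    rw [hcy u ⟨interior_subset hu.2, huK⟩,
      ← hm y hyO a (interior_subset ha.1) u (interior_subset hu.2), ← mul_assoc] at e1
    exact (mul_right_cancel e1).symm
  intro a ha b hb
  rw [hc a ha, hc b hb, ← hm y hyO a (interior_subset ha.1) b (interior_subset hb.1)]; group

/-- Near a point of a flat set, the ambient space has a chart flattening the set. -/
def FlatAt (F : Type*) [TopologicalSpace F] (X : Set M) (x : M) : Prop :=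
  ∃ φ : OpenPartialHomeomorph M (F × ℝ), x ∈ φ.source ∧ ∀ y ∈ φ.source, y ∈ X → (φ y).2 = 0

theorem FlatAt.mono {F : Type*} [TopologicalSpace F] {X Y : Set M} {x : M} (h : FlatAt F Y x)
    (hXY : X ⊆ Y) : FlatAt F X x := by
  obtain ⟨φ, hx, h⟩ := h
  exact ⟨φ, hx, fun y hy hyX => h y hy (hXY hyX)⟩

end Wildness

section Flat

variable {F G : Type*} [NormedAddCommGroup F] [NormedSpace ℝ F] [Group G]

/-- A cocycle off a subset of a hyperplane slab is a coboundary when the subset does not separate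
the hyperplane piece. -/
theorem trivOn_of_flat {τ : F × ℝ → F × ℝ → G} {D : Set F} (hD : IsOpen D) (hDc : Convex ℝ D)
    {ε : ℝ} {L : Set (F × ℝ)} (hL : ∀ y ∈ D ×ˢ Ioo (-ε) ε, y ∈ L → y.2 = 0)
    (hpre : IsPreconnected {z | z ∈ D ∧ (z, (0:ℝ)) ∉ L})
    (hLo : IsOpen ((D ×ˢ Ioo (-ε) ε) \ L)) (hτ : CocycleOn τ ((D ×ˢ Ioo (-ε) ε) \ L)) :
    TrivOn τ ((D ×ˢ Ioo (-ε) ε) \ L) := by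
  classical
  have hp : CocycleOn τ (D ×ˢ Ioo 0 ε) := hτ.mono fun y hy =>
    ⟨⟨hy.1, by linarith [hy.2.1, hy.2.2], hy.2.2⟩, fun h => hy.2.1.ne'
      (hL y ⟨hy.1, by linarith [hy.2.1, hy.2.2], hy.2.2⟩ h)⟩
  have hn : CocycleOn τ (D ×ˢ Ioo (-ε) 0) := hτ.mono fun y hy =>
    ⟨⟨hy.1, hy.2.1, by linarith [hy.2.1, hy.2.2]⟩, fun h => hy.2.2.ne
      (hL y ⟨hy.1, hy.2.1, by linarith [hy.2.1, hy.2.2]⟩ h)⟩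
  obtain ⟨σ₁, hσ₁⟩ := hp.trivOn_of_convex (hD.prod isOpen_Ioo) (hDc.prod (convex_Ioo _ _))
  obtain ⟨σ₂, hσ₂⟩ := hn.trivOn_of_convex (hD.prod isOpen_Ioo) (hDc.prod (convex_Ioo _ _))
  have key : ∀ z : F, ∃ (O : Set (F × ℝ)) (c₁ c₂ : G), z ∈ D → (z, (0:ℝ)) ∉ L → 0 < ε →
      (IsOpen O ∧ (z, (0:ℝ)) ∈ O ∧ O ⊆ D ×ˢ Ioo (-ε) ε ∧
      (∀ a ∈ O, ∀ b ∈ O, ∀ c ∈ O, τ a b * τ b c = τ a c) ∧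
      (∀ a ∈ O, 0 < a.2 → σ₁ a = c₁ * τ (z, 0) a) ∧ ∀ a ∈ O, a.2 < 0 → σ₂ a = c₂ * τ (z, 0) a) := by
    intro z
    by_cases hz : z ∈ D ∧ (z, (0:ℝ)) ∉ L ∧ 0 < ε
    · have hzU : (z, (0:ℝ)) ∈ D ×ˢ Ioo (-ε) ε := ⟨hz.1, by linarith [hz.2.2], hz.2.2⟩
      obtain ⟨Q, hQ, hm⟩ := hτ (z, 0) ⟨hzU, hz.2.1⟩
      obtain ⟨r, hr, hsub⟩ := Metric.mem_nhds_iff.1 (Filter.inter_mem hQ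
        ((hD.prod isOpen_Ioo).mem_nhds hzU))
      have hb : ∀ a : F × ℝ, a ∈ ball z r ×ˢ Ioo (-r) r → a ∈ ball (z, (0:ℝ)) r := by
        intro a ha
        rw [← ball_prod_same]
        exact ⟨ha.1, by rw [mem_ball, Real.dist_eq, sub_zero, abs_lt]; exact ha.2⟩
      obtain ⟨c₁, h1⟩ := ((convex_ball z r).prod (convex_Ioo 0 r)).isPreconnected
        |>.exists_trivialization_eq (τ := τ) (σ := σ₁) (O := Q)
        (fun a ha => (hsub (hb a ⟨ha.1, by linarith [ha.2.1], ha.2.2⟩)).1) hm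
        (fun a ha => hσ₁ a ⟨(hsub (hb a ⟨ha.1, by linarith [ha.2.1], ha.2.2⟩)).2.1, ha.2.1,
          (hsub (hb a ⟨ha.1, by linarith [ha.2.1], ha.2.2⟩)).2.2.2⟩) (mem_of_mem_nhds hQ)
      obtain ⟨c₂, h2⟩ := ((convex_ball z r).prod (convex_Ioo (-r) 0)).isPreconnected
        |>.exists_trivialization_eq (τ := τ) (σ := σ₂) (O := Q)
        (fun a ha => (hsub (hb a ⟨ha.1, ha.2.1, by linarith [ha.2.2]⟩)).1) hm
        (fun a ha => hσ₂ a ⟨(hsub (hb a ⟨ha.1, ha.2.1, by linarith [ha.2.2]⟩)).2.1,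
          (hsub (hb a ⟨ha.1, ha.2.1, by linarith [ha.2.2]⟩)).2.2.1, ha.2.2⟩) (mem_of_mem_nhds hQ)
      refine ⟨ball z r ×ˢ Ioo (-r) r, c₁, c₂, fun _ _ _ => ⟨isOpen_ball.prod isOpen_Ioo,
        ⟨mem_ball_self hr, by linarith, hr⟩, fun a ha => (hsub (hb a ha)).2,
        fun a ha b hb' c hc => hm a (hsub (hb a ha)).1 b (hsub (hb b hb')).1 c (hsub (hb c hc)).1,
        fun a ha h => h1 a ⟨ha.1, h, ha.2.2⟩, fun a ha h => h2 a ⟨ha.1, ha.2.1, h⟩⟩⟩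
    · exact ⟨∅, 1, 1, fun h1 h2 h3 => absurd ⟨h1, h2, h3⟩ hz⟩
  choose O c₁ c₂ hO using key
  have hε : ∀ y ∈ D ×ˢ Ioo (-ε) ε, 0 < ε := fun y hy => by linarith [hy.2.1, hy.2.2]
  -- how the constants vary
  have hvar : ∀ z ∈ D, (z, (0:ℝ)) ∉ L → 0 < ε → ∀ w, w ∈ D → (w, (0:ℝ)) ∉ L →
      (w, (0:ℝ)) ∈ O z → c₁ w = c₁ z * τ (z, 0) (w, 0) ∧ c₂ w = c₂ z * τ (z, 0) (w, 0) := by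
    intro z hz hzL hε w hw hwL hwO
    obtain ⟨o1, m1, s1, mm1, p1, n1⟩ := hO z hz hzL hε
    obtain ⟨o2, m2, s2, mm2, p2, n2⟩ := hO w hw hwL hε
    obtain ⟨r, hr, hsub⟩ := Metric.isOpen_iff.1 (o1.inter o2) (w, 0) ⟨hwO, m2⟩
    constructor
    · have hmem : (w, r / 2) ∈ O z ∩ O w := hsub (by
        rw [mem_ball, Prod.dist_eq]; simp [abs_of_pos hr, hr])
      have e1 := p1 _ hmem.1 (by simpa using hr)
      rw [p2 _ hmem.2 (by simpa using hr), ← mm1 _ m1 _ hwO _ hmem.1, ← mul_assoc] at e1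
      exact mul_right_cancel e1
    · have hmem : (w, -(r / 2)) ∈ O z ∩ O w := hsub (by
        rw [mem_ball, Prod.dist_eq]; simp [abs_of_pos hr, hr])
      have e1 := n1 _ hmem.1 (by simpa using hr)
      rw [n2 _ hmem.2 (by simpa using hr), ← mm1 _ m1 _ hwO _ hmem.1, ← mul_assoc] at e1
      exact mul_right_cancel e1
  obtain ⟨k, hk⟩ : ∃ k : G, 0 < ε → ∀ z ∈ D, (z, (0:ℝ)) ∉ L → c₁ z = k * c₂ z := by
    rcases {z | z ∈ D ∧ (z, (0:ℝ)) ∉ L}.eq_empty_or_nonempty with he | ⟨z₀, hz₀⟩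
    · exact ⟨1, fun _ z h1 h2 => absurd (show z ∈ {z | z ∈ D ∧ (z, (0:ℝ)) ∉ L} from ⟨h1, h2⟩)
        (by rw [he]; simp)⟩
    · refine ⟨c₁ z₀ * (c₂ z₀)⁻¹, fun hε z h1 h2 => ?_⟩
      have := hpre.eq_of_locally_eq (f := fun z => c₁ z * (c₂ z)⁻¹) (fun z hz => ?_) hz₀
        (show z ∈ {z | z ∈ D ∧ (z, (0:ℝ)) ∉ L} from ⟨h1, h2⟩)
      · rw [this]; group
      · obtain ⟨o1, m1, -⟩ := hO z hz.1 hz.2 hε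
        refine ⟨(fun w => (w, (0:ℝ))) ⁻¹' O z, (o1.preimage (by fun_prop)).mem_nhds m1,
          fun w hw hw' => ?_⟩
        obtain ⟨e1, e2⟩ := hvar z hz.1 hz.2 hε w hw'.1 hw'.2 hw
        rw [e1, e2]; group
  refine ⟨fun a => if 0 < a.2 then σ₁ a else if a.2 < 0 then k * σ₂ a else c₁ a.1,
    fun y hy => ?_⟩
  have hε := hε y hy.1
  rcases lt_trichotomy y.2 0 with h | h | h
  · obtain ⟨Q, hQ, hq⟩ := hσ₂ y ⟨hy.1.1, hy.1.2.1, h⟩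
    refine ⟨Q ∩ {a | a.2 < 0}, Filter.inter_mem hQ ((isOpen_lt (by fun_prop)
      continuous_const).mem_nhds h), fun a ha b hb => ?_⟩
    have h1 : a.2 < 0 := ha.2
    have h2 : b.2 < 0 := hb.2
    simp only [if_neg h1.not_gt, if_neg h2.not_gt, if_pos h1, if_pos h2]
    rw [hq a ha.1 b hb.1]; group
  · obtain ⟨z, t⟩ := y
    dsimp only at h
    subst h
    obtain ⟨o1, m1, s1, mm1, p1, n1⟩ := hO z hy.1.1 hy.2 hε
    have hall : ∀ a ∈ O z ∩ ((D ×ˢ Ioo (-ε) ε) \ L),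
        (if 0 < a.2 then σ₁ a else if a.2 < 0 then k * σ₂ a else c₁ a.1) =
          c₁ z * τ (z, 0) a := by
      rintro ⟨w, t⟩ ha
      rcases lt_trichotomy t 0 with h | h | h
      · rw [if_neg (by simpa using h.le), if_pos h, n1 _ ha.1 h, hk hε z hy.1.1 hy.2, mul_assoc]
      · subst h
        simpa using (hvar z hy.1.1 hy.2 hε w ha.2.1.1 ha.2.2 ha.1).1
      · rw [if_pos h, p1 _ ha.1 h]
    refine ⟨O z ∩ ((D ×ˢ Ioo (-ε) ε) \ L), Filter.inter_mem (o1.mem_nhds m1) (hLo.mem_nhds hy),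
      fun a ha b hb => ?_⟩
    dsimp only
    rw [hall a ha, hall b hb, ← mm1 _ m1 a ha.1 b hb.1]; group
  · obtain ⟨Q, hQ, hq⟩ := hσ₁ y ⟨hy.1.1, h, hy.1.2.2⟩
    refine ⟨Q ∩ {a | 0 < a.2}, Filter.inter_mem hQ ((isOpen_lt continuous_const
      (by fun_prop)).mem_nhds h), fun a ha b hb => ?_⟩
    have h1 : 0 < a.2 := ha.2
    have h2 : 0 < b.2 := hb.2
    simp only [if_pos h1, if_pos h2]
    exact hq a ha.1 b hb.1

/-- A compact totally disconnected set is not wild at its flat points. -/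
theorem FlatAt.not_wildAt {M : Type*} [TopologicalSpace M] [T2Space M]
    (hF : 1 < Module.rank ℝ F) [ProperSpace F]
    {K : Set M} (hK : IsCompact K) (hKd : IsTotallyDisconnected K) {x : M} (h : FlatAt F K x) :
    ¬ WildAt G K x := by
  intro hw
  obtain ⟨φ, hx, hφ⟩ := h
  have hxK : x ∈ K := hw.mem
  have hx0 := hφ x hx hxK
  obtain ⟨U, hU, hxU, τ, hτ, hV⟩ := hw.map (L := φ.symm ⁻¹' K ∩ φ.target) φ hx (fun y hy => by
    simp [φ.left_inv hy, φ.map_source hy])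
  obtain ⟨r, hr, hsub⟩ := Metric.isOpen_iff.1 (hU.inter φ.open_target) (φ x)
    ⟨hxU, φ.map_source hx⟩
  set z := (φ x).1 with hz
  set ε := r / 2 with hε
  have hε0 : 0 < ε := half_pos hr
  have hxz : φ x = (z, 0) := Prod.ext rfl hx0
  have hcb : ∀ y : F × ℝ, y.1 ∈ closedBall z ε → y.2 ∈ Icc (-ε) ε → y ∈ U ∩ φ.target := by
    intro y h1 h2
    refine hsub ?_
    rw [hxz, ← ball_prod_same]
    refine ⟨closedBall_subset_ball (half_lt_self hr) h1, ?_⟩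
    rw [mem_ball, Real.dist_eq, sub_zero]
    exact (abs_le.2 h2).trans_lt (half_lt_self hr)
  have hB : ∀ y ∈ ball z ε ×ˢ Ioo (-ε) ε, y ∈ U ∩ φ.target := fun y hy =>
    hcb y (ball_subset_closedBall hy.1) (Ioo_subset_Icc_self hy.2)
  have hopen : IsOpen ((ball z ε ×ˢ Ioo (-ε) ε) \ (φ.symm ⁻¹' K ∩ φ.target)) := by
    have h1 : IsOpen ((ball z ε ×ˢ Ioo (-ε) ε) ∩ (φ.target ∩ φ.symm ⁻¹' Kᶜ)) :=
      (isOpen_ball.prod isOpen_Ioo).inter (φ.isOpen_inter_preimage_symm hK.isClosed.isOpen_compl)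
    convert h1 using 1
    ext y
    constructor
    · exact fun h => ⟨h.1, (hB y h.1).2, fun h' => h.2 ⟨h', (hB y h.1).2⟩⟩
    · exact fun h => ⟨h.1, fun h' => h.2.2 h'.1⟩
  refine hV (ball z ε ×ˢ Ioo (-ε) ε) (isOpen_ball.prod isOpen_Ioo)
    (by rw [hxz]; exact ⟨mem_ball_self hε0, by simpa using hε0, hε0⟩) (fun y hy => (hB y hy).1)
    (trivOn_of_flat isOpen_ball (convex_ball z ε) ?_ ?_ hopen
      (hτ.mono fun y hy => ⟨(hB y hy.1).1, hy.2⟩))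
  · intro y hy hyL
    have := hφ _ (φ.map_target hyL.2) hyL.1
    rwa [φ.right_inv hyL.2] at this
  · have h0 : ∀ w ∈ closedBall z ε, (w, (0:ℝ)) ∈ φ.target := fun w hw =>
      (hcb (w, 0) hw ⟨by simpa using hε0.le, hε0.le⟩).2
    have hc : ContinuousOn (fun w : F => φ.symm (w, 0)) (closedBall z ε) :=
      φ.continuousOn_symm.comp (by fun_prop) h0
    set K₀ := closedBall z ε ∩ (fun w : F => φ.symm (w, 0)) ⁻¹' K with hK₀
    have hK₀c : IsCompact K₀ := (isCompact_closedBall z ε).of_isClosed_subset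
      (hc.preimage_isClosed_of_isClosed isClosed_closedBall hK.isClosed) inter_subset_left
    have hK₀d : IsTotallyDisconnected K₀ := by
      intro t hts ht a ha b hb
      have h1 := hKd _ (image_subset_iff.2 fun w hw => (hts hw).2)
        (ht.image (fun w : F => φ.symm (w, 0)) (hc.mono fun w hw => (hts hw).1))
        (mem_image_of_mem _ ha) (mem_image_of_mem _ hb)
      exact congrArg Prod.fst
        (φ.symm.injOn (h0 a (hts ha).1) (h0 b (hts hb).1) h1)
    have := (convex_ball z ε).isPreconnected_diff hF isOpen_ball hK₀c hK₀d
    convert this using 1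
    ext w
    constructor
    · exact fun h => ⟨h.1, fun h' => h.2 ⟨h'.2, h0 w h'.1⟩⟩
    · exact fun h => ⟨h.1, fun h' => h.2 ⟨ball_subset_closedBall h.1, h'.1⟩⟩

end Flat


section Push

variable {E : Type*} [NormedAddCommGroup E] [NormedSpace ℝ E] [CompleteSpace E]

theorem exists_homeomorph_push {p q : E} {r : ℝ} (h : dist q p < r) :
    ∃ g : E ≃ₜ E, g p = q ∧ ∀ x ∉ ball p r, g x = x := by
  have hr : 0 < r := dist_nonneg.trans_lt h
  rcases subsingleton_or_nontrivial E with hE | hE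
  · exact ⟨Homeomorph.refl E, Subsingleton.elim _ _, fun _ _ => rfl⟩
  set v := q - p with hv
  have hvr : ‖v‖ < r := by rwa [hv, ← dist_eq_norm]
  set f : E → E := fun x => x + max 0 (1 - ‖x - p‖ / r) • v with hf
  have hc : 0 ≤ ‖v‖ / r := by positivity
  have happ : ApproximatesLinearOn f ((ContinuousLinearEquiv.refl ℝ E : E ≃L[ℝ] E) : E →L[ℝ] E) univ
      (‖v‖ / r).toNNReal := by
    intro x _ y _
    have e : f x - f y - ((ContinuousLinearEquiv.refl ℝ E : E ≃L[ℝ] E) : E →L[ℝ] E) (x - y) =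
        (max 0 (1 - ‖x - p‖ / r) - max 0 (1 - ‖y - p‖ / r)) • v := by
      simp only [hf, ContinuousLinearEquiv.coe_coe, ContinuousLinearEquiv.refl_apply, sub_smul]
      abel
    rw [e, norm_smul, Real.coe_toNNReal _ hc]
    have h1 : ‖max 0 (1 - ‖x - p‖ / r) - max 0 (1 - ‖y - p‖ / r)‖ ≤ ‖x - y‖ / r := by
      have h2 := abs_max_sub_max_le_abs (1 - ‖x - p‖ / r) (1 - ‖y - p‖ / r) 0
      rw [max_comm _ (0 : ℝ), max_comm _ (0 : ℝ)] at h2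
      rw [Real.norm_eq_abs]
      refine h2.trans ?_
      have h3 := abs_norm_sub_norm_le (y - p) (x - p)
      rw [sub_sub_sub_cancel_right, norm_sub_rev y x] at h3
      have e2 : 1 - ‖x - p‖ / r - (1 - ‖y - p‖ / r) = (‖y - p‖ - ‖x - p‖) / r := by ring
      rw [e2, abs_div, abs_of_pos hr]
      gcongr
    calc _ ≤ ‖x - y‖ / r * ‖v‖ := by gcongr
      _ = _ := by ring
  have hlt : (‖v‖ / r).toNNReal <
      ‖((ContinuousLinearEquiv.refl ℝ E).symm : E →L[ℝ] E)‖₊⁻¹ := by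
    have : ‖((ContinuousLinearEquiv.refl ℝ E).symm : E →L[ℝ] E)‖₊ = 1 := by
      rw [← NNReal.coe_inj]
      exact ContinuousLinearMap.norm_id
    rw [this, inv_one, ← NNReal.coe_lt_coe, Real.coe_toNNReal _ hc]
    simpa using (div_lt_one hr).2 hvr
  refine ⟨happ.toHomeomorph f (Or.inr hlt), ?_, fun x hx => ?_⟩
  · change f p = q
    simp [hf, hv]
  · change f x = x
    have : r ≤ ‖x - p‖ := by simpa [dist_eq_norm] using hx
    have h2 : 1 - ‖x - p‖ / r ≤ 0 := by
      rw [sub_nonpos, le_div_iff₀ hr]; linarith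
    simp [hf, max_eq_left h2]

theorem exists_homeomorph_move {O : Set E} (hO : IsOpen O) (hOc : IsPreconnected O) {p q : E}
    (hp : p ∈ O) (hq : q ∈ O) : ∃ g : E ≃ₜ E, g p = q ∧ ∀ x ∉ O, g x = x := by
  refine hOc.prop_of_locally (p := fun q => ∃ g : E ≃ₜ E, g p = q ∧ ∀ x ∉ O, g x = x)
    (fun x hx => ?_) hp hq ⟨Homeomorph.refl E, rfl, fun _ _ => rfl⟩
  obtain ⟨r, hr, hsub⟩ := Metric.isOpen_iff.1 hO x hx
  refine ⟨ball x (r / 3), ball_mem_nhds x (by positivity), fun a ha b hb _ _ => ?_⟩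
  rintro ⟨g, hg, hg'⟩
  rw [mem_ball] at ha hb
  have hab : dist b a < 2 * r / 3 := by
    have := dist_triangle_right b a x
    linarith
  obtain ⟨k, hk, hk'⟩ := exists_homeomorph_push hab
  refine ⟨g.trans k, by simp [hg, hk], fun y hy => ?_⟩
  have : y ∉ ball a (2 * r / 3) := fun h => hy (hsub (by
    rw [mem_ball] at h ⊢
    have := dist_triangle y a x
    linarith))
  simp [hg' y hy, hk' y this]

theorem exists_homeomorph_move_finset [FiniteDimensional ℝ E] (hE : 1 < Module.rank ℝ E)
    {Ω K : Set E} (hΩ : IsOpen Ω)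
    (hΩc : IsPreconnected Ω) (hK : ThinSet K) {ι : Type*} (s : Finset ι) {p q : ι → E}
    (hp : Function.Injective p) (hq : Function.Injective q) (hpΩ : ∀ i, p i ∈ Ω \ K)
    (hqΩ : ∀ i, q i ∈ Ω \ K) :
    ∃ g : E ≃ₜ E, (∀ i ∈ s, g (p i) = q i) ∧ (∀ x ∉ Ω, g x = x) ∧ ∀ x ∈ K, g x = x := by
  classical
  induction s using Finset.induction_on with
  | empty => exact ⟨Homeomorph.refl E, by simp, fun _ _ => rfl, fun _ _ => rfl⟩
  | insert a s ha ih =>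
    obtain ⟨g, hg, hgΩ, hgK⟩ := ih
    have hQ : (q '' (s : Set ι)).Finite := s.finite_toSet.image q
    have hT : ThinSet (K ∪ q '' (s : Set ι)) :=
      hK.union (hQ.isCompact.thinSet hE hQ.countable.isTotallyDisconnected) (by
        rw [disjoint_left]
        rintro _ h ⟨i, _, rfl⟩
        exact (hqΩ i).2 h)
    have hO := hT.isPreconnected_diff hΩ hΩc
    have h1 : g (p a) ∈ Ω \ (K ∪ q '' (s : Set ι)) := by
      refine ⟨?_, ?_⟩
      · by_contra h
        have := g.injective (hgΩ _ h)
        exact h (by rw [this]; exact (hpΩ a).1)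
      · rintro (h | ⟨i, hi, h⟩)
        · have := g.injective (hgK _ h)
          exact (hpΩ a).2 (by rw [← this]; exact h)
        · rw [← hg i hi] at h
          have := hp (g.injective h)
          exact ha (this ▸ hi)
    have h2 : q a ∈ Ω \ (K ∪ q '' (s : Set ι)) := by
      refine ⟨(hqΩ a).1, ?_⟩
      rintro (h | ⟨i, hi, h⟩)
      · exact (hqΩ a).2 h
      · exact ha (hq h ▸ hi)
    obtain ⟨k, hk, hk'⟩ := exists_homeomorph_move (hΩ.sdiff hT.isClosed) hO h1 h2
    refine ⟨g.trans k, ?_, ?_, ?_⟩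
    · intro i hi
      rcases Finset.mem_insert.1 hi with rfl | hi
      · simp [hk]
      · simp only [Homeomorph.trans_apply, hg i hi]
        exact hk' _ fun h => h.2 (Or.inr ⟨i, hi, rfl⟩)
    · intro x hx
      simp only [Homeomorph.trans_apply, hgΩ x hx]
      exact hk' _ fun h => hx h.1
    · intro x hx
      simp only [Homeomorph.trans_apply, hgK x hx]
      exact hk' _ fun h => h.2 (Or.inl hx)

end Push

theorem exists_homeomorph_combine {M ι : Type*} [TopologicalSpace M] (s : Finset ι)
    {S : ι → Set M} (hS : ∀ i ∈ s, ∀ j ∈ s, i ≠ j → Disjoint (S i) (S j)) (θ : ι → M ≃ₜ M)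
    (hθ : ∀ i ∈ s, ∀ x ∉ S i, θ i x = x) :
    ∃ G : M ≃ₜ M, (∀ i ∈ s, ∀ x ∈ S i, G x = θ i x) ∧ ∀ x, (∀ i ∈ s, x ∉ S i) → G x = x := by
  classical
  induction s using Finset.induction_on with
  | empty => exact ⟨Homeomorph.refl M, by simp, fun _ _ => rfl⟩
  | insert a s ha ih =>
    obtain ⟨G, h1, h2⟩ := ih (fun i hi j hj => hS i (Finset.mem_insert_of_mem hi) j
      (Finset.mem_insert_of_mem hj)) (fun i hi => hθ i (Finset.mem_insert_of_mem hi))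
    have hdis : ∀ i ∈ s, ∀ x ∈ S a, x ∉ S i := fun i hi x hx hx' =>
      disjoint_left.1 (hS a (Finset.mem_insert_self _ _) i (Finset.mem_insert_of_mem hi)
        (fun h => ha (h ▸ hi))) hx hx'
    have ha' := hθ a (Finset.mem_insert_self _ _)
    refine ⟨(θ a).trans G, ?_, ?_⟩
    · intro i hi x hx
      rcases Finset.mem_insert.1 hi with rfl | hi
      · have : θ i x ∈ S i := by
          by_contra h
          have := (θ i).injective (ha' _ h)
          exact h (by rw [this]; exact hx)
        exact h2 _ fun j hj => hdis j hj _ this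
      · simp [ha' x fun h => hdis i hi x h hx, h1 i hi x hx]
    · intro x hx
      simp only [Homeomorph.trans_apply, ha' x (hx a (Finset.mem_insert_self _ _))]
      exact h2 x fun i hi => hx i (Finset.mem_insert_of_mem hi)

theorem exists_open_preconnected_closure_subset {M : Type*} [NormedAddCommGroup M]
    [NormedSpace ℝ M] [ProperSpace M] {Ω L : Set M} (hΩ : IsOpen Ω) (hΩc : IsPreconnected Ω)
    (hL : IsCompact L) (hLΩ : L ⊆ Ω) (hLne : L.Nonempty) :
    ∃ V : Set M, IsOpen V ∧ IsPreconnected V ∧ L ⊆ V ∧ IsCompact (closure V) ∧ closure V ⊆ Ω := by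
  obtain ⟨x₀, hx₀⟩ := hLne
  have hloc : ∀ x ∈ Ω, ∃ r > 0, closedBall x r ⊆ Ω := fun x hx =>
    Metric.nhds_basis_closedBall.mem_iff.1 (hΩ.mem_nhds hx)
  have key : ∀ a ∈ Ω, ∃ V : Set M, IsOpen V ∧ IsPreconnected V ∧ x₀ ∈ V ∧ a ∈ V ∧
      IsCompact (closure V) ∧ closure V ⊆ Ω := by
    have hball : ∀ x ∈ Ω, ∀ r > 0, closedBall x r ⊆ Ω → IsCompact (closure (ball x r)) ∧
        closure (ball x r) ⊆ Ω := fun x _ r _ h =>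
      ⟨(isCompact_closedBall x r).closure_of_subset ball_subset_closedBall,
        closure_ball_subset_closedBall.trans h⟩
    intro a ha
    refine hΩc.prop_of_locally (p := fun a => ∃ V : Set M, IsOpen V ∧ IsPreconnected V ∧ x₀ ∈ V ∧
      a ∈ V ∧ IsCompact (closure V) ∧ closure V ⊆ Ω) (fun x hx => ?_) (hLΩ hx₀) ha ?_
    · obtain ⟨r, hr, hsub⟩ := hloc x hx
      obtain ⟨hb1, hb2⟩ := hball x hx r hr hsub
      refine ⟨ball x r, ball_mem_nhds x hr, ?_⟩
      rintro a ha b hb _ _ ⟨V, hV, hVc, h0, haV, hc, hs⟩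
      refine ⟨V ∪ ball x r, hV.union isOpen_ball,
        IsPreconnected.union a haV ha hVc (convex_ball x r).isPreconnected, Or.inl h0, Or.inr hb, ?_⟩
      rw [closure_union]
      exact ⟨hc.union hb1, union_subset hs hb2⟩
    · obtain ⟨r, hr, hsub⟩ := hloc x₀ (hLΩ hx₀)
      obtain ⟨hb1, hb2⟩ := hball x₀ (hLΩ hx₀) r hr hsub
      exact ⟨ball x₀ r, isOpen_ball, (convex_ball x₀ r).isPreconnected, mem_ball_self hr,
        mem_ball_self hr, hb1, hb2⟩
  choose! V hVo hVp hV0 hVa hVc hVs using key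
  obtain ⟨t, htL, htc⟩ := hL.elim_nhds_subcover V fun x hx =>
    (hVo x (hLΩ hx)).mem_nhds (hVa x (hLΩ hx))
  refine ⟨⋃ x ∈ t, V x, isOpen_biUnion fun x hx => hVo x (hLΩ (htL x hx)), ?_, htc, ?_, ?_⟩
  · have e : (⋃ x ∈ t, V x) = ⋃₀ (V '' (t : Set M)) := by simp
    rw [e]
    refine isPreconnected_sUnion x₀ _ ?_ ?_
    · rintro _ ⟨x, hx, rfl⟩
      exact hV0 x (hLΩ (htL x hx))
    · rintro _ ⟨x, hx, rfl⟩
      exact hVp x (hLΩ (htL x hx))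
  · rw [Finset.closure_biUnion]
    exact t.isCompact_biUnion fun x hx => hVc x (hLΩ (htL x hx))
  · rw [Finset.closure_biUnion]
    exact iUnion₂_subset fun x hx => hVs x (hLΩ (htL x hx))


/-- A continuous family of increasing bijections of the line, as a homeomorphism. -/
theorem exists_homeomorph_fiberwise {Z : Type*} [TopologicalSpace Z] {φ : Z → ℝ → ℝ}
    (hc : Continuous fun p : Z × ℝ => φ p.1 p.2) (hm : ∀ z, StrictMono (φ z))
    (hs : ∀ z, Function.Surjective (φ z)) :
    ∃ θ : Z × ℝ ≃ₜ Z × ℝ, ∀ p, θ p = (p.1, φ p.1 p.2) := by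
  choose ψ hψ using hs
  refine ⟨{ toFun := fun p => (p.1, φ p.1 p.2)
            invFun := fun p => (p.1, ψ p.1 p.2)
            left_inv := fun p => Prod.ext rfl ((hm p.1).injective (hψ _ _))
            right_inv := fun p => Prod.ext rfl (hψ _ _)
            continuous_toFun := continuous_fst.prodMk hc
            continuous_invFun := ?_ }, fun p => rfl⟩
  refine continuous_fst.prodMk (continuous_iff_continuousAt.2 fun p => ?_)
  refine tendsto_order.2 ⟨fun a ha => ?_, fun a ha => ?_⟩
  · have h1 : φ p.1 a < p.2 := by simpa [hψ] using hm p.1 ha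
    have hc' : Continuous fun q : Z × ℝ => φ q.1 a :=
      hc.comp (continuous_fst.prodMk continuous_const)
    filter_upwards [hc'.continuousAt.eventually_lt continuous_snd.continuousAt h1] with q hq
    rw [← (hm q.1).lt_iff_lt, hψ]
    exact hq
  · have h1 : p.2 < φ p.1 a := by simpa [hψ] using hm p.1 ha
    have hc' : Continuous fun q : Z × ℝ => φ q.1 a :=
      hc.comp (continuous_fst.prodMk continuous_const)
    filter_upwards [continuous_snd.continuousAt.eventually_lt hc'.continuousAt h1] with q hq
    rw [← (hm q.1).lt_iff_lt, hψ]
    exact hq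

theorem exists_squeeze {F : Type*} [PseudoMetricSpace F] (x : F) {s c ρ j δ : ℝ} (hs : 0 < s)
    (hρ : 0 < ρ) (hj : j ∈ Ioo (c - 2 * ρ) (c + 2 * ρ)) (hδ : 0 < δ) (hδρ : δ ≤ ρ) :
    ∃ θ : F × ℝ ≃ₜ F × ℝ,
      (∀ p, p ∉ closedBall x (2 * s) ×ˢ Icc (c - 3 * ρ) (c + 3 * ρ) → θ p = p) ∧
      (∀ p, (θ p).1 = p.1) ∧
      (∀ p u v, j ∈ Ioo u v → p.2 ∈ Ioo u v → (θ p).2 ∈ Ioo u v) ∧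
      ∀ p ∈ closedBall x s ×ˢ Icc (c - 2 * ρ) (c + 2 * ρ), (θ p).2 ∈ Ioo (j - δ) (j + δ) := by
  obtain ⟨hj1, hj2⟩ := hj
  set a := c - 3 * ρ with ha
  set b := c + 3 * ρ with hb
  set κ := δ / (6 * ρ) with hκ
  have hκ0 : 0 < κ := by positivity
  have hκρ : κ * (4 * ρ) = δ * (2 / 3) := by rw [hκ]; field_simp; norm_num
  have hκ1 : κ ≤ 1 := by rw [hκ, div_le_one (by positivity)]; linarith
  set f : ℝ → ℝ := fun t => max (min (max t (a + 7 * (t - a))) (j + κ * (t - j)))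
    (min t (b + 7 * (t - b))) with hf
  have hfm : StrictMono f := by
    intro t t' h
    refine max_lt_max (min_lt_min (max_lt_max h (by linarith)) ?_) (min_lt_min h (by linarith))
    nlinarith
  have hfc : Continuous f := by fun_prop
  have hfo : ∀ t, t ∉ Icc a b → f t = t := by
    intro t ht
    simp only [hf]
    by_cases h1 : a ≤ t
    · have h2 : b < t := not_le.1 fun h => ht ⟨h1, h⟩
      rw [min_eq_left (show t ≤ b + 7 * (t - b) by linarith)]
      exact max_eq_right ((min_le_right _ _).trans (by nlinarith))
    · push Not at h1
      rw [max_eq_left (show a + 7 * (t - a) ≤ t by linarith), min_eq_left (by nlinarith)]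
      exact max_eq_left (min_le_left _ _)
  have hfj : ∀ t, t ≤ j → t ≤ f t ∧ f t ≤ j := by
    intro t ht
    refine ⟨le_max_of_le_left (le_min (le_max_left _ _) (by nlinarith)), max_le ?_ ?_⟩
    · exact (min_le_right _ _).trans (by nlinarith)
    · exact (min_le_left _ _).trans ht
  have hfj' : ∀ t, j ≤ t → f t ≤ t ∧ j ≤ f t := by
    intro t ht
    refine ⟨max_le ((min_le_right _ _).trans (by nlinarith)) (min_le_left _ _),
      le_max_of_le_left (le_min (le_max_of_le_left ht) (by nlinarith))⟩
  have hft : ∀ t ∈ Icc (c - 2 * ρ) (c + 2 * ρ), f t ∈ Ioo (j - δ) (j + δ) := by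
    rintro t ⟨ht1, ht2⟩
    have h1 : κ * (t - j) < δ := by nlinarith
    have h2 : -δ < κ * (t - j) := by nlinarith
    refine ⟨lt_max_of_lt_left (lt_min (lt_max_of_lt_right (by linarith)) (by linarith)),
      max_lt ((min_le_right _ _).trans_lt (by linarith)) ((min_le_right _ _).trans_lt ?_)⟩
    linarith
  set l : F → ℝ := fun z => max 0 (min 1 (2 - dist z x / s)) with hl
  have hl0 : ∀ z, 0 ≤ l z := fun z => le_max_left _ _
  have hl1 : ∀ z, l z ≤ 1 := fun z => max_le zero_le_one (min_le_left _ _)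
  have hlc : Continuous l := by fun_prop
  have hlo : ∀ z, z ∉ closedBall x (2 * s) → l z = 0 := by
    intro z hz
    rw [mem_closedBall, not_le] at hz
    refine max_eq_left ((min_le_right _ _).trans ?_)
    rw [sub_nonpos, le_div_iff₀ hs]
    exact hz.le
  have hli : ∀ z ∈ closedBall x s, l z = 1 := by
    intro z hz
    rw [mem_closedBall] at hz
    have : dist z x / s ≤ 1 := (div_le_one hs).2 hz
    simp only [hl]
    rw [min_eq_left (by linarith), max_eq_right zero_le_one]
  set φ : F → ℝ → ℝ := fun z t => t + l z * (f t - t) with hφ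
  have hφf : ∀ z t, f t = t → φ z t = t := fun z t h => by simp [hφ, h]
  obtain ⟨θ, hθ⟩ := exists_homeomorph_fiberwise (φ := φ) (by fun_prop) (fun z t t' h => by
    have h1 := hfm h
    have h2 := hl0 z
    have h3 := hl1 z
    simp only [hφ]
    rcases eq_or_lt_of_le h2 with h4 | h4
    · rw [← h4]; linarith
    · nlinarith) (fun z u => by
      have hcz : Continuous (φ z) := by fun_prop
      have e1 : φ z (min u a - 1) = min u a - 1 := hφf _ _ (hfo _ fun h => by
        have := min_le_right u a
        linarith [h.1])
      have e2 : φ z (max u b + 1) = max u b + 1 := hφf _ _ (hfo _ fun h => by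
        have := le_max_right u b
        linarith [h.2])
      have h1 := min_le_left u a
      have h2 := le_max_left u b
      have := intermediate_value_Icc (show min u a - 1 ≤ max u b + 1 by linarith)
        hcz.continuousOn
      rw [e1, e2] at this
      obtain ⟨t, -, ht⟩ := this ⟨by linarith, by linarith⟩
      exact ⟨t, ht⟩)
  refine ⟨θ, ?_, fun p => by rw [hθ], ?_, ?_⟩
  · intro p hp
    rw [hθ]
    refine Prod.ext rfl ?_
    by_cases h : p.1 ∈ closedBall x (2 * s)
    · exact hφf _ _ (hfo _ fun h' => hp ⟨h, h'⟩)
    · simp [hφ, hlo _ h]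
  · rintro p u v ⟨hu, hv⟩ ⟨hpu, hpv⟩
    rw [hθ]
    have h2 := hl0 p.1
    have h3 := hl1 p.1
    simp only [hφ, mem_Ioo]
    rcases le_total p.2 j with h | h
    · obtain ⟨h4, h5⟩ := hfj _ h
      constructor <;> nlinarith
    · obtain ⟨h4, h5⟩ := hfj' _ h
      constructor <;> nlinarith
  · intro p hp
    rw [hθ]
    simp only [hφ, hli _ hp.1, one_mul, add_sub_cancel]
    exact hft _ hp.2

theorem exists_small_clopen_partition {M : Type*} [PseudoMetricSpace M] [T2Space M]
    {K : Set M} (hK : IsCompact K) (hKd : IsTotallyDisconnected K)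
    {π : M → ℝ} (hπ : ContinuousOn π K) {ε ρ : ℝ} (hε : 0 < ε) (hρ : 0 < ρ) :
    ∃ (n : ℕ) (A : Fin n → Set M), (∀ i, IsCompact (A i) ∧ A i ⊆ K ∧
        (∀ x ∈ A i, ∀ y ∈ A i, dist x y < ε ∧ |π x - π y| < ρ)) ∧
      Pairwise (Function.onFun Disjoint A) ∧ K ⊆ ⋃ i, A i := by
  have : CompactSpace K := isCompact_iff_compactSpace.1 hK
  have : TotallyDisconnectedSpace K := totallyDisconnectedSpace_subtype_iff.2 hKd
  have hπ' : Continuous fun x : K => π x := continuousOn_iff_continuous_domRestrict.1 hπ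
  have ho : ∀ x : K, IsOpen {y : K | dist (y : M) x < ε / 2 ∧ |π y - π x| < ρ / 2} := fun x =>
    IsOpen.and (isOpen_lt (by fun_prop) continuous_const)
      (isOpen_lt (hπ'.sub continuous_const).abs continuous_const)
  obtain ⟨n, W, hW, hWcov, hWdis⟩ :=
    TopologicalSpace.IsOpenCover.exists_finite_nonempty_disjoint_clopen_cover
      (U := fun x : K => (⟨_, ho x⟩ : TopologicalSpace.Opens K)) (by
      rw [TopologicalSpace.IsOpenCover, eq_top_iff]
      intro x _
      rw [TopologicalSpace.Opens.mem_iSup]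
      exact ⟨x, show dist (x : M) x < ε / 2 ∧ |π x - π x| < ρ / 2 by simp [hε, hρ]⟩)
  refine ⟨n, fun i => Subtype.val '' (W i : Set K), fun i => ⟨?_, ?_, ?_⟩, ?_, ?_⟩
  · exact (W i).isClopen.isClosed.isCompact.image continuous_subtype_val
  · rintro _ ⟨x, _, rfl⟩
    exact x.2
  · rintro _ ⟨x, hx, rfl⟩ _ ⟨y, hy, rfl⟩
    obtain ⟨z, hz⟩ := (hW i).2
    obtain ⟨h1, h2⟩ := hz hx
    obtain ⟨h3, h4⟩ := hz hy
    constructor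
    · have := dist_triangle_right (x : M) y z
      linarith
    · have := abs_sub_le (π x) (π z) (π y)
      rw [abs_sub_comm (π z)] at this
      linarith
  · intro i j hij
    refine (disjoint_image_iff Subtype.val_injective).2 ?_
    have := hWdis hij
    rw [Function.onFun, disjoint_iff] at this
    rw [Set.disjoint_iff_inter_eq_empty]
    exact congrArg (fun c : TopologicalSpace.Clopens K => (c : Set K)) this
  · intro x hx
    obtain ⟨i, hi⟩ := mem_iUnion.1 (hWcov (mem_univ ⟨x, hx⟩))
    exact mem_iUnion.2 ⟨i, ⟨x, hx⟩, hi, rfl⟩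

/-- A neighbourhood of a totally disconnected compactum splits into small connected pieces. -/
theorem exists_small_components {M : Type*} [NormedAddCommGroup M] [NormedSpace ℝ M]
    {K Ω : Set M} (hK : IsCompact K) (hKd : IsTotallyDisconnected K) (hΩ : IsOpen Ω) (hKΩ : K ⊆ Ω)
    {π : M → ℝ} (hπ : ContinuousOn π K) {ε ρ : ℝ} (hε : 0 < ε) (hρ : 0 < ρ) :
    ∃ 𝒰 : Set (Set M), 𝒰.Finite ∧ (∀ U ∈ 𝒰, IsOpen U ∧ IsPreconnected U ∧ U ⊆ Ω ∧
        (∀ x ∈ U, ∀ y ∈ U, dist x y < ε) ∧ (K ∩ U).Nonempty ∧ IsCompact (K ∩ U) ∧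
        ∀ x ∈ K ∩ U, ∀ y ∈ K ∩ U, |π x - π y| < ρ) ∧
      (∀ U ∈ 𝒰, ∀ V ∈ 𝒰, U ≠ V → Disjoint U V) ∧ K ⊆ ⋃₀ 𝒰 := by
  classical
  obtain ⟨n, A, hA, hAd, hAc⟩ := exists_small_clopen_partition hK hKd hπ (half_pos hε) hρ
  have hth : ∀ i j, i ≠ j → ∀ᶠ η in 𝓝[>] (0 : ℝ),
      Disjoint (thickening η (A i)) (thickening η (A j)) := by
    intro i j hij
    obtain ⟨δ, hδ, h⟩ := Disjoint.exists_thickenings (hAd hij) (hA i).1 (hA j).1.isClosed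
    filter_upwards [Ioo_mem_nhdsGT hδ] with η hη
    exact h.mono (thickening_mono hη.2.le _) (thickening_mono hη.2.le _)
  obtain ⟨δ, hδ, hδΩ⟩ := hK.exists_thickening_subset_open hΩ hKΩ
  obtain ⟨η, h1, ⟨hη0, hη1⟩, hη2⟩ := ((Filter.eventually_all.2 fun i => Filter.eventually_all.2
    fun j => Filter.eventually_imp_distrib_left.2 (hth i j)).and
      ((Filter.eventually_mem_set.2 (Ioo_mem_nhdsGT hδ)).and
        (Filter.eventually_mem_set.2 (Ioo_mem_nhdsGT (show 0 < ε / 4 by positivity))))).exists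
  have hsub : ∀ i, A i ⊆ thickening η (A i) := fun i => self_subset_thickening hη0 _
  set 𝒰 : Set (Set M) := {U | ∃ i, ∃ x ∈ A i, U = connectedComponentIn (thickening η (A i)) x}
    with h𝒰
  have hopen : ∀ U ∈ 𝒰, IsOpen U := by
    rintro _ ⟨i, x, hx, rfl⟩
    exact isOpen_thickening.connectedComponentIn
  have hdisj : ∀ U ∈ 𝒰, ∀ V ∈ 𝒰, U ≠ V → Disjoint U V := by
    rintro _ ⟨i, x, hx, rfl⟩ _ ⟨j, y, hy, rfl⟩ hne
    by_cases hij : i = j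
    · subst hij
      rw [disjoint_left]
      intro z hz hz'
      exact hne ((connectedComponentIn_eq hz).trans (connectedComponentIn_eq hz').symm)
    · exact (h1 i j hij).mono (connectedComponentIn_subset _ _) (connectedComponentIn_subset _ _)
  have hcov : K ⊆ ⋃₀ 𝒰 := by
    intro x hx
    obtain ⟨i, hi⟩ := mem_iUnion.1 (hAc hx)
    exact ⟨_, ⟨i, x, hi, rfl⟩, mem_connectedComponentIn (hsub i hi)⟩
  have hne : ∀ U ∈ 𝒰, (K ∩ U).Nonempty := by
    rintro _ ⟨i, x, hx, rfl⟩
    exact ⟨x, (hA i).2.1 hx, mem_connectedComponentIn (hsub i hx)⟩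
  have hKA : ∀ i, ∀ x ∈ K, x ∈ thickening η (A i) → x ∈ A i := by
    intro i x hx hxi
    obtain ⟨j, hj⟩ := mem_iUnion.1 (hAc hx)
    by_cases hij : i = j
    · rwa [hij]
    · exact (disjoint_left.1 (h1 i j hij) hxi (hsub j hj)).elim
  refine ⟨𝒰, ?_, fun U hU => ⟨hopen U hU, ?_, ?_, ?_, hne U hU, ?_, ?_⟩, hdisj, hcov⟩
  · obtain ⟨t, ht, htf, htc⟩ := hK.elim_finite_subcover_image (b := 𝒰) (c := id) hopen
      (by rwa [sUnion_eq_biUnion] at hcov)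
    refine htf.subset fun U hU => ?_
    obtain ⟨x, hxK, hxU⟩ := hne U hU
    obtain ⟨V, hV, hxV⟩ := mem_iUnion₂.1 (htc hxK)
    by_cases h : U = V
    · rwa [h]
    · exact (disjoint_left.1 (hdisj U hU V (ht hV) h) hxU hxV).elim
  · obtain ⟨i, x, hx, rfl⟩ := hU
    exact isPreconnected_connectedComponentIn
  · obtain ⟨i, x, hx, rfl⟩ := hU
    exact (connectedComponentIn_subset _ _).trans
      ((thickening_mono hη1.le _).trans ((thickening_subset_of_subset _ (hA i).2.1).trans hδΩ))
  · obtain ⟨i, x, hx, rfl⟩ := hU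
    intro y hy z hz
    obtain ⟨y', hy', hyy⟩ := mem_thickening_iff.1 (connectedComponentIn_subset _ _ hy)
    obtain ⟨z', hz', hzz⟩ := mem_thickening_iff.1 (connectedComponentIn_subset _ _ hz)
    have h3 := ((hA i).2.2 _ hy' _ hz').1
    have h4 := dist_triangle4 y y' z' z
    rw [dist_comm z' z] at h4
    linarith [hη2.2]
  · have e : K ∩ U = K \ ⋃₀ (𝒰 \ {U}) := by
      ext y
      refine and_congr_right fun hyK => ⟨fun hyU => ?_, fun hy => ?_⟩
      · rintro ⟨V, ⟨hV, hVU⟩, hyV⟩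
        exact disjoint_left.1 (hdisj U hU V hV fun h => hVU h.symm) hyU hyV
      · obtain ⟨V, hV, hyV⟩ := hcov hyK
        by_contra hyU
        exact hy ⟨V, ⟨hV, fun h => hyU (by rwa [← mem_singleton_iff.1 h])⟩, hyV⟩
    rw [e]
    exact hK.diff (isOpen_sUnion fun V hV => hopen V hV.1)
  · obtain ⟨i, x, hx, rfl⟩ := hU
    intro y hy z hz
    exact ((hA i).2.2 _ (hKA i y hy.1 (connectedComponentIn_subset _ _ hy.2)) _
      (hKA i z hz.1 (connectedComponentIn_subset _ _ hz.2))).2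

theorem IsPreconnected.diff_of_inter_subset {M : Type*} [TopologicalSpace M] {W b Y : Set M}
    (hW : IsOpen W) (hWc : IsPreconnected W) (hb : IsOpen b) (hbW : b ⊆ W) (hWY : W ∩ Y ⊆ b)
    (hY : IsClosed Y) (hbY : IsPreconnected (b \ Y)) (hbne : (b \ Y).Nonempty) :
    IsPreconnected (W \ Y) := by
  classical
  refine isPreconnected_of_forall_locally_const fun f hf => ?_
  have hf' : ∀ x ∈ W \ Y, ∃ O ∈ 𝓝 x, ∀ a ∈ O, a ∉ Y ∧ f a = f x := by
    intro x hx
    obtain ⟨O, hO, h⟩ := hf x hx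
    exact ⟨O ∩ (W \ Y), Filter.inter_mem hO ((hW.sdiff hY).mem_nhds hx), fun a ha =>
      ⟨ha.2.2, h a ha.1 ha.2⟩⟩
  obtain ⟨v, hv⟩ := hbne
  have hbc : ∀ x ∈ b \ Y, f x = f v := fun x hx =>
    hbY.eq_of_locally_eq (fun y hy => by
      obtain ⟨O, hO, h⟩ := hf' y ⟨hbW hy.1, hy.2⟩
      exact ⟨O, hO, fun a ha _ => (h a ha).2⟩) hx hv
  set g : M → ℤˣ := fun x => if x ∈ Y then f v else f x with hg
  have hgb : ∀ x ∈ b, g x = f v := by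
    intro x hx
    by_cases h : x ∈ Y
    · simp [hg, h]
    · simp [hg, h, hbc x ⟨hx, h⟩]
  intro x hx y hy
  have key := hWc.eq_of_locally_eq (f := g) (fun z hz => by
    by_cases hzb : z ∈ b
    · exact ⟨b, hb.mem_nhds hzb, fun a ha _ => (hgb a ha).trans (hgb z hzb).symm⟩
    · have hzY : z ∉ Y := fun h => hzb (hWY ⟨hz, h⟩)
      obtain ⟨O, hO, h⟩ := hf' z ⟨hz, hzY⟩
      exact ⟨O, hO, fun a ha _ => by simp [hg, hzY, (h a ha).1, (h a ha).2]⟩) hx.1 hy.1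
  simpa [hg, hx.2, hy.2] using key

section Frontier

variable {F : Type*} [NormedAddCommGroup F] [NormedSpace ℝ F]

theorem exists_mem_Ioo_notMem {C : Set ℝ} (hC : interior C = ∅) {α β : ℝ} (h : α < β) :
    ∃ t ∈ Ioo α β, t ∉ C := by
  by_contra! hc
  have := interior_maximal (show Ioo α β ⊆ C from hc) isOpen_Ioo
  rw [hC] at this
  exact this (show (α + β) / 2 ∈ Ioo α β by constructor <;> linarith)

theorem isPreconnected_box_diff {X : Set F} {C : Set ℝ} (hCi : interior C = ∅) {x : F}
    (hx : x ∈ frontier X) {r α β : ℝ} (hr : 0 < r) (hαβ : α < β) :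
    IsPreconnected ((ball x r ×ˢ Ioo α β) \ X ×ˢ C) ∧
      ((ball x r ×ˢ Ioo α β) \ X ×ˢ C).Nonempty := by
  have hx' : x ∈ closure Xᶜ := by
    rw [frontier_eq_closure_inter_closure] at hx
    exact hx.2
  obtain ⟨z₀, hz₀X, hz₀⟩ := Metric.mem_closure_iff.1 hx' r hr
  rw [dist_comm] at hz₀
  obtain ⟨t₀, ht₀, ht₀C⟩ := exists_mem_Ioo_notMem hCi hαβ
  refine ⟨?_, ⟨(z₀, t₀), ⟨hz₀, ht₀⟩, fun h => hz₀X h.1⟩⟩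
  refine isPreconnected_of_forall_locally_const fun f hf => ?_
  have hS : ∀ S, IsPreconnected S → S ⊆ (ball x r ×ˢ Ioo α β) \ X ×ˢ C → ∀ p ∈ S, ∀ q ∈ S,
      f p = f q := fun S hSc hS p hp q hq =>
    hSc.eq_of_locally_eq (fun y hy => by
      obtain ⟨O, hO, h⟩ := hf y (hS hy)
      exact ⟨O, hO, fun a ha haS => h a ha (hS haS)⟩) hp hq
  have hv : ∀ z ∈ ball x r, z ∉ X → ∀ t ∈ Ioo α β, ∀ t' ∈ Ioo α β, f (z, t) = f (z, t') :=
    fun z hz hzX t ht t' ht' => hS ({z} ×ˢ Ioo α β) (isPreconnected_singleton.prod isPreconnected_Ioo)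
      (fun p hp => ⟨⟨by rw [hp.1]; exact hz, hp.2⟩, fun h => hzX (by rw [← hp.1]; exact h.1)⟩)
      _ ⟨rfl, ht⟩ _ ⟨rfl, ht'⟩
  have hh : ∀ t ∈ Ioo α β, t ∉ C → ∀ z ∈ ball x r, f (z, t) = f (z₀, t) :=
    fun t ht htC z hz => hS (ball x r ×ˢ {t})
      ((convex_ball x r).isPreconnected.prod isPreconnected_singleton)
      (fun p hp => ⟨⟨hp.1, by rw [hp.2]; exact ht⟩, fun h => htC (by rw [← hp.2]; exact h.2)⟩)
      _ ⟨hz, rfl⟩ _ ⟨hz₀, rfl⟩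
  have main : ∀ p ∈ (ball x r ×ˢ Ioo α β) \ X ×ˢ C, f p = f (z₀, t₀) := by
    rintro ⟨z, t⟩ ⟨⟨hz, ht⟩, hn⟩
    by_cases htC : t ∈ C
    · have hzX : z ∉ X := fun h => hn ⟨h, htC⟩
      rw [hv z hz hzX t ht t₀ ht₀]
      exact hh t₀ ht₀ ht₀C z hz
    · rw [hh t ht htC z hz]
      exact hv z₀ hz₀ hz₀X t ht t₀ ht₀
  intro p hp q hq
  rw [main p hp, main q hq]

variable [FiniteDimensional ℝ F]

theorem infinite_frontier_inter_ball (hF : 1 < Module.rank ℝ F) {X : Set F} (hX : IsClosed X)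
    (hXp : ∀ x ∈ X, AccPt x (Filter.principal X)) {x : F} (hx : x ∈ frontier X) {r : ℝ}
    (hr : 0 < r) : (frontier X ∩ ball x r).Infinite := by
  intro hfin
  have hxX : x ∈ X := hX.frontier_subset hx
  have hpre : IsPreconnected (ball x r \ (frontier X ∩ ball x r)) :=
    (convex_ball x r).isPreconnected_diff hF isOpen_ball hfin.isCompact
      hfin.countable.isTotallyDisconnected
  have hx' : x ∈ closure Xᶜ := by
    rw [frontier_eq_closure_inter_closure] at hx
    exact hx.2
  obtain ⟨z₀, hz₀X, hz₀⟩ := Metric.mem_closure_iff.1 hx' r hr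
  rw [dist_comm] at hz₀
  have hsub : X ∩ ball x r ⊆ frontier X ∩ ball x r := by
    intro y hy
    refine ⟨?_, hy.2⟩
    by_contra hyf
    have hm := hpre.eq_of_locally_eq (f := fun z => (z ∈ X : Prop)) (fun z hz => ?_)
      (x := y) (y := z₀) ⟨hy.2, fun h => hyf h.1⟩
      ⟨hz₀, fun h => hz₀X (hX.frontier_subset h.1)⟩
    · exact hz₀X (hm ▸ hy.1)
    · have hzf : z ∉ frontier X := fun h => hz.2 ⟨h, hz.1⟩
      by_cases hzX : z ∈ X
      · have : z ∈ interior X := by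
          by_contra hzi
          exact hzf (by rw [hX.frontier_eq]; exact ⟨hzX, hzi⟩)
        exact ⟨_, isOpen_interior.mem_nhds this, fun a ha _ => by
          simp [hzX, interior_subset ha]⟩
      · exact ⟨_, hX.isOpen_compl.mem_nhds hzX, fun a ha _ => by
          simpa [hzX] using ha⟩
  have hacc := (hXp x hxX).nhds_inter (ball_mem_nhds x hr)
  rw [inter_comm] at hacc
  exact Set.Infinite.of_accPt hacc (hfin.subset hsub)

theorem frontier_nonempty_of_isCompact [Nontrivial F] {X : Set F} (hX : IsCompact X)
    (hne : X.Nonempty) : (frontier X).Nonempty := by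
  by_contra h
  rw [not_nonempty_iff_eq_empty, ← isClopen_iff_frontier_eq_empty, isClopen_iff] at h
  rcases h with h | h
  · exact hne.ne_empty h
  · exact noncompact_univ F (h ▸ hX)

end Frontier


section Node

variable {F : Type*} [NormedAddCommGroup F] [NormedSpace ℝ F]

/-- The open set `W` meets the image under `H` of the fence `X ×ˢ C` in the image of a small
box around a frontier point of `X`, over an interval containing the values of `π` on `K ∩ W`. -/
def IsNode (X : Set F) (C : Set ℝ) (K : Set (F × ℝ)) (π : F × ℝ → ℝ) (H : F × ℝ ≃ₜ F × ℝ)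
    (W : Set (F × ℝ)) : Prop :=
  IsOpen W ∧ IsPreconnected W ∧ IsCompact (K ∩ W) ∧ ∃ x ∈ frontier X, ∃ r > 0, ∃ α β, α < β ∧
    H '' (ball x r ×ˢ Ioo α β) ⊆ W ∧ W ∩ H '' (X ×ˢ C) ⊆ H '' (ball x r ×ˢ Ioo α β) ∧
    Disjoint K (H '' (ball x r ×ˢ Ioo α β)) ∧ MapsTo π (K ∩ W) (Ioo α β)

/-- `W` meets `K`, and both `W` and the part of the fence inside `W` are `ε`-small. -/
def IsSmallFor (X : Set F) (C : Set ℝ) (K : Set (F × ℝ)) (H : F × ℝ ≃ₜ F × ℝ) (ε : ℝ)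
    (W : Set (F × ℝ)) : Prop :=
  (K ∩ W).Nonempty ∧ (∀ x ∈ W, ∀ y ∈ W, dist x y ≤ ε) ∧
    ∀ y ∈ X ×ˢ C, ∀ y' ∈ X ×ˢ C, H y ∈ W → H y' ∈ W → dist y y' ≤ ε

variable [FiniteDimensional ℝ F]

theorem one_lt_rank_prod_real (hF : 1 < Module.rank ℝ F) : 1 < Module.rank ℝ (F × ℝ) :=
  hF.trans_le (LinearMap.rank_le_of_injective (LinearMap.inl ℝ F ℝ) LinearMap.inl_injective)

theorem IsNode.refine (hF : 1 < Module.rank ℝ F) {X : Set F} {C : Set ℝ} {K : Set (F × ℝ)}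
    {π : F × ℝ → ℝ} {H : F × ℝ ≃ₜ F × ℝ} {W : Set (F × ℝ)} (hX : IsCompact X)
    (hXp : ∀ x ∈ X, AccPt x (Filter.principal X)) (hC : IsCompact C) (hCi : interior C = ∅)
    (hK : IsCompact K) (hKd : IsTotallyDisconnected K) (hπ : ContinuousOn π K)
    (hKY : Disjoint K (H '' (X ×ˢ C))) (h : IsNode X C K π H W) {ε : ℝ} (hε : 0 < ε) :
    ∃ G : F × ℝ ≃ₜ F × ℝ, (∀ y ∉ W, G y = y) ∧ (∀ y ∈ K, G y = y) ∧
      ∃ 𝒲 : Set (Set (F × ℝ)), 𝒲.Finite ∧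
        (∀ V ∈ 𝒲, closure V ⊆ W ∧ IsNode X C K π (H.trans G) V ∧
          IsSmallFor X C K (H.trans G) ε V) ∧
        (∀ V ∈ 𝒲, ∀ V' ∈ 𝒲, V ≠ V' → Disjoint (closure V) (closure V')) ∧ K ∩ W ⊆ ⋃₀ 𝒲 := by
  classical
  obtain ⟨hW, hWc, hKW, x₀, hx₀, r, hr, α, β, hαβ, hbW, hWY, hKb, hπW⟩ := h
  have : ProperSpace F := FiniteDimensional.proper ℝ F
  have hM := one_lt_rank_prod_real hF
  set b := ball x₀ r ×ˢ Ioo α β with hb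
  set Y := X ×ˢ C with hY
  have hYc : IsClosed (H '' Y) := ((hX.prod hC).image H.continuous).isClosed
  have hbo : IsOpen b := isOpen_ball.prod isOpen_Ioo
  obtain ⟨hbp, hbn⟩ := isPreconnected_box_diff hCi hx₀ hr hαβ
  set Ω := W \ H '' Y with hΩdef
  have hΩ : IsOpen Ω := hW.sdiff hYc
  have hΩc : IsPreconnected Ω := by
    refine IsPreconnected.diff_of_inter_subset hW hWc (H.isOpen_image.2 hbo) hbW hWY hYc ?_ ?_
    · rw [← image_sdiff H.injective]
      exact hbp.image _ H.continuous.continuousOn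
    · rw [← image_sdiff H.injective]
      exact hbn.image _
  have hKΩ : K ∩ W ⊆ Ω := fun k hk => ⟨hk.2, fun h => disjoint_left.1 hKY hk.1 h⟩
  have hthinK : ThinSet K := hK.thinSet hM hKd
  -- the scale in the direction of `ℝ`
  obtain ⟨δ', hδ', hδαβ⟩ := (hKW.image_of_continuousOn
    (hπ.mono inter_subset_left)).exists_thickening_subset_open isOpen_Ioo hπW.image_subset
  obtain ⟨ρ, hρ, hρ1, hρ2⟩ : ∃ ρ : ℝ, 0 < ρ ∧ 3 * ρ < δ' ∧ 4 * ρ ≤ ε :=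
    ⟨min (δ' / 4) (ε / 4), by positivity, by
      have := min_le_left (δ' / 4) (ε / 4)
      linarith, by
      have := min_le_right (δ' / 4) (ε / 4)
      linarith⟩
  obtain ⟨𝒰, h𝒰f, h𝒰, h𝒰d, h𝒰c⟩ := exists_small_components hKW
    (fun t ht => hKd t (ht.trans inter_subset_left)) hΩ hKΩ (hπ.mono inter_subset_left) hε hρ
  have : Finite 𝒰 := h𝒰f
  have : Fintype 𝒰 := Fintype.ofFinite _
  have hKU : ∀ i : 𝒰, K ∩ W ∩ (i : Set (F × ℝ)) = K ∩ i := fun i => by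
    rw [inter_assoc, inter_eq_right.2 (((h𝒰 i i.2).2.2.1).trans sdiff_subset)]
  have hUd : ∀ i j : 𝒰, i ≠ j → Disjoint (i : Set (F × ℝ)) j := fun i j hij =>
    h𝒰d i i.2 j j.2 fun h => hij (Subtype.ext h)
  have hne : ∀ i : 𝒰, (K ∩ (i : Set (F × ℝ))).Nonempty := fun i => by
    rw [← hKU]
    exact (h𝒰 i i.2).2.2.2.2.1
  choose k hk using hne
  set c : 𝒰 → ℝ := fun i => π (k i) with hc
  have hπc : ∀ i : 𝒰, ∀ y ∈ K ∩ (i : Set (F × ℝ)), |π y - c i| < ρ := fun i y hy =>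
    (h𝒰 i i.2).2.2.2.2.2.2 y (by rw [hKU]; exact hy) (k i) (by rw [hKU]; exact hk i)
  have hIcc : ∀ i, Icc (c i - 3 * ρ) (c i + 3 * ρ) ⊆ Ioo α β := by
    intro i t ht
    refine hδαβ (mem_thickening_iff.2 ⟨c i, ⟨k i, ⟨(hk i).1, ?_⟩, rfl⟩, ?_⟩)
    · exact ((h𝒰 i i.2).2.2.1 (hk i).2).1
    · rw [Real.dist_eq, abs_lt]
      constructor <;> linarith [ht.1, ht.2]
  -- the tips of the new fingers
  obtain ⟨x, hxinj, hxm⟩ : ∃ x : 𝒰 → F, Function.Injective x ∧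
      ∀ i, x i ∈ frontier X ∩ ball x₀ r := by
    have := (infinite_frontier_inter_ball hF hX.isClosed hXp hx₀ hr).to_subtype
    set e := ((Fintype.equivFin 𝒰).toEmbedding.trans Fin.valEmbedding).trans
      (Infinite.natEmbedding (frontier X ∩ ball x₀ r : Set F))
    exact ⟨fun i => e i, Subtype.val_injective.comp e.injective, fun i => (e i).2⟩
  have hj : ∀ i, ∃ t ∈ Ioo (c i - 2 * ρ) (c i + 2 * ρ), t ∉ C := fun i =>
    exists_mem_Ioo_notMem hCi (by linarith)
  choose j hj hjC using hj
  have hxjb : ∀ i, (x i, j i) ∈ b := fun i => ⟨(hxm i).2, hIcc i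
    ⟨by linarith [(hj i).1], by linarith [(hj i).2]⟩⟩
  have hpΩ : ∀ i, H (x i, j i) ∈ Ω \ K := fun i =>
    ⟨⟨hbW ⟨_, hxjb i, rfl⟩, fun ⟨y, hy, hyx⟩ => hjC i (by
      have := H.injective hyx
      rw [this] at hy
      exact hy.2)⟩, fun hK' => disjoint_left.1 hKb hK' ⟨_, hxjb i, rfl⟩⟩
  have hq : ∀ i : 𝒰, ∃ q ∈ (i : Set (F × ℝ)), q ∉ K := fun i =>
    hthinK.exists_mem ((h𝒰 i i.2).1.mem_nhds (hk i).2)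
  choose q hqU hqK using hq
  obtain ⟨g, hgp, hgΩ, hgK⟩ := exists_homeomorph_move_finset hM hΩ hΩc hthinK
    (Finset.univ : Finset 𝒰) (p := fun i => H (x i, j i)) (q := q)
    (fun i l h => hxinj (congrArg Prod.fst (H.injective h)))
    (fun i l h => by
      by_contra hne
      exact disjoint_left.1 (hUd i l hne) (hqU i) (by rw [h]; exact hqU l))
    hpΩ (fun i => ⟨(h𝒰 i i.2).2.2.1 (hqU i), hqK i⟩)
  replace hgp : ∀ i, g (H (x i, j i)) = q i := fun i => hgp i (Finset.mem_univ i)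
  set V' : 𝒰 → Set (F × ℝ) := fun i => g ⁻¹' i with hV'
  have hV'o : ∀ i, IsOpen (V' i) := fun i => (h𝒰 i i.2).1.preimage g.continuous
  have hV'c : ∀ i, IsPreconnected (V' i) := fun i => by
    rw [hV']
    dsimp only
    rw [← g.image_symm]
    exact (h𝒰 i i.2).2.1.image _ g.symm.continuous.continuousOn
  have hV'Ω : ∀ i, V' i ⊆ Ω := fun i y hy => by
    by_contra hyΩ
    have : g y ∈ Ω := (h𝒰 i i.2).2.2.1 hy
    rw [hgΩ y hyΩ] at this
    exact hyΩ this
  have hδ : ∀ i, ∃ δ > 0, δ ≤ ρ ∧ closedBall (x i, j i) δ ⊆ H ⁻¹' V' i := by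
    intro i
    have : H ⁻¹' V' i ∈ 𝓝 (x i, j i) := ((hV'o i).preimage H.continuous).mem_nhds
      (show g (H (x i, j i)) ∈ (i : Set (F × ℝ)) by rw [hgp]; exact hqU i)
    obtain ⟨δ, hδ, hsub⟩ := Metric.nhds_basis_closedBall.mem_iff.1 this
    exact ⟨min δ ρ, lt_min hδ hρ, min_le_right _ _,
      (closedBall_subset_closedBall (min_le_left _ _)).trans hsub⟩
  choose δ hδ hδρ hδV using hδ
  -- the part of the finger cores to be avoided
  set T : 𝒰 → 𝒰 → Set (F × ℝ) := fun i l => {x l} ×ˢ (Icc (c l - 3 * ρ) (c l + 3 * ρ) \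
    {t | l = i ∧ t ∈ Ioo (j i - δ i) (j i + δ i)}) with hT
  have hTcl : ∀ i l, IsCompact (T i l) := by
    intro i l
    refine isCompact_singleton.prod (isCompact_Icc.diff ?_)
    by_cases h : l = i
    · simp only [h, true_and]
      exact isOpen_Ioo
    · simp [h]
  have hTb : ∀ i l, T i l ⊆ b := by
    rintro i l ⟨z, t⟩ ⟨hz, ht⟩
    rw [mem_singleton_iff] at hz
    dsimp only at hz
    rw [hz]
    exact ⟨(hxm l).2, hIcc l ht.1⟩
  set Z : 𝒰 → Set (F × ℝ) := fun i => ⋃ l ∈ (Finset.univ : Finset 𝒰), T i l with hZ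
  have hZthin : ∀ i, ThinSet (Z i) := fun i => ThinSet.biUnion _
    (fun l _ => thinSet_of_subset_line hF (hTcl i l).isClosed (x := x l) fun p hp => hp.1)
    fun l _ l' _ hne => by
      rw [disjoint_left]
      intro p hp hp'
      exact hne (hxinj (hp.1.symm.trans hp'.1))
  have hZc : ∀ i, IsCompact (Z i) := fun i => Finset.isCompact_biUnion _ fun l _ => hTcl i l
  have hZb : ∀ i, Z i ⊆ b := fun i => iUnion₂_subset fun l _ => hTb i l
  have hV : ∀ i : 𝒰, ∃ V : Set (F × ℝ), IsOpen V ∧ IsPreconnected V ∧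
      (K ∩ i) ∪ {H (x i, j i)} ⊆ V ∧ IsCompact (closure V) ∧ closure V ⊆ V' i \ H '' Z i := by
    intro i
    have hth := (hZthin i).image H
    refine exists_open_preconnected_closure_subset ((hV'o i).sdiff hth.isClosed)
      (hth.isPreconnected_diff (hV'o i) (hV'c i)) ?_ ?_ ?_
    · rw [← hKU]
      exact (h𝒰 i i.2).2.2.2.2.2.1.union isCompact_singleton
    · rintro y (hy | hy)
      · refine ⟨show g y ∈ (i : Set (F × ℝ)) by rw [hgK y hy.1]; exact hy.2, ?_⟩
        exact fun h => disjoint_left.1 hKb hy.1 (image_mono (hZb i) h)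
      · rw [mem_singleton_iff] at hy
        rw [hy]
        refine ⟨show g _ ∈ (i : Set (F × ℝ)) by rw [hgp]; exact hqU i, ?_⟩
        rintro ⟨y, hyZ, hyx⟩
        rw [H.injective hyx] at hyZ
        obtain ⟨l, -, hl⟩ := mem_iUnion₂.1 hyZ
        have hli : l = i := hxinj (hl.1.symm)
        exact hl.2.2 ⟨hli, by linarith [hδ i], by linarith [hδ i]⟩
    · exact ⟨k i, Or.inl (hk i)⟩
  choose V₀ hV₀o hV₀c hV₀K hV₀cpt hV₀sub using hV
  obtain ⟨s, hs, hsε, hsδ, hsr, hsd, hsZ⟩ : ∃ s > 0, 2 * s ≤ ε ∧ (∀ i, 2 * s ≤ δ i) ∧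
      (∀ i, closedBall (x i) (2 * s) ⊆ ball x₀ r) ∧
      (∀ i l, i ≠ l → Disjoint (closedBall (x i) (2 * s)) (closedBall (x l) (2 * s))) ∧
      ∀ i, Disjoint (cthickening (2 * s) (Z i)) (H ⁻¹' closure (V₀ i)) := by
    have key : ∀ (P : ℝ → Prop), (∃ η > 0, ∀ s, 0 < s → s ≤ η → P s) → ∀ᶠ s in 𝓝[>] (0 : ℝ),
        P (2 * s) := by
      rintro P ⟨η, hη, h⟩
      filter_upwards [Ioo_mem_nhdsGT (half_pos hη)] with s hs
      exact h _ (by linarith [hs.1]) (by linarith [hs.2])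
    have e1 := key (fun s => s ≤ ε) ⟨ε, hε, fun s _ h => h⟩
    have e2 := Filter.eventually_all.2 fun i => key (fun s => s ≤ δ i) ⟨δ i, hδ i, fun s _ h => h⟩
    have e3 := Filter.eventually_all.2 fun i => key (fun s => closedBall (x i) s ⊆ ball x₀ r) (by
      obtain ⟨η, hη, h⟩ := Metric.nhds_basis_closedBall.mem_iff.1 (isOpen_ball.mem_nhds (hxm i).2)
      exact ⟨η, hη, fun s _ hs => (closedBall_subset_closedBall hs).trans h⟩)
    have e4 := Filter.eventually_all.2 fun i => Filter.eventually_all.2 fun l =>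
      key (fun s => i ≠ l → Disjoint (closedBall (x i) s) (closedBall (x l) s)) (by
        by_cases hil : i = l
        · exact ⟨1, one_pos, fun s _ _ h => (h hil).elim⟩
        · have hd : 0 < dist (x i) (x l) := dist_pos.2 fun h => hil (hxinj h)
          exact ⟨dist (x i) (x l) / 3, by positivity, fun s _ hs _ =>
            closedBall_disjoint_closedBall (by linarith)⟩)
    have e5 := Filter.eventually_all.2 fun i =>
      key (fun s => Disjoint (cthickening s (Z i)) (H ⁻¹' closure (V₀ i))) (by
        have hdz : Disjoint (Z i) (H ⁻¹' closure (V₀ i)) := by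
          rw [disjoint_left]
          intro y hy hy'
          exact (hV₀sub i hy').2 ⟨y, hy, rfl⟩
        obtain ⟨η, hη, h⟩ := hdz.exists_cthickenings (hZc i)
          (isClosed_closure.preimage H.continuous)
        exact ⟨η, hη, fun s hs hsη => h.mono (cthickening_mono hsη _)
          (self_subset_cthickening _)⟩)
    obtain ⟨s, h1, h2, h3, h4, h5, h6⟩ := (e1.and (e2.and (e3.and (e4.and (e5.and
      (eventually_mem_nhdsWithin)))))).exists
    exact ⟨s, h6, h1, h2, h3, h4, h5⟩
  -- squeezing the fingers
  set S : 𝒰 → Set (F × ℝ) := fun i =>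
    closedBall (x i) (2 * s) ×ˢ Icc (c i - 3 * ρ) (c i + 3 * ρ) with hS
  have hSd : ∀ i l, i ≠ l → Disjoint (S i) (S l) := fun i l hil => by
    rw [disjoint_left]
    intro p hp hp'
    exact disjoint_left.1 (hsd i l hil) hp.1 hp'.1
  have hSb : ∀ i, S i ⊆ b := fun i => prod_mono (hsr i) (hIcc i)
  choose θ₀ hθ₀ hθ₀1 hθ₀2 hθ₀3 using fun i => exists_squeeze (x i) hs hρ (hj i) (hδ i) (hδρ i)
  obtain ⟨θ, hθ, hθo⟩ := exists_homeomorph_combine (Finset.univ : Finset 𝒰)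
    (fun i _ l _ h => hSd i l h) θ₀ fun i _ p hp => hθ₀ i p hp
  replace hθ : ∀ i, ∀ p ∈ S i, θ p = θ₀ i p := fun i => hθ i (Finset.mem_univ i)
  replace hθo : ∀ p, (∀ i, p ∉ S i) → θ p = p := fun p h => hθo p fun i _ => h i
  set G : F × ℝ ≃ₜ F × ℝ := ((H.symm.trans θ).trans H).trans g with hG
  have hGa : ∀ y, G y = g (H (θ (H.symm y))) := fun y => rfl
  have hθb : ∀ y ∉ H '' b, H (θ (H.symm y)) = y := by
    intro y hy
    rw [hθo _ fun i hi => hy ⟨_, hSb i hi, H.apply_symm_apply y⟩, H.apply_symm_apply]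
  have hGW : ∀ y ∉ W, G y = y := fun y hy => by
    rw [hGa, hθb y fun h => hy (hbW h), hgΩ y fun h => hy h.1]
  have hGK : ∀ y ∈ K, G y = y := fun y hy => by
    rw [hGa, hθb y fun h => disjoint_left.1 hKb hy h, hgK y hy]
  have hbox : ∀ i, ∀ p : F × ℝ, p.1 ∈ closedBall (x i) (2 * s) →
      p.2 ∈ Ioo (j i - δ i) (j i + δ i) → H p ∈ V' i := by
    intro i p hp1 hp2
    refine hδV i ?_
    rw [mem_closedBall, Prod.dist_eq, max_le_iff]
    refine ⟨(mem_closedBall.1 hp1).trans (hsδ i), ?_⟩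
    rw [Real.dist_eq, abs_le]
    constructor <;> linarith [hp2.1, hp2.2]
  have hjδ : ∀ i, j i ∈ Ioo (j i - δ i) (j i + δ i) := fun i =>
    ⟨by linarith [hδ i], by linarith [hδ i]⟩
  have hθV₀ : ∀ i, ∀ y ∈ closure (V₀ i), H (θ (H.symm y)) ∈ V' i := by
    intro i y hy
    by_cases hyS : ∃ l, H.symm y ∈ S l
    · obtain ⟨l, hl⟩ := hyS
      have hli : l = i ∧ (H.symm y).2 ∈ Ioo (j i - δ i) (j i + δ i) := by
        by_contra hcon
        have hmem : (x l, (H.symm y).2) ∈ Z i :=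
          mem_iUnion₂.2 ⟨l, Finset.mem_univ l, rfl, hl.2, hcon⟩
        have hcl : H.symm y ∈ cthickening (2 * s) (Z i) := by
          refine mem_cthickening_of_dist_le _ _ _ _ hmem ?_
          rw [Prod.dist_eq, dist_self, max_le_iff]
          exact ⟨hl.1, by positivity⟩
        exact disjoint_left.1 (hsZ i) hcl (by simpa using hy)
      obtain ⟨rfl, hl2⟩ := hli
      rw [hθ l _ hl]
      exact hbox l _ (by rw [hθ₀1]; exact hl.1) (hθ₀2 l _ _ _ (hjδ l) hl2)
    · push Not at hyS
      rw [hθo _ hyS, H.apply_symm_apply]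
      exact (hV₀sub i hy).1
  set B : 𝒰 → Set (F × ℝ) := fun i =>
    ball (x i) s ×ˢ Ioo (c i - 2 * ρ) (c i + 2 * ρ) with hB
  have hBcl : ∀ i, closure (B i) ⊆ closedBall (x i) s ×ˢ Icc (c i - 2 * ρ) (c i + 2 * ρ) :=
    fun i => closure_minimal (prod_mono ball_subset_closedBall Ioo_subset_Icc_self)
      (isClosed_closedBall.prod isClosed_Icc)
  have hBS : ∀ i, closedBall (x i) s ×ˢ Icc (c i - 2 * ρ) (c i + 2 * ρ) ⊆ S i := fun i =>
    prod_mono (closedBall_subset_closedBall (by linarith))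
      (Icc_subset_Icc (by linarith) (by linarith))
  have hθB : ∀ i, ∀ p ∈ closure (B i), H (θ p) ∈ V' i := by
    intro i p hp
    have hp' := hBcl i hp
    rw [hθ i p (hBS i hp')]
    exact hbox i _ (by rw [hθ₀1]; exact (hBS i hp').1) (hθ₀3 i p hp')
  set V : 𝒰 → Set (F × ℝ) := fun i => V₀ i ∪ H '' B i with hVdef
  have hVcl : ∀ i, closure (G '' V i) ⊆ i := by
    intro i
    rw [← G.image_closure, hVdef]
    dsimp only
    rw [closure_union, ← H.image_closure]
    rintro _ ⟨y, hy | ⟨p, hp, rfl⟩, rfl⟩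
    · exact hθV₀ i y hy
    · have := hθB i p hp
      rw [hGa, H.symm_apply_apply]
      exact this
  have hBo : ∀ i, IsOpen (B i) := fun i => isOpen_ball.prod isOpen_Ioo
  have hxB : ∀ i, (x i, j i) ∈ B i := fun i => ⟨mem_ball_self hs, hj i⟩
  have hKV : ∀ i : 𝒰, K ∩ i ⊆ G '' V i := fun i y hy =>
    ⟨y, Or.inl (hV₀K i (Or.inl hy)), hGK y hy.1⟩
  have hKGV : ∀ i, K ∩ G '' V i = K ∩ i := fun i =>
    Subset.antisymm (inter_subset_inter_right _ (subset_closure.trans (hVcl i)))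
      (subset_inter inter_subset_left (hKV i))
  have hYV : ∀ i, ∀ y ∈ Y, H y ∈ V i → y ∈ B i := by
    rintro i y hy (h | ⟨z, hz, hzy⟩)
    · exact ((hV'Ω i (hV₀sub i (subset_closure h)).1).2 ⟨y, hy, rfl⟩).elim
    · rwa [← H.injective hzy]
  refine ⟨G, hGW, hGK, range fun i => G '' V i, finite_range _, ?_, ?_, ?_⟩
  · rintro _ ⟨i, rfl⟩
    refine ⟨(hVcl i).trans ((h𝒰 i i.2).2.2.1.trans sdiff_subset), ?_, ?_⟩
    · refine ⟨G.isOpen_image.2 ((hV₀o i).union (H.isOpen_image.2 (hBo i))), ?_, ?_, x i, (hxm i).1,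
        s, hs, c i - 2 * ρ, c i + 2 * ρ, by linarith, ?_, ?_, ?_, ?_⟩
      · refine IsPreconnected.image ?_ _ G.continuous.continuousOn
        refine IsPreconnected.union (H (x i, j i)) (hV₀K i (Or.inr rfl)) ⟨_, hxB i, rfl⟩ (hV₀c i) ?_
        exact ((convex_ball _ _).isPreconnected.prod isPreconnected_Ioo).image _
          H.continuous.continuousOn
      · rw [hKGV, ← hKU]
        exact (h𝒰 i i.2).2.2.2.2.2.1
      · rintro _ ⟨p, hp, rfl⟩
        exact ⟨H p, Or.inr ⟨p, hp, rfl⟩, rfl⟩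
      · rintro _ ⟨⟨v, hv, rfl⟩, y, hy, hyv⟩
        have : H y = v := G.injective hyv
        exact ⟨y, hYV i y hy (by rwa [this]), hyv⟩
      · rw [disjoint_left]
        rintro y hy ⟨p, hp, rfl⟩
        have h1 : G (H p) = G (G (H p)) := (hGK _ hy).symm
        have hy' : H p ∈ K := by
          rw [G.injective h1]
          exact hy
        exact disjoint_left.1 hKb hy' ⟨p, hSb i (hBS i (hBcl i (subset_closure hp))), rfl⟩
      · intro y hy
        rw [hKGV] at hy
        have := abs_lt.1 (hπc i y hy)
        constructor <;> linarith [this.1, this.2]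
    · refine ⟨?_, ?_, ?_⟩
      · rw [hKGV]
        exact ⟨k i, hk i⟩
      · intro y hy y' hy'
        exact ((h𝒰 i i.2).2.2.2.1 y (hVcl i (subset_closure hy)) y'
          (hVcl i (subset_closure hy'))).le
      · rintro y hy y' hy' ⟨v, hv, hvy⟩ ⟨v', hv', hvy'⟩
        have e1 : v = H y := G.injective hvy
        have e2 : v' = H y' := G.injective hvy'
        have h1 := hYV i y hy (e1 ▸ hv)
        have h2 := hYV i y' hy' (e2 ▸ hv')
        rw [Prod.dist_eq, max_le_iff]
        constructor
        · have := dist_triangle_right y.1 y'.1 (x i)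
          linarith [mem_ball.1 h1.1, mem_ball.1 h2.1]
        · rw [Real.dist_eq, abs_le]
          constructor <;> linarith [h1.2.1, h1.2.2, h2.2.1, h2.2.2]
  · rintro _ ⟨i, rfl⟩ _ ⟨l, rfl⟩ hne
    exact (hUd i l fun h => hne (by rw [h])).mono (hVcl i) (hVcl l)
  · intro y hy
    obtain ⟨U, hU, hyU⟩ := h𝒰c hy
    exact ⟨_, ⟨⟨U, hU⟩, rfl⟩, hKV ⟨U, hU⟩ ⟨hy.1, hyU⟩⟩

end Node


section Stage

variable {F : Type*} [NormedAddCommGroup F] [NormedSpace ℝ F]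

theorem IsNode.congr {X : Set F} {C : Set ℝ} {K : Set (F × ℝ)} {π : F × ℝ → ℝ}
    {H H' : F × ℝ ≃ₜ F × ℝ} {W : Set (F × ℝ)} (h : IsNode X C K π H W)
    (hH : ∀ p, H p ∈ W ∨ H' p ∈ W → H p = H' p) : IsNode X C K π H' W := by
  obtain ⟨h1, h2, h3, x, hx, r, hr, α, β, hαβ, h4, h5, h6, h7⟩ := h
  have e : H' '' (ball x r ×ˢ Ioo α β) = H '' (ball x r ×ˢ Ioo α β) :=
    image_congr fun p hp => (hH p (Or.inl (h4 ⟨p, hp, rfl⟩))).symm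
  refine ⟨h1, h2, h3, x, hx, r, hr, α, β, hαβ, by rwa [e], ?_, by rwa [e], h7⟩
  rw [e]
  rintro _ ⟨hw, y, hy, rfl⟩
  have e' := hH y (Or.inr hw)
  rw [← e'] at hw ⊢
  exact h5 ⟨hw, y, hy, rfl⟩

theorem IsSmallFor.congr {X : Set F} {C : Set ℝ} {K : Set (F × ℝ)} {ε : ℝ}
    {H H' : F × ℝ ≃ₜ F × ℝ} {W : Set (F × ℝ)} (h : IsSmallFor X C K H ε W)
    (hH : ∀ p, H p ∈ W ∨ H' p ∈ W → H p = H' p) : IsSmallFor X C K H' ε W :=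
  ⟨h.1, h.2.1, fun y hy y' hy' hw hw' => h.2.2 y hy y' hy' (by rwa [hH y (Or.inr hw)])
    (by rwa [hH y' (Or.inr hw')])⟩

/-- A finite disjoint family of nodes around `K`. -/
structure IsStage (X : Set F) (C : Set ℝ) (K : Set (F × ℝ)) (π : F × ℝ → ℝ)
    (H : F × ℝ ≃ₜ F × ℝ) (𝒲 : Set (Set (F × ℝ))) : Prop where
  finite : 𝒲.Finite
  isNode : ∀ W ∈ 𝒲, IsNode X C K π H W
  disjoint : ∀ W ∈ 𝒲, ∀ W' ∈ 𝒲, W ≠ W' → Disjoint (closure W) (closure W')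
  subset : K ⊆ ⋃₀ 𝒲
  disjoint_image : Disjoint K (H '' (X ×ˢ C))

/-- `(H', 𝒲')` refines `(H, 𝒲)`, with pieces of size at most `ε`. -/
structure StageRefines (X : Set F) (C : Set ℝ) (K : Set (F × ℝ)) (H : F × ℝ ≃ₜ F × ℝ)
    (𝒲 : Set (Set (F × ℝ))) (ε : ℝ) (H' : F × ℝ ≃ₜ F × ℝ) (𝒲' : Set (Set (F × ℝ))) : Prop where
  eq_of_notMem : ∀ y, H y ∉ ⋃₀ 𝒲 → H' y = H y
  mem_of_mem : ∀ W ∈ 𝒲, ∀ y, H y ∈ W → H' y ∈ W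
  small : ∀ V ∈ 𝒲', IsSmallFor X C K H' ε V
  exists_closure_subset : ∀ V ∈ 𝒲', ∃ W ∈ 𝒲, closure V ⊆ W

variable [FiniteDimensional ℝ F]

theorem IsStage.exists_refines (hF : 1 < Module.rank ℝ F) {X : Set F} {C : Set ℝ}
    {K : Set (F × ℝ)} {π : F × ℝ → ℝ} {H : F × ℝ ≃ₜ F × ℝ} {𝒲 : Set (Set (F × ℝ))}
    (hX : IsCompact X) (hXp : ∀ x ∈ X, AccPt x (Filter.principal X)) (hC : IsCompact C)
    (hCi : interior C = ∅) (hK : IsCompact K) (hKd : IsTotallyDisconnected K)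
    (hπ : ContinuousOn π K) (h : IsStage X C K π H 𝒲) {ε : ℝ} (hε : 0 < ε) :
    ∃ H' 𝒲', IsStage X C K π H' 𝒲' ∧ StageRefines X C K H 𝒲 ε H' 𝒲' := by
  classical
  have hstep := fun (W : Set (F × ℝ)) (hW : W ∈ 𝒲) =>
    (h.isNode W hW).refine hF hX hXp hC hCi hK hKd hπ h.disjoint_image hε
  choose! G hG1 hG2 𝒱 h𝒱f h𝒱 h𝒱d h𝒱c using hstep
  have hdis : ∀ W ∈ 𝒲, ∀ W' ∈ 𝒲, W ≠ W' → Disjoint W W' := fun W hW W' hW' hne =>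
    (h.disjoint W hW W' hW' hne).mono subset_closure subset_closure
  obtain ⟨g, hg, hgo⟩ := exists_homeomorph_combine h.finite.toFinset (S := id)
    (fun W hW W' hW' hne => hdis W (by simpa using hW) W' (by simpa using hW') hne) G
    (fun W hW y hy => hG1 W (by simpa using hW) y hy)
  replace hg : ∀ W ∈ 𝒲, ∀ y ∈ W, g y = G W y := fun W hW y hy => hg W (by simpa using hW) y hy
  replace hgo : ∀ y, y ∉ ⋃₀ 𝒲 → g y = y := fun y hy => hgo y fun W hW hyW =>
    hy ⟨W, by simpa using hW, hyW⟩
  have hGW : ∀ W ∈ 𝒲, ∀ y, G W y ∈ W → y ∈ W := fun W hW y hy => by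
    by_contra hn
    rw [hG1 W hW y hn] at hy
    exact hn hy
  have hWG : ∀ W ∈ 𝒲, ∀ y ∈ W, G W y ∈ W := fun W hW y hy => by
    by_contra hn
    have := (G W).injective (hG1 W hW _ hn)
    exact hn (by rwa [this])
  have hgW : ∀ W ∈ 𝒲, ∀ y ∈ W, g y ∈ W := fun W hW y hy => by
    rw [hg W hW y hy]
    exact hWG W hW y hy
  have hWg : ∀ W ∈ 𝒲, ∀ y, g y ∈ W → y ∈ W := fun W hW y hy => by
    by_cases hm : y ∈ ⋃₀ 𝒲
    · obtain ⟨W', hW', hyW'⟩ := hm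
      by_cases hne : W' = W
      · rwa [← hne]
      · exact (disjoint_left.1 (hdis W' hW' W hW hne) (hgW W' hW' y hyW') hy).elim
    · rwa [hgo y hm] at hy
  have hgK : ∀ y ∈ K, g y = y := fun y hy => by
    obtain ⟨W, hW, hyW⟩ := h.subset hy
    rw [hg W hW y hyW, hG2 W hW y hy]
  have hcongr : ∀ W ∈ 𝒲, ∀ V ∈ 𝒱 W, ∀ p, (H.trans (G W)) p ∈ V ∨ (H.trans g) p ∈ V →
      (H.trans (G W)) p = (H.trans g) p := by
    intro W hW V hV p hp
    have hVW : V ⊆ W := subset_closure.trans (h𝒱 W hW V hV).1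
    refine (hg W hW _ ?_).symm
    rcases hp with hp | hp
    · exact hGW W hW _ (hVW hp)
    · exact hWg W hW _ (hVW hp)
  refine ⟨H.trans g, ⋃ W ∈ 𝒲, 𝒱 W, ⟨h.finite.biUnion fun W hW => h𝒱f W hW, ?_, ?_, ?_, ?_⟩,
    ⟨fun y hy => hgo _ hy, fun W hW y hy => hgW W hW _ hy, ?_, ?_⟩⟩
  · intro V hV
    obtain ⟨W, hW, hVW⟩ := mem_iUnion₂.1 hV
    exact (h𝒱 W hW V hVW).2.1.congr (hcongr W hW V hVW)
  · intro V hV V' hV' hne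
    obtain ⟨W, hW, hVW⟩ := mem_iUnion₂.1 hV
    obtain ⟨W', hW', hVW'⟩ := mem_iUnion₂.1 hV'
    by_cases hWW : W = W'
    · subst hWW
      exact h𝒱d W hW V hVW V' hVW' hne
    · exact (hdis W hW W' hW' hWW).mono (h𝒱 W hW V hVW).1 (h𝒱 W' hW' V' hVW').1
  · intro y hy
    obtain ⟨W, hW, hyW⟩ := h.subset hy
    obtain ⟨V, hV, hyV⟩ := h𝒱c W hW ⟨hy, hyW⟩
    exact ⟨V, mem_iUnion₂.2 ⟨W, hW, hV⟩, hyV⟩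
  · rw [disjoint_left]
    rintro _ hy ⟨p, hp, rfl⟩
    have h1 : g (H p) = g (g (H p)) := (hgK _ hy).symm
    have hy' : H p ∈ K := by
      rw [g.injective h1]
      exact hy
    exact disjoint_left.1 h.disjoint_image hy' ⟨p, hp, rfl⟩
  · intro V hV
    obtain ⟨W, hW, hVW⟩ := mem_iUnion₂.1 hV
    exact (h𝒱 W hW V hVW).2.2.congr (hcongr W hW V hVW)
  · intro V hV
    obtain ⟨W, hW, hVW⟩ := mem_iUnion₂.1 hV
    exact ⟨W, hW, (h𝒱 W hW V hVW).1⟩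

theorem exists_isStage (hF : 1 < Module.rank ℝ F) {X : Set F} {C : Set ℝ} {K : Set (F × ℝ)}
    {π : F × ℝ → ℝ} (hX : IsCompact X) (hXne : X.Nonempty) (hC : IsCompact C)
    (hK : IsCompact K) (hπC : MapsTo π K C) : ∃ H 𝒲, IsStage X C K π H 𝒲 := by
  have : Nontrivial F := rank_pos_iff_nontrivial.1 (zero_lt_one.trans hF)
  obtain ⟨x, hx⟩ := frontier_nonempty_of_isCompact hX hXne
  obtain ⟨r, hr, hXr⟩ : ∃ r > 0, X ⊆ ball x r := by
    obtain ⟨r, hr⟩ := hX.isBounded.subset_ball x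
    exact ⟨max r 1, by positivity, hr.trans (ball_subset_ball (le_max_left _ _))⟩
  obtain ⟨a, ha0, ha⟩ : ∃ a > 0, C ⊆ ball 0 a := by
    obtain ⟨r, hr⟩ := hC.isBounded.subset_ball 0
    exact ⟨max r 1, by positivity, hr.trans (ball_subset_ball (le_max_left _ _))⟩
  rw [Real.ball_eq_Ioo, zero_sub, zero_add] at ha
  obtain ⟨R, hR⟩ := hK.isBounded.subset_ball (0 : F × ℝ)
  set H : F × ℝ ≃ₜ F × ℝ := Homeomorph.addRight (0, a + R) with hH
  have hdis : Disjoint K (H '' (ball x r ×ˢ Ioo (-a) a)) := by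
    rw [disjoint_left]
    rintro _ hk ⟨p, hp, rfl⟩
    have h1 := hR hk
    rw [mem_ball, dist_zero_right, Prod.norm_def, max_lt_iff] at h1
    have h2 : |p.2 + (a + R)| < R := h1.2
    have := abs_lt.1 h2
    linarith [hp.2.1]
  have hYb : X ×ˢ C ⊆ ball x r ×ˢ Ioo (-a) a := prod_mono hXr ha
  refine ⟨H, {univ}, finite_singleton _, ?_, ?_, by simp, hdis.mono_right (image_mono hYb)⟩
  · rintro _ rfl
    refine ⟨isOpen_univ, isPreconnected_univ, by simpa using hK, x, hx, r, hr, -a, a,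
      by linarith, subset_univ _, ?_, hdis, ?_⟩
    · rw [univ_inter]
      exact image_mono hYb
    · rw [inter_univ]
      exact hπC.mono_right ha
  · rintro _ rfl _ rfl h
    exact (h rfl).elim

/-- **Fences through a totally disconnected compactum.** There is a fence of copies of `X`,
indexed by `C`, such that every `k ∈ K` lies on the copy with index `π k` and each copy is locally
flat off `K`. -/
theorem exists_fence (hF : 1 < Module.rank ℝ F) {X : Set F} {C : Set ℝ} {K : Set (F × ℝ)}
    {π : F × ℝ → ℝ} (hX : IsCompact X) (hXne : X.Nonempty)
    (hXp : ∀ x ∈ X, AccPt x (Filter.principal X)) (hC : IsCompact C) (hCi : interior C = ∅)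
    (hK : IsCompact K) (hKd : IsTotallyDisconnected K) (hπ : ContinuousOn π K)
    (hπC : MapsTo π K C) :
    ∃ Φ : F × ℝ → F × ℝ, Continuous Φ ∧ InjOn Φ (X ×ˢ C) ∧
      (∀ k ∈ K, k ∈ Φ '' (X ×ˢ {π k})) ∧
      ∀ s ∈ C, ∀ p ∈ Φ '' (X ×ˢ {s}), p ∉ K → FlatAt F (Φ '' (X ×ˢ {s})) p := by
  classical
  have : ProperSpace F := FiniteDimensional.proper ℝ F
  obtain ⟨H₀, 𝒲₀, h₀⟩ := exists_isStage hF (π := π) hX hXne hC hK hπC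
  set St := {p : (F × ℝ ≃ₜ F × ℝ) × Set (Set (F × ℝ)) // IsStage X C K π p.1 p.2} with hSt
  have hnext : ∀ (n : ℕ) (p : St), ∃ q : St,
      StageRefines X C K p.1.1 p.1.2 ((1 / 2) ^ n) q.1.1 q.1.2 := fun n p => by
    obtain ⟨H', 𝒲', h1, h2⟩ := p.2.exists_refines hF hX hXp hC hCi hK hKd hπ
      (ε := (1 / 2) ^ n) (by positivity)
    exact ⟨⟨(H', 𝒲'), h1⟩, h2⟩
  choose next hnext using hnext
  set st : ℕ → St := fun n => Nat.rec ⟨(H₀, 𝒲₀), h₀⟩ next n with hst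
  set H : ℕ → F × ℝ ≃ₜ F × ℝ := fun n => (st n).1.1 with hHdef
  set 𝒲 : ℕ → Set (Set (F × ℝ)) := fun n => (st n).1.2 with h𝒲def
  have hS : ∀ n, IsStage X C K π (H n) (𝒲 n) := fun n => (st n).2
  have hR : ∀ n, StageRefines X C K (H n) (𝒲 n) ((1 / 2) ^ n) (H (n + 1)) (𝒲 (n + 1)) :=
    fun n => hnext n (st n)
  clear_value H 𝒲
  have hanti : ∀ n m, n ≤ m → ∀ V ∈ 𝒲 m, ∃ W ∈ 𝒲 n, V ⊆ W := by
    intro n m hnm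
    induction m, hnm using Nat.le_induction with
    | base => exact fun V hV => ⟨V, hV, subset_rfl⟩
    | succ m _ ih =>
      intro V hV
      obtain ⟨V', hV', h1⟩ := (hR m).exists_closure_subset V hV
      obtain ⟨W, hW, h2⟩ := ih V' hV'
      exact ⟨W, hW, (subset_closure.trans h1).trans h2⟩
  have huanti : ∀ n m, n ≤ m → ⋃₀ 𝒲 m ⊆ ⋃₀ 𝒲 n := fun n m h y ⟨V, hV, hy⟩ => by
    obtain ⟨W, hW, hVW⟩ := hanti n m h V hV
    exact ⟨W, hW, hVW hy⟩
  have hdis : ∀ n, ∀ W ∈ 𝒲 n, ∀ W' ∈ 𝒲 n, W ≠ W' → Disjoint W W' := fun n W hW W' hW' hne =>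
    ((hS n).disjoint W hW W' hW' hne).mono subset_closure subset_closure
  have hstay : ∀ n m, n ≤ m → ∀ W ∈ 𝒲 n, ∀ y, H n y ∈ W → H m y ∈ W := by
    intro n m hnm W hW y hy
    induction m, hnm using Nat.le_induction with
    | base => exact hy
    | succ m hnm ih =>
      by_cases hm : H m y ∈ ⋃₀ 𝒲 m
      · obtain ⟨V, hV, hyV⟩ := hm
        obtain ⟨W', hW', hVW'⟩ := hanti n m hnm V hV
        have : W' = W := by
          by_contra hne
          exact disjoint_left.1 (hdis n W' hW' W hW hne) (hVW' hyV) ih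
        rw [← this]
        exact hVW' ((hR m).mem_of_mem V hV y hyV)
      · rwa [(hR m).eq_of_notMem y hm]
  have hstat : ∀ n m, n ≤ m → ∀ y, H n y ∉ ⋃₀ 𝒲 n → H m y = H n y := by
    intro n m hnm y hy
    induction m, hnm using Nat.le_induction with
    | base => rfl
    | succ m hnm ih =>
      rw [(hR m).eq_of_notMem y (fun h => hy (huanti n m hnm (by rwa [ih] at h))), ih]
  have hsmall : ∀ n, ∀ W ∈ 𝒲 (n + 1), IsSmallFor X C K (H (n + 1)) ((1 / 2) ^ n) W := fun n =>
    (hR n).small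
  have hdist : ∀ n m, n + 1 ≤ m → ∀ y, dist (H (n + 1) y) (H m y) ≤ (1 / 2) ^ n := by
    intro n m hnm y
    by_cases hy : H (n + 1) y ∈ ⋃₀ 𝒲 (n + 1)
    · obtain ⟨W, hW, hyW⟩ := hy
      exact (hsmall n W hW).2.1 _ hyW _ (hstay _ m hnm W hW y hyW)
    · rw [hstat _ m hnm y hy, dist_self]
      positivity
  have hpow : Filter.Tendsto (fun n : ℕ => ((1 : ℝ) / 2) ^ n) Filter.atTop (𝓝 0) :=
    tendsto_pow_atTop_nhds_zero_of_lt_one (by norm_num) (by norm_num)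
  have hpow' : ∀ ε > 0, ∃ n : ℕ, ((1 : ℝ) / 2) ^ n < ε := fun ε hε =>
    exists_pow_lt_of_lt_one hε (by norm_num)
  have hlim : ∀ y, ∃ z, Filter.Tendsto (fun n => H n y) Filter.atTop (𝓝 z) := fun y => by
    refine cauchySeq_tendsto_of_complete (Metric.cauchySeq_iff'.2 fun ε hε => ?_)
    obtain ⟨n, hn⟩ := hpow' ε hε
    exact ⟨n + 1, fun m hm => by
      rw [dist_comm]
      exact (hdist n m hm y).trans_lt hn⟩
  choose Φ hΦ using hlim
  have hΦd : ∀ n y, dist (H (n + 1) y) (Φ y) ≤ (1 / 2) ^ n := fun n y =>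
    le_of_tendsto (tendsto_const_nhds.dist (hΦ y))
      ((Filter.eventually_ge_atTop (n + 1)).mono fun m hm => hdist n m hm y)
  have hΦc : Continuous Φ := by
    refine Metric.continuous_iff.2 fun y ε hε => ?_
    obtain ⟨n, hn⟩ := hpow' (ε / 3) (by positivity)
    obtain ⟨δ, hδ, h⟩ := Metric.continuous_iff.1 (H (n + 1)).continuous y (ε / 3) (by positivity)
    refine ⟨δ, hδ, fun z hz => ?_⟩
    have h1 := hΦd n z
    have h2 := hΦd n y
    have h3 := h z hz
    have h4 := dist_triangle4 (Φ z) (H (n + 1) z) (H (n + 1) y) (Φ y)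
    rw [dist_comm (Φ z) (H (n + 1) z)] at h4
    linarith
  have hΦstat : ∀ n y, H n y ∉ ⋃₀ 𝒲 n → Φ y = H n y := fun n y hy =>
    tendsto_nhds_unique (hΦ y) (tendsto_const_nhds.congr'
      ((Filter.eventually_ge_atTop n).mono fun m hm => (hstat n m hm y hy).symm))
  have hΦcl : ∀ n, ∀ W ∈ 𝒲 n, ∀ y, H n y ∈ W → Φ y ∈ closure W := fun n W hW y hy =>
    mem_closure_of_tendsto (hΦ y)
      ((Filter.eventually_ge_atTop n).mono fun m hm => hstay n m hm W hW y hy)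
  have hΦK : ∀ y, (∀ n, H n y ∈ ⋃₀ 𝒲 n) → Φ y ∈ K := by
    intro y hy
    rw [← hK.isClosed.closure_eq, Metric.mem_closure_iff]
    intro ε hε
    obtain ⟨n, hn⟩ := hpow' (ε / 2) (by positivity)
    obtain ⟨W, hW, hyW⟩ := hy (n + 1)
    obtain ⟨⟨k, hk, hkW⟩, hd, -⟩ := hsmall n W hW
    refine ⟨k, hk, ?_⟩
    have h1 := hΦd n y
    have h2 := hd _ hyW _ hkW
    have h3 := dist_triangle_left (Φ y) k (H (n + 1) y)
    linarith
  have hΦinj : InjOn Φ (X ×ˢ C) := by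
    intro y hy y' hy' he
    by_contra hne
    have hnotK : ∀ y ∈ X ×ˢ C, ∀ n, H n y ∉ ⋃₀ 𝒲 n → Φ y ∉ K := fun y hy n hn hK' => by
      rw [hΦstat n y hn] at hK'
      exact disjoint_left.1 (hS n).disjoint_image hK' ⟨y, hy, rfl⟩
    by_cases h1 : ∀ n, H n y ∈ ⋃₀ 𝒲 n
    · by_cases h2 : ∀ n, H n y' ∈ ⋃₀ 𝒲 n
      · obtain ⟨n, hn⟩ := hpow' (dist y y') (dist_pos.2 hne)
        obtain ⟨W, hW, hyW⟩ := h1 (n + 1)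
        obtain ⟨W', hW', hyW'⟩ := h2 (n + 1)
        have hWW : W ≠ W' := by
          rintro rfl
          exact absurd ((hsmall n W hW).2.2 y hy y' hy' hyW hyW') (not_le.2 hn)
        exact disjoint_left.1 ((hS (n + 1)).disjoint W hW W' hW' hWW) (hΦcl _ W hW y hyW)
          (he ▸ hΦcl _ W' hW' y' hyW')
      · push Not at h2
        obtain ⟨n, hn⟩ := h2
        exact hnotK y' hy' n hn (he ▸ hΦK y h1)
    · push Not at h1
      obtain ⟨n, hn⟩ := h1
      by_cases h2 : ∀ n, H n y' ∈ ⋃₀ 𝒲 n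
      · exact hnotK y hy n hn (he ▸ hΦK y' h2)
      · push Not at h2
        obtain ⟨m, hm⟩ := h2
        have e1 : Φ y = H (max n m) y := by
          rw [hΦstat n y hn, hstat n _ (le_max_left _ _) y hn]
        have e2 : Φ y' = H (max n m) y' := by
          rw [hΦstat m y' hm, hstat m _ (le_max_right _ _) y' hm]
        rw [e1, e2] at he
        exact hne ((H _).injective he)
  refine ⟨Φ, hΦc, hΦinj, ?_, ?_⟩
  · intro k hk
    have hcpt : IsCompact (Φ '' (X ×ˢ {π k})) := (hX.prod isCompact_singleton).image hΦc
    rw [← hcpt.isClosed.closure_eq, Metric.mem_closure_iff]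
    intro ε hε
    obtain ⟨n, hn⟩ := hpow' (ε / 2) (by positivity)
    obtain ⟨W, hW, hkW⟩ := (hS (n + 1)).subset hk
    obtain ⟨-, -, -, x, hx, r, hr, α, β, -, hb, -, -, hm⟩ := (hS (n + 1)).isNode W hW
    refine ⟨Φ (x, π k), ⟨(x, π k), ⟨hX.isClosed.frontier_subset hx, mem_singleton _⟩, rfl⟩, ?_⟩
    have h1 := hΦd n (x, π k)
    have h2 := (hsmall n W hW).2.1 _ hkW _ (hb ⟨(x, π k), ⟨mem_ball_self hr, hm ⟨hk, hkW⟩⟩, rfl⟩)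
    have h3 := dist_triangle k (H (n + 1) (x, π k)) (Φ (x, π k))
    linarith
  · intro s hs p hp hpK
    obtain ⟨ε, hε, hεK⟩ := Metric.isOpen_iff.1 hK.isClosed.isOpen_compl p hpK
    obtain ⟨n, hn⟩ := hpow' (ε / 2) (by positivity)
    have hO : ∀ W ∈ 𝒲 (n + 1), Disjoint (ball p (ε / 2)) W := by
      intro W hW
      rw [disjoint_left]
      intro y hy hyW
      obtain ⟨⟨k, hk, hkW⟩, hd, -⟩ := hsmall n W hW
      refine hεK (show k ∈ ball p ε from ?_) hk
      have h1 := hd _ hkW _ hyW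
      have h2 := dist_triangle k y p
      rw [mem_ball] at hy ⊢
      linarith
    set φ : F × ℝ ≃ₜ F × ℝ := (H (n + 1)).symm.trans (Homeomorph.addRight (0, -s)) with hφ
    refine ⟨φ.toOpenPartialHomeomorph.restrOpen (ball p (ε / 2)) isOpen_ball, ?_, ?_⟩
    · simp [hε]
    · intro q hq hqX
      have hqb : q ∈ ball p (ε / 2) := by simpa using hq
      obtain ⟨⟨z, t⟩, ⟨hz, ht⟩, rfl⟩ := hqX
      have ht' : t = s := ht
      have hnot : H (n + 1) (z, t) ∉ ⋃₀ 𝒲 (n + 1) := by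
        rintro ⟨W, hW, hzW⟩
        have h1 := hΦcl _ W hW _ hzW
        exact disjoint_left.1 ((hO W hW).closure_right isOpen_ball) hqb h1
      have e : Φ (z, t) = H (n + 1) (z, t) := hΦstat _ _ hnot
      change (φ (Φ (z, t))).2 = 0
      rw [e, hφ]
      simp [ht']

end Stage


section LocEq

variable {Y Z G : Type*} [TopologicalSpace Y] [TopologicalSpace Z] [Group G]

/-- `τ` and `τ'` agree near each point of `S`. -/
def LocEqOn (τ τ' : Y → Y → G) (S : Set Y) : Prop :=
  ∀ x ∈ S, ∃ O ∈ 𝓝 x, ∀ a ∈ O, ∀ b ∈ O, τ' a b = τ a b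

theorem LocEqOn.mono {τ τ' : Y → Y → G} {S T : Set Y} (h : LocEqOn τ τ' T) (hST : S ⊆ T) :
    LocEqOn τ τ' S := fun x hx => h x (hST hx)

theorem LocEqOn.symm {τ τ' : Y → Y → G} {S : Set Y} (h : LocEqOn τ τ' S) : LocEqOn τ' τ S :=
  fun x hx => let ⟨O, hO, h⟩ := h x hx; ⟨O, hO, fun a ha b hb => (h a ha b hb).symm⟩

theorem LocEqOn.trans {τ τ' τ'' : Y → Y → G} {S : Set Y} (h : LocEqOn τ τ' S)
    (h' : LocEqOn τ' τ'' S) : LocEqOn τ τ'' S := by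
  intro x hx
  obtain ⟨O, hO, h⟩ := h x hx
  obtain ⟨O', hO', h'⟩ := h' x hx
  exact ⟨O ∩ O', Filter.inter_mem hO hO', fun a ha b hb =>
    (h' a ha.2 b hb.2).trans (h a ha.1 b hb.1)⟩

theorem LocEqOn.comp {τ τ' : Z → Z → G} {S : Set Z} (h : LocEqOn τ τ' S) {T : Set Y} {f : Y → Z}
    (hf : ∀ y ∈ T, ContinuousAt f y) (hT : MapsTo f T S) :
    LocEqOn (fun a b => τ (f a) (f b)) (fun a b => τ' (f a) (f b)) T := by
  intro x hx
  obtain ⟨O, hO, h⟩ := h (f x) (hT hx)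
  exact ⟨f ⁻¹' O, hf x hx hO, fun a ha b hb => h _ ha _ hb⟩

theorem LocEqOn.cohomOn {τ τ' : Y → Y → G} {S : Set Y} (h : LocEqOn τ τ' S) : CohomOn τ τ' S :=
  CohomOn.of_eq h

end LocEq

section Jump

variable {G : Type*} [Group G]

open Classical in
/-- The model cocycle on the punctured plane, with value `g` across the positive real axis. -/
noncomputable def jump (g : G) (z w : ℂ) : G :=
  if 0 < z.re ∧ 0 < w.re then
    g ^ ((if 0 ≤ w.im then (1 : ℤ) else 0) - (if 0 ≤ z.im then (1 : ℤ) else 0))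
  else 1

theorem jump_real_smul (g : G) {r : ℝ} (hr : 0 < r) (z w : ℂ) :
    jump g (r * z) (r * w) = jump g z w := by
  simp [jump, hr]

/-- The cocycle `τ` on the punctured plane has holonomy `g` around the origin. -/
def HasHolonomy (τ : ℂ → ℂ → G) (g : G) : Prop :=
  ∃ σ : ℂ → G, (∀ a, ∃ O ∈ 𝓝 a, ∀ b ∈ O, ∀ c ∈ O,
    τ (Complex.exp b) (Complex.exp c) = (σ b)⁻¹ * σ c) ∧
    ∀ a, σ (a + 2 * Real.pi * Complex.I) = g * σ a

theorem HasHolonomy.cohomOn {τ τ' : ℂ → ℂ → G} {g : G} (h : HasHolonomy τ g)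
    (h' : HasHolonomy τ' g) : CohomOn τ τ' {z | z ≠ 0} := by
  obtain ⟨σ, h1, h2⟩ := h
  obtain ⟨σ', h1', h2'⟩ := h'
  have hper : ∀ a, (σ (Complex.log (Complex.exp a)))⁻¹ * σ' (Complex.log (Complex.exp a))
      = (σ a)⁻¹ * σ' a := by
    intro a
    have hp : Function.Periodic (fun a => (σ a)⁻¹ * σ' a) (2 * Real.pi * Complex.I) := by
      intro a
      simp only [h2, h2']
      group
    have he : Complex.exp (Complex.log (Complex.exp a)) = Complex.exp a :=
      Complex.exp_log (Complex.exp_ne_zero a)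
    obtain ⟨n, hn⟩ := Complex.exp_eq_exp_iff_exists_int.1 he
    rw [hn]
    exact hp.int_mul n a
  refine ⟨fun z => (σ (Complex.log z))⁻¹ * σ' (Complex.log z), fun z hz => ?_⟩
  obtain ⟨O, hO, h1⟩ := h1 (Complex.log z)
  obtain ⟨O', hO', h1'⟩ := h1' (Complex.log z)
  have hmap := (Complex.hasStrictDerivAt_exp (Complex.log z)).map_nhds_eq (Complex.exp_ne_zero _)
  rw [Complex.exp_log hz] at hmap
  refine ⟨Complex.exp '' (O ∩ O'), ?_, ?_⟩
  · rw [← hmap]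
    exact Filter.image_mem_map (Filter.inter_mem hO hO')
  · rintro _ ⟨b, hb, rfl⟩ _ ⟨c, hc, rfl⟩
    rw [h1 b hb.1 c hc.1, h1' b hb.2 c hc.2]
    simp only [hper]
    group

theorem HasHolonomy.cocycleOn {τ : ℂ → ℂ → G} {g : G} (h : HasHolonomy τ g) :
    CocycleOn τ {z | z ≠ 0} := by
  obtain ⟨σ, h1, -⟩ := h
  intro z hz
  obtain ⟨O, hO, h1⟩ := h1 (Complex.log z)
  have hmap := (Complex.hasStrictDerivAt_exp (Complex.log z)).map_nhds_eq (Complex.exp_ne_zero _)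
  rw [Complex.exp_log hz] at hmap
  refine ⟨Complex.exp '' O, hmap ▸ Filter.image_mem_map hO, ?_⟩
  rintro _ ⟨a, ha, rfl⟩ _ ⟨b, hb, rfl⟩ _ ⟨c, hc, rfl⟩
  rw [h1 a ha b hb, h1 b hb c hc, h1 a ha c hc]
  group

theorem HasHolonomy.comp_pow {τ : ℂ → ℂ → G} {g : G} (h : HasHolonomy τ g) (N : ℕ) :
    HasHolonomy (fun z w => τ (z ^ N) (w ^ N)) (g ^ N) := by
  obtain ⟨σ, h1, h2⟩ := h
  refine ⟨fun a => σ (N * a), fun a => ?_, fun a => ?_⟩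
  · obtain ⟨O, hO, h1⟩ := h1 (N * a)
    refine ⟨(fun b : ℂ => (N : ℂ) * b) ⁻¹' O, ?_, fun b hb c hc => ?_⟩
    · exact (continuous_const.mul continuous_id).continuousAt hO
    · simp only [← Complex.exp_nat_mul]
      exact h1 _ hb _ hc
  · have : ∀ (n : ℕ) (b : ℂ), σ (b + n * (2 * Real.pi * Complex.I)) = g ^ n * σ b := by
      intro n b
      induction n with
      | zero => simp
      | succ n ih =>
        rw [pow_succ', mul_assoc g, ← ih, ← h2]
        congr 1
        push_cast
        ring
    simp only [mul_add]
    exact this N _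

theorem hasHolonomy_jump (g : G) : HasHolonomy (jump g) g := by
  have hpi := Real.pi_pos
  have hexp : ∀ b : ℂ, (Complex.exp b).re = Real.exp b.re * Real.cos b.im ∧
      (Complex.exp b).im = Real.exp b.re * Real.sin b.im := fun b =>
    ⟨Complex.exp_re b, Complex.exp_im b⟩
  refine ⟨fun a => g ^ ⌊a.im / (2 * Real.pi)⌋, fun a => ?_, fun a => ?_⟩
  · set m := ⌊a.im / (2 * Real.pi) + 1 / 2⌋ with hm
    have hm1 := Int.floor_le (a.im / (2 * Real.pi) + 1 / 2)
    have hm2 := Int.lt_floor_add_one (a.im / (2 * Real.pi) + 1 / 2)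
    rw [← hm] at hm1 hm2
    have e1 : a.im = a.im / (2 * Real.pi) * (2 * Real.pi) := by field_simp
    set y := a.im / (2 * Real.pi) with hy
    have hc : Continuous fun b : ℂ => b.im / (2 * Real.pi) := by fun_prop
    have him : ∀ b : ℂ, b.im = b.im / (2 * Real.pi) * (2 * Real.pi) := fun b => by field_simp
    have hper : ∀ t : ℝ, Real.cos (t * (2 * Real.pi)) = Real.cos ((t - m) * (2 * Real.pi)) ∧
        Real.sin (t * (2 * Real.pi)) = Real.sin ((t - m) * (2 * Real.pi)) := fun t => by
      rw [sub_mul, Real.cos_sub_int_mul_two_pi, Real.sin_sub_int_mul_two_pi]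
      exact ⟨rfl, rfl⟩
    rcases lt_trichotomy y m with h | h | h
    · -- just below an integer
      refine ⟨(fun b : ℂ => b.im / (2 * Real.pi)) ⁻¹' Ioo (m - 3 / 4) m,
        hc.continuousAt (Ioo_mem_nhds (by linarith) h), fun b hb c hc => ?_⟩
      have hfl : ∀ b : ℂ, b.im / (2 * Real.pi) ∈ Ioo ((m : ℝ) - 3 / 4) m →
          ⌊b.im / (2 * Real.pi)⌋ = m - 1 ∧ (0 < (Complex.exp b).re → ¬ 0 ≤ (Complex.exp b).im) := by
        rintro b ⟨hb1, hb2⟩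
        refine ⟨Int.floor_eq_iff.2 ⟨by push_cast; linarith, by push_cast; linarith⟩, ?_⟩
        rw [(hexp b).1, (hexp b).2, him b, (hper _).1, (hper _).2]
        set t := b.im / (2 * Real.pi) - m
        have ht1 : -(3 / 4) < t := by simp only [t]; linarith
        have ht2 : t < 0 := by simp only [t]; linarith
        intro h0
        have h0' : 0 < Real.cos (t * (2 * Real.pi)) := by
          by_contra h'
          exact absurd h0 (not_lt.2 (mul_nonpos_of_nonneg_of_nonpos (Real.exp_pos _).le (not_lt.1 h')))
        rw [not_le]
        refine mul_neg_of_pos_of_neg (Real.exp_pos _) ?_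
        have ht3 : -(1 / 2) < t := by
          by_contra h'
          push Not at h'
          have : Real.cos (t * (2 * Real.pi) + 2 * Real.pi) ≤ 0 :=  by
            have := Real.cos_nonpos_of_pi_div_two_le_of_le (x := t * (2 * Real.pi) + 2 * Real.pi)
              (by nlinarith) (by nlinarith)
            exact this
          rw [Real.cos_add_two_pi] at this
          linarith
        exact Real.sin_neg_of_neg_of_neg_pi_lt (by nlinarith) (by nlinarith)
      dsimp only
      rw [(hfl b hb).1, (hfl c hc).1, jump]
      simp only [inv_mul_cancel]
      split_ifs with h1 h2 h3 h3
      · exact absurd h2 ((hfl c hc).2 h1.2)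
      · exact absurd h2 ((hfl c hc).2 h1.2)
      · exact absurd h3 ((hfl b hb).2 h1.1)
      · simp
      · rfl
    · refine ⟨(fun b : ℂ => b.im / (2 * Real.pi)) ⁻¹' Ioo (m - 1 / 4) (m + 1 / 4),
        hc.continuousAt (Ioo_mem_nhds (by linarith) (by linarith)), fun b hb c hc => ?_⟩
      have hfl : ∀ b : ℂ, b.im / (2 * Real.pi) ∈ Ioo ((m : ℝ) - 1 / 4) (m + 1 / 4) →
          0 < (Complex.exp b).re ∧ ⌊b.im / (2 * Real.pi)⌋ =
            m - 1 + (if 0 ≤ (Complex.exp b).im then 1 else 0) := by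
        rintro b ⟨hb1, hb2⟩
        rw [(hexp b).1, (hexp b).2, him b, (hper _).1, (hper _).2, ← him b]
        set t := b.im / (2 * Real.pi) - m with ht
        have ht1 : -(1 / 4) < t := by linarith
        have ht2 : t < 1 / 4 := by linarith
        refine ⟨mul_pos (Real.exp_pos _) (Real.cos_pos_of_mem_Ioo ⟨by nlinarith, by nlinarith⟩), ?_⟩
        split_ifs with h0
        · have : 0 ≤ t := by
            by_contra h'
            push Not at h'
            exact absurd h0 (not_le.2 (mul_neg_of_pos_of_neg (Real.exp_pos _)
              (Real.sin_neg_of_neg_of_neg_pi_lt (by nlinarith) (by nlinarith))))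
          rw [Int.floor_eq_iff]
          push_cast
          constructor <;> linarith
        · have : t < 0 := by
            by_contra h'
            push Not at h'
            exact h0 (mul_nonneg (Real.exp_pos _).le
              (Real.sin_nonneg_of_nonneg_of_le_pi (by nlinarith) (by nlinarith)))
          rw [Int.floor_eq_iff]
          push_cast
          constructor <;> linarith
      obtain ⟨hb1, hb2⟩ := hfl b hb
      obtain ⟨hc1, hc2⟩ := hfl c hc
      dsimp only
      rw [hb2, hc2, jump, if_pos ⟨hb1, hc1⟩, ← zpow_neg, ← zpow_add]
      congr 1
      ring
    · refine ⟨(fun b : ℂ => b.im / (2 * Real.pi)) ⁻¹' Ioo (m : ℝ) (m + 3 / 4),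
        hc.continuousAt (Ioo_mem_nhds h (by linarith)), fun b hb c hc => ?_⟩
      have hfl : ∀ b : ℂ, b.im / (2 * Real.pi) ∈ Ioo (m : ℝ) (m + 3 / 4) →
          ⌊b.im / (2 * Real.pi)⌋ = m ∧ (0 < (Complex.exp b).re → 0 ≤ (Complex.exp b).im) := by
        rintro b ⟨hb1, hb2⟩
        refine ⟨Int.floor_eq_iff.2 ⟨by linarith, by linarith⟩, ?_⟩
        rw [(hexp b).1, (hexp b).2, him b, (hper _).1, (hper _).2]
        set t := b.im / (2 * Real.pi) - m
        have ht1 : 0 < t := by simp only [t]; linarith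
        have ht2 : t < 3 / 4 := by simp only [t]; linarith
        intro h0
        have h0' : 0 < Real.cos (t * (2 * Real.pi)) := by
          by_contra h'
          exact absurd h0 (not_lt.2 (mul_nonpos_of_nonneg_of_nonpos (Real.exp_pos _).le (not_lt.1 h')))
        refine mul_nonneg (Real.exp_pos _).le ?_
        have ht3 : t < 1 / 2 := by
          by_contra h'
          push Not at h'
          have := Real.cos_nonpos_of_pi_div_two_le_of_le (x := t * (2 * Real.pi))
              (by nlinarith) (by nlinarith)
          linarith
        exact Real.sin_nonneg_of_nonneg_of_le_pi (by nlinarith) (by nlinarith)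
      dsimp only
      rw [(hfl b hb).1, (hfl c hc).1, jump]
      simp only [inv_mul_cancel]
      split_ifs with h1 h2 h3 h3
      · simp
      · exact absurd ((hfl b hb).2 h1.1) h3
      · exact absurd ((hfl c hc).2 h1.2) h2
      · exact absurd ((hfl c hc).2 h1.2) h2
      · rfl
  · have : (a + 2 * Real.pi * Complex.I).im / (2 * Real.pi) = a.im / (2 * Real.pi) + 1 := by
      simp
      field_simp
    simp only [this, Int.floor_add_one]
    rw [zpow_add_one, ← zpow_one_add, ← zpow_add_one, add_comm]

/-- The jump cocycle with nontrivial value is not a coboundary around the unit circle. -/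
theorem not_trivOn_jump {g : G} (hg : g ≠ 1) {τ : ℝ → ℝ → G} {σ : ℝ → G}
    (hτ : ∀ a, ∃ O ∈ 𝓝 a, ∀ b ∈ O, ∀ c ∈ O,
      τ b c = jump g (Complex.exp (b * Complex.I)) (Complex.exp (c * Complex.I)))
    (hσ : ∀ a, ∃ O ∈ 𝓝 a, ∀ b ∈ O, ∀ c ∈ O, τ b c = (σ b)⁻¹ * σ c) :
    σ (2 * Real.pi) ≠ σ 0 := by
  obtain ⟨σ', h1, h2⟩ := hasHolonomy_jump g
  have hσ' : ∀ a ∈ (univ : Set ℝ), ∃ O ∈ 𝓝 a, ∀ b ∈ O, ∀ c ∈ O,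
      τ b c = (σ' (b * Complex.I))⁻¹ * σ' (c * Complex.I) := by
    intro a _
    obtain ⟨O, hO, h⟩ := hτ a
    obtain ⟨O', hO', h'⟩ := h1 (a * Complex.I)
    have hc : Continuous fun b : ℝ => (b : ℂ) * Complex.I := by fun_prop
    refine ⟨O ∩ (fun b : ℝ => (b : ℂ) * Complex.I) ⁻¹' O',
      Filter.inter_mem hO (hc.continuousAt hO'), fun b hb c hc => ?_⟩
    rw [h b hb.1 c hc.1, h' _ hb.2 _ hc.2]
  have := isPreconnected_univ.trivialization_unique (fun a _ => hσ a) hσ'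
    (mem_univ (2 * Real.pi)) (mem_univ 0)
  have h3 := h2 0
  intro he
  simp only [he] at this
  have h4 := mul_right_cancel this
  apply hg
  have h5 : σ' (2 * Real.pi * Complex.I) = g * σ' 0 := by simpa using h3
  push_cast at h4
  rw [h5] at h4
  simpa using h4

end Jump


section Glue

variable {M G ι : Type*} [TopologicalSpace M] [Group G]

/-- A disjoint family of solid tubes `{‖w‖ < 2}` inside `{‖w‖ < 1 / 2}`. -/
structure IsTubeFamily (w : M → ℂ) (ψ : ι → OpenPartialHomeomorph M M) : Prop where
  source : ∀ i, (ψ i).source = {p | ‖w p‖ < 2}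
  disjoint : ∀ i j, i ≠ j → Disjoint (ψ i).target (ψ j).target
  target : ∀ i, (ψ i).target ⊆ {p | ‖w p‖ < 1 / 2}

open Classical in
/-- The cocycle `c i` in the tube `i`, and `τ` outside the tubes. -/
noncomputable def glueCocycle (w : M → ℂ) (ψ : ι → OpenPartialHomeomorph M M) (τ : M → M → G)
    (c : ι → M → M → G) (p q : M) : G :=
  if h : ∃ i, p ∈ ψ i '' {x | ‖w x‖ < 3 / 4} ∧ q ∈ ψ i '' {x | ‖w x‖ < 3 / 4} then
    c h.choose ((ψ h.choose).symm p) ((ψ h.choose).symm q)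
  else τ p q

theorem glueCocycle_of_not {w : M → ℂ} {ψ : ι → OpenPartialHomeomorph M M} {τ : M → M → G}
    {c : ι → M → M → G} {p q : M}
    (h : ¬ ∃ i, p ∈ ψ i '' {x | ‖w x‖ < 3 / 4} ∧ q ∈ ψ i '' {x | ‖w x‖ < 3 / 4}) :
    glueCocycle w ψ τ c p q = τ p q := dif_neg h

namespace IsTubeFamily

variable {w : M → ℂ} {ψ : ι → OpenPartialHomeomorph M M} (hψ : IsTubeFamily w ψ)
include hψ

theorem mem_source {i : ι} {x : M} (hx : ‖w x‖ < 2) : x ∈ (ψ i).source := by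
  rw [hψ.source]; exact hx

theorem eq_of_mem {i j : ι} {x y : M} (hx : ‖w x‖ < 2) (hy : ‖w y‖ < 2) (h : ψ i x = ψ j y) :
    i = j ∧ x = y := by
  have hij : i = j := by
    by_contra hne
    exact disjoint_left.1 (hψ.disjoint i j hne) ((ψ i).map_source (hψ.mem_source hx))
      (h ▸ (ψ j).map_source (hψ.mem_source hy))
  subst hij
  exact ⟨rfl, (ψ i).injOn (hψ.mem_source hx) (hψ.mem_source hy) h⟩

theorem norm_lt {i : ι} {x : M} (hx : ‖w x‖ < 2) : ‖w (ψ i x)‖ < 1 / 2 :=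
  hψ.target i ((ψ i).map_source (hψ.mem_source hx))

theorem continuousAt {i : ι} {x : M} (hx : ‖w x‖ < 2) : ContinuousAt (ψ i) x :=
  (ψ i).continuousAt (hψ.mem_source hx)

theorem image_mem_nhds {i : ι} {x : M} (hx : ‖w x‖ < 2) {O : Set M} (hO : O ∈ 𝓝 x) :
    ψ i '' O ∈ 𝓝 (ψ i x) := by
  rw [← (ψ i).map_nhds_eq (hψ.mem_source hx)]
  exact Filter.image_mem_map hO

theorem glueCocycle_apply {τ : M → M → G} {c : ι → M → M → G} {i : ι} {x y : M}
    (hx : ‖w x‖ < 3 / 4) (hy : ‖w y‖ < 3 / 4) :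
    glueCocycle w ψ τ c (ψ i x) (ψ i y) = c i x y := by
  have h : ∃ j, ψ i x ∈ ψ j '' {x | ‖w x‖ < 3 / 4} ∧ ψ i y ∈ ψ j '' {x | ‖w x‖ < 3 / 4} :=
    ⟨i, ⟨x, hx, rfl⟩, ⟨y, hy, rfl⟩⟩
  rw [glueCocycle, dif_pos h]
  obtain ⟨x', hx', e⟩ := h.choose_spec.1
  rw [mem_ofPred_eq] at hx'
  have hj : h.choose = i := (hψ.eq_of_mem (by linarith) (by linarith) e).1
  generalize h.choose = j at hj
  subst hj
  rw [(ψ j).left_inv (hψ.mem_source (by linarith)), (ψ j).left_inv (hψ.mem_source (by linarith))]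

theorem isClosed_image [T2Space M] (hc : ∀ r, IsCompact {p | ‖w p‖ ≤ r}) {r : ℝ} (hr : r < 2)
    (i : ι) : IsClosed (ψ i '' {p | ‖w p‖ ≤ r}) :=
  ((hc r).image_of_continuousOn ((ψ i).continuousOn.mono fun p hp =>
    hψ.mem_source (lt_of_le_of_lt hp hr))).isClosed

/-- Gluing cocycles in tubes to a cocycle outside the tubes. -/
theorem glue [T2Space M] [Finite ι] (hw : Continuous w) (hc : ∀ r, IsCompact {p | ‖w p‖ ≤ r})
    {τ : M → M → G} {c : ι → M → M → G} {L : ι → Set M} {U : Set M}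
    (hτ : CocycleOn τ (U \ ⋃ i, ψ i '' {p | ‖w p‖ ≤ 1 / 2}))
    (hcc : ∀ i, CocycleOn (c i) (({p | ‖w p‖ < 2} ∩ ψ i ⁻¹' U) \ L i))
    (heq : ∀ i, LocEqOn (c i) (fun a b => τ (ψ i a) (ψ i b))
      ({p | 1 / 2 < ‖w p‖ ∧ ‖w p‖ < 2} ∩ ψ i ⁻¹' U)) :
    CocycleOn (glueCocycle w ψ τ c) (U \ ⋃ i, ψ i '' L i) ∧
    LocEqOn τ (glueCocycle w ψ τ c) (U \ ⋃ i, ψ i '' {p | ‖w p‖ ≤ 1 / 2}) ∧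
    ∀ i, LocEqOn (c i) (fun a b => glueCocycle w ψ τ c (ψ i a) (ψ i b))
      ({p | ‖w p‖ < 2} ∩ ψ i ⁻¹' U) := by
  have hin : ∀ i, ∀ x, ‖w x‖ < 3 / 4 → ∃ O ∈ 𝓝 x, ∀ a ∈ O, ∀ b ∈ O,
      glueCocycle w ψ τ c (ψ i a) (ψ i b) = c i a b := fun i x hx =>
    ⟨{p | ‖w p‖ < 3 / 4}, (isOpen_lt hw.norm continuous_const).mem_nhds hx, fun a ha b hb =>
      hψ.glueCocycle_apply ha hb⟩
  have hmid : ∀ i, LocEqOn τ (glueCocycle w ψ τ c)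
      (ψ i '' ({p | 1 / 2 < ‖w p‖ ∧ ‖w p‖ < 2} ∩ ψ i ⁻¹' U)) := by
    rintro i _ ⟨x, ⟨⟨hx1, hx2⟩, hxU⟩, rfl⟩
    obtain ⟨O, hO, h⟩ := heq i x ⟨⟨hx1, hx2⟩, hxU⟩
    refine ⟨ψ i '' (O ∩ {p | ‖w p‖ < 2}), hψ.image_mem_nhds hx2 (Filter.inter_mem hO
      ((isOpen_lt hw.norm continuous_const).mem_nhds hx2)), ?_⟩
    rintro _ ⟨a, ha, rfl⟩ _ ⟨b, hb, rfl⟩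
    by_cases hab : ‖w a‖ < 3 / 4 ∧ ‖w b‖ < 3 / 4
    · rw [hψ.glueCocycle_apply hab.1 hab.2]
      exact (h a ha.1 b hb.1).symm
    · refine glueCocycle_of_not ?_
      rintro ⟨j, ⟨a', ha', ea⟩, ⟨b', hb', eb⟩⟩
      rw [mem_ofPred_eq] at ha' hb'
      have h1 := hψ.eq_of_mem (by linarith) ha.2 ea
      have h2 := hψ.eq_of_mem (by linarith) hb.2 eb
      rw [h1.2] at ha'
      rw [h2.2] at hb'
      exact hab ⟨ha', hb'⟩
  have hout : LocEqOn τ (glueCocycle w ψ τ c) (U \ ⋃ i, ψ i '' {p | ‖w p‖ ≤ 1 / 2}) := by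
    rintro p ⟨hpU, hp⟩
    by_cases h : p ∈ ⋃ i, ψ i '' {p | ‖w p‖ ≤ 3 / 4}
    · obtain ⟨i, x, hx, rfl⟩ := mem_iUnion.1 h
      rw [mem_ofPred_eq] at hx
      refine hmid i _ ⟨x, ⟨⟨?_, by linarith⟩, hpU⟩, rfl⟩
      by_contra h'
      exact hp (mem_iUnion.2 ⟨i, x, not_lt.1 h', rfl⟩)
    · refine ⟨_, (isClosed_iUnion_of_finite fun i =>
        hψ.isClosed_image hc (r := 3 / 4) (by norm_num) i).isOpen_compl.mem_nhds h,
        fun a ha b hb => glueCocycle_of_not ?_⟩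
      rintro ⟨i, ⟨x, hx, rfl⟩, -⟩
      rw [mem_ofPred_eq] at hx
      exact ha (mem_iUnion.2 ⟨i, x, hx.le, rfl⟩)
  have hinner : ∀ i, LocEqOn (c i) (fun a b => glueCocycle w ψ τ c (ψ i a) (ψ i b))
      ({p | ‖w p‖ < 2} ∩ ψ i ⁻¹' U) := by
    rintro i x ⟨hx, hxU⟩
    by_cases h : ‖w x‖ < 3 / 4
    · exact hin i x h
    · push Not at h
      have hx' : x ∈ {p | 1 / 2 < ‖w p‖ ∧ ‖w p‖ < 2} ∩ ψ i ⁻¹' U := ⟨⟨by linarith, hx⟩, hxU⟩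
      obtain ⟨O, hO, h1⟩ := heq i x hx'
      obtain ⟨O', hO', h2⟩ := hmid i (ψ i x) ⟨x, hx', rfl⟩
      exact ⟨O ∩ ψ i ⁻¹' O', Filter.inter_mem hO (hψ.continuousAt hx hO'), fun a ha b hb =>
        (h2 _ ha.2 _ hb.2).trans (h1 a ha.1 b hb.1)⟩
  refine ⟨?_, hout, hinner⟩
  rintro p ⟨hpU, hp⟩
  by_cases h : p ∈ ⋃ i, ψ i '' {p | ‖w p‖ ≤ 1 / 2}
  · obtain ⟨i, x, hx, rfl⟩ := mem_iUnion.1 h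
    rw [mem_ofPred_eq] at hx
    have hx2 : ‖w x‖ < 2 := by linarith
    have hxL : x ∉ L i := fun h' => hp (mem_iUnion.2 ⟨i, x, h', rfl⟩)
    obtain ⟨O, hO, h1⟩ := (hcc i).congr ((hinner i).mono sdiff_subset) x ⟨⟨hx2, hpU⟩, hxL⟩
    refine ⟨ψ i '' O, hψ.image_mem_nhds hx2 hO, ?_⟩
    rintro _ ⟨a, ha, rfl⟩ _ ⟨b, hb, rfl⟩ _ ⟨c, hc, rfl⟩
    exact h1 a ha b hb c hc
  · exact hτ.congr hout p ⟨hpU, h⟩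

end IsTubeFamily

/-- Every `g ∈ S` is the outer holonomy of a cocycle off the tubes `ψ i` whose holonomies around
the tubes are in `S'`. -/
def PosStep (w : M → ℂ) (ψ : ι → OpenPartialHomeomorph M M) (S S' : Set G) : Prop :=
  ∀ g ∈ S, ∃ lab : ι → G, (∀ i, lab i ∈ S') ∧ ∃ τ : M → M → G,
    CocycleOn τ (⋃ i, ψ i '' {p | ‖w p‖ ≤ 1 / 2})ᶜ ∧
    LocEqOn (fun p q => jump g (w p) (w q)) τ {p | 1 / 2 < ‖w p‖} ∧
    ∀ i, LocEqOn (fun p q => jump (lab i) (w p) (w q)) (fun p q => τ (ψ i p) (ψ i q))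
      {p | 1 / 2 < ‖w p‖ ∧ ‖w p‖ < 2}

theorem cocycleOn_jump {w : M → ℂ} (hw : Continuous w) (g : G) {S : Set M}
    (hS : ∀ p ∈ S, w p ≠ 0) : CocycleOn (fun p q => jump g (w p) (w q)) S :=
  (hasHolonomy_jump g).cocycleOn.comp (fun p _ => hw.continuousAt) hS

theorem PosStep.of_cohomOn {w : M → ℂ} (hw : Continuous w) {ψ : ι → OpenPartialHomeomorph M M}
    (hψ : IsTubeFamily w ψ) {S S' : Set G}
    (h : ∀ g ∈ S, ∃ lab : ι → G, (∀ i, lab i ∈ S') ∧ ∃ τ : M → M → G,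
      CocycleOn τ (⋃ i, ψ i '' {p | ‖w p‖ ≤ 1 / 2})ᶜ ∧
      CohomOn τ (fun p q => jump g (w p) (w q)) {p | 1 / 2 < ‖w p‖} ∧
      ∀ i, LocEqOn (fun p q => jump (lab i) (w p) (w q)) (fun p q => τ (ψ i p) (ψ i q))
        {p | 1 / 2 < ‖w p‖ ∧ ‖w p‖ < 2}) : PosStep w ψ S S' := by
  intro g hg
  obtain ⟨lab, hlab, τ, h1, ⟨s, h2⟩, h3⟩ := h g hg
  classical
  let s' : M → G := fun p => if 1 / 2 < ‖w p‖ then s p else 1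
  have hcoh : ∀ A, CohomOn τ (fun a b => (s' a)⁻¹ * τ a b * s' b) A := fun A =>
    ⟨s', fun _ _ => ⟨univ, Filter.univ_mem, fun _ _ _ _ => rfl⟩⟩
  refine ⟨lab, hlab, fun a b => (s' a)⁻¹ * τ a b * s' b, (hcoh _).cocycleOn h1, ?_, ?_⟩
  · intro x hx
    obtain ⟨O, hO, h⟩ := h2 x hx
    refine ⟨O ∩ {p | 1 / 2 < ‖w p‖}, Filter.inter_mem hO
      ((isOpen_lt continuous_const hw.norm).mem_nhds hx), fun a ha b hb => ?_⟩
    simp only [s']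
    have ha2 : 1 / 2 < ‖w a‖ := ha.2
    have hb2 : 1 / 2 < ‖w b‖ := hb.2
    rw [if_pos ha2, if_pos hb2]
    exact (h a ha.1 b hb.1).symm
  · intro i x hx
    obtain ⟨O, hO, h⟩ := h3 i x hx
    refine ⟨O ∩ {p | ‖w p‖ < 2}, Filter.inter_mem hO
      ((isOpen_lt hw.norm continuous_const).mem_nhds hx.2), fun a ha b hb => ?_⟩
    simp only [s']
    rw [if_neg (not_lt.2 (hψ.norm_lt ha.2).le), if_neg (not_lt.2 (hψ.norm_lt hb.2).le)]
    simpa using h a ha.1 b hb.1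

theorem IsTubeFamily.trans {w : M → ℂ} {ι' : Type*} {ψ : ι → OpenPartialHomeomorph M M}
    {φ : ι' → OpenPartialHomeomorph M M} (hψ : IsTubeFamily w ψ) (hφ : IsTubeFamily w φ) :
    IsTubeFamily w (fun k : ι × ι' => (φ k.2).trans (ψ k.1)) := by
  have hsrc : ∀ k : ι × ι', ((φ k.2).trans (ψ k.1)).source = {p | ‖w p‖ < 2} := by
    intro k
    rw [OpenPartialHomeomorph.trans_source, hφ.source, hψ.source]
    ext p
    refine ⟨fun h => h.1, fun h => ⟨h, ?_⟩⟩
    have := hφ.norm_lt (i := k.2) h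
    change ‖w (φ k.2 p)‖ < 2
    linarith
  refine ⟨hsrc, ?_, fun k => ?_⟩
  · intro k l hkl
    rw [disjoint_left]
    intro p hp hp'
    obtain ⟨x, hx, rfl⟩ : ∃ x, ‖w x‖ < 2 ∧ (φ k.2).trans (ψ k.1) x = p :=
      ⟨_, (hsrc k).le (((φ k.2).trans (ψ k.1)).map_target hp),
        ((φ k.2).trans (ψ k.1)).right_inv hp⟩
    obtain ⟨y, hy, e⟩ : ∃ y, ‖w y‖ < 2 ∧ (φ l.2).trans (ψ l.1) y = (φ k.2).trans (ψ k.1) x :=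
      ⟨_, (hsrc l).le (((φ l.2).trans (ψ l.1)).map_target hp'),
        ((φ l.2).trans (ψ l.1)).right_inv hp'⟩
    have h1 := hφ.norm_lt (i := k.2) hx
    have h2 := hφ.norm_lt (i := l.2) hy
    have h3 := hψ.eq_of_mem (i := l.1) (j := k.1) (x := φ l.2 y) (y := φ k.2 x) (by linarith)
      (by linarith) e
    have h4 := hφ.eq_of_mem hy hx h3.2
    exact hkl (Prod.ext h3.1.symm h4.1.symm)
  · rw [OpenPartialHomeomorph.trans_target]
    exact inter_subset_left.trans (hψ.target _)

theorem PosStep.trans [T2Space M] {w : M → ℂ} (hw : Continuous w)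
    (hc : ∀ r, IsCompact {p | ‖w p‖ ≤ r}) {ι' : Type*} [Finite ι]
    {ψ : ι → OpenPartialHomeomorph M M} {φ : ι' → OpenPartialHomeomorph M M}
    (hψ : IsTubeFamily w ψ) (hφ : IsTubeFamily w φ) {S S' S'' : Set G}
    (h : PosStep w ψ S S') (h' : PosStep w φ S' S'') :
    PosStep w (fun k : ι × ι' => (φ k.2).trans (ψ k.1)) S S'' := by
  intro g hg
  obtain ⟨lab, hlab, τ, h1, h2, h3⟩ := h g hg
  choose lab' hlab' τ' h1' h2' h3' using fun i => h' (lab i) (hlab i)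
  have hcomp : ∀ A : Set M, (⋃ k : ι × ι', ((φ k.2).trans (ψ k.1)) '' A) =
      ⋃ i, ψ i '' ⋃ j, φ j '' A := by
    intro A
    ext p
    simp only [mem_iUnion, mem_image, OpenPartialHomeomorph.coe_trans, Function.comp, Prod.exists]
    constructor
    · rintro ⟨i, j, x, hx, rfl⟩
      exact ⟨i, _, ⟨j, x, hx, rfl⟩, rfl⟩
    · rintro ⟨i, _, ⟨j, x, hx, rfl⟩, rfl⟩
      exact ⟨i, j, x, hx, rfl⟩
  obtain ⟨g1, g2, g3⟩ := hψ.glue hw hc (U := univ) (τ := τ) (c := τ')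
    (L := fun _ => ⋃ j, φ j '' {p | ‖w p‖ ≤ 1 / 2}) (h1.mono fun p hp => hp.2)
    (fun i => (h1' i).mono fun p hp => hp.2)
    (fun i => ((h2' i).symm.mono fun p hp => hp.1.1).trans ((h3 i).mono fun p hp => hp.1))
  refine ⟨fun k => lab' k.1 k.2, fun k => hlab' _ _, glueCocycle w ψ τ τ', ?_, ?_, ?_⟩
  · rw [hcomp]
    exact g1.mono fun p hp => ⟨trivial, hp⟩
  · refine h2.trans (g2.mono fun p hp => ⟨trivial, fun h => ?_⟩)
    obtain ⟨i, x, hx, rfl⟩ := mem_iUnion.1 h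
    rw [mem_ofPred_eq] at hx hp
    have := hψ.norm_lt (i := i) (x := x) (by linarith)
    linarith
  · rintro ⟨i, j⟩
    refine (h3' i j).trans ?_
    refine ((g3 i).comp (f := φ j) (fun y hy => hφ.continuousAt hy.2) ?_)
    intro y hy
    have := hφ.norm_lt (i := j) hy.2
    exact ⟨by change ‖w (φ j y)‖ < 2; linarith, trivial⟩

end Glue


section Tower

variable {M G : Type*} [TopologicalSpace M] [Group G] {ι : ℕ → Type} {ι' : ℕ → Type}

/-- The union of the images of `A` under the compositions of `n` consecutive maps of the tower `E`,
starting from level `m`. -/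
def towerSet (E : ∀ m, ι m → OpenPartialHomeomorph M M) (A : Set M) : ℕ → ℕ → Set M
  | 0, _ => A
  | n + 1, m => ⋃ i, E m i '' towerSet E A n (m + 1)

/-- The limit set of the tower `E`, from level `m`. -/
def towerCore (w : M → ℂ) (E : ∀ m, ι m → OpenPartialHomeomorph M M) (m : ℕ) : Set M :=
  ⋂ n, towerSet E {p | ‖w p‖ ≤ 1} n m

/-- Indices of compositions in a tower. -/
def TowerIndex (ι ι' : ℕ → Type) : ℕ → ℕ → Type
  | 0, m => ι' m × Unit
  | n + 1, m => ι m × TowerIndex ι ι' n (m + 1)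

instance TowerIndex.finite [∀ m, Finite (ι m)] [∀ m, Finite (ι' m)] (n m : ℕ) :
    Finite (TowerIndex ι ι' n m) := by
  induction n generalizing m with
  | zero => exact inferInstanceAs (Finite (ι' m × Unit))
  | succ n ih =>
    have := ih (m + 1)
    exact inferInstanceAs (Finite (ι m × TowerIndex ι ι' n (m + 1)))

/-- Compositions of `n` maps of `E`, preceded by a map of `L`. -/
def towerComp (E : ∀ m, ι m → OpenPartialHomeomorph M M)
    (L : ∀ m, ι' m → OpenPartialHomeomorph M M) :
    ∀ n m, TowerIndex ι ι' n m → OpenPartialHomeomorph M M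
  | 0, m => fun k => L m k.1
  | n + 1, m => fun k => (towerComp E L n (m + 1) k.2).trans (E m k.1)

variable {w : M → ℂ} {E : ∀ m, ι m → OpenPartialHomeomorph M M}
  {L : ∀ m, ι' m → OpenPartialHomeomorph M M}

theorem isTubeFamily_towerComp (hE : ∀ m, IsTubeFamily w (E m)) (hL : ∀ m, IsTubeFamily w (L m))
    (n m : ℕ) : IsTubeFamily w (towerComp E L n m) := by
  induction n generalizing m with
  | zero =>
    refine ⟨fun k => (hL m).source k.1, fun k l hkl => (hL m).disjoint k.1 l.1 fun h => hkl ?_,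
      fun k => (hL m).target k.1⟩
    obtain ⟨k, u⟩ := k
    obtain ⟨l, v⟩ := l
    exact Prod.ext h rfl
  | succ n ih => exact (hE m).trans (ih (m + 1))

theorem towerSet_eq_iUnion (A : Set M) (n m : ℕ) :
    towerSet E A (n + 1) m = ⋃ k, towerComp E E n m k '' A := by
  induction n generalizing m with
  | zero =>
    ext p
    simp only [towerSet, mem_iUnion]
    exact ⟨fun ⟨i, h⟩ => ⟨(i, ()), h⟩, fun ⟨k, h⟩ => ⟨k.1, h⟩⟩
  | succ n ih =>
    rw [towerSet, ih (m + 1)]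
    ext p
    simp only [mem_iUnion, mem_image]
    constructor
    · rintro ⟨i, _, ⟨k, x, hx, rfl⟩, rfl⟩
      exact ⟨(i, k), x, hx, rfl⟩
    · rintro ⟨k, x, hx, rfl⟩
      exact ⟨k.1, _, ⟨k.2, x, hx, rfl⟩, rfl⟩

theorem towerSet_mono {A B : Set M} (h : A ⊆ B) (n m : ℕ) :
    towerSet E A n m ⊆ towerSet E B n m := by
  induction n generalizing m with
  | zero => exact h
  | succ n ih => exact iUnion_mono fun i => image_mono (ih (m + 1))

theorem towerSet_add (A : Set M) (n k m : ℕ) :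
    towerSet E A (n + k) m = towerSet E (towerSet E A k (m + n)) n m := by
  induction n generalizing m with
  | zero => simp [towerSet]
  | succ n ih =>
    rw [show n + 1 + k = (n + k) + 1 by ring, towerSet, towerSet, ih (m + 1)]
    rw [show m + 1 + n = m + (n + 1) by ring]

theorem towerSet_one_subset (hE : ∀ m, IsTubeFamily w (E m)) {r : ℝ} (hr : r < 2) (m : ℕ) :
    towerSet E {p | ‖w p‖ ≤ r} 1 m ⊆ {p | ‖w p‖ ≤ 1 / 2} := by
  intro p hp
  obtain ⟨i, x, hx, rfl⟩ := mem_iUnion.1 hp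
  change ‖w x‖ ≤ r at hx
  exact ((hE m).norm_lt (lt_of_le_of_lt hx hr)).le

theorem towerSet_succ_subset (hE : ∀ m, IsTubeFamily w (E m)) (n m : ℕ) :
    towerSet E {p | ‖w p‖ ≤ 1} (n + 1) m ⊆ towerSet E {p | ‖w p‖ ≤ 1 / 2} n m := by
  rw [towerSet_add]
  exact towerSet_mono (towerSet_one_subset hE (by norm_num) _) n m

theorem towerSet_antitone (hE : ∀ m, IsTubeFamily w (E m)) (m : ℕ) :
    Antitone fun n => towerSet E {p | ‖w p‖ ≤ 1} n m :=
  antitone_nat_of_succ_le fun n => (towerSet_succ_subset hE n m).trans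
    (towerSet_mono (fun p (hp : ‖w p‖ ≤ 1 / 2) => show ‖w p‖ ≤ 1 by linarith) n m)

theorem towerSet_subset_norm (hE : ∀ m, IsTubeFamily w (E m)) (n m : ℕ) :
    towerSet E {p | ‖w p‖ ≤ 1} n m ⊆ {p | ‖w p‖ ≤ 1} :=
  towerSet_antitone hE m (Nat.zero_le n)

theorem isCompact_towerSet [∀ m, Finite (ι m)] [T2Space M] (hE : ∀ m, IsTubeFamily w (E m))
    (hc : ∀ r, IsCompact {p | ‖w p‖ ≤ r}) (n m : ℕ) :
    IsCompact (towerSet E {p | ‖w p‖ ≤ 1} n m) := by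
  induction n generalizing m with
  | zero => exact hc 1
  | succ n ih =>
    refine isCompact_iUnion fun i => (ih (m + 1)).image_of_continuousOn
      ((E m i).continuousOn.mono fun p hp => (hE m).mem_source ?_)
    have : ‖w p‖ ≤ 1 := towerSet_subset_norm hE n _ hp
    linarith

theorem isCompact_towerCore [∀ m, Finite (ι m)] [T2Space M] (hE : ∀ m, IsTubeFamily w (E m))
    (hc : ∀ r, IsCompact {p | ‖w p‖ ≤ r}) (m : ℕ) : IsCompact (towerCore w E m) :=
  (isCompact_towerSet hE hc 0 m).of_isClosed_subset
    (isClosed_iInter fun n => (isCompact_towerSet hE hc n m).isClosed) (iInter_subset _ 0)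

theorem apply_mem_towerSet_iff (hE : ∀ m, IsTubeFamily w (E m)) {A : Set M}
    (hA : A ⊆ {p | ‖w p‖ ≤ 1}) {n m : ℕ} {i : ι m} {x : M} (hx : ‖w x‖ < 2) :
    E m i x ∈ towerSet E A (n + 1) m ↔ x ∈ towerSet E A n (m + 1) := by
  refine ⟨fun h => ?_, fun h => mem_iUnion.2 ⟨i, x, h, rfl⟩⟩
  obtain ⟨j, y, hy, e⟩ := mem_iUnion.1 h
  have hy' : ‖w y‖ ≤ 1 := towerSet_subset_norm hE n _ (towerSet_mono hA n _ hy)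
  exact ((hE m).eq_of_mem (by linarith) hx e).2 ▸ hy

theorem apply_mem_towerCore_iff (hE : ∀ m, IsTubeFamily w (E m)) {m : ℕ} {i : ι m} {x : M}
    (hx : ‖w x‖ < 2) : E m i x ∈ towerCore w E m ↔ x ∈ towerCore w E (m + 1) := by
  simp only [towerCore, mem_iInter]
  refine ⟨fun h n => (apply_mem_towerSet_iff hE subset_rfl hx).1 (h (n + 1)), fun h n => ?_⟩
  exact towerSet_antitone hE m (Nat.le_succ n) ((apply_mem_towerSet_iff hE subset_rfl hx).2 (h n))

theorem towerCore_subset_norm (hE : ∀ m, IsTubeFamily w (E m)) (m : ℕ) :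
    towerCore w E m ⊆ {p | ‖w p‖ ≤ 1 / 2} := fun _ hp =>
  towerSet_one_subset hE (by norm_num) m (mem_iInter.1 hp 1)

/-- The cocycle obtained by gluing in `n` levels of the tower. -/
noncomputable def towerApprox (w : M → ℂ) (E : ∀ m, ι m → OpenPartialHomeomorph M M)
    (τ : ℕ → G → M → M → G) (lab : ∀ m, G → ι m → G) : ℕ → ℕ → G → M → M → G
  | 0, _, g => fun p q => jump g (w p) (w q)
  | n + 1, m, g => glueCocycle w (E m) (τ m g)
      (fun i => towerApprox w E τ lab n (m + 1) (lab m g i))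

theorem towerApprox_eq (w : M → ℂ) (E : ∀ m, ι m → OpenPartialHomeomorph M M)
    (τ : ℕ → G → M → M → G) (lab : ∀ m, G → ι m → G) {n k m : ℕ} {g : G} {p q : M}
    (h : ¬ (p ∈ towerSet E {p | ‖w p‖ < 3 / 4} (n + 1) m ∧
      q ∈ towerSet E {p | ‖w p‖ < 3 / 4} (n + 1) m)) (hE : ∀ m, IsTubeFamily w (E m)) :
    towerApprox w E τ lab (n + 1 + k) m g p q = towerApprox w E τ lab (n + 1) m g p q := by
  induction n generalizing m g p q with
  | zero =>
    have h' : ¬ ∃ i, p ∈ E m i '' {x | ‖w x‖ < 3 / 4} ∧ q ∈ E m i '' {x | ‖w x‖ < 3 / 4} := by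
      rintro ⟨i, h1, h2⟩
      exact h ⟨mem_iUnion.2 ⟨i, h1⟩, mem_iUnion.2 ⟨i, h2⟩⟩
    rw [show 0 + 1 + k = k + 1 by ring, towerApprox, glueCocycle_of_not h', towerApprox,
      glueCocycle_of_not h']
  | succ n ih =>
    rw [show n + 1 + 1 + k = (n + 1 + k) + 1 by ring, towerApprox, towerApprox]
    by_cases h' : ∃ i, p ∈ E m i '' {x | ‖w x‖ < 3 / 4} ∧ q ∈ E m i '' {x | ‖w x‖ < 3 / 4}
    · obtain ⟨i, ⟨x, hx, rfl⟩, ⟨y, hy, rfl⟩⟩ := h'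
      rw [(hE m).glueCocycle_apply hx hy, (hE m).glueCocycle_apply hx hy]
      refine ih fun hxy => h ⟨?_, ?_⟩
      · exact mem_iUnion.2 ⟨i, _, hxy.1, rfl⟩
      · exact mem_iUnion.2 ⟨i, _, hxy.2, rfl⟩
    · rw [glueCocycle_of_not h', glueCocycle_of_not h']

theorem exists_towerCocycle [T2Space M] [∀ m, Finite (ι m)] (hw : Continuous w)
    (hc : ∀ r, IsCompact {p | ‖w p‖ ≤ r}) (hE : ∀ m, IsTubeFamily w (E m)) {S : Set G}
    (hpos : ∀ m, PosStep w (E m) S S) :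
    ∃ (c : ℕ → G → M → M → G) (lab : ∀ m, G → ι m → G), ∀ m, ∀ g ∈ S, (∀ i, lab m g i ∈ S) ∧
      CocycleOn (c m g) (towerCore w E m)ᶜ ∧
      LocEqOn (fun p q => jump g (w p) (w q)) (c m g) {p | 1 / 2 < ‖w p‖} ∧
      ∀ i, LocEqOn (c (m + 1) (lab m g i)) (fun p q => c m g (E m i p) (E m i q))
        ({p | ‖w p‖ < 2} \ towerCore w E (m + 1)) := by
  classical
  have hpos' : ∀ m, ∀ g, ∃ (lab : ι m → G) (τ : M → M → G), g ∈ S → (∀ i, lab i ∈ S) ∧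
      CocycleOn τ (⋃ i, E m i '' {p | ‖w p‖ ≤ 1 / 2})ᶜ ∧
      LocEqOn (fun p q => jump g (w p) (w q)) τ {p | 1 / 2 < ‖w p‖} ∧
      ∀ i, LocEqOn (fun p q => jump (lab i) (w p) (w q)) (fun p q => τ (E m i p) (E m i q))
        {p | 1 / 2 < ‖w p‖ ∧ ‖w p‖ < 2} := by
    intro m g
    by_cases hg : g ∈ S
    · obtain ⟨lab, h1, τ, h2⟩ := hpos m g hg
      exact ⟨lab, τ, fun _ => ⟨h1, h2⟩⟩
    · exact ⟨fun _ => 1, fun _ _ => 1, fun h => absurd h hg⟩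
  choose lab τ hlab using hpos'
  set A := towerApprox w E τ lab with hA
  have happ : ∀ n m, ∀ g ∈ S, CocycleOn (A (n + 1) m g)
      (towerSet E {p | ‖w p‖ ≤ 1 / 2} (n + 1) m)ᶜ ∧
      LocEqOn (fun p q => jump g (w p) (w q)) (A (n + 1) m g) {p | 1 / 2 < ‖w p‖} ∧
      ∀ i, LocEqOn (A n (m + 1) (lab m g i)) (fun p q => A (n + 1) m g (E m i p) (E m i q))
        {p | ‖w p‖ < 2} := by
    intro n
    induction n with
    | zero =>
      intro m g hg
      obtain ⟨h1, h2, h3, h4⟩ := hlab m g hg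
      have hz : ∀ p : M, 1 / 2 < ‖w p‖ → w p ≠ 0 := fun p hp h0 => by
        rw [h0, norm_zero] at hp; linarith
      obtain ⟨g1, g2, g3⟩ := (hE m).glue hw hc (U := univ) (τ := τ m g)
        (c := fun i => A 0 (m + 1) (lab m g i)) (L := fun _ => {p | ‖w p‖ ≤ 1 / 2})
        (h2.mono fun p hp => hp.2) (fun i => cocycleOn_jump hw _ fun p hp => hz p (not_le.1 hp.2))
        (fun i => (h4 i).mono fun p hp => hp.1)
      refine ⟨g1.mono fun p hp => ⟨trivial, hp⟩, h3.trans (g2.mono fun p hp => ⟨trivial, ?_⟩),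
        fun i => (g3 i).mono fun p hp => ⟨hp, trivial⟩⟩
      intro h
      have h' := towerSet_one_subset hE (by norm_num) m h
      change ‖w p‖ ≤ 1 / 2 at h'
      change 1 / 2 < ‖w p‖ at hp
      linarith
    | succ n ih =>
      intro m g hg
      obtain ⟨h1, h2, h3, h4⟩ := hlab m g hg
      obtain ⟨g1, g2, g3⟩ := (hE m).glue hw hc (U := univ) (τ := τ m g)
        (c := fun i => A (n + 1) (m + 1) (lab m g i))
        (L := fun _ => towerSet E {p | ‖w p‖ ≤ 1 / 2} (n + 1) (m + 1))
        (h2.mono fun p hp => hp.2) (fun i => (ih (m + 1) _ (h1 i)).1.mono fun p hp => hp.2)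
        (fun i => ((ih (m + 1) _ (h1 i)).2.1.symm.mono fun p hp => hp.1.1).trans
          ((h4 i).mono fun p hp => hp.1))
      refine ⟨g1.mono fun p hp => ⟨trivial, hp⟩, h3.trans (g2.mono fun p hp => ⟨trivial, ?_⟩),
        fun i => (g3 i).mono fun p hp => ⟨hp, trivial⟩⟩
      intro h
      have h' := towerSet_one_subset hE (by norm_num) m h
      change ‖w p‖ ≤ 1 / 2 at h'
      change 1 / 2 < ‖w p‖ at hp
      linarith
  let c : ℕ → G → M → M → G := fun m g p q =>
    if h : ∃ n, ¬ (p ∈ towerSet E {p | ‖w p‖ < 3 / 4} (n + 1) m ∧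
      q ∈ towerSet E {p | ‖w p‖ < 3 / 4} (n + 1) m) then A (Nat.find h + 1) m g p q else 1
  have hcA : ∀ n m g p q, ¬ (p ∈ towerSet E {p | ‖w p‖ < 3 / 4} (n + 1) m ∧
      q ∈ towerSet E {p | ‖w p‖ < 3 / 4} (n + 1) m) → c m g p q = A (n + 1) m g p q := by
    intro n m g p q h
    have hex : ∃ n, ¬ (p ∈ towerSet E {p | ‖w p‖ < 3 / 4} (n + 1) m ∧
      q ∈ towerSet E {p | ‖w p‖ < 3 / 4} (n + 1) m) := ⟨n, h⟩
    simp only [c]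
    rw [dif_pos hex]
    obtain ⟨k, hk⟩ := Nat.exists_eq_add_of_le (Nat.find_min' hex h)
    have := towerApprox_eq w E τ lab (k := k) (g := g) (Nat.find_spec hex) hE
    rw [hA, ← this]
    congr 1
    omega
  have hloc : ∀ n m g, LocEqOn (A (n + 1) m g) (c m g)
      (towerSet E {p | ‖w p‖ ≤ 1} (n + 1) m)ᶜ := by
    intro n m g x hx
    refine ⟨_, (isCompact_towerSet hE hc (n + 1) m).isClosed.isOpen_compl.mem_nhds hx,
      fun a ha b _ => hcA n m g a b fun h => ha ?_⟩
    exact towerSet_mono (fun p (hp : ‖w p‖ < 3 / 4) => show ‖w p‖ ≤ 1 by linarith) _ _ h.1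
  have hlev : ∀ m, ∀ x ∉ towerCore w E m, ∃ n, x ∉ towerSet E {p | ‖w p‖ ≤ 1} (n + 1) m := by
    intro m x hx
    simp only [towerCore, mem_iInter, not_forall] at hx
    obtain ⟨n, hn⟩ := hx
    exact ⟨n, fun h => hn (towerSet_antitone hE m (Nat.le_succ n) h)⟩
  have hhalf : ∀ n m, towerSet E {p | ‖w p‖ ≤ 1 / 2} n m ⊆ towerSet E {p | ‖w p‖ ≤ 1} n m :=
    fun n m => towerSet_mono (fun p (hp : ‖w p‖ ≤ 1 / 2) => show ‖w p‖ ≤ 1 by linarith) _ _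
  refine ⟨c, lab, fun m g hg => ⟨(hlab m g hg).1, ?_, ?_, fun i => ?_⟩⟩
  · intro x hx
    obtain ⟨n, hn⟩ := hlev m x hx
    exact CocycleOn.congr (S := {x}) ((happ n m g hg).1.mono (by
      rintro _ rfl
      exact fun h => hn (hhalf _ _ h)))
      ((hloc n m g).mono (by rintro _ rfl; exact hn)) x rfl
  · refine (happ 0 m g hg).2.1.trans ((hloc 0 m g).mono fun x hx h => ?_)
    have h' := towerSet_one_subset hE (by norm_num) m h
    change ‖w x‖ ≤ 1 / 2 at h'
    change 1 / 2 < ‖w x‖ at hx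
    linarith
  · rintro x ⟨hx2, hx⟩
    obtain ⟨n, hn⟩ := hlev (m + 1) x hx
    have h1 := ((hloc n (m + 1) (lab m g i)).mono (S := {x}) (by rintro _ rfl; exact hn)).symm
    have h2 := ((happ (n + 1) m g hg).2.2 i).mono (S := {x}) (by rintro _ rfl; exact hx2)
    have h3 := (hloc (n + 1) m g).comp (T := {x}) (f := E m i)
      (by rintro _ rfl; exact (hE m).continuousAt hx2)
      (by rintro _ rfl h; exact hn ((apply_mem_towerSet_iff hE subset_rfl hx2).1 h))
    exact (h1.trans (h2.trans h3)) x rfl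

/-- The limit set of a tower is wild, if each level carries nontrivial holonomies. -/
theorem wildAt_towerCore [T2Space M] [∀ m, Finite (ι m)] (hw : Continuous w)
    (hc : ∀ r, IsCompact {p | ‖w p‖ ≤ r}) (hE : ∀ m, IsTubeFamily w (E m)) {S : Set G}
    (hpos : ∀ m, PosStep w (E m) S S) (hS : S.Nonempty) (hS1 : (1 : G) ∉ S)
    {γ : ℝ → M} (hγ : Continuous γ) (hγw : ∀ b : ℝ, w (γ b) = Complex.exp (b * Complex.I))
    (hγp : γ (2 * Real.pi) = γ 0) {x : M}
    (hx : ∀ V ∈ 𝓝 x, ∃ n k, towerComp E E n 0 k '' {p | ‖w p‖ ≤ 1} ⊆ V) :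
    WildAt G (towerCore w E 0) x := by
  obtain ⟨c, lab, h⟩ := exists_towerCocycle hw hc hE hpos
  obtain ⟨g₀, hg₀⟩ := hS
  refine ⟨univ, isOpen_univ, mem_univ x, c 0 g₀, (h 0 g₀ hg₀).2.1.mono fun p hp => hp.2, ?_⟩
  rintro V hV hxV - ⟨σ, hσ⟩
  obtain ⟨n, k, hk⟩ := hx V (hV.mem_nhds hxV)
  have key : ∀ n m, ∀ g ∈ S, ∀ k : TowerIndex ι ι n m, ∃ g' ∈ S,
      LocEqOn (fun p q => jump g' (w p) (w q))
        (fun p q => c m g (towerComp E E n m k p) (towerComp E E n m k q))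
        {p | 1 / 2 < ‖w p‖ ∧ ‖w p‖ < 2} ∧
      ∀ p, 1 / 2 < ‖w p‖ → ‖w p‖ < 2 → towerComp E E n m k p ∉ towerCore w E m := by
    have hcore : ∀ m p, 1 / 2 < ‖w p‖ → p ∉ towerCore w E m := fun m p hp h' =>
      absurd hp (not_lt.2 (towerCore_subset_norm hE m h'))
    intro n
    induction n with
    | zero =>
      intro m g hg k
      obtain ⟨h1, h2, h3, h4⟩ := h m g hg
      refine ⟨lab m g k.1, h1 k.1, ?_, fun p hp hp2 h' => ?_⟩
      · exact ((h _ _ (h1 k.1)).2.2.1.mono fun p hp => hp.1).trans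
          ((h4 k.1).mono fun p hp => ⟨hp.2, hcore _ _ hp.1⟩)
      · exact hcore (m + 1) p hp ((apply_mem_towerCore_iff hE hp2).1 h')
    | succ n ih =>
      intro m g hg k
      obtain ⟨h1, h2, h3, h4⟩ := h m g hg
      obtain ⟨g', hg', h5, h6⟩ := ih (m + 1) (lab m g k.1) (h1 k.1) k.2
      have hT := isTubeFamily_towerComp hE hE n (m + 1)
      refine ⟨g', hg', h5.trans ((h4 k.1).comp (f := towerComp E E n (m + 1) k.2)
        (fun y hy => hT.continuousAt hy.2) fun p hp => ⟨?_, h6 p hp.1 hp.2⟩), fun p hp hp2 h' => ?_⟩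
      · have := hT.norm_lt (i := k.2) hp.2
        change ‖w _‖ < 2
        linarith
      · have := hT.norm_lt (i := k.2) hp2
        exact h6 p hp hp2 ((apply_mem_towerCore_iff hE (by linarith)).1 h')
  obtain ⟨g, hg, h1, h2⟩ := key n 0 g₀ hg₀ k
  have hT := isTubeFamily_towerComp hE hE n 0
  have hn : ∀ b, ‖w (γ b)‖ = 1 := fun b => by rw [hγw, Complex.norm_exp_ofReal_mul_I]
  have hγT : ∀ b, ContinuousAt (fun b => towerComp E E n 0 k (γ b)) b := fun b =>
    ContinuousAt.comp (f := γ) (hT.continuousAt (by rw [hn]; norm_num)) hγ.continuousAt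
  refine not_trivOn_jump (g := g) (fun h => hS1 (h ▸ hg))
    (τ := fun b b' => c 0 g₀ (towerComp E E n 0 k (γ b)) (towerComp E E n 0 k (γ b')))
    (σ := fun b => σ (towerComp E E n 0 k (γ b))) ?_ ?_ (by simp only [hγp])
  · intro a
    obtain ⟨O, hO, h3⟩ := h1 (γ a) ⟨by rw [hn]; norm_num, by rw [hn]; norm_num⟩
    refine ⟨γ ⁻¹' O, hγ.continuousAt hO, fun b hb b' hb' => ?_⟩
    have := h3 _ hb _ hb'
    simp only [hγw] at this
    exact this
  · intro a
    obtain ⟨O, hO, h3⟩ := hσ (towerComp E E n 0 k (γ a)) ⟨hk ⟨γ a, (hn a).le, rfl⟩,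
      h2 _ (by rw [hn]; norm_num) (by rw [hn]; norm_num)⟩
    exact ⟨_, hγT a hO, fun b hb b' hb' => h3 _ hb _ hb'⟩

end Tower


section CircleGeometry

open Complex in
theorem coe_exp_arg {z : ℂ} (hz : z ≠ 0) : (Circle.exp (arg z) : ℂ) = z / ‖z‖ := by
  rw [Circle.coe_exp, eq_div_iff (by simpa using hz), mul_comm, norm_mul_exp_arg_mul_I]

theorem continuousOn_exp_arg : ContinuousOn (fun z : ℂ => Circle.exp (Complex.arg z)) {z | z ≠ 0} := by
  have hi : Topology.IsInducing (fun u : Circle => (u : ℂ)) := ⟨rfl⟩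
  refine hi.continuousOn_iff.2 ?_
  refine ContinuousOn.congr (f := fun z : ℂ => z / ‖z‖) ?_ fun z hz => coe_exp_arg hz
  exact continuousOn_id.div (by fun_prop) fun z hz => by simpa using hz

theorem exp_arg_real_mul {ρ : ℝ} (hρ : 0 < ρ) (u : Circle) :
    Circle.exp (Complex.arg (ρ * (u : ℂ))) = u := by
  rw [Complex.arg_real_mul _ hρ, Circle.exp_arg]

theorem abs_arg_eq_arccos (θ : Circle) : |Complex.arg θ| = Real.arccos (θ : ℂ).re := by
  have h := Complex.cos_arg θ.coe_ne_zero
  rw [Circle.norm_coe, div_one] at h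
  rw [← h, ← Real.cos_abs, Real.arccos_cos (abs_nonneg _) (Complex.abs_arg_le_pi _)]

theorem continuous_abs_arg : Continuous fun θ : Circle => |Complex.arg θ| := by
  simp only [abs_arg_eq_arccos]
  exact Real.continuous_arccos.comp (Complex.continuous_re.comp continuous_subtype_val)

theorem arg_coe_exp {t : ℝ} (ht : |t| < Real.pi) : Complex.arg (Circle.exp t) = t :=
  Circle.arg_exp (by linarith [(abs_lt.1 ht).1]) (by linarith [(abs_lt.1 ht).2])

/-- The angular distance of two points of the circle. -/
noncomputable def circleDist (θ ζ : Circle) : ℝ := |Complex.arg (θ / ζ : Circle)|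

theorem continuous_circleDist (ζ : Circle) : Continuous fun θ => circleDist θ ζ :=
  continuous_abs_arg.comp (continuous_id.div' continuous_const)

theorem circleDist_nonneg (θ ζ : Circle) : 0 ≤ circleDist θ ζ := abs_nonneg _

/-- The division points of the circle of the two parities. -/
noncomputable def ringPoint (r : ℕ) (e : Bool) (m : Fin r) : Circle :=
  Circle.exp ((2 * (m : ℕ) + e.toNat : ℝ) * (Real.pi / r))

theorem exists_circleDist_le {r : ℕ} (hr : 0 < r) (θ : Circle) :
    ∃ e m, circleDist θ (ringPoint r e m) ≤ Real.pi / r / 2 := by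
  have hr' : (0 : ℝ) < r := by exact_mod_cast hr
  set d := Real.pi / r with hd
  have hdpos : 0 < d := div_pos Real.pi_pos hr'
  have hrd : r * d = Real.pi := by rw [hd]; field_simp
  set k₀ : ℤ := round (Complex.arg θ / d) with hk
  have h2r : (0 : ℤ) < 2 * r := by omega
  set k : ℤ := k₀ % (2 * r) with hkk
  have hk0 : 0 ≤ k := Int.emod_nonneg _ (by omega)
  have hk1 : k < 2 * r := Int.emod_lt_of_pos _ h2r
  have hkd : k₀ = k + 2 * r * (k₀ / (2 * r)) := (Int.emod_add_mul_ediv k₀ (2 * r)).symm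
  have hm : (k / 2).toNat < r := by omega
  have habs : |Complex.arg θ - k₀ * d| ≤ d / 2 := by
    have := abs_sub_round (Complex.arg θ / d)
    rw [← hk] at this
    have e : Complex.arg θ - k₀ * d = (Complex.arg θ / d - k₀) * d := by field_simp
    rw [e, abs_mul, abs_of_pos hdpos]
    nlinarith
  have hlt : |Complex.arg θ - k₀ * d| < Real.pi := by
    refine lt_of_le_of_lt habs ?_
    have : (1 : ℝ) ≤ r := by exact_mod_cast hr
    nlinarith
  refine ⟨decide (k % 2 = 1), ⟨(k / 2).toNat, hm⟩, ?_⟩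
  have hcast : (2 * ((k / 2).toNat : ℕ) + (decide (k % 2 = 1)).toNat : ℝ) = k := by
    have h1 : (2 * ((k / 2).toNat : ℤ) + ((decide (k % 2 = 1)).toNat : ℤ)) = k := by
      rcases Int.emod_two_eq_zero_or_one k with h | h <;> simp [h] <;> omega
    exact_mod_cast h1
  rw [circleDist, ringPoint]
  simp only
  rw [hcast, ← hd]
  have : θ / Circle.exp (k * d) = Circle.exp (Complex.arg θ - k₀ * d) := by
    rw [div_eq_iff_eq_mul, ← Circle.exp_add]
    conv_lhs => rw [← Circle.exp_arg θ]
    rw [Circle.exp_eq_exp]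
    refine ⟨k₀ / (2 * r), ?_⟩
    have h2 : (k₀ : ℝ) = k + 2 * r * ((k₀ / (2 * r) : ℤ) : ℝ) := by exact_mod_cast hkd
    rw [← hrd]
    nth_rewrite 1 [h2]
    ring
  rw [this, arg_coe_exp hlt]
  exact habs

theorem two_mul_le_circleDist_add {r : ℕ} (e : Bool) {m m' : Fin r} (h : m ≠ m') (θ : Circle) :
    2 * (Real.pi / r) ≤ circleDist θ (ringPoint r e m) + circleDist θ (ringPoint r e m') := by
  have hr : 0 < r := m.pos
  have hr' : (0 : ℝ) < r := by exact_mod_cast hr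
  set d := Real.pi / r with hd
  have hdpos : 0 < d := div_pos Real.pi_pos hr'
  have hrd : r * d = Real.pi := by rw [hd]; field_simp
  set α := Complex.arg (θ / ringPoint r e m : Circle) with hα
  set α' := Complex.arg (θ / ringPoint r e m' : Circle) with hα'
  have h1 : Circle.exp (α + (2 * (m : ℕ) + e.toNat : ℝ) * d) =
      Circle.exp (α' + (2 * (m' : ℕ) + e.toNat : ℝ) * d) := by
    rw [Circle.exp_add, Circle.exp_add, hα, hα', Circle.exp_arg, Circle.exp_arg]
    simp only [ringPoint, ← hd]
    rw [div_mul_cancel, div_mul_cancel]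
  obtain ⟨n, hn⟩ := Circle.exp_eq_exp.1 h1
  set j : ℤ := (m' : ℕ) - (m : ℕ) + r * n with hj
  have hj0 : j ≠ 0 := by
    intro h0
    have hm := m.2
    have hm' := m'.2
    have hne : (m : ℕ) ≠ m' := fun h' => h (Fin.ext h')
    rcases lt_trichotomy n 0 with hn | hn | hn
    · have : (r : ℤ) * n ≤ r * (-1) := mul_le_mul_of_nonneg_left (by omega) (by omega)
      omega
    · rw [hn] at hj
      omega
    · have : (r : ℤ) * 1 ≤ r * n := mul_le_mul_of_nonneg_left (by omega) (by omega)
      omega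
  have h2 : α - α' = 2 * d * j := by
    rw [hj]
    push_cast
    rw [← hrd] at hn
    linarith
  have h3 : (1 : ℝ) ≤ |(j : ℝ)| := by
    rw [← Int.cast_abs]
    exact_mod_cast Int.one_le_abs hj0
  calc 2 * d ≤ |2 * d * j| := by
        rw [abs_mul, abs_of_pos (by linarith)]
        nlinarith
    _ = |α - α'| := by rw [h2]
    _ ≤ |α| + |α'| := abs_sub α α'

end CircleGeometry


section Ring

/-- The footprint of a point of `Circle × ℂ` in the vertical plane at angle `1`. -/
noncomputable def footprint (q : Circle × ℂ) : ℂ := (Complex.arg q.1 : ℝ) + q.2.re * Complex.I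

/-- The tube coordinate of the round ring of radius `3 * d / 4`. -/
noncomputable def ringCoord (d : ℝ) (q : Circle × ℂ) : ℂ :=
  ((‖footprint q‖ - 3 * d / 4) / (d / 16) : ℝ) + (q.2.im / (d / 16) : ℝ) * Complex.I

theorem ringCoord_re (d : ℝ) (q : Circle × ℂ) :
    (ringCoord d q).re = (‖footprint q‖ - 3 * d / 4) / (d / 16) := by
  simp only [ringCoord, Complex.add_re, Complex.ofReal_re, Complex.re_ofReal_mul, Complex.I_re,
    mul_zero, add_zero]

theorem ringCoord_im (d : ℝ) (q : Circle × ℂ) : (ringCoord d q).im = q.2.im / (d / 16) := by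
  simp only [ringCoord, Complex.add_im, Complex.ofReal_im, Complex.im_ofReal_mul, Complex.I_im,
    mul_one, zero_add]

theorem norm_footprint (q : Circle × ℂ) :
    ‖footprint q‖ = √(|Complex.arg q.1| ^ 2 + q.2.re ^ 2) := by
  rw [footprint, Complex.norm_add_mul_I, sq_abs]

theorem sq_norm_footprint (q : Circle × ℂ) :
    ‖footprint q‖ ^ 2 = |Complex.arg q.1| ^ 2 + q.2.re ^ 2 := by
  rw [norm_footprint, Real.sq_sqrt (by positivity)]

theorem continuous_norm_footprint : Continuous fun q : Circle × ℂ => ‖footprint q‖ := by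
  simp only [norm_footprint]
  have := continuous_abs_arg.comp (continuous_fst (X := Circle) (Y := ℂ))
  simp only [Function.comp_def] at this
  exact Real.continuous_sqrt.comp
    ((this.pow 2).add ((Complex.continuous_re.comp continuous_snd).pow 2))

theorem continuous_ringCoord (d : ℝ) : Continuous (ringCoord d) := by
  have h1 := continuous_norm_footprint
  have h2 : Continuous fun q : Circle × ℂ => q.2.im := Complex.continuous_im.comp continuous_snd
  unfold ringCoord
  fun_prop

theorem ringCoord_bounds {d : ℝ} (hd : 0 < d) {q : Circle × ℂ} (h : ‖ringCoord d q‖ < 2) :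
    5 * d / 8 < ‖footprint q‖ ∧ ‖footprint q‖ < 7 * d / 8 ∧ |q.2.im| < d / 8 := by
  have h1 := (Complex.abs_re_le_norm _).trans_lt h
  have h2 := (Complex.abs_im_le_norm _).trans_lt h
  rw [ringCoord_re] at h1
  rw [ringCoord_im] at h2
  rw [abs_div, abs_of_pos (by linarith : 0 < d / 16), div_lt_iff₀ (by linarith)] at h1 h2
  rw [abs_lt] at h1
  exact ⟨by linarith [h1.1], by linarith [h1.2], by linarith⟩

/-- The parametrization of the tube of a small round ring in `Circle × ℂ`. -/
noncomputable def ringMap (d : ℝ) (p : Circle × ℂ) : Circle × ℂ :=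
  (Circle.exp ((3 * d / 4 + d / 16 * p.2.re) * (p.1 : ℂ).re),
    ((3 * d / 4 + d / 16 * p.2.re) * (p.1 : ℂ).im : ℝ) + (d / 16 * p.2.im : ℝ) * Complex.I)

theorem continuous_ringMap (d : ℝ) : Continuous (ringMap d) := by
  have h1 : Continuous fun p : Circle × ℂ => p.2.re := Complex.continuous_re.comp continuous_snd
  have h2 : Continuous fun p : Circle × ℂ => p.2.im := Complex.continuous_im.comp continuous_snd
  have h3 : Continuous fun p : Circle × ℂ => (p.1 : ℂ) :=
    Continuous.comp (g := fun u : Circle => (u : ℂ)) continuous_subtype_val continuous_fst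
  have h4 := Complex.continuous_re.comp h3
  have h5 := Complex.continuous_im.comp h3
  simp only [Function.comp_def] at h4 h5
  unfold ringMap
  refine Continuous.prodMk (Circle.exp.continuous.comp ?_) ?_ <;> fun_prop

theorem ringMap_radius {d : ℝ} (hd : 0 < d) {p : Circle × ℂ} (hp : ‖p.2‖ < 2) :
    5 * d / 8 < 3 * d / 4 + d / 16 * p.2.re ∧ 3 * d / 4 + d / 16 * p.2.re < 7 * d / 8 := by
  have := abs_lt.1 ((Complex.abs_re_le_norm _).trans_lt hp)
  constructor <;> nlinarith [this.1, this.2]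

theorem ringMap_arg {d : ℝ} (hd : 0 < d) (hd1 : d ≤ 1) {p : Circle × ℂ} (hp : ‖p.2‖ < 2) :
    Complex.arg (ringMap d p).1 = (3 * d / 4 + d / 16 * p.2.re) * (p.1 : ℂ).re := by
  obtain ⟨h1, h2⟩ := ringMap_radius hd hp
  rw [ringMap]
  refine arg_coe_exp ?_
  have := Complex.abs_re_le_norm (p.1 : ℂ)
  rw [Circle.norm_coe] at this
  rw [abs_mul, abs_of_pos (by linarith)]
  have h3 := Real.pi_gt_three
  nlinarith [abs_nonneg (p.1 : ℂ).re]

theorem footprint_ringMap {d : ℝ} (hd : 0 < d) (hd1 : d ≤ 1) {p : Circle × ℂ} (hp : ‖p.2‖ < 2) :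
    footprint (ringMap d p) = (3 * d / 4 + d / 16 * p.2.re : ℝ) * (p.1 : ℂ) := by
  rw [footprint, ringMap_arg hd hd1 hp]
  apply Complex.ext <;> simp [ringMap]

theorem norm_footprint_ringMap {d : ℝ} (hd : 0 < d) (hd1 : d ≤ 1) {p : Circle × ℂ}
    (hp : ‖p.2‖ < 2) : ‖footprint (ringMap d p)‖ = 3 * d / 4 + d / 16 * p.2.re := by
  rw [footprint_ringMap hd hd1 hp, norm_mul, Circle.norm_coe, mul_one, Complex.norm_real,
    Real.norm_of_nonneg (by linarith [ringMap_radius hd hp])]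

theorem ringMap_im (d : ℝ) (p : Circle × ℂ) : (ringMap d p).2.im = d / 16 * p.2.im := by
  simp [ringMap]

theorem ringCoord_ringMap {d : ℝ} (hd : 0 < d) (hd1 : d ≤ 1) {p : Circle × ℂ}
    (hp : ‖p.2‖ < 2) : ringCoord d (ringMap d p) = p.2 := by
  apply Complex.ext
  · rw [ringCoord_re, norm_footprint_ringMap hd hd1 hp]
    field_simp
    ring
  · rw [ringCoord_im, ringMap_im]
    field_simp

/-- The tube of a small round ring in `Circle × ℂ`. -/
noncomputable def ringChart {d : ℝ} (hd : 0 < d) (hd1 : d ≤ 1) :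
    OpenPartialHomeomorph (Circle × ℂ) (Circle × ℂ) where
  toFun := ringMap d
  invFun q := (Circle.exp (Complex.arg (footprint q)), ringCoord d q)
  source := {p | ‖p.2‖ < 2}
  target := {q | ‖ringCoord d q‖ < 2}
  map_source' p hp := by
    rw [mem_ofPred_eq, ringCoord_ringMap hd hd1 hp]
    exact hp
  map_target' q hq := hq
  left_inv' p hp := by
    rw [footprint_ringMap hd hd1 hp, ringCoord_ringMap hd hd1 hp,
      exp_arg_real_mul (by linarith [ringMap_radius hd hp])]
  right_inv' q hq := by
    obtain ⟨h1, h2, h3⟩ := ringCoord_bounds hd hq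
    have hne : footprint q ≠ 0 := by
      intro h
      rw [h, norm_zero] at h1
      linarith
    have hre : (3 * d / 4 + d / 16 * (ringCoord d q).re : ℝ) = ‖footprint q‖ := by
      rw [ringCoord_re]
      field_simp
      ring
    have hn : ‖footprint q‖ ≠ 0 := by simpa using hne
    rw [ringMap]
    simp only [hre, coe_exp_arg hne]
    refine Prod.ext ?_ ?_
    · have : ‖footprint q‖ * (footprint q / ‖footprint q‖).re = Complex.arg q.1 := by
        rw [Complex.div_ofReal_re]
        field_simp
        simp [footprint]
      simp only [this, Circle.exp_arg]
    · have h4 : ‖footprint q‖ * (footprint q / ‖footprint q‖).im = q.2.re := by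
        rw [Complex.div_ofReal_im]
        field_simp
        simp [footprint]
      have h5 : d / 16 * (ringCoord d q).im = q.2.im := by
        rw [ringCoord_im]
        field_simp
      simp only [h4, h5, Complex.re_add_im]
  open_source := isOpen_lt continuous_snd.norm continuous_const
  open_target := isOpen_lt (continuous_ringCoord d).norm continuous_const
  continuousOn_toFun := (continuous_ringMap d).continuousOn
  continuousOn_invFun := by
    refine ContinuousOn.prodMk ?_ (continuous_ringCoord d).continuousOn
    refine continuousOn_exp_arg.comp ?_ fun q hq h => ?_
    · intro q hq
      obtain ⟨h1, h2, h3⟩ := ringCoord_bounds hd hq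
      have harg : |Complex.arg q.1| < Real.pi := by
        have h4 := Real.pi_gt_three
        have h5 := sq_norm_footprint q
        have : |Complex.arg q.1| ≤ ‖footprint q‖ := abs_le_of_sq_le_sq' (by nlinarith [sq_nonneg q.2.re]) (norm_nonneg _) |>.2
        linarith
      have hc : ContinuousAt (fun q : Circle × ℂ => Complex.arg q.1) q := by
        refine ContinuousAt.comp (g := Complex.arg) (f := fun q : Circle × ℂ => (q.1 : ℂ))
          (Complex.continuousAt_arg ?_)
          (Continuous.comp (g := fun u : Circle => (u : ℂ)) continuous_subtype_val
            continuous_fst).continuousAt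
        rw [Complex.mem_slitPlane_iff_arg]
        exact ⟨fun h => by rw [h, abs_of_pos Real.pi_pos] at harg; exact lt_irrefl _ harg,
          Circle.coe_ne_zero _⟩
      have h2' : Continuous fun q : Circle × ℂ => q.2.re := Complex.continuous_re.comp continuous_snd
      unfold footprint
      exact (((Complex.continuous_ofReal.continuousAt.comp hc).add
        ((Complex.continuous_ofReal.comp h2').continuousAt.mul continuousAt_const))).continuousWithinAt
    · obtain ⟨h1, h2, h3⟩ := ringCoord_bounds hd hq
      rw [h, norm_zero] at h1
      linarith

end Ring


section RingFamily

/-- The unit by which the rings of the two parities are rotated. -/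
noncomputable def ringTwist (e : Bool) : Circle := cond e (Circle.exp (Real.pi / 2)) 1

theorem coe_ringTwist_true : (ringTwist true : ℂ) = Complex.I := by
  simp [ringTwist, Circle.coe_exp, Complex.exp_pi_div_two_mul_I]

/-- The coordinates with respect to a ring. -/
noncomputable def ringLocal (r : ℕ) (e : Bool) (m : Fin r) (q : Circle × ℂ) : Circle × ℂ :=
  (q.1 / ringPoint r e m, (ringTwist e : ℂ)⁻¹ * q.2)

theorem continuous_ringLocal (r : ℕ) (e : Bool) (m : Fin r) : Continuous (ringLocal r e m) :=
  (continuous_fst.div' continuous_const).prodMk (continuous_const.mul continuous_snd)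

/-- The rotation from the standard position of a ring to its actual position. -/
noncomputable def ringRotation (r : ℕ) (e : Bool) (m : Fin r) : Circle × ℂ ≃ₜ Circle × ℂ where
  toFun q := (q.1 * ringPoint r e m, (ringTwist e : ℂ) * q.2)
  invFun := ringLocal r e m
  left_inv q := by simp [ringLocal]
  right_inv q := by simp [ringLocal]
  continuous_toFun := (continuous_fst.mul continuous_const).prodMk
    (continuous_const.mul continuous_snd)
  continuous_invFun := continuous_ringLocal r e m

variable {r : ℕ}

/-- The gap between consecutive rings. -/
noncomputable abbrev ringGap (r : ℕ) : ℝ := Real.pi / r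

theorem ringGap_pos (hr : 13 ≤ r) : 0 < ringGap r :=
  div_pos Real.pi_pos (by exact_mod_cast (by omega : 0 < r))

theorem ringGap_le (hr : 13 ≤ r) : ringGap r ≤ 1 / 4 := by
  have : (13 : ℝ) ≤ r := by exact_mod_cast hr
  rw [ringGap, div_le_iff₀ (by linarith)]
  linarith [Real.pi_lt_d2]

/-- The chain of linked rings around the core of `Circle × ℂ`. -/
noncomputable def ringTube (hr : 13 ≤ r) (k : Bool × Fin r) :
    OpenPartialHomeomorph (Circle × ℂ) (Circle × ℂ) :=
  (ringChart (ringGap_pos hr) (by linarith [ringGap_le hr])).trans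
    (ringRotation r k.1 k.2).toOpenPartialHomeomorph

theorem ringLocal_ringTube (hr : 13 ≤ r) (k : Bool × Fin r) (p : Circle × ℂ) :
    ringLocal r k.1 k.2 (ringTube hr k p) = ringMap (ringGap r) p :=
  (ringRotation r k.1 k.2).left_inv _

theorem ringTube_source (hr : 13 ≤ r) (k : Bool × Fin r) :
    (ringTube hr k).source = {p | ‖p.2‖ < 2} := by
  rw [ringTube, OpenPartialHomeomorph.trans_source]
  simp [ringChart]

theorem mem_ringTube_target (hr : 13 ≤ r) {k : Bool × Fin r} {q : Circle × ℂ} :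
    q ∈ (ringTube hr k).target ↔ ‖ringCoord (ringGap r) (ringLocal r k.1 k.2 q)‖ < 2 := by
  rw [ringTube, OpenPartialHomeomorph.trans_target]
  simp [ringChart, ringRotation]

/-- The height over the plane of the rings of the opposite parity. -/
noncomputable def ringHeight (e : Bool) (q : Circle × ℂ) : ℝ := ((ringTwist e : ℂ)⁻¹ * q.2).im

/-- The coordinate in the plane of a ring transverse to the core. -/
noncomputable def ringWidth (e : Bool) (q : Circle × ℂ) : ℝ := ((ringTwist e : ℂ)⁻¹ * q.2).re

theorem ringHeight_false (q : Circle × ℂ) : ringHeight false q = q.2.im := by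
  simp [ringHeight, ringTwist]

theorem ringWidth_false (q : Circle × ℂ) : ringWidth false q = q.2.re := by
  simp [ringWidth, ringTwist]

theorem ringHeight_true (q : Circle × ℂ) : ringHeight true q = -q.2.re := by
  simp [ringHeight, coe_ringTwist_true]

theorem ringWidth_true (q : Circle × ℂ) : ringWidth true q = q.2.im := by
  simp [ringWidth, coe_ringTwist_true]

theorem continuous_ringHeight (e : Bool) : Continuous (ringHeight e) :=
  Complex.continuous_im.comp (continuous_const.mul continuous_snd)

theorem continuous_ringWidth (e : Bool) : Continuous (ringWidth e) :=
  Complex.continuous_re.comp (continuous_const.mul continuous_snd)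

theorem sq_ringWidth_not (e : Bool) (q : Circle × ℂ) :
    ringWidth (!e) q ^ 2 = ringHeight e q ^ 2 := by
  cases e <;> simp [ringHeight_false, ringHeight_true, ringWidth_false, ringWidth_true]

theorem sq_ringHeight_not (e : Bool) (q : Circle × ℂ) :
    ringHeight (!e) q ^ 2 = ringWidth e q ^ 2 := by
  cases e <;> simp [ringHeight_false, ringHeight_true, ringWidth_false, ringWidth_true]

/-- The squared distance from the centre of the footprint in the plane of a ring. -/
noncomputable def ringSq (r : ℕ) (e : Bool) (m : Fin r) (q : Circle × ℂ) : ℝ :=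
  circleDist q.1 (ringPoint r e m) ^ 2 + ringWidth e q ^ 2

theorem continuous_ringSq (e : Bool) (m : Fin r) : Continuous (ringSq r e m) :=
  (((continuous_circleDist _).comp continuous_fst).pow 2).add ((continuous_ringWidth e).pow 2)

theorem ringSq_eq (e : Bool) (m : Fin r) (q : Circle × ℂ) :
    ringSq r e m q = ‖footprint (ringLocal r e m q)‖ ^ 2 := by
  rw [sq_norm_footprint]
  rfl

theorem ringTube_target_bounds (hr : 13 ≤ r) {k : Bool × Fin r} {q : Circle × ℂ}
    (hq : q ∈ (ringTube hr k).target) :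
    (5 * ringGap r / 8) ^ 2 < ringSq r k.1 k.2 q ∧ ringSq r k.1 k.2 q < (7 * ringGap r / 8) ^ 2 ∧
      |ringHeight k.1 q| < ringGap r / 8 := by
  have hd := ringGap_pos hr
  obtain ⟨h1, h2, h3⟩ := ringCoord_bounds hd ((mem_ringTube_target hr).1 hq)
  rw [ringSq_eq]
  exact ⟨pow_lt_pow_left₀ h1 (by positivity) (by norm_num),
    pow_lt_pow_left₀ h2 (norm_nonneg _) (by norm_num), h3⟩

theorem circleDist_lt_of_sq {r : ℕ} {e : Bool} {m : Fin r} {q : Circle × ℂ} {a : ℝ} (ha : 0 ≤ a)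
    (h : ringSq r e m q < a ^ 2) : circleDist q.1 (ringPoint r e m) < a := by
  refine lt_of_pow_lt_pow_left₀ 2 ha (lt_of_le_of_lt ?_ h)
  exact le_add_of_nonneg_right (sq_nonneg _)

theorem exists_opposite_ring (hr : 13 ≤ r) {e : Bool} {m : Fin r} {θ : Circle}
    (h1 : ringGap r / 2 < circleDist θ (ringPoint r e m))
    (h2 : circleDist θ (ringPoint r e m) < 7 * ringGap r / 8) :
    ∃ m', circleDist θ (ringPoint r (!e) m') ≤ ringGap r / 2 := by
  have hd := ringGap_pos hr
  obtain ⟨e', m', h⟩ := exists_circleDist_le (by omega : 0 < r) θ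
  by_cases he : e' = e
  · subst he
    by_cases hm : m = m'
    · subst hm
      exact absurd h (not_le.2 h1)
    · have := two_mul_le_circleDist_add e' hm θ
      change 2 * ringGap r ≤ _ at this
      change _ ≤ ringGap r / 2 at h
      linarith
  · exact ⟨m', by rwa [show (!e) = e' by cases e <;> cases e' <;> simp_all]⟩

theorem isTubeFamily_ringTube (hr : 13 ≤ r) :
    IsTubeFamily (Prod.snd : Circle × ℂ → ℂ) (ringTube hr) := by
  have hd := ringGap_pos hr
  have hd4 := ringGap_le hr
  set d := ringGap r with hdd
  refine ⟨ringTube_source hr, ?_, ?_⟩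
  · intro k l hkl
    rw [Set.disjoint_left]
    intro q hq hq'
    obtain ⟨h1, h2, h3⟩ := ringTube_target_bounds hr hq
    obtain ⟨h1', h2', h3'⟩ := ringTube_target_bounds hr hq'
    have h4 := circleDist_lt_of_sq (by positivity) h2
    have h4' := circleDist_lt_of_sq (by positivity) h2'
    obtain ⟨e, m⟩ := k
    obtain ⟨e', m'⟩ := l
    by_cases he : e' = e
    · subst he
      have hm : m ≠ m' := fun h => hkl (by rw [h])
      have := two_mul_le_circleDist_add e' hm q.1
      change 2 * d ≤ _ at this
      simp only at h4 h4'
      linarith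
    · obtain rfl : e' = !e := by cases e <;> cases e' <;> simp_all
      simp only at h1 h1' h2 h2' h3 h3' h4 h4'
      have hlow : ∀ e (m : Fin r), (5 * d / 8) ^ 2 < ringSq r e m q → |ringWidth e q| < d / 8 →
          d / 2 < circleDist q.1 (ringPoint r e m) := by
        intro e m h hw
        have := circleDist_nonneg q.1 (ringPoint r e m)
        rw [ringSq, ← sq_abs (ringWidth e q)] at h
        nlinarith [abs_nonneg (ringWidth e q)]
      have hw : |ringWidth e q| < d / 8 := by
        refine lt_of_pow_lt_pow_left₀ 2 (by positivity) ?_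
        rw [sq_abs, ← sq_ringHeight_not, ← sq_abs]
        exact pow_lt_pow_left₀ h3' (abs_nonneg _) (by norm_num)
      have hw' : |ringWidth (!e) q| < d / 8 := by
        refine lt_of_pow_lt_pow_left₀ 2 (by positivity) ?_
        rw [sq_abs, sq_ringWidth_not, ← sq_abs]
        exact pow_lt_pow_left₀ h3 (abs_nonneg _) (by norm_num)
      have h5 := hlow e m h1 hw
      have h5' := hlow (!e) m' h1' hw'
      obtain ⟨m'', h6⟩ := exists_opposite_ring hr h5 h4
      have hm : m' ≠ m'' := by
        rintro rfl
        exact absurd h6 (not_le.2 h5')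
      have := two_mul_le_circleDist_add (!e) hm q.1
      change 2 * d ≤ _ at this
      rw [← hdd] at h6
      linarith
  · intro k q hq
    obtain ⟨h1, h2, h3⟩ := ringTube_target_bounds hr hq
    change ‖q.2‖ < 1 / 2
    have h4 : ‖q.2‖ ^ 2 = ringWidth k.1 q ^ 2 + ringHeight k.1 q ^ 2 := by
      have : ‖q.2‖ = ‖(ringTwist k.1 : ℂ)⁻¹ * q.2‖ := by
        rw [norm_mul, norm_inv, Circle.norm_coe, inv_one, one_mul]
      rw [this, ← Complex.normSq_eq_norm_sq, Complex.normSq_apply]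
      simp only [ringWidth, ringHeight]
      ring
    refine lt_of_pow_lt_pow_left₀ 2 (by positivity) ?_
    rw [h4, ← sq_abs (ringHeight k.1 q)]
    rw [ringSq] at h2
    nlinarith [sq_nonneg (circleDist q.1 (ringPoint r k.1 k.2)), abs_nonneg (ringHeight k.1 q)]

end RingFamily


section RingCocycle

variable {r : ℕ} {G : Type*} [Group G]

/-- The union of the discs bounded by the footprints of the rings of one parity. -/
def ringDisc (r : ℕ) (e : Bool) : Set (Circle × ℂ) :=
  {q | ∃ m, ringSq r e m q ≤ (3 * ringGap r / 4) ^ 2}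

theorem isClosed_ringDisc (e : Bool) : IsClosed (ringDisc r e) := by
  have : ringDisc r e = ⋃ m, {q | ringSq r e m q ≤ (3 * ringGap r / 4) ^ 2} := by
    ext q
    simp [ringDisc]
  rw [this]
  exact isClosed_iUnion_of_finite fun m => isClosed_le (continuous_ringSq e m) continuous_const

open Classical in
/-- The sign of the height, as an integer. -/
noncomputable def ringSide (e : Bool) (q : Circle × ℂ) : ℤ := if 0 ≤ ringHeight e q then 1 else 0

open Classical in
/-- The cocycle of the rings of one parity. -/
noncomputable def ringCocycle (r : ℕ) (e : Bool) (g : G) (p q : Circle × ℂ) : G :=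
  if p ∉ ringDisc r e ∧ q ∉ ringDisc r e then g ^ (ringSide e q - ringSide e p) else 1

theorem ringSide_locally {e : Bool} {q : Circle × ℂ} (hq : ringHeight e q ≠ 0) :
    ∃ O ∈ 𝓝 q, ∀ a ∈ O, ringSide e a = ringSide e q := by
  rcases lt_or_gt_of_ne hq with h | h
  · refine ⟨_, (isOpen_lt (continuous_ringHeight e) continuous_const).mem_nhds h, fun a ha => ?_⟩
    have ha' : ringHeight e a < 0 := ha
    rw [ringSide, ringSide, if_neg (not_le.2 ha'), if_neg (not_le.2 h)]
  · refine ⟨_, (isOpen_lt continuous_const (continuous_ringHeight e)).mem_nhds h, fun a ha => ?_⟩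
    have ha' : 0 < ringHeight e a := ha
    rw [ringSide, ringSide, if_pos ha'.le, if_pos (le_of_lt h)]

theorem ringCocycle_locally_one {e : Bool} {q : Circle × ℂ} (g : G)
    (h : ringHeight e q ≠ 0 ∨ ∃ m, ringSq r e m q < (3 * ringGap r / 4) ^ 2) :
    ∃ O ∈ 𝓝 q, ∀ a ∈ O, ∀ b ∈ O, ringCocycle r e g a b = 1 := by
  rcases h with h | ⟨m, h⟩
  · obtain ⟨O, hO, h1⟩ := ringSide_locally h
    refine ⟨O, hO, fun a ha b hb => ?_⟩
    rw [ringCocycle, h1 a ha, h1 b hb, sub_self, zpow_zero, ite_self]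
  · refine ⟨_, (isOpen_lt (continuous_ringSq e m) continuous_const).mem_nhds h,
      fun a ha b hb => if_neg fun h' => h'.1 ⟨m, le_of_lt ha⟩⟩

theorem ringCocycle_locally_eq {e : Bool} {q : Circle × ℂ} (g : G)
    (h : ringHeight e q ≠ 0 ∨ q ∉ ringDisc r e) :
    ∃ O ∈ 𝓝 q, ∀ a ∈ O, ∀ b ∈ O, ringCocycle r e g a b = g ^ (ringSide e b - ringSide e a) := by
  rcases h with h | h
  · obtain ⟨O, hO, h1⟩ := ringSide_locally h
    refine ⟨O, hO, fun a ha b hb => ?_⟩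
    rw [ringCocycle, h1 a ha, h1 b hb, sub_self, zpow_zero, ite_self]
  · exact ⟨_, (isClosed_ringDisc e).isOpen_compl.mem_nhds h, fun a ha b hb => if_pos ⟨ha, hb⟩⟩

theorem ringCocycle_ringTube (hr : 13 ≤ r) (k : Bool × Fin r) (g : G) {p q : Circle × ℂ}
    (hp : ‖p.2‖ < 2) (hq : ‖q.2‖ < 2) :
    ringCocycle r k.1 g (ringTube hr k p) (ringTube hr k q) = jump g p.2 q.2 := by
  have hd := ringGap_pos hr
  have hd4 := ringGap_le hr
  have hdisc : ∀ {p : Circle × ℂ}, ‖p.2‖ < 2 →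
      (ringTube hr k p ∉ ringDisc r k.1 ↔ 0 < p.2.re) := by
    intro p hp
    have hsq : ringSq r k.1 k.2 (ringTube hr k p) = (3 * ringGap r / 4 + ringGap r / 16 * p.2.re) ^ 2 := by
      rw [ringSq_eq, ringLocal_ringTube, norm_footprint_ringMap hd (by linarith) hp]
    have hpos := (ringMap_radius hd hp).1
    have htar : ringTube hr k p ∈ (ringTube hr k).target :=
      (ringTube hr k).map_source (by rw [ringTube_source]; exact hp)
    constructor
    · intro h
      by_contra! hre
      refine h ⟨k.2, ?_⟩
      rw [hsq]
      exact pow_le_pow_left₀ (by linarith) (by nlinarith) 2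
    · rintro hre ⟨m, hm⟩
      by_cases hkm : k.2 = m
      · rw [← hkm, hsq] at hm
        have := pow_lt_pow_left₀ (show 3 * ringGap r / 4 < 3 * ringGap r / 4 + ringGap r / 16 * p.2.re by
          nlinarith [mul_pos hd hre]) (by positivity) (two_ne_zero)
        linarith
      · have h1 := two_mul_le_circleDist_add k.1 hkm (ringTube hr k p).1
        have h2 := circleDist_lt_of_sq (by positivity) (ringTube_target_bounds hr htar).2.1
        have h3 : circleDist (ringTube hr k p).1 (ringPoint r k.1 m) < ringGap r :=
          circleDist_lt_of_sq hd.le (hm.trans_lt (pow_lt_pow_left₀ (by linarith) (by positivity) two_ne_zero))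
        change 2 * ringGap r ≤ _ at h1
        linarith
  have hside : ∀ p : Circle × ℂ, (0 ≤ ringHeight k.1 (ringTube hr k p) ↔ 0 ≤ p.2.im) := by
    intro p
    have : ringHeight k.1 (ringTube hr k p) = (ringLocal r k.1 k.2 (ringTube hr k p)).2.im := rfl
    rw [this, ringLocal_ringTube, ringMap_im]
    exact mul_nonneg_iff_of_pos_left (by linarith)
  simp only [ringCocycle, jump, hdisc hp, hdisc hq, ringSide, hside]

theorem ringCocycle_not_ringTube (hr : 13 ≤ r) {k : Bool × Fin r} (g : G) {q : Circle × ℂ}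
    (hq : q ∈ (ringTube hr k).target) :
    ∃ O ∈ 𝓝 q, ∀ a ∈ O, ∀ b ∈ O, ringCocycle r (!k.1) g a b = 1 := by
  have hd := ringGap_pos hr
  obtain ⟨h1, h2, h3⟩ := ringTube_target_bounds hr hq
  by_cases hx : ringHeight (!k.1) q = 0
  · refine ringCocycle_locally_one g (Or.inr ?_)
    have hw : ringWidth k.1 q ^ 2 = 0 := by rw [← sq_ringHeight_not, hx]; norm_num
    have h4 := circleDist_lt_of_sq (by positivity) h2
    have h5 : ringGap r / 2 < circleDist q.1 (ringPoint r k.1 k.2) := by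
      refine lt_of_pow_lt_pow_left₀ 2 (circleDist_nonneg _ _) ?_
      rw [ringSq, hw] at h1
      nlinarith
    obtain ⟨m', h6⟩ := exists_opposite_ring hr h5 h4
    refine ⟨m', ?_⟩
    rw [ringSq, sq_ringWidth_not, ← sq_abs (ringHeight k.1 q)]
    have := circleDist_nonneg q.1 (ringPoint r (!k.1) m')
    nlinarith [abs_nonneg (ringHeight k.1 q)]
  · exact ringCocycle_locally_one g (Or.inl hx)

/-- The cocycle of the chain of rings. -/
noncomputable def chainCocycle (r : ℕ) (b c : G) (p q : Circle × ℂ) : G :=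
  ringCocycle r false b p q * ringCocycle r true c p q

theorem mem_core_of_ringSq_eq (hr : 13 ≤ r) {k : Bool × Fin r} {q : Circle × ℂ}
    (h : ringHeight k.1 q = 0) (h' : ringSq r k.1 k.2 q = (3 * ringGap r / 4) ^ 2) :
    q ∈ ringTube hr k '' {p | ‖p.2‖ ≤ 1 / 2} := by
  have hd := ringGap_pos hr
  have hc : ringCoord (ringGap r) (ringLocal r k.1 k.2 q) = 0 := by
    rw [ringSq_eq] at h'
    have h'' : ‖footprint (ringLocal r k.1 k.2 q)‖ = 3 * ringGap r / 4 :=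
      (pow_left_inj₀ (norm_nonneg _) (by positivity) two_ne_zero).1 h'
    apply Complex.ext
    · rw [ringCoord_re, h'']
      simp
    · rw [ringCoord_im]
      have : (ringLocal r k.1 k.2 q).2.im = 0 := h
      simp [this]
  have hq : q ∈ (ringTube hr k).target := by
    rw [mem_ringTube_target, hc, norm_zero]
    norm_num
  refine ⟨(ringTube hr k).symm q, ?_, (ringTube hr k).right_inv hq⟩
  have : ((ringTube hr k).symm q).2 = ringCoord (ringGap r) (ringLocal r k.1 k.2 q) := rfl
  rw [mem_ofPred_eq, this, hc, norm_zero]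
  norm_num

theorem cocycleOn_ringCocycle (hr : 13 ≤ r) (e : Bool) (g : G) :
    CocycleOn (ringCocycle r e g) (⋃ k, ringTube hr k '' {p | ‖p.2‖ ≤ 1 / 2})ᶜ := by
  intro q hq
  by_cases h1 : ringHeight e q ≠ 0 ∨ q ∉ ringDisc r e
  · obtain ⟨O, hO, h⟩ := ringCocycle_locally_eq g h1
    refine ⟨O, hO, fun x hx y hy z hz => ?_⟩
    rw [h x hx y hy, h y hy z hz, h x hx z hz, ← zpow_add]
    congr 1
    ring
  · push Not at h1
    obtain ⟨h1, m, h2⟩ := h1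
    have h3 : ringSq r e m q < (3 * ringGap r / 4) ^ 2 := lt_of_le_of_ne h2 fun h =>
      hq (mem_iUnion.2 ⟨(e, m), mem_core_of_ringSq_eq hr h1 h⟩)
    obtain ⟨O, hO, h⟩ := ringCocycle_locally_one g (Or.inr ⟨m, h3⟩)
    exact ⟨O, hO, fun x hx y hy z hz => by rw [h x hx y hy, h y hy z hz, h x hx z hz, one_mul]⟩

theorem exists_ringCocycle_trivial (hr : 13 ≤ r) (q : Circle × ℂ) :
    ∃ e, ∀ g : G, ∃ O ∈ 𝓝 q, ∀ a ∈ O, ∀ b ∈ O, ringCocycle r e g a b = 1 := by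
  have hd := ringGap_pos hr
  by_cases h0 : ringHeight false q = 0
  · by_cases h1 : ringHeight true q = 0
    · obtain ⟨e, m, h⟩ := exists_circleDist_le (by omega : 0 < r) q.1
      change _ ≤ ringGap r / 2 at h
      refine ⟨e, fun g => ringCocycle_locally_one g (Or.inr ⟨m, ?_⟩)⟩
      have hw : ringWidth e q ^ 2 = 0 := by
        rw [← sq_ringHeight_not]
        cases e <;> simp [h0, h1]
      rw [ringSq, hw]
      nlinarith [circleDist_nonneg q.1 (ringPoint r e m)]
    · exact ⟨true, fun g => ringCocycle_locally_one g (Or.inl h1)⟩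
  · exact ⟨false, fun g => ringCocycle_locally_one g (Or.inl h0)⟩

theorem cocycleOn_chainCocycle (hr : 13 ≤ r) (b c : G) :
    CocycleOn (chainCocycle r b c) (⋃ k, ringTube hr k '' {p | ‖p.2‖ ≤ 1 / 2})ᶜ := by
  intro q hq
  obtain ⟨e, he⟩ := exists_ringCocycle_trivial (G := G) hr q
  cases e
  · obtain ⟨O, hO, h⟩ := he b
    obtain ⟨O', hO', h'⟩ := cocycleOn_ringCocycle hr true c q hq
    refine ⟨O ∩ O', Filter.inter_mem hO hO', fun x hx y hy z hz => ?_⟩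
    rw [chainCocycle, chainCocycle, chainCocycle, h x hx.1 y hy.1, h y hy.1 z hz.1,
      h x hx.1 z hz.1, one_mul, one_mul, one_mul, h' x hx.2 y hy.2 z hz.2]
  · obtain ⟨O, hO, h⟩ := he c
    obtain ⟨O', hO', h'⟩ := cocycleOn_ringCocycle hr false b q hq
    refine ⟨O ∩ O', Filter.inter_mem hO hO', fun x hx y hy z hz => ?_⟩
    rw [chainCocycle, chainCocycle, chainCocycle, h x hx.1 y hy.1, h y hy.1 z hz.1,
      h x hx.1 z hz.1, mul_one, mul_one, mul_one, h' x hx.2 y hy.2 z hz.2]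

theorem chainCocycle_locally_of_far (hr : 13 ≤ r) (b c : G) {q : Circle × ℂ} (hq : 1 / 2 < ‖q.2‖) :
    ∃ O ∈ 𝓝 q, ∀ x ∈ O, ∀ y ∈ O, chainCocycle r b c x y =
      b ^ (ringSide false y - ringSide false x) * c ^ (ringSide true y - ringSide true x) := by
  have hd := ringGap_pos hr
  have hd4 := ringGap_le hr
  have hsq : 1 / 4 < q.2.re ^ 2 + q.2.im ^ 2 := by
    have h := pow_lt_pow_left₀ hq (by norm_num) two_ne_zero
    rw [← Complex.normSq_eq_norm_sq, Complex.normSq_apply] at h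
    linarith
  have hd2 : (3 * ringGap r / 4) ^ 2 < 1 / 4 := by nlinarith
  have key : ∀ e, ringHeight e q ≠ 0 ∨ q ∉ ringDisc r e := by
    intro e
    by_contra h
    push Not at h
    obtain ⟨h1, m, h2⟩ := h
    have h3 : q.2.re ^ 2 + q.2.im ^ 2 = ringWidth e q ^ 2 + ringHeight e q ^ 2 := by
      cases e
      · rw [ringWidth_false, ringHeight_false]
      · rw [ringWidth_true, ringHeight_true]
        ring
    rw [ringSq] at h2
    rw [h1] at h3
    nlinarith [sq_nonneg (circleDist q.1 (ringPoint r e m))]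
  obtain ⟨O, hO, h⟩ := ringCocycle_locally_eq b (key false)
  obtain ⟨O', hO', h'⟩ := ringCocycle_locally_eq c (key true)
  exact ⟨O ∩ O', Filter.inter_mem hO hO', fun x hx y hy => by
    rw [chainCocycle, h x hx.1 y hy.1, h' x hx.2 y hy.2]⟩

open Classical in
/-- The coboundary comparing the cocycle of the chain to the model cocycle, by quadrant. -/
noncomputable def quadrantTwist (b c : G) (z : ℂ) : G :=
  if 0 < z.re then (if 0 ≤ z.im then 1 else c * b * c⁻¹)
  else (if 0 ≤ z.im then c⁻¹ else b * c⁻¹)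

theorem cohomOn_chainCocycle (hr : 13 ≤ r) (b c : G) :
    CohomOn (chainCocycle r b c) (fun p q => jump (c * b⁻¹ * c⁻¹ * b) p.2 q.2)
      {p | 1 / 2 < ‖p.2‖} := by
  refine ⟨fun q => quadrantTwist b c q.2, fun q hq => ?_⟩
  have hq' : 1 / 2 < ‖q.2‖ := hq
  obtain ⟨O, hO, h⟩ := chainCocycle_locally_of_far hr b c hq'
  have hre : Continuous fun q : Circle × ℂ => q.2.re := Complex.continuous_re.comp continuous_snd
  have him : Continuous fun q : Circle × ℂ => q.2.im := Complex.continuous_im.comp continuous_snd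
  have hside : ∀ q : Circle × ℂ, ringSide true q = if 0 < q.2.re then 0 else 1 := by
    intro q
    rw [ringSide, ringHeight_true]
    by_cases h : 0 < q.2.re
    · rw [if_pos h, if_neg (by linarith)]
    · rw [if_neg h, if_pos (by linarith)]
  have hside' : ∀ q : Circle × ℂ, ringSide false q = if 0 ≤ q.2.im then 1 else 0 := by
    intro q
    rw [ringSide, ringHeight_false]
  rcases lt_trichotomy q.2.re 0 with h1 | h1 | h1
  · refine ⟨O ∩ {q | q.2.re < 0}, Filter.inter_mem hO ((isOpen_lt hre continuous_const).mem_nhds h1),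
      fun x hx y hy => ?_⟩
    have hx' : ¬ 0 < x.2.re := not_lt.2 (le_of_lt hx.2)
    have hy' : ¬ 0 < y.2.re := not_lt.2 (le_of_lt hy.2)
    rw [h x hx.1 y hy.1]
    simp only [hside, hside', quadrantTwist, jump, hx', hy', if_false, false_and]
    by_cases h2 : 0 ≤ x.2.im <;> by_cases h3 : 0 ≤ y.2.im <;> simp [h2, h3]
  · have h2 : q.2.im ≠ 0 := by
      intro h2
      have : q.2 = 0 := Complex.ext h1 h2
      rw [this, norm_zero] at hq'
      linarith
    rcases lt_or_gt_of_ne h2 with h2 | h2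
    · refine ⟨O ∩ {q | q.2.im < 0}, Filter.inter_mem hO ((isOpen_lt him continuous_const).mem_nhds h2),
        fun x hx y hy => ?_⟩
      have hx' : ¬ 0 ≤ x.2.im := not_le.2 hx.2
      have hy' : ¬ 0 ≤ y.2.im := not_le.2 hy.2
      rw [h x hx.1 y hy.1]
      simp only [hside, hside', quadrantTwist, jump, hx', hy', if_false]
      by_cases h2 : 0 < x.2.re <;> by_cases h3 : 0 < y.2.re <;> simp [h2, h3, mul_assoc]
    · refine ⟨O ∩ {q | 0 < q.2.im}, Filter.inter_mem hO ((isOpen_lt continuous_const him).mem_nhds h2),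
        fun x hx y hy => ?_⟩
      have hx' : 0 ≤ x.2.im := le_of_lt hx.2
      have hy' : 0 ≤ y.2.im := le_of_lt hy.2
      rw [h x hx.1 y hy.1]
      simp only [hside, hside', quadrantTwist, jump, hx', hy', if_true]
      by_cases h2 : 0 < x.2.re <;> by_cases h3 : 0 < y.2.re <;> simp [h2, h3]
  · refine ⟨O ∩ {q | 0 < q.2.re}, Filter.inter_mem hO ((isOpen_lt continuous_const hre).mem_nhds h1),
      fun x hx y hy => ?_⟩
    have hx' : 0 < x.2.re := hx.2
    have hy' : 0 < y.2.re := hy.2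
    rw [h x hx.1 y hy.1]
    simp only [hside, hside', quadrantTwist, jump, hx', hy', if_true, and_self]
    by_cases h2 : 0 ≤ x.2.im <;> by_cases h3 : 0 ≤ y.2.im <;> simp [h2, h3, mul_assoc]

/-- Holonomies that are commutators of the given form pass to the rings of a chain. -/
theorem posStep_ringTube (hr : 13 ≤ r) {S S' : Set G}
    (hS : ∀ g ∈ S, ∃ b ∈ S', ∃ c ∈ S', g = c * b⁻¹ * c⁻¹ * b) :
    PosStep (Prod.snd : Circle × ℂ → ℂ) (ringTube hr) S S' := by
  refine PosStep.of_cohomOn continuous_snd (isTubeFamily_ringTube hr) fun g hg => ?_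
  obtain ⟨b, hb, c, hc, rfl⟩ := hS g hg
  refine ⟨fun k => cond k.1 c b, fun ⟨e, _⟩ => by cases e <;> assumption, chainCocycle r b c,
    cocycleOn_chainCocycle hr b c, cohomOn_chainCocycle hr b c, fun k p hp => ?_⟩
  have hp2 : ‖p.2‖ < 2 := hp.2
  have hfam := isTubeFamily_ringTube hr
  have hnear : {p : Circle × ℂ | ‖p.2‖ < 2} ∈ 𝓝 p :=
    (isOpen_lt continuous_snd.norm continuous_const).mem_nhds hp2
  have htar : ringTube hr k p ∈ (ringTube hr k).target :=
    (ringTube hr k).map_source (hfam.mem_source hp2)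
  have hcont : ContinuousAt (ringTube hr k) p := hfam.continuousAt hp2
  obtain ⟨e, m⟩ := k
  cases e
  · obtain ⟨O, hO, h⟩ := ringCocycle_not_ringTube hr c htar
    refine ⟨_, Filter.inter_mem (hcont hO) hnear, fun x hx y hy => ?_⟩
    dsimp only
    rw [chainCocycle, ringCocycle_ringTube hr (false, m) b hx.2 hy.2,
      show true = !(false, m).1 from rfl, h _ hx.1 _ hy.1, mul_one]
    rfl
  · obtain ⟨O, hO, h⟩ := ringCocycle_not_ringTube hr b htar
    refine ⟨_, Filter.inter_mem (hcont hO) hnear, fun x hx y hy => ?_⟩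
    dsimp only
    rw [chainCocycle, ringCocycle_ringTube hr (true, m) c hx.2 hy.2,
      show false = !(true, m).1 from rfl, h _ hx.1 _ hy.1, one_mul]
    rfl

end RingCocycle


section Cable

/-- The function vanishing on the torus knot which runs once around the core of `Circle × ℂ`
for `N` turns of its parameter. -/
noncomputable def cableFun (N : ℕ) (a : ℝ) (q : Circle × ℂ) : ℂ := (a * q.2) ^ N - q.1

theorem continuous_coe_fst : Continuous fun p : Circle × ℂ => (p.1 : ℂ) :=
  Continuous.comp (g := fun u : Circle => (u : ℂ)) continuous_subtype_val continuous_fst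

theorem continuous_cableFun (N : ℕ) (a : ℝ) : Continuous (cableFun N a) :=
  ((continuous_const.mul continuous_snd).pow N).sub continuous_coe_fst

/-- The parametrization of the tube of a torus knot. -/
noncomputable def cableMap (N : ℕ) (a : ℝ) (p : Circle × ℂ) : Circle × ℂ :=
  (p.1 ^ N, (a : ℂ)⁻¹ * (p.1 * (1 + ((p.1 : ℂ) ^ N)⁻¹ * p.2 / 8) ^ ((N : ℂ)⁻¹)))

theorem cable_slit {u w : ℂ} (hu : ‖u‖ = 1) (hw : ‖w‖ < 2) :
    1 + u⁻¹ * w / 8 ∈ Complex.slitPlane := by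
  refine Or.inl ?_
  have h1 : ‖u⁻¹ * w / 8‖ < 1 := by
    rw [norm_div, norm_mul, norm_inv, hu]
    norm_num
    linarith
  have := (abs_lt.1 ((Complex.abs_re_le_norm _).trans_lt h1)).1
  rw [Complex.add_re, Complex.one_re]
  linarith

theorem norm_coe_pow (u : Circle) (N : ℕ) : ‖(u : ℂ) ^ N‖ = 1 := by
  rw [norm_pow, Circle.norm_coe, one_pow]

variable {N : ℕ} {a : ℝ}

theorem scaled_cableMap (ha : 4 ≤ a) (p : Circle × ℂ) : a * (cableMap N a p).2 =
    p.1 * (1 + ((p.1 : ℂ) ^ N)⁻¹ * p.2 / 8) ^ ((N : ℂ)⁻¹) := by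
  have : (a : ℂ) ≠ 0 := by exact_mod_cast (by linarith : a ≠ 0)
  simp only [cableMap]
  rw [mul_inv_cancel_left₀ this]

theorem scaled_cableMap_pow (hN : N ≠ 0) (ha : 4 ≤ a) (p : Circle × ℂ) :
    (a * (cableMap N a p).2) ^ N = (p.1 : ℂ) ^ N * (1 + ((p.1 : ℂ) ^ N)⁻¹ * p.2 / 8) := by
  rw [scaled_cableMap ha, mul_pow, Complex.cpow_nat_inv_pow _ hN]

theorem cableFun_cableMap (hN : N ≠ 0) (ha : 4 ≤ a) (p : Circle × ℂ) :
    cableFun N a (cableMap N a p) = p.2 / 8 := by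
  rw [cableFun, scaled_cableMap_pow hN ha]
  have : (p.1 : ℂ) ^ N ≠ 0 := pow_ne_zero _ (Circle.coe_ne_zero _)
  simp only [cableMap, Circle.coe_pow]
  field_simp
  ring

/-- The unique `N`-th root of the angle close to the direction of the plane coordinate. -/
noncomputable def cableRoot (N : ℕ) (a : ℝ) (q : Circle × ℂ) : ℂ :=
  a * q.2 * (((a * q.2) ^ N * (q.1 : ℂ)⁻¹) ^ ((N : ℂ)⁻¹))⁻¹

theorem cable_ratio_slit {q : Circle × ℂ} (hq : ‖8 * cableFun N a q‖ < 2) :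
    (a * q.2) ^ N * (q.1 : ℂ)⁻¹ ∈ Complex.slitPlane := by
  have := cable_slit (Circle.norm_coe q.1) hq
  convert this using 1
  have := Circle.coe_ne_zero q.1
  rw [cableFun]
  field_simp
  ring

theorem cableRoot_pow (hN : N ≠ 0) {q : Circle × ℂ} (hq : ‖8 * cableFun N a q‖ < 2) :
    cableRoot N a q ^ N = q.1 := by
  have h0 : (a * q.2) ^ N * (q.1 : ℂ)⁻¹ ≠ 0 := Complex.slitPlane_ne_zero (cable_ratio_slit hq)
  have h1 : (a * q.2) ^ N ≠ 0 := left_ne_zero_of_mul h0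
  rw [cableRoot, mul_pow, inv_pow, Complex.cpow_nat_inv_pow _ hN]
  have := Circle.coe_ne_zero q.1
  field_simp

theorem norm_cableRoot (hN : N ≠ 0) {q : Circle × ℂ} (hq : ‖8 * cableFun N a q‖ < 2) :
    ‖cableRoot N a q‖ = 1 := by
  have := congrArg norm (cableRoot_pow hN hq)
  rw [norm_pow, Circle.norm_coe] at this
  exact (pow_eq_one_iff_of_nonneg (norm_nonneg _) hN).1 this

theorem coe_exp_arg_cableRoot (hN : N ≠ 0) {q : Circle × ℂ} (hq : ‖8 * cableFun N a q‖ < 2) :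
    (Circle.exp (Complex.arg (cableRoot N a q)) : ℂ) = cableRoot N a q := by
  have h := norm_cableRoot hN hq
  rw [coe_exp_arg (by intro h0; rw [h0, norm_zero] at h; norm_num at h), h]
  simp

/-- The tube of a torus knot in `Circle × ℂ`. -/
noncomputable def cableChart (hN : N ≠ 0) (ha : 4 ≤ a) :
    OpenPartialHomeomorph (Circle × ℂ) (Circle × ℂ) where
  toFun := cableMap N a
  invFun q := (Circle.exp (Complex.arg (cableRoot N a q)), 8 * cableFun N a q)
  source := {p | ‖p.2‖ < 2}
  target := {q | ‖8 * cableFun N a q‖ < 2}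
  map_source' p hp := by
    have : 8 * (p.2 / 8) = p.2 := by ring
    rw [mem_ofPred_eq, cableFun_cableMap hN ha, this]
    exact hp
  map_target' q hq := hq
  left_inv' p hp := by
    have hu : (p.1 : ℂ) ^ N ≠ 0 := pow_ne_zero _ (Circle.coe_ne_zero _)
    have hs := cable_slit (norm_coe_pow p.1 N) hp
    have h0 : (1 + ((p.1 : ℂ) ^ N)⁻¹ * p.2 / 8) ^ ((N : ℂ)⁻¹) ≠ 0 := by
      rw [Complex.cpow_def_of_ne_zero (Complex.slitPlane_ne_zero hs)]
      exact Complex.exp_ne_zero _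
    have h1 : cableRoot N a (cableMap N a p) = p.1 := by
      rw [cableRoot, scaled_cableMap_pow hN ha, scaled_cableMap ha]
      have : (p.1 : ℂ) ^ N * (1 + ((p.1 : ℂ) ^ N)⁻¹ * p.2 / 8) * ((cableMap N a p).1 : ℂ)⁻¹ =
          1 + ((p.1 : ℂ) ^ N)⁻¹ * p.2 / 8 := by
        simp only [cableMap, Circle.coe_pow]
        field_simp
      rw [this, mul_inv_cancel_right₀ h0]
    rw [h1, Circle.exp_arg, cableFun_cableMap hN ha]
    refine Prod.ext rfl ?_
    simp only
    ring
  right_inv' q hq := by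
    have ha0 : (a : ℂ) ≠ 0 := by exact_mod_cast (by linarith : a ≠ 0)
    have hr := cableRoot_pow hN hq
    have hs := cable_ratio_slit hq
    have h0 : ((a * q.2) ^ N * (q.1 : ℂ)⁻¹) ^ ((N : ℂ)⁻¹) ≠ 0 := by
      rw [Complex.cpow_def_of_ne_zero (Complex.slitPlane_ne_zero hs)]
      exact Complex.exp_ne_zero _
    have h1 : 1 + (q.1 : ℂ)⁻¹ * (8 * cableFun N a q) / 8 = (a * q.2) ^ N * (q.1 : ℂ)⁻¹ := by
      have := Circle.coe_ne_zero q.1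
      rw [cableFun]
      field_simp
      ring
    refine Prod.ext ?_ ?_
    · refine Circle.ext ?_
      simp only [cableMap, Circle.coe_pow]
      rw [coe_exp_arg_cableRoot hN hq, hr]
    · simp only [cableMap]
      rw [coe_exp_arg_cableRoot hN hq, hr, h1, cableRoot, inv_mul_cancel_right₀ h0,
        inv_mul_cancel_left₀ ha0]
  open_source := isOpen_lt continuous_snd.norm continuous_const
  open_target := isOpen_lt (continuous_const.mul (continuous_cableFun N a)).norm continuous_const
  continuousOn_toFun := by
    intro p hp
    have hs := cable_slit (norm_coe_pow p.1 N) hp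
    have hu : (p.1 : ℂ) ^ N ≠ 0 := pow_ne_zero _ (Circle.coe_ne_zero _)
    have h1 : ContinuousAt (fun p : Circle × ℂ => 1 + ((p.1 : ℂ) ^ N)⁻¹ * p.2 / 8) p :=
      continuousAt_const.add ((((continuous_coe_fst.continuousAt.pow N).inv₀ hu).mul
        continuous_snd.continuousAt).div_const 8)
    refine ContinuousAt.continuousWithinAt (ContinuousAt.prodMk (continuous_fst.pow N).continuousAt
      (continuousAt_const.mul (continuous_coe_fst.continuousAt.mul ?_)))
    exact h1.cpow continuousAt_const hs
  continuousOn_invFun := by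
    refine ContinuousOn.prodMk ?_ (continuous_const.mul (continuous_cableFun N a)).continuousOn
    refine continuousOn_exp_arg.comp ?_ fun q hq h => ?_
    · intro q hq
      have hs := cable_ratio_slit hq
      have h0 : ((a * q.2) ^ N * (q.1 : ℂ)⁻¹) ^ ((N : ℂ)⁻¹) ≠ 0 := by
        rw [Complex.cpow_def_of_ne_zero (Complex.slitPlane_ne_zero hs)]
        exact Complex.exp_ne_zero _
      have h1 : ContinuousAt (fun q : Circle × ℂ => (a * q.2) ^ N * (q.1 : ℂ)⁻¹) q :=
        ((continuous_const.mul continuous_snd).pow N).continuousAt.mul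
          (continuous_coe_fst.continuousAt.inv₀ (Circle.coe_ne_zero _))
      exact ((continuous_const.mul continuous_snd).continuousAt.mul
        ((h1.cpow continuousAt_const hs).inv₀ h0)).continuousWithinAt
    · have := norm_cableRoot hN hq
      rw [h, norm_zero] at this
      norm_num at this

theorem cableChart_target_bounds (hN : N ≠ 0) (ha : 4 ≤ a) {q : Circle × ℂ}
    (hq : q ∈ (cableChart hN ha).target) : 3 / 4 < a * ‖q.2‖ ∧ a * ‖q.2‖ < 5 / 4 := by
  have hq' : ‖8 * cableFun N a q‖ < 2 := hq
  have h1 : ‖(a * q.2) ^ N - q.1‖ < 1 / 4 := by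
    rw [norm_mul] at hq'
    rw [cableFun] at hq'
    norm_num at hq' ⊢
    linarith
  have hn : ‖(a * q.2 : ℂ)‖ = a * ‖q.2‖ := by
    rw [norm_mul, Complex.norm_real, Real.norm_of_nonneg (by linarith)]
  have h2 := norm_sub_norm_le ((a * q.2) ^ N) (q.1 : ℂ)
  have h3 := norm_sub_norm_le (q.1 : ℂ) ((a * q.2) ^ N)
  rw [norm_sub_rev (q.1 : ℂ)] at h3
  rw [Circle.norm_coe, norm_pow, hn] at h2 h3
  have h0 : 0 ≤ a * ‖q.2‖ := mul_nonneg (by linarith) (norm_nonneg _)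
  constructor
  · by_contra! h
    have := pow_le_of_le_one h0 (by linarith) hN
    linarith
  · by_contra! h
    have := le_self_pow₀ (by linarith : 1 ≤ a * ‖q.2‖) hN
    linarith

theorem isTubeFamily_cableChart (hN : N ≠ 0) (ha : 4 ≤ a) :
    IsTubeFamily (Prod.snd : Circle × ℂ → ℂ) (fun _ : Unit => cableChart hN ha) := by
  refine ⟨fun _ => rfl, fun i j h => absurd (Subsingleton.elim i j) h, fun _ q hq => ?_⟩
  have h := (cableChart_target_bounds hN ha hq).2
  change ‖q.2‖ < 1 / 2
  nlinarith [norm_nonneg q.2]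

variable {G : Type*} [Group G]

/-- The holonomy of a torus knot is an `N`-th root of the holonomy of the core. -/
theorem posStep_cableChart (hN : N ≠ 0) (ha : 4 ≤ a) (S : Set G) :
    PosStep (Prod.snd : Circle × ℂ → ℂ) (fun _ : Unit => cableChart hN ha)
      {g | ∃ x ∈ S, g = x ^ N} S := by
  refine PosStep.of_cohomOn continuous_snd (isTubeFamily_cableChart hN ha) ?_
  rintro _ ⟨x, hx, rfl⟩
  refine ⟨fun _ => x, fun _ => hx, fun p q => jump x (cableFun N a p) (cableFun N a q), ?_, ?_, ?_⟩
  · refine cocycleOn_jump (continuous_cableFun N a) x fun p hp h => hp (mem_iUnion.2 ⟨(), ?_⟩)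
    have hp' : p ∈ (cableChart hN ha).target := by
      change ‖8 * cableFun N a p‖ < 2
      rw [h]
      norm_num
    refine ⟨(cableChart hN ha).symm p, ?_, (cableChart hN ha).right_inv hp'⟩
    change ‖8 * cableFun N a p‖ ≤ 1 / 2
    rw [h]
    norm_num
  · have hU : IsOpen {p : Circle × ℂ | 1 / 2 < ‖p.2‖} :=
      isOpen_lt continuous_const continuous_snd.norm
    have ha0 : (a : ℂ) ≠ 0 := by exact_mod_cast (by linarith : a ≠ 0)
    have h1 := ((hasHolonomy_jump x).cocycleOn).cohomOn_of_homotopy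
      (Y₀ := {p : Circle × ℂ | 1 / 2 < ‖p.2‖}) (fun p t => (a * p.2) ^ N - t * p.1)
      (fun p _ t _ => by
        refine Continuous.continuousAt ?_
        have h2 : Continuous fun q : (Circle × ℂ) × ℝ => (q.1.1 : ℂ) :=
          continuous_coe_fst.comp continuous_fst
        fun_prop) (fun p hp t ht => by
        have hp' : 1 / 2 < ‖p.2‖ := hp
        change (a * p.2) ^ N - t * p.1 ≠ 0
        intro h
        have h2 := congrArg norm (sub_eq_zero.1 h)
        rw [norm_pow, norm_mul, norm_mul, Circle.norm_coe, Complex.norm_real, Complex.norm_real,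
          Real.norm_of_nonneg (by linarith), Real.norm_of_nonneg ht.1] at h2
        have h3 : 1 < a * ‖p.2‖ := by nlinarith
        have := one_lt_pow₀ h3 hN
        linarith [ht.2]) hU
    have h2 := (((hasHolonomy_jump x).comp_pow N).cohomOn (hasHolonomy_jump (x ^ N))).comp
      (T := {p : Circle × ℂ | 1 / 2 < ‖p.2‖}) (f := fun p => a * p.2)
      (fun p _ => (continuous_const.mul continuous_snd).continuousAt) (fun p hp => by
        have hp' : 1 / 2 < ‖p.2‖ := hp
        refine mul_ne_zero ha0 fun h => ?_
        rw [h, norm_zero] at hp'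
        linarith)
    have h2' : CohomOn (fun p q : Circle × ℂ => jump x ((a * p.2) ^ N - (0 : ℝ) * p.1)
        ((a * q.2) ^ N - (0 : ℝ) * q.1)) (fun p q => jump (x ^ N) p.2 q.2)
        {p : Circle × ℂ | 1 / 2 < ‖p.2‖} := by
      simpa only [Complex.ofReal_zero, zero_mul, sub_zero,
        jump_real_smul _ (by linarith : 0 < a)] using h2
    have h3 := h1.symm.trans h2'
    simp only [Complex.ofReal_one, one_mul] at h3
    exact h3
  · intro i p _
    refine ⟨univ, Filter.univ_mem, fun p _ q _ => ?_⟩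
    change jump x (cableFun N a (cableMap N a p)) (cableFun N a (cableMap N a q)) =
      jump x p.2 q.2
    rw [cableFun_cableMap hN ha, cableFun_cableMap hN ha]
    have := jump_real_smul x (by norm_num : (0 : ℝ) < 1 / 8) p.2 q.2
    push_cast at this
    rw [← this]
    congr 1 <;> ring

end Cable


section SlotLift

/-- The product of a torus with the plane. -/
abbrev SolidTorus (d : ℕ) := (Fin d → Circle) × ℂ

variable {d : ℕ}

/-- The `j`-th angle and the plane coordinate. -/
def slot (j : Fin d) (p : SolidTorus d) : Circle × ℂ := (p.1 j, p.2)

/-- Replace the `j`-th angle and the plane coordinate. -/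
def setSlot (j : Fin d) (p : SolidTorus d) (q : Circle × ℂ) : SolidTorus d :=
  (Function.update p.1 j q.1, q.2)

theorem slot_setSlot (j : Fin d) (p : SolidTorus d) (q : Circle × ℂ) :
    slot j (setSlot j p q) = q := by
  simp [slot, setSlot]

theorem setSlot_slot (j : Fin d) (p : SolidTorus d) : setSlot j p (slot j p) = p := by
  simp [slot, setSlot]

theorem setSlot_setSlot (j : Fin d) (p : SolidTorus d) (q q' : Circle × ℂ) :
    setSlot j (setSlot j p q) q' = setSlot j p q' := by
  simp [setSlot]

theorem continuous_slot (j : Fin d) : Continuous (slot j) :=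
  ((continuous_apply j).comp continuous_fst).prodMk continuous_snd

theorem continuous_setSlot (j : Fin d) :
    Continuous fun x : SolidTorus d × (Circle × ℂ) => setSlot j x.1 x.2 :=
  ((continuous_fst.comp continuous_fst).update j (continuous_fst.comp continuous_snd)).prodMk
    (continuous_snd.comp continuous_snd)

/-- The partial homeomorphism `ψ`, applied in the `j`-th slot. -/
noncomputable def slotLift (j : Fin d) (ψ : OpenPartialHomeomorph (Circle × ℂ) (Circle × ℂ)) :
    OpenPartialHomeomorph (SolidTorus d) (SolidTorus d) where
  toFun p := setSlot j p (ψ (slot j p))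
  invFun p := setSlot j p (ψ.symm (slot j p))
  source := slot j ⁻¹' ψ.source
  target := slot j ⁻¹' ψ.target
  map_source' p hp := by
    rw [mem_preimage, slot_setSlot]
    exact ψ.map_source hp
  map_target' p hp := by
    rw [mem_preimage, slot_setSlot]
    exact ψ.map_target hp
  left_inv' p hp := by
    rw [slot_setSlot, setSlot_setSlot, ψ.left_inv hp, setSlot_slot]
  right_inv' p hp := by
    rw [slot_setSlot, setSlot_setSlot, ψ.right_inv hp, setSlot_slot]
  open_source := ψ.open_source.preimage (continuous_slot j)
  open_target := ψ.open_target.preimage (continuous_slot j)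
  continuousOn_toFun := (continuous_setSlot j).comp_continuousOn (continuousOn_id.prodMk
    (ψ.continuousOn.comp (continuous_slot j).continuousOn fun _ h => h))
  continuousOn_invFun := (continuous_setSlot j).comp_continuousOn (continuousOn_id.prodMk
    (ψ.continuousOn_symm.comp (continuous_slot j).continuousOn fun _ h => h))

variable {j : Fin d}

theorem slotLift_apply (ψ : OpenPartialHomeomorph (Circle × ℂ) (Circle × ℂ)) (p : SolidTorus d) :
    slotLift j ψ p = setSlot j p (ψ (slot j p)) := rfl

theorem slot_slotLift (ψ : OpenPartialHomeomorph (Circle × ℂ) (Circle × ℂ)) (p : SolidTorus d) :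
    slot j (slotLift j ψ p) = ψ (slot j p) := slot_setSlot j p _

theorem slotLift_image_preimage (ψ : OpenPartialHomeomorph (Circle × ℂ) (Circle × ℂ))
    (A : Set (Circle × ℂ)) : slotLift j ψ '' (slot j ⁻¹' A) = slot j ⁻¹' (ψ '' A) := by
  ext p
  constructor
  · rintro ⟨q, hq, rfl⟩
    exact ⟨slot j q, hq, (slot_slotLift ψ q).symm⟩
  · rintro ⟨q, hq, hqp⟩
    refine ⟨setSlot j p q, by rwa [mem_preimage, slot_setSlot], ?_⟩
    rw [slotLift_apply, slot_setSlot, setSlot_setSlot, hqp, setSlot_slot]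

variable {ι : Type*} {ψ : ι → OpenPartialHomeomorph (Circle × ℂ) (Circle × ℂ)}

theorem IsTubeFamily.slotLift (hψ : IsTubeFamily (Prod.snd : Circle × ℂ → ℂ) ψ) :
    IsTubeFamily (Prod.snd : SolidTorus d → ℂ) (fun i => slotLift j (ψ i)) := by
  refine ⟨fun i => ?_, fun i k h => ?_, fun i p hp => hψ.target i (a := slot j p) hp⟩
  · change slot j ⁻¹' (ψ i).source = _
    rw [hψ.source]
    rfl
  · exact (hψ.disjoint i k h).preimage _

variable {G : Type*} [Group G]

theorem PosStep.slotLift {S S' : Set G} (h : PosStep (Prod.snd : Circle × ℂ → ℂ) ψ S S') :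
    PosStep (Prod.snd : SolidTorus d → ℂ) (fun i => slotLift j (ψ i)) S S' := by
  intro g hg
  obtain ⟨lab, hlab, τ, h1, h2, h3⟩ := h g hg
  have hcont : ∀ p : SolidTorus d, ContinuousAt (slot j) p :=
    fun _ => (continuous_slot j).continuousAt
  refine ⟨lab, hlab, fun p q => τ (slot j p) (slot j q), h1.comp (fun p _ => hcont p) ?_,
    h2.comp (fun p _ => hcont p) (fun p hp => hp), fun i => ?_⟩
  · intro p hp hp'
    refine hp ?_
    obtain ⟨i, hi⟩ := mem_iUnion.1 hp'
    refine mem_iUnion.2 ⟨i, ?_⟩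
    have := slotLift_image_preimage (j := j) (ψ i) {q | ‖q.2‖ ≤ 1 / 2}
    exact this.ge hi
  · simp only [slot_slotLift]
    exact (h3 i).comp (T := {p : SolidTorus d | 1 / 2 < ‖p.2‖ ∧ ‖p.2‖ < 2})
      (fun p _ => hcont p) (fun p hp => hp)

end SlotLift


section Meridian

variable {Y Z G : Type*} [TopologicalSpace Y] [TopologicalSpace Z] [Group G]

/-- The function `σ` exhibits `τ` as a coboundary near each point of `S`. -/
def Trivializes (σ : Y → G) (τ : Y → Y → G) (S : Set Y) : Prop :=
  ∀ x ∈ S, ∃ O ∈ 𝓝 x, ∀ a ∈ O, ∀ b ∈ O, τ a b = (σ a)⁻¹ * σ b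

theorem Trivializes.comp {σ : Z → G} {τ : Z → Z → G} {S : Set Z} (h : Trivializes σ τ S)
    {T : Set Y} {f : Y → Z} (hf : Continuous f) (hT : MapsTo f T S) :
    Trivializes (fun y => σ (f y)) (fun a b => τ (f a) (f b)) T := by
  intro x hx
  obtain ⟨O, hO, h⟩ := h (f x) (hT hx)
  exact ⟨f ⁻¹' O, hf.continuousAt hO, fun a ha b hb => h _ ha _ hb⟩

theorem Trivializes.exists_eq_mul {σ σ' : Y → G} {τ : Y → Y → G} {S : Set Y}
    (h : Trivializes σ τ S) (h' : Trivializes σ' τ S) (hS : IsPreconnected S) :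
    ∃ g, ∀ x ∈ S, σ' x = g * σ x := by
  rcases S.eq_empty_or_nonempty with rfl | ⟨x₀, hx₀⟩
  · exact ⟨1, fun x hx => hx.elim⟩
  · refine ⟨σ' x₀ * (σ x₀)⁻¹, fun x hx => ?_⟩
    rw [hS.trivialization_unique h h' hx₀ hx, inv_mul_cancel_right]

theorem Trivializes.exists_shift {σ : Y → G} {τ : Y → Y → G} {S : Set Y}
    (h : Trivializes σ τ S) (hS : IsPreconnected S) {T : Y → Y} (hT : Continuous T)
    (hTS : MapsTo T S S) (hτ : ∀ a b, τ (T a) (T b) = τ a b) :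
    ∃ g, ∀ x ∈ S, σ (T x) = g * σ x := by
  refine h.exists_eq_mul (σ' := fun x => σ (T x)) ?_ hS
  have := h.comp hT hTS
  simpa only [hτ] using this

theorem apply_add_nsmul {σ : ℝ → G} {g : G} {r : ℝ} (h : ∀ x, σ (x + r) = g * σ x) (n : ℕ) (x : ℝ) :
    σ (x + n * r) = g ^ n * σ x := by
  induction n with
  | zero => simp
  | succ n ih =>
    rw [pow_succ', mul_assoc, ← ih, ← h]
    congr 1
    push_cast
    ring

variable {d : ℕ} {j : Fin d} {N : ℕ} {a : ℝ}

/-- The complement of the tube of a torus knot in the solid torus of radius `2`. -/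
def cableCompl (j : Fin d) (N : ℕ) (a : ℝ) : Set (SolidTorus d) :=
  {p | ‖p.2‖ < 2 ∧ 1 / 2 < ‖8 * cableFun N a (slot j p)‖}

theorem circle_exp_periodic (x : ℝ) : Circle.exp (x + 2 * Real.pi) = Circle.exp x := by
  rw [Circle.exp_add, Circle.exp_two_pi, mul_one]

theorem mem_cableCompl_of_norm (hN : N ≠ 0) (ha : 4 ≤ a) {p : SolidTorus d} (h1 : 1 / 2 < ‖p.2‖)
    (h2 : ‖p.2‖ < 2) : p ∈ cableCompl j N a := by
  refine ⟨h2, ?_⟩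
  have h3 : ‖(a * p.2 : ℂ)‖ = a * ‖p.2‖ := by
    rw [norm_mul, Complex.norm_real, Real.norm_of_nonneg (by linarith)]
  have h4 : 2 ≤ ‖(a * p.2 : ℂ)‖ := by rw [h3]; nlinarith
  have h5 := norm_sub_norm_le ((a * p.2 : ℂ) ^ N) (p.1 j : ℂ)
  rw [norm_pow, Circle.norm_coe] at h5
  have h6 := le_self_pow₀ (by linarith : 1 ≤ ‖(a * p.2 : ℂ)‖) hN
  rw [norm_mul]
  change 1 / 2 < ‖(8 : ℂ)‖ * ‖(a * p.2 : ℂ) ^ N - p.1 j‖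
  norm_num
  linarith

/-- Around the tube of a torus knot with `N` turns, the meridian of the solid torus acts trivially
in every group with exponent dividing `N`. -/
theorem meridian_trivial (hN : N ≠ 0) (hN2 : Even N) (ha : 4 ≤ a) (hexp : ∀ g : G, g ^ N = 1)
    {τ : SolidTorus d → SolidTorus d → G} (hτ : CocycleOn τ (cableCompl j N a))
    (p : SolidTorus d) {σ : ℝ → G} (hσ : Trivializes σ
      (fun b c : ℝ => τ (p.1, Circle.exp b) (p.1, Circle.exp c)) univ) (c : ℝ) :
    σ (c + 2 * Real.pi) = σ c := by
  set θ := p.1 j with hθ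
  have hcirc : Continuous fun u : Circle => (u : ℂ) := continuous_subtype_val
  let f : ℝ × ℝ → SolidTorus d := fun x => setSlot j p (Circle.exp x.1 * θ, Circle.exp x.2)
  have hf : Continuous f := (continuous_setSlot j).comp (continuous_const.prodMk
    (((Circle.exp.continuous.comp continuous_fst).mul continuous_const).prodMk
      (hcirc.comp (Circle.exp.continuous.comp continuous_snd))))
  have hfD : ∀ x, f x ∈ cableCompl j N a := fun x =>
    mem_cableCompl_of_norm hN ha (by simp [f, setSlot]; norm_num) (by simp [f, setSlot])
  obtain ⟨σT, hσT⟩ : TrivOn (fun x y => τ (f x) (f y)) univ :=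
    (hτ.comp (fun x _ => hf.continuousAt) (fun x _ => hfD x)).trivOn_of_convex isOpen_univ
      convex_univ
  change Trivializes σT _ univ at hσT
  set β : ℝ := Complex.arg (-(θ : ℂ)) / N with hβ
  have hNβ : Circle.exp (N * β) = -(θ : ℂ) := by
    rw [hβ, mul_div_cancel₀ _ (by exact_mod_cast hN), coe_exp_arg (by simp), norm_neg,
      Circle.norm_coe, Complex.ofReal_one, div_one]
  let h : ℝ × ℝ → SolidTorus d := fun x =>
    setSlot j p (Circle.exp (N * x.2) * θ, x.1 * Circle.exp (β + x.2))
  have hh : Continuous h := by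
    refine (continuous_setSlot j).comp (continuous_const.prodMk (.prodMk ?_ ?_))
    · exact (Circle.exp.continuous.comp (continuous_const.mul continuous_snd)).mul continuous_const
    · exact (Complex.continuous_ofReal.comp continuous_fst).mul (hcirc.comp
        (Circle.exp.continuous.comp (continuous_const.add continuous_snd)))
  have hpow : ∀ x : ℝ, ((Circle.exp (β + x) : Circle) : ℂ) ^ N =
      -(θ : ℂ) * Circle.exp (N * x) := by
    intro x
    rw [← Circle.coe_pow, ← hNβ, ← Circle.coe_mul, ← Circle.exp_add, ← mul_add,
      ← nsmul_eq_mul, Circle.exp_nsmul]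
  let Ω : Set (ℝ × ℝ) := {x | ‖x.1‖ < 2}
  have hΩo : IsOpen Ω := isOpen_lt continuous_fst.norm continuous_const
  have hΩc : Convex ℝ Ω := by
    have : Ω = (fun x : ℝ × ℝ => x.1) ⁻¹' ball 0 2 := by
      ext x
      simp [Ω]
    rw [this]
    exact (convex_ball (0 : ℝ) 2).is_linear_preimage ⟨fun _ _ => rfl, fun _ _ => rfl⟩
  have hhD : ∀ x ∈ Ω, h x ∈ cableCompl j N a := by
    intro x hx
    refine ⟨?_, ?_⟩
    · have hx' : ‖x.1‖ < 2 := hx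
      simpa [h, setSlot] using hx'
    · have e : cableFun N a (slot j (h x)) =
          -(θ * Circle.exp (N * x.2) * ((1 + (a * x.1) ^ N : ℝ) : ℂ)) := by
        rw [slot_setSlot, cableFun, ← mul_assoc, mul_pow, hpow]
        push_cast
        ring
      have h0 : 0 ≤ (a * x.1) ^ N := hN2.pow_nonneg _
      rw [e, norm_mul, norm_neg, norm_mul, norm_mul, Circle.norm_coe, Circle.norm_coe,
        Complex.norm_real, Real.norm_of_nonneg (by linarith)]
      norm_num
      linarith
  obtain ⟨σO, hσO⟩ : TrivOn (fun x y => τ (h x) (h y)) Ω :=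
    (hτ.comp (fun x _ => hh.continuousAt) hhD).trivOn_of_convex hΩo hΩc
  change Trivializes σO _ Ω at hσO
  have hper1 : ∀ x : ℝ, Circle.exp (N * (x + 2 * Real.pi)) = Circle.exp (N * x) := by
    intro x
    rw [mul_add, Circle.exp_add, ← nsmul_eq_mul N (2 * Real.pi), Circle.exp_nsmul,
      Circle.exp_two_pi, one_pow, mul_one]
  obtain ⟨g, hg⟩ := hσO.exists_shift hΩc.isPreconnected (T := fun x => (x.1, x.2 + 2 * Real.pi))
    (by fun_prop) (fun x hx => hx) (fun x y => by
      simp only [h, hper1, ← add_assoc, circle_exp_periodic])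
  have hline : ∀ t : ℝ, Continuous fun x : ℝ => (t, x) := fun t => by fun_prop
  have hg1 : g = 1 := by
    obtain ⟨g₀, hg₀⟩ := (hσO.comp (hline 0) (T := univ) (fun x _ => by simp [Ω])).exists_shift
      isPreconnected_univ (T := fun x => x + 2 * Real.pi / N) (by fun_prop) (fun _ _ => mem_univ _)
      (fun x y => by
        have hper : ∀ x : ℝ, Circle.exp (N * (x + 2 * Real.pi / N)) = Circle.exp (N * x) := by
          intro x
          rw [mul_add, mul_div_cancel₀ _ (by exact_mod_cast hN), circle_exp_periodic]
        simp only [h, hper, Complex.ofReal_zero, zero_mul])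
    have h1 := apply_add_nsmul (σ := fun x => σO (0, x)) (fun x => hg₀ x (mem_univ x)) N 0
    have h2 := hg (0, 0) (by simp [Ω])
    rw [hexp, mul_div_cancel₀ _ (by exact_mod_cast hN), one_mul] at h1
    simp only at h1 h2
    rw [h1] at h2
    exact (mul_eq_right.1 h2.symm)
  obtain ⟨g₁, hg₁⟩ := hσT.exists_shift isPreconnected_univ (T := fun x => (x.1 + 2 * Real.pi, x.2))
    (by fun_prop) (fun _ _ => mem_univ _) (fun x y => by simp only [f, circle_exp_periodic])
  obtain ⟨g₂, hg₂⟩ := hσT.exists_shift isPreconnected_univ (T := fun x => (x.1, x.2 + 2 * Real.pi))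
    (by fun_prop) (fun _ _ => mem_univ _) (fun x y => by simp only [f, circle_exp_periodic])
  have hdiag := hσT.comp (f := fun x : ℝ => (N * x, β + x)) (T := univ) (by fun_prop)
    (fun _ _ => mem_univ _)
  have hdiag' := hσO.comp (hline 1) (T := univ) (fun x _ => by simp [Ω])
  simp only [h, Complex.ofReal_one, one_mul] at hdiag'
  obtain ⟨k, hk⟩ := hdiag'.exists_eq_mul hdiag isPreconnected_univ
  have hk1 := hk (0 + 2 * Real.pi) (mem_univ _)
  have hk2 := hk 0 (mem_univ _)
  have hg3 := hg (1, 0) (by simp [Ω])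
  simp only [hg1, one_mul] at hg3 hk1 hk2
  rw [hg3, ← hk2] at hk1
  have h4 := apply_add_nsmul (σ := fun x => σT (x, β + (0 + 2 * Real.pi)))
    (fun x => hg₁ (x, β + (0 + 2 * Real.pi)) (mem_univ _)) N 0
  have h5 := hg₂ (0, β) (mem_univ _)
  simp only [hexp, one_mul, zero_add, mul_zero, add_zero] at h4 h5 hk1
  rw [h4, h5] at hk1
  have hg21 : g₂ = 1 := mul_eq_right.1 hk1
  have hfin := hσT.comp (hline 0) (T := univ) (fun _ _ => mem_univ _)
  have e : ∀ x : ℝ, f (0, x) = (p.1, (Circle.exp x : ℂ)) := by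
    intro x
    simp [f, setSlot, hθ]
  simp only [e] at hfin
  obtain ⟨k', hk'⟩ := hfin.exists_eq_mul hσ isPreconnected_univ
  rw [hk' _ (mem_univ _), hk' _ (mem_univ _), hg₂ (0, c) (mem_univ _), hg21, one_mul]

end Meridian

section Extension

variable {G : Type*} [Group G] {d : ℕ} {j : Fin d} {N : ℕ} {a : ℝ}

/-- In a group with exponent dividing `N`, cocycles defined outside of the tube of a torus knot
with `N` turns extend over the solid torus. -/
theorem exists_extension (hN : N ≠ 0) (hN2 : Even N) (ha : 4 ≤ a) (hexp : ∀ g : G, g ^ N = 1)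
    {τ : SolidTorus d → SolidTorus d → G} (hτ : CocycleOn τ (cableCompl j N a)) :
    ∃ τ' : SolidTorus d → SolidTorus d → G, CocycleOn τ' univ ∧
      LocEqOn τ' τ {p | 1 / 2 < ‖p.2‖ ∧ ‖p.2‖ < 2} := by
  let Y₀ : Set (SolidTorus d) := {y | |y.2.re| < Real.log 2}
  have hlog : 0 < Real.log 2 := Real.log_pos (by norm_num)
  have hY₀ : IsOpen Y₀ :=
    isOpen_lt (Complex.continuous_re.comp continuous_snd).abs continuous_const
  have hnorm : ∀ z : ℂ, |z.re| < Real.log 2 → 1 / 2 < ‖Complex.exp z‖ ∧ ‖Complex.exp z‖ < 2 := by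
    intro z hz
    rw [Complex.norm_exp]
    have h2 := abs_lt.1 hz
    constructor
    · have := Real.exp_lt_exp.2 h2.1
      rwa [Real.exp_neg, Real.exp_log (by norm_num), ← one_div] at this
    · have := Real.exp_lt_exp.2 h2.2
      rwa [Real.exp_log (by norm_num)] at this
  have hmem : ∀ y ∈ Y₀, ∀ t ∈ Icc (0 : ℝ) 1,
      ((y.1, Complex.exp (t * y.2)) : SolidTorus d) ∈ cableCompl j N a := by
    intro y hy t ht
    have hy' : |y.2.re| < Real.log 2 := hy
    have := hnorm (t * y.2) (by
      rw [Complex.re_ofReal_mul, abs_mul, abs_of_nonneg ht.1]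
      nlinarith [ht.1, ht.2, abs_nonneg y.2.re])
    exact mem_cableCompl_of_norm hN ha this.1 this.2
  obtain ⟨s, hs⟩ := hτ.cohomOn_of_homotopy (Y₀ := Y₀)
    (fun y t => (y.1, Complex.exp (t * y.2))) (fun y _ t _ => by
      refine Continuous.continuousAt ?_
      fun_prop) hmem hY₀
  simp only [Complex.ofReal_zero, zero_mul, Complex.exp_zero, Complex.ofReal_one, one_mul] at hs
  have hone : ∀ θ : Fin d → Circle, τ (θ, 1) (θ, 1) = 1 := fun θ =>
    hτ.refl (mem_cableCompl_of_norm hN ha (by norm_num) (by norm_num))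
  let strip : Set ℂ := {z | |z.re| < Real.log 2}
  have hstrip : IsPreconnected strip := by
    have : strip = Complex.reLm ⁻¹' ball 0 (Real.log 2) := by
      ext z
      simp [strip]
    rw [this]
    exact ((convex_ball (0 : ℝ) (Real.log 2)).linear_preimage _).isPreconnected
  have hfib : ∀ θ : Fin d → Circle, Trivializes (fun z => s (θ, z))
      (fun z z' => τ (θ, Complex.exp z) (θ, Complex.exp z')) strip := by
    intro θ z hz
    obtain ⟨O, hO, h⟩ := hs (θ, z) hz
    refine ⟨(fun z => (θ, z)) ⁻¹' O, (Continuous.prodMk_right θ).continuousAt hO,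
      fun z₁ h₁ z₂ h₂ => ?_⟩
    have := h _ h₁ _ h₂
    rw [hone, mul_one] at this
    exact this
  have hper : ∀ θ : Fin d → Circle, ∀ z ∈ strip,
      s (θ, z + 2 * Real.pi * Complex.I) = s (θ, z) := by
    intro θ
    obtain ⟨g, hg⟩ := (hfib θ).exists_shift hstrip (T := fun z => z + 2 * Real.pi * Complex.I)
      (by fun_prop) (fun z hz => by simpa [strip] using hz)
      (fun z z' => by simp only [Complex.exp_periodic _])
    have h1 := (hfib θ).comp (f := fun c : ℝ => (c : ℂ) * Complex.I) (T := univ) (by fun_prop)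
      (fun c _ => by simpa [strip] using hlog)
    have h2 := meridian_trivial hN hN2 ha hexp hτ (θ, 0) (σ := fun c : ℝ => s (θ, c * Complex.I))
      (by simpa only [Circle.coe_exp] using h1) 0
    have h3 := hg 0 (by simpa [strip] using hlog)
    simp only [zero_add, Complex.ofReal_zero, zero_mul, Complex.ofReal_mul,
      Complex.ofReal_ofNat] at h2
    simp only [zero_add] at h3
    rw [h2] at h3
    intro z hz
    rw [hg z hz, mul_eq_right.1 h3.symm, one_mul]
  have hper' : ∀ θ : Fin d → Circle, ∀ z ∈ strip, ∀ n : ℤ,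
      s (θ, z + n * (2 * Real.pi * Complex.I)) = s (θ, z) := by
    intro θ z hz n
    have hz' : ∀ n : ℤ, z + n * (2 * Real.pi * Complex.I) ∈ strip := by
      intro n
      have : (z + n * (2 * Real.pi * Complex.I)).re = z.re := by simp
      change |(z + n * (2 * Real.pi * Complex.I)).re| < _
      rw [this]
      exact hz
    have hstep : ∀ n : ℤ, s (θ, z + (n + 1 : ℤ) * (2 * Real.pi * Complex.I)) =
        s (θ, z + n * (2 * Real.pi * Complex.I)) := by
      intro n
      rw [← hper θ _ (hz' n)]
      congr 2
      push_cast
      ring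
    induction n using Int.induction_on with
    | zero => simp
    | succ n ih => rw [hstep, ih]
    | pred n ih =>
      have h1 := hstep (-(n : ℤ) - 1)
      rw [sub_add_cancel] at h1
      exact h1.symm.trans ih
  let s' : SolidTorus d → G := fun p => s (p.1, Complex.log p.2)
  have hs' : ∀ y ∈ Y₀, s' (y.1, Complex.exp y.2) = s y := by
    intro y hy
    obtain ⟨n, hn⟩ := Complex.exp_eq_exp_iff_exists_int.1 (Complex.exp_log (Complex.exp_ne_zero y.2))
    change s (y.1, Complex.log (Complex.exp y.2)) = s (y.1, y.2)
    rw [hn]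
    exact hper' y.1 y.2 hy n
  have hopen : IsOpenMap fun y : SolidTorus d => ((y.1, Complex.exp y.2) : SolidTorus d) :=
    IsOpenMap.id.prodMap Complex.isOpenMap_exp
  refine ⟨fun p q => (s' p)⁻¹ * τ (p.1, 1) (q.1, 1) * s' q, ?_, ?_⟩
  · refine CohomOn.cocycleOn (τ := fun p q => τ (p.1, 1) (q.1, 1))
      ⟨s', fun _ _ => ⟨univ, Filter.univ_mem, fun _ _ _ _ => rfl⟩⟩ ?_
    refine hτ.comp (f := fun p : SolidTorus d => (p.1, 1)) (fun p _ => by fun_prop) fun p _ => ?_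
    exact mem_cableCompl_of_norm hN ha (by norm_num) (by norm_num)
  · intro p hp
    have hp0 : p.2 ≠ 0 := by
      intro h
      have := hp.1
      rw [h, norm_zero] at this
      linarith
    have hy : ((p.1, Complex.log p.2) : SolidTorus d) ∈ Y₀ := by
      change |(Complex.log p.2).re| < _
      rw [Complex.log_re, abs_lt]
      have h0 := norm_pos_iff.2 hp0
      constructor
      · rw [← Real.log_inv]
        exact Real.log_lt_log (by norm_num) (by linarith [hp.1])
      · exact Real.log_lt_log h0 hp.2
    obtain ⟨O, hO, h⟩ := hs _ hy
    refine ⟨(fun y : SolidTorus d => (y.1, Complex.exp y.2)) '' (O ∩ Y₀), ?_, ?_⟩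
    · have := hopen.image_mem_nhds (Filter.inter_mem hO (hY₀.mem_nhds hy))
      simpa only [Complex.exp_log hp0] using this
    · rintro _ ⟨y, ⟨hyO, hy⟩, rfl⟩ _ ⟨z, ⟨hzO, hz⟩, rfl⟩
      simp only
      rw [h y hyO z hzO, hs' y hy, hs' z hz]

end Extension


section Limit

variable {M G : Type*} [TopologicalSpace M] [Group G]

/-- A cocycle which is trivial outside of each set of a decreasing sequence of compact sets is
trivial outside of their intersection. -/
theorem TrivOn.of_antitone [LocallyPathConnectedSpace M] [LocallyCompactSpace M] [T2Space M]
    {τ : M → M → G} {V : Set M} (hV : IsOpen V) {T : ℕ → Set M} (hT : ∀ n, IsCompact (T n))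
    (hanti : Antitone T) (hconn : IsPreconnected (V \ ⋂ n, T n))
    (h : ∀ n, TrivOn τ (V \ T n)) : TrivOn τ (V \ ⋂ n, T n) := by
  classical
  rcases (V \ ⋂ n, T n).eq_empty_or_nonempty with h0 | ⟨y₀, hy₀⟩
  · rw [h0]
    exact ⟨fun _ => 1, fun x hx => hx.elim⟩
  set S := V \ ⋂ n, T n with hS
  have hSo : IsOpen S := hV.sdiff (isClosed_iInter fun n => (hT n).isClosed)
  have hpath : IsPathConnected S := (hSo.isConnected_iff_isPathConnected).1 ⟨⟨y₀, hy₀⟩, hconn⟩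
  choose σ hσ using h
  let s : ℕ → M → G := fun n q => (σ n y₀)⁻¹ * σ n q
  have hs : ∀ n, Trivializes (s n) τ (V \ T n) := by
    intro n x hx
    obtain ⟨O, hO, h⟩ := hσ n x hx
    refine ⟨O, hO, fun a ha b hb => ?_⟩
    rw [h a ha b hb]
    simp only [s]
    group
  have key : ∀ p ∈ S, ∃ N, ∃ O ∈ 𝓝 p, ∀ n ≥ N, p ∉ T n ∧ ∀ q ∈ O, s n q = s N q := by
    intro p hp
    obtain ⟨γ, hγ⟩ := hpath.joinedIn y₀ hy₀ p hp
    obtain ⟨P, hP, hpP, hPS⟩ := exists_compact_subset hSo hp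
    obtain ⟨O, ⟨hO, hOc⟩, hOP⟩ := (path_connected_basis p).mem_iff.1
      (isOpen_interior.mem_nhds hpP)
    have hc : IsCompact (range γ ∪ P) := (isCompact_range γ.continuous).union hP
    have hcS : range γ ∪ P ⊆ S := union_subset (range_subset_iff.2 hγ) hPS
    obtain ⟨N, hN⟩ := hc.elim_directed_family_closed T (fun n => (hT n).isClosed)
      (by
        refine eq_empty_of_forall_notMem fun q hq => ?_
        exact (hcS hq.1).2 hq.2) hanti.directed_ge
    have hD : IsPreconnected (range γ ∪ O) :=
      IsPreconnected.union p ⟨1, γ.target⟩ (mem_of_mem_nhds hO)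
        (isPreconnected_range γ.continuous) hOc.isConnected.isPreconnected
    have hDS : ∀ q ∈ range γ ∪ O, ∀ n ≥ N, q ∈ V \ T n := by
      intro q hq n hn
      have hq' : q ∈ range γ ∪ P := union_subset_union_right _ (hOP.trans interior_subset) hq
      refine ⟨(hcS hq').1, fun h => ?_⟩
      have : q ∈ (range γ ∪ P) ∩ T N := ⟨hq', hanti hn h⟩
      rw [hN] at this
      exact this
    refine ⟨N, O, hO, fun n hn => ⟨(hDS p (Or.inr (mem_of_mem_nhds hO)) n hn).2, fun q hq => ?_⟩⟩
    have := hD.trivialization_unique (fun x hx => hs N x (hDS x hx N le_rfl))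
      (fun x hx => hs n x (hDS x hx n hn)) (x := y₀) (y := q) (Or.inl ⟨0, γ.source⟩) (Or.inr hq)
    have h1 : ∀ n, s n y₀ = 1 := fun n => inv_mul_cancel _
    rw [h1, h1, inv_one, mul_one, eq_comm, mul_inv_eq_one] at this
    exact this
  choose! N O hO hN using key
  refine ⟨fun q => s (N q) q, fun p hp => ?_⟩
  obtain ⟨O', hO', h'⟩ := hs (N p) p ⟨hp.1, (hN p hp _ le_rfl).1⟩
  have heq : ∀ a ∈ O p ∩ S, s (N a) a = s (N p) a := by
    intro a ha
    rw [← (hN p hp _ (le_max_left (N p) (N a))).2 a ha.1,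
      ← (hN a ha.2 _ (le_max_right (N p) (N a))).2 a (mem_of_mem_nhds (hO a ha.2))]
  refine ⟨O p ∩ S ∩ O', Filter.inter_mem (Filter.inter_mem (hO p hp) (hSo.mem_nhds hp)) hO',
    fun a ha b hb => ?_⟩
  simp only
  rw [heq a ha.1, heq b hb.1, h' a ha.2 b hb.2]

end Limit

section NegativeTower

variable {M G : Type*} [MetricSpace M] [Group G] {ι ι' : ℕ → Type} {w : M → ℂ}
  {E : ∀ m, ι m → OpenPartialHomeomorph M M} {L : ∀ m, ι' m → OpenPartialHomeomorph M M}
  {C : ℕ → Set M}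

theorem mem_of_towerComp_mem (hE : ∀ m, IsTubeFamily w (E m)) (hL : ∀ m, IsTubeFamily w (L m))
    (hEL : ∀ m k x, ‖w x‖ ≤ 1 / 2 → ∃ i, ∃ y ∈ C m, ‖w y‖ ≤ 1 / 2 ∧ E m k x = L m i y)
    (n m : ℕ) (k : TowerIndex ι ι' n m) {x : M} (hx : ‖w x‖ < 2)
    (h : towerComp E L n m k x ∈ towerCore w E m) : x ∈ C (m + n) := by
  induction n generalizing m with
  | zero =>
    obtain ⟨i, y, hy, e⟩ := mem_iUnion.1 (mem_iInter.1 h 1)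
    have hz : E m i y ∈ towerCore w E m := by rw [e]; exact h
    change ‖w y‖ ≤ 1 at hy
    have hy' := (apply_mem_towerCore_iff hE (by linarith)).1 hz
    obtain ⟨l, z, hzC, hz, ez⟩ := hEL m i y (towerCore_subset_norm hE _ hy')
    have e' : L m l z = L m k.1 x := by rw [← ez, e]; rfl
    exact ((hL m).eq_of_mem (by linarith) hx e').2 ▸ hzC
  | succ n ih =>
    have h1 : ‖w (towerComp E L n (m + 1) k.2 x)‖ < 1 / 2 :=
      (isTubeFamily_towerComp hE hL n (m + 1)).norm_lt hx
    have := ih (m + 1) k.2 ((apply_mem_towerCore_iff hE (i := k.1) (by linarith)).1 h)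
    rwa [show m + 1 + n = m + (n + 1) by ring] at this

theorem towerCore_subset_towerComp (hE : ∀ m, IsTubeFamily w (E m))
    (hEL : ∀ m k x, ‖w x‖ ≤ 1 / 2 → ∃ i, ∃ y ∈ C m, ‖w y‖ ≤ 1 / 2 ∧ E m k x = L m i y) (n m : ℕ) :
    towerCore w E m ⊆ ⋃ k, towerComp E L n m k '' {p | ‖w p‖ ≤ 1 / 2} := by
  induction n generalizing m with
  | zero =>
    intro p hp
    obtain ⟨i, y, hy, rfl⟩ := mem_iUnion.1 (mem_iInter.1 hp 1)
    change ‖w y‖ ≤ 1 at hy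
    have hy' := (apply_mem_towerCore_iff hE (by linarith)).1 hp
    obtain ⟨l, z, -, hz, ez⟩ := hEL m i y (towerCore_subset_norm hE _ hy')
    exact mem_iUnion.2 ⟨(l, ()), z, hz, ez.symm⟩
  | succ n ih =>
    intro p hp
    obtain ⟨i, y, hy, rfl⟩ := mem_iUnion.1 (mem_iInter.1 hp 1)
    change ‖w y‖ ≤ 1 at hy
    obtain ⟨k, z, hz, e⟩ :=
      mem_iUnion.1 (ih (m + 1) ((apply_mem_towerCore_iff hE (by linarith)).1 hp))
    exact mem_iUnion.2 ⟨(i, k), z, hz, congrArg (E m i) e⟩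

theorem towerComp_mem_towerSet (hL : ∀ m, IsTubeFamily w (L m))
    (n m : ℕ) (k : TowerIndex ι ι' n m) {x : M} (hx : ‖w x‖ < 2) :
    towerComp E L n m k x ∈ towerSet E {p | ‖w p‖ ≤ 1} n m := by
  induction n generalizing m with
  | zero =>
    have : ‖w (L m k.1 x)‖ < 1 / 2 := (hL m).norm_lt hx
    change ‖w (L m k.1 x)‖ ≤ 1
    linarith
  | succ n ih => exact mem_iUnion.2 ⟨k.1, _, ih (m + 1) k.2, rfl⟩

/-- If, at infinitely many levels, the cocycles on the complements of the next stage extend over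
the tubes, then the limit set of the tower is not wild. -/
theorem not_wildAt_towerCore [∀ m, Finite (ι m)] [∀ m, Finite (ι' m)] [LocallyCompactSpace M]
    (hw : Continuous w)
    (hc : ∀ r, IsCompact {p | ‖w p‖ ≤ r}) (hE : ∀ m, IsTubeFamily w (E m))
    (hL : ∀ m, IsTubeFamily w (L m))
    (hEL : ∀ m k x, ‖w x‖ ≤ 1 / 2 → ∃ i, ∃ y ∈ C m, ‖w y‖ ≤ 1 / 2 ∧ E m k x = L m i y)
    (hext : ∃ᶠ m in Filter.atTop, ∀ τ : M → M → G, CocycleOn τ ({p | ‖w p‖ < 2} \ C m) →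
      ∃ τ' : M → M → G, CocycleOn τ' univ ∧ LocEqOn τ' τ {p | 1 / 2 < ‖w p‖ ∧ ‖w p‖ < 2})
    (hsmall : ∀ ε > 0, ∃ n₀, ∀ n ≥ n₀, ∀ k, ∀ x y, ‖w x‖ < 2 → ‖w y‖ < 2 →
      dist (towerComp E L n 0 k x) (towerComp E L n 0 k y) < ε)
    {F : Type*} [NormedAddCommGroup F] [NormedSpace ℝ F] {e : M → F} (he : IsOpenEmbedding e)
    (hthin : ThinSet (e '' towerCore w E 0)) (x : M) :
    ¬ WildAt G (towerCore w E 0) x := by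
  classical
  rintro ⟨U, hU, hxU, τ, hτ, hnt⟩
  have hlp : LocallyPathConnectedSpace M := he.locallyPathConnectedSpace
  obtain ⟨ε, hε, hεU⟩ := Metric.isOpen_iff.1 hU x hxU
  have hopen : IsOpen (e '' ball x (ε / 2)) := he.isOpenMap _ isOpen_ball
  obtain ⟨δ, hδ, hδe⟩ := Metric.isOpen_iff.1 hopen (e x) ⟨x, mem_ball_self (by linarith), rfl⟩
  set V : Set M := e ⁻¹' ball (e x) δ with hVdef
  have hVo : IsOpen V := isOpen_ball.preimage he.continuous
  have hVε : V ⊆ ball x (ε / 2) := by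
    intro p hp
    obtain ⟨q, hq, hqp⟩ := hδe hp
    exact he.injective hqp ▸ hq
  have hVim : e '' V = ball (e x) δ := by
    rw [hVdef, image_preimage_eq_inter_range, inter_eq_left]
    exact hδe.trans (image_subset_range _ _)
  have hVU : V ⊆ U := fun p hp => hεU (ball_subset_ball (by linarith) (hVε hp))
  refine hnt V hVo (mem_ball_self hδ) hVU ?_
  have htriv : ∀ c : M → M → G, CocycleOn c V → TrivOn c V := by
    intro c hc
    have : Nonempty M := ⟨x⟩
    let φ := he.toOpenPartialHomeomorph e
    have hφ : ∀ y, φ.symm (e y) = y := fun y => φ.left_inv (mem_univ y)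
    have h1 : CocycleOn (fun a b => c (φ.symm a) (φ.symm b)) (ball (e x) δ) := by
      refine hc.comp (fun y hy => ?_) fun y hy => ?_
      · obtain ⟨z, _, rfl⟩ := hδe hy
        exact φ.symm.continuousAt (φ.map_source (mem_univ z))
      · obtain ⟨z, _, rfl⟩ := hδe hy
        rw [hφ]
        exact hy
    have h2 := (h1.trivOn_of_convex isOpen_ball (convex_ball _ _)).comp (f := e) (T := V)
      (fun y _ => he.continuous.continuousAt) (fun y hy => hy)
    simpa only [hφ] using h2
  have hcore : towerCore w E 0 = ⋂ n, towerSet E {p | ‖w p‖ ≤ 1} n 0 := rfl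
  have hanti := towerSet_antitone hE 0
  rw [hcore]
  refine TrivOn.of_antitone hVo (fun n => isCompact_towerSet hE hc n 0) hanti ?_ ?_
  · rw [← hcore]
    refine (he.isInducing.isPreconnected_image).1 ?_
    rw [image_sdiff he.injective, hVim]
    exact hthin.isPreconnected_diff isOpen_ball (convex_ball _ _).isPreconnected
  obtain ⟨n₀, hn₀⟩ := hsmall (ε / 2) (by linarith)
  intro n₁
  obtain ⟨n, hn1, hext⟩ := Filter.frequently_atTop.1 hext (max n₁ n₀)
  have hn : n₀ ≤ n := (le_max_right _ _).trans hn1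
  refine TrivOn.mono ?_ (sdiff_subset_sdiff_right (hanti ((le_max_left n₁ n₀).trans hn1)))
  have hψ := isTubeFamily_towerComp hE hL n 0
  set ψ := towerComp E L n 0 with hψdef
  have hk : ∀ k, ∃ c : M → M → G, CocycleOn c univ ∧
      LocEqOn c (fun p q => τ (ψ k p) (ψ k q))
        ({p | 1 / 2 < ‖w p‖ ∧ ‖w p‖ < 2} ∩ ψ k ⁻¹' V) := by
    intro k
    by_cases hne : ∃ y, ‖w y‖ < 2 ∧ ψ k y ∈ V
    · obtain ⟨y, hy, hyV⟩ := hne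
      have hcoc : CocycleOn (fun p q => τ (ψ k p) (ψ k q)) ({p | ‖w p‖ < 2} \ C n) := by
        refine hτ.comp (fun p hp => hψ.continuousAt hp.1) fun p hp => ⟨hεU ?_, fun h => hp.2 ?_⟩
        · have h1 := hn₀ n hn k p y hp.1 hy
          have h2 := mem_ball.1 (hVε hyV)
          exact mem_ball.2 (by linarith [dist_triangle (ψ k p) (ψ k y) x])
        · exact (zero_add n) ▸ mem_of_towerComp_mem hE hL hEL n 0 k hp.1 h
      obtain ⟨c, h1, h2⟩ := hext _ hcoc
      exact ⟨c, h1, h2.mono inter_subset_left⟩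
    · refine ⟨fun _ _ => 1, fun _ _ => ⟨univ, Filter.univ_mem, fun _ _ _ _ _ _ => one_mul 1⟩, ?_⟩
      exact fun p hp => absurd ⟨p, hp.1.2, hp.2⟩ hne
  choose c hc1 hc2 using hk
  have htube : ∀ k p, ‖w p‖ < 2 → ψ k p ∈ towerSet E {p | ‖w p‖ ≤ 1} n 0 := fun k p hp =>
    towerComp_mem_towerSet hL n 0 k hp
  have hsub : V \ towerSet E {p | ‖w p‖ ≤ 1} n 0 ⊆ V \ ⋃ k, ψ k '' {p | ‖w p‖ ≤ 1 / 2} := by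
    refine sdiff_subset_sdiff_right (iUnion_subset fun k => ?_)
    rintro _ ⟨p, hp, rfl⟩
    change ‖w p‖ ≤ 1 / 2 at hp
    exact htube k p (by linarith)
  have hKsub : towerCore w E 0 ⊆ ⋃ k, ψ k '' {p | ‖w p‖ ≤ 1 / 2} :=
    towerCore_subset_towerComp hE hEL n 0
  obtain ⟨h1, h2, -⟩ := hψ.glue hw hc (τ := τ) (c := c) (L := fun _ => ∅) (U := V)
    (hτ.mono (sdiff_subset_sdiff hVU hKsub)) (fun k => (hc1 k).mono (subset_univ _))
    hc2
  have h3 := htriv _ (h1.mono (by simp))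
  have h4 := (h2.mono hsub).symm.cohomOn
  exact h4.trivOn (h3.mono sdiff_subset)

end NegativeTower


section TowerCode

variable {M : Type*} [TopologicalSpace M] {ι : ℕ → Type} {w : M → ℂ}
  {A : ∀ m, Bool × ι m → OpenPartialHomeomorph M M}

/-- The subtower of `A` determined by a sequence of bits. -/
def subtower (A : ∀ m, Bool × ι m → OpenPartialHomeomorph M M) (t : ℕ → Bool) (m : ℕ) (i : ι m) :
    OpenPartialHomeomorph M M := A m (t m, i)

theorem isTubeFamily_subtower (hA : ∀ m, IsTubeFamily w (A m)) (t : ℕ → Bool) (m : ℕ) :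
    IsTubeFamily w (subtower A t m) :=
  ⟨fun i => (hA m).source _, fun i k h => (hA m).disjoint _ _ fun e => h (congrArg Prod.snd e),
    fun i => (hA m).target _⟩

open Classical in
/-- Pass to the coordinates of the tube containing the point. -/
noncomputable def towerPeel (A : ∀ m, Bool × ι m → OpenPartialHomeomorph M M) (m : ℕ) (p : M) : M :=
  if h : ∃ k, p ∈ (A m k).target then (A m h.choose).symm p else p

open Classical in
/-- The bit of the tube containing the point. -/
noncomputable def towerBit (A : ∀ m, Bool × ι m → OpenPartialHomeomorph M M) (m : ℕ) (p : M) :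
    Bool := decide (∃ i, p ∈ (A m (true, i)).target)

/-- The bits of the point in a tower, starting from level `m`. -/
noncomputable def towerCode (A : ∀ m, Bool × ι m → OpenPartialHomeomorph M M) :
    ℕ → ℕ → M → Bool
  | 0, m => towerBit A m
  | n + 1, m => fun p => towerCode A n (m + 1) (towerPeel A m p)

theorem towerPeel_eq (hA : ∀ m, IsTubeFamily w (A m)) {m : ℕ} {k : Bool × ι m} {p : M}
    (hp : p ∈ (A m k).target) : towerPeel A m p = (A m k).symm p := by
  have h : ∃ k, p ∈ (A m k).target := ⟨k, hp⟩
  have e : h.choose = k := by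
    by_contra hne
    exact disjoint_left.1 ((hA m).disjoint _ _ hne) h.choose_spec hp
  rw [towerPeel, dif_pos h, e]

open Classical in
theorem towerBit_eq (hA : ∀ m, IsTubeFamily w (A m)) {m : ℕ} {k : Bool × ι m} {p : M}
    (hp : p ∈ (A m k).target) : towerBit A m p = k.1 := by
  obtain ⟨b, i⟩ := k
  cases b
  · refine decide_eq_false fun ⟨j, hj⟩ => ?_
    exact disjoint_left.1 ((hA m).disjoint (true, j) (false, i) (by simp)) hj hp
  · exact decide_eq_true ⟨i, hp⟩

theorem IsTubeFamily.apply_mem_target (hA : ∀ m, IsTubeFamily w (A m)) {m : ℕ} (k : Bool × ι m)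
    {x : M} (hx : ‖w x‖ < 2) : A m k x ∈ (A m k).target :=
  (A m k).map_source ((hA m).mem_source hx)

theorem towerPeel_apply (hA : ∀ m, IsTubeFamily w (A m)) {m : ℕ} (k : Bool × ι m) {x : M}
    (hx : ‖w x‖ < 2) : towerPeel A m (A m k x) = x := by
  rw [towerPeel_eq hA (IsTubeFamily.apply_mem_target hA k hx),
    (A m k).left_inv ((hA m).mem_source hx)]

theorem exists_of_mem_towerCore {κ : ℕ → Type} {E : ∀ m, κ m → OpenPartialHomeomorph M M}
    (hE : ∀ m, IsTubeFamily w (E m)) {m : ℕ} {p : M} (hp : p ∈ towerCore w E m) :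
    ∃ k x, ‖w x‖ < 2 ∧ x ∈ towerCore w E (m + 1) ∧ E m k x = p := by
  obtain ⟨k, x, hx, rfl⟩ := mem_iUnion.1 (mem_iInter.1 hp 1)
  have hx : ‖w x‖ ≤ 1 := hx
  have hx2 : ‖w x‖ < 2 := by linarith
  exact ⟨k, x, hx2, (apply_mem_towerCore_iff hE hx2).1 hp, rfl⟩

theorem eventually_towerCode_eq (hA : ∀ m, IsTubeFamily w (A m)) (n m : ℕ) {p : M}
    (hp : p ∈ towerCore w A m) : ∀ᶠ q in 𝓝 p, towerCode A n m q = towerCode A n m p := by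
  induction n generalizing m p with
  | zero =>
    obtain ⟨k, x, hx, -, rfl⟩ := exists_of_mem_towerCore hA hp
    have hk := IsTubeFamily.apply_mem_target hA k hx
    filter_upwards [(A m k).open_target.mem_nhds hk] with q hq
    simp only [towerCode]
    rw [towerBit_eq hA hq, towerBit_eq hA hk]
  | succ n ih =>
    obtain ⟨k, x, hx, hxc, rfl⟩ := exists_of_mem_towerCore hA hp
    have hk := IsTubeFamily.apply_mem_target hA k hx
    have h1 := ih (m + 1) hxc
    have h2 : Filter.Tendsto (A m k).symm (𝓝 (A m k x)) (𝓝 x) := by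
      have := ((A m k).symm.continuousAt hk).tendsto
      rwa [(A m k).left_inv ((hA m).mem_source hx)] at this
    filter_upwards [(A m k).open_target.mem_nhds hk, h2.eventually h1] with q hq hq'
    simp only [towerCode]
    rw [towerPeel_eq hA hq, towerPeel_apply hA k hx, hq']

theorem mem_subtower_core (hA : ∀ m, IsTubeFamily w (A m)) {t : ℕ → Bool} {p : M} :
    p ∈ towerCore w (subtower A t) 0 ↔ p ∈ towerCore w A 0 ∧ ∀ n, towerCode A n 0 p = t n := by
  constructor
  · intro hp
    refine ⟨?_, fun n => ?_⟩
    · have : ∀ n m, towerSet (subtower A t) {p | ‖w p‖ ≤ 1} n m ⊆ towerSet A {p | ‖w p‖ ≤ 1} n m := by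
        intro n
        induction n with
        | zero => exact fun m => subset_rfl
        | succ n ih =>
          intro m
          refine iUnion_subset fun i => ?_
          exact (image_mono (ih (m + 1))).trans
            (subset_iUnion (fun k => A m k '' towerSet A {p | ‖w p‖ ≤ 1} n (m + 1)) (t m, i))
      exact mem_iInter.2 fun n => this n 0 (mem_iInter.1 hp n)
    · suffices h : ∀ m, ∀ p ∈ towerCore w (subtower A t) m, towerCode A n m p = t (m + n) by
        simpa using h 0 p hp
      clear hp p
      induction n with
      | zero =>
        intro m p hp
        obtain ⟨k, x, hx, -, rfl⟩ := exists_of_mem_towerCore (isTubeFamily_subtower hA t) hp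
        exact towerBit_eq hA (IsTubeFamily.apply_mem_target hA (t m, k) hx)
      | succ n ih =>
        intro m p hp
        obtain ⟨k, x, hx, hxc, rfl⟩ := exists_of_mem_towerCore (isTubeFamily_subtower hA t) hp
        have := ih (m + 1) x hxc
        rw [show m + (n + 1) = m + 1 + n by ring, ← this]
        exact congrArg _ (towerPeel_apply hA (t m, k) hx)
  · rintro ⟨hp, hc⟩
    suffices h : ∀ n m, ∀ p ∈ towerCore w A m, (∀ n, towerCode A n m p = t (m + n)) →
        p ∈ towerSet (subtower A t) {p | ‖w p‖ ≤ 1} n m from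
      mem_iInter.2 fun n => h n 0 p hp (by simpa using hc)
    clear hp hc p
    intro n
    induction n with
    | zero => exact fun m p hp _ => mem_iInter.1 hp 0
    | succ n ih =>
      intro m p hp hc
      obtain ⟨⟨b, i⟩, x, hx, hxc, rfl⟩ := exists_of_mem_towerCore hA hp
      have hb : b = t m :=
        (towerBit_eq hA (IsTubeFamily.apply_mem_target hA (b, i) hx)).symm.trans (hc 0)
      subst hb
      refine mem_iUnion.2 ⟨i, x, ih (m + 1) x hxc fun l => ?_, rfl⟩
      have := hc (l + 1)
      simp only [towerCode] at this
      rw [towerPeel_apply hA _ hx] at this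
      rw [this, show m + (l + 1) = m + 1 + l by ring]

theorem towerCore_nonempty [T2Space M] {κ : ℕ → Type} [∀ m, Finite (κ m)] [∀ m, Nonempty (κ m)]
    {E : ∀ m, κ m → OpenPartialHomeomorph M M} (hE : ∀ m, IsTubeFamily w (E m))
    (hc : ∀ r, IsCompact {p | ‖w p‖ ≤ r}) {x : M} (hx : ‖w x‖ ≤ 1) :
    (towerCore w E 0).Nonempty := by
  refine IsCompact.nonempty_iInter_of_sequence_nonempty_isCompact_isClosed _
    (fun n => towerSet_antitone hE 0 (Nat.le_succ n)) (fun n => ?_) (isCompact_towerSet hE hc 0 0)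
    fun n => (isCompact_towerSet hE hc n 0).isClosed
  have : ∀ n m, (towerSet E {p | ‖w p‖ ≤ 1} n m).Nonempty := by
    intro n
    induction n with
    | zero => exact fun m => ⟨x, hx⟩
    | succ n ih =>
      intro m
      exact (((ih (m + 1)).image (E m (Classical.arbitrary _)))).mono
        (subset_iUnion (fun k => E m k '' towerSet E {p | ‖w p‖ ≤ 1} n (m + 1)) _)
  exact this n 0

end TowerCode

section SmallTower

variable {M : Type*} [MetricSpace M] {ι ι' : ℕ → Type} {w : M → ℂ}
  {E : ∀ m, ι m → OpenPartialHomeomorph M M}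

/-- The maps of the `n`-th level of the tower have small images, uniformly as `n` tends to
infinity. -/
def SmallTower (w : M → ℂ) (E : ∀ m, ι m → OpenPartialHomeomorph M M)
    (L : ∀ m, ι' m → OpenPartialHomeomorph M M) : Prop :=
  ∀ ε > 0, ∃ n₀, ∀ n ≥ n₀, ∀ k, ∀ x y, ‖w x‖ < 2 → ‖w y‖ < 2 →
    dist (towerComp E L n 0 k x) (towerComp E L n 0 k y) < ε

theorem exists_image_subset_of_mem_towerCore (hs : SmallTower w E E) {x : M}
    (hx : x ∈ towerCore w E 0) {V : Set M} (hV : V ∈ 𝓝 x) :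
    ∃ n k, towerComp E E n 0 k '' {p | ‖w p‖ ≤ 1} ⊆ V := by
  obtain ⟨ε, hε, hεV⟩ := Metric.mem_nhds_iff.1 hV
  obtain ⟨n, hn⟩ := hs ε hε
  have h := mem_iInter.1 hx (n + 1)
  rw [towerSet_eq_iUnion] at h
  obtain ⟨k, y, hy, rfl⟩ := mem_iUnion.1 h
  have hy : ‖w y‖ ≤ 1 := hy
  refine ⟨n, k, ?_⟩
  rintro _ ⟨z, hz, rfl⟩
  have hz : ‖w z‖ ≤ 1 := hz
  exact hεV (hn n le_rfl k z y (by linarith) (by linarith))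

theorem isTotallyDisconnected_towerCore (hE : ∀ m, IsTubeFamily w (E m)) (hs : SmallTower w E E) :
    IsTotallyDisconnected (towerCore w E 0) := by
  intro S hS hSc x hx y hy
  refine eq_of_forall_dist_le fun ε hε => ?_
  obtain ⟨n, hn⟩ := hs ε hε
  have hψ := isTubeFamily_towerComp hE hE n 0
  have hcov : ∀ p ∈ S, ∃ k, ∃ z, ‖w z‖ < 2 ∧ towerComp E E n 0 k z = p := by
    intro p hp
    have h := mem_iInter.1 (hS hp) (n + 1)
    rw [towerSet_eq_iUnion] at h
    obtain ⟨k, y, hy, rfl⟩ := mem_iUnion.1 h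
    have hy : ‖w y‖ ≤ 1 := hy
    exact ⟨k, y, by linarith, rfl⟩
  obtain ⟨k, x', hx', rfl⟩ := hcov x hx
  have hmem : ∀ k z, ‖w z‖ < 2 → towerComp E E n 0 k z ∈ (towerComp E E n 0 k).target :=
    fun k z hz => (towerComp E E n 0 k).map_source (hψ.mem_source hz)
  have hsub : S ⊆ (towerComp E E n 0 k).target := by
    refine hSc.subset_left_of_subset_union (v := ⋃ l ∈ {l | l ≠ k}, (towerComp E E n 0 l).target)
      (towerComp E E n 0 k).open_target
      (isOpen_biUnion fun l _ => (towerComp E E n 0 l).open_target) ?_ ?_ ⟨_, hx, hmem k x' hx'⟩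
    · refine disjoint_iUnion₂_right.2 fun l hl => hψ.disjoint _ _ ?_
      exact fun e => hl e.symm
    · intro p hp
      obtain ⟨l, z, hz, rfl⟩ := hcov p hp
      by_cases h : l = k
      · subst h
        exact Or.inl (hmem _ z hz)
      · exact Or.inr (mem_biUnion h (hmem l z hz))
  obtain ⟨l, z, hz, rfl⟩ := hcov y hy
  have hlk : l = k := by
    by_contra h
    exact disjoint_left.1 (hψ.disjoint _ _ h) (hmem l z hz) (hsub hy)
  subst hlk
  exact (hn n le_rfl l x' z hx' hz).le

end SmallTower


section Contraction

theorem dist_coe_circle (u v : Circle) : dist u v = ‖(u : ℂ) - v‖ := by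
  rw [← dist_eq_norm]
  rfl

theorem dist_circleExp_le (x y : ℝ) : dist (Circle.exp x) (Circle.exp y) ≤ |x - y| := by
  rw [dist_coe_circle, Circle.coe_exp, Circle.coe_exp]
  have h : Complex.exp (x * Complex.I) - Complex.exp (y * Complex.I) =
      Complex.exp (y * Complex.I) * (Complex.exp (Complex.I * ((x - y : ℝ) : ℂ)) - 1) := by
    rw [mul_sub, ← Complex.exp_add, mul_one]
    congr 2
    push_cast
    ring
  rw [h, norm_mul, Complex.norm_exp_ofReal_mul_I, one_mul]
  exact Real.norm_exp_I_mul_ofReal_sub_one_le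

theorem dist_ringMap_le {d : ℝ} (hd : 0 < d) {p q : Circle × ℂ} (hq : ‖q.2‖ < 2) :
    dist (ringMap d p) (ringMap d q) ≤ 2 * d * dist p q := by
  have hu : ‖(p.1 : ℂ) - q.1‖ ≤ dist p q := by
    rw [← dist_coe_circle]
    exact le_max_left _ _
  have hw : ‖p.2 - q.2‖ ≤ dist p q := by
    rw [← dist_eq_norm]
    exact le_max_right _ _
  set D := dist p q
  have hur := (Complex.abs_re_le_norm _).trans hu
  have hui := (Complex.abs_im_le_norm _).trans hu
  have hwr := (Complex.abs_re_le_norm _).trans hw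
  have hwi := (Complex.abs_im_le_norm _).trans hw
  rw [Complex.sub_re] at hur hwr
  rw [Complex.sub_im] at hui hwi
  have hpr : |(p.1 : ℂ).re| ≤ 1 := (Complex.abs_re_le_norm _).trans (Circle.norm_coe _).le
  have hpi : |(p.1 : ℂ).im| ≤ 1 := (Complex.abs_im_le_norm _).trans (Circle.norm_coe _).le
  have hq2 := abs_lt.1 ((Complex.abs_re_le_norm q.2).trans_lt hq)
  have hR : |3 * d / 4 + d / 16 * q.2.re| ≤ 7 * d / 8 := by
    rw [abs_le]
    constructor <;> nlinarith
  have hRR : |(3 * d / 4 + d / 16 * p.2.re) - (3 * d / 4 + d / 16 * q.2.re)| ≤ d / 16 * D := by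
    rw [show (3 * d / 4 + d / 16 * p.2.re) - (3 * d / 4 + d / 16 * q.2.re) =
      d / 16 * (p.2.re - q.2.re) by ring, abs_mul, abs_of_pos (by linarith : 0 < d / 16)]
    gcongr
  have key : ∀ R R' x y : ℝ, |R'| ≤ 7 * d / 8 → |R - R'| ≤ d / 16 * D → |x| ≤ 1 → |x - y| ≤ D →
      |R * x - R' * y| ≤ d * D := by
    intro R R' x y h1 h2 h3 h4
    have hD : 0 ≤ D := dist_nonneg
    calc |R * x - R' * y| = |(R - R') * x + R' * (x - y)| := by congr 1; ring
      _ ≤ |R - R'| * |x| + |R'| * |x - y| := by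
        rw [← abs_mul, ← abs_mul]
        exact abs_add_le _ _
      _ ≤ d / 16 * D * 1 + 7 * d / 8 * D := by gcongr
      _ ≤ d * D := by nlinarith [mul_nonneg hd.le hD]
  have hD : 0 ≤ D := dist_nonneg
  have hdD := mul_nonneg hd.le hD
  refine max_le ?_ ?_
  · refine (dist_circleExp_le _ _).trans ?_
    have := key _ _ _ _ hR hRR hpr hur
    linarith
  · have h1 := key _ _ _ _ hR hRR hpi hui
    have h2 : |d / 16 * p.2.im - d / 16 * q.2.im| ≤ d / 16 * D := by
      rw [← mul_sub, abs_mul, abs_of_pos (by linarith : 0 < d / 16)]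
      gcongr
    rw [dist_eq_norm]
    simp only [ringMap]
    refine (Complex.norm_le_abs_re_add_abs_im _).trans ?_
    simp only [Complex.sub_re, Complex.sub_im, Complex.add_re, Complex.add_im, Complex.ofReal_re,
      Complex.ofReal_im, Complex.re_ofReal_mul, Complex.im_ofReal_mul, Complex.I_re, Complex.I_im,
      mul_zero, add_zero, zero_add, mul_one]
    linarith

theorem dist_ringTube_le {r : ℕ} (hr : 13 ≤ r) (k : Bool × Fin r) {p q : Circle × ℂ}
    (hq : ‖q.2‖ < 2) :
    dist (ringTube hr k p) (ringTube hr k q) ≤ 2 * ringGap r * dist p q := by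
  refine le_trans (le_of_eq ?_) (dist_ringMap_le (ringGap_pos hr) hq)
  change dist ((ringMap (ringGap r) p).1 * ringPoint r k.1 k.2, _ * (ringMap (ringGap r) p).2)
    ((ringMap (ringGap r) q).1 * ringPoint r k.1 k.2, _ * (ringMap (ringGap r) q).2) = _
  rw [Prod.dist_eq, Prod.dist_eq]
  congr 1
  · rw [dist_coe_circle, dist_coe_circle, Circle.coe_mul, Circle.coe_mul, ← sub_mul, norm_mul,
      Circle.norm_coe, mul_one]
  · rw [dist_eq_norm, dist_eq_norm, ← mul_sub, norm_mul, Circle.norm_coe, one_mul]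

theorem norm_pow_sub_pow_le {u v : ℂ} (hu : ‖u‖ ≤ 1) (hv : ‖v‖ ≤ 1) (N : ℕ) :
    ‖u ^ N - v ^ N‖ ≤ N * ‖u - v‖ := by
  induction N with
  | zero => simp
  | succ N ih =>
    calc ‖u ^ (N + 1) - v ^ (N + 1)‖ = ‖u * (u ^ N - v ^ N) + (u - v) * v ^ N‖ := by
          congr 1
          ring
      _ ≤ ‖u‖ * ‖u ^ N - v ^ N‖ + ‖u - v‖ * ‖v ^ N‖ := by
        rw [← norm_mul, ← norm_mul]
        exact norm_add_le _ _
      _ ≤ 1 * (N * ‖u - v‖) + ‖u - v‖ * 1 := by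
        gcongr
        rw [norm_pow]
        exact pow_le_one₀ (norm_nonneg _) hv
      _ = (N + 1 : ℕ) * ‖u - v‖ := by push_cast; ring

theorem norm_root_bounds {N : ℕ} (hN : N ≠ 0) {x y : ℂ} (hx : ‖x‖ ≤ 1 / 4) (hy : ‖y‖ ≤ 1 / 4) :
    ‖(1 + x) ^ ((N : ℂ)⁻¹)‖ ≤ 2 ∧
      ‖(1 + x) ^ ((N : ℂ)⁻¹) - (1 + y) ^ ((N : ℂ)⁻¹)‖ ≤ 2 * ‖x - y‖ := by
  have hN1 : (1 : ℝ) ≤ N := by exact_mod_cast Nat.one_le_iff_ne_zero.2 hN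
  have hNi : (N : ℝ)⁻¹ ≤ 1 := inv_le_one_of_one_le₀ hN1
  have hN0 : 0 < (N : ℝ)⁻¹ := by positivity
  have hcast : ((N : ℂ)⁻¹) = ((N : ℝ)⁻¹ : ℝ) := by push_cast; rfl
  have hslit : ∀ z ∈ closedBall (0 : ℂ) (1 / 4), 1 + z ∈ Complex.slitPlane := by
    intro z hz
    rw [mem_closedBall_zero_iff] at hz
    refine Or.inl ?_
    have := (abs_le.1 ((Complex.abs_re_le_norm z).trans hz)).1
    rw [Complex.add_re, Complex.one_re]
    linarith
  have hlow : ∀ z ∈ closedBall (0 : ℂ) (1 / 4), 3 / 4 ≤ ‖1 + z‖ ∧ ‖1 + z‖ ≤ 5 / 4 := by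
    intro z hz
    rw [mem_closedBall_zero_iff] at hz
    have h1 := norm_sub_le (1 + z) z
    have h2 := norm_add_le 1 z
    rw [add_sub_cancel_right, norm_one] at h1
    rw [norm_one] at h2
    constructor <;> linarith
  have hx' : x ∈ closedBall (0 : ℂ) (1 / 4) := mem_closedBall_zero_iff.2 hx
  have hy' : y ∈ closedBall (0 : ℂ) (1 / 4) := mem_closedBall_zero_iff.2 hy
  constructor
  · obtain ⟨h1, h2⟩ := hlow x hx'
    rw [hcast, Complex.norm_cpow_real]
    calc ‖1 + x‖ ^ ((N : ℝ)⁻¹) ≤ (5 / 4) ^ ((N : ℝ)⁻¹) := by gcongr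
      _ ≤ (5 / 4 : ℝ) ^ (1 : ℝ) := Real.rpow_le_rpow_of_exponent_le (by norm_num) hNi
      _ ≤ 2 := by norm_num
  · refine (convex_closedBall (0 : ℂ) (1 / 4)).norm_image_sub_le_of_norm_hasDerivWithin_le
      (f := fun z : ℂ => (1 + z) ^ ((N : ℂ)⁻¹))
      (f' := fun z => (N : ℂ)⁻¹ * (1 + z) ^ ((N : ℂ)⁻¹ - 1) * 1) ?_ ?_ hy' hx'
    · intro z hz
      exact (((hasDerivAt_id z).const_add 1).cpow_const (hslit z hz)).hasDerivWithinAt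
    · intro z hz
      obtain ⟨h1, h2⟩ := hlow z hz
      have e : (N : ℂ)⁻¹ - 1 = (((N : ℝ)⁻¹ - 1 : ℝ) : ℂ) := by push_cast; rfl
      rw [mul_one, norm_mul, e, Complex.norm_cpow_real, hcast, Complex.norm_real,
        Real.norm_of_nonneg hN0.le]
      have h3 : ‖1 + z‖ ^ ((N : ℝ)⁻¹ - 1) ≤ (3 / 4) ^ ((N : ℝ)⁻¹ - 1) :=
        Real.rpow_le_rpow_of_nonpos (by norm_num) h1 (by linarith)
      have h4 : (3 / 4 : ℝ) ^ ((N : ℝ)⁻¹ - 1) ≤ (3 / 4 : ℝ) ^ (-1 : ℝ) :=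
        Real.rpow_le_rpow_of_exponent_ge (by norm_num) (by norm_num) (by linarith)
      calc (N : ℝ)⁻¹ * ‖1 + z‖ ^ ((N : ℝ)⁻¹ - 1) ≤ 1 * (3 / 4 : ℝ) ^ (-1 : ℝ) := by
            gcongr
            exact h3.trans h4
        _ ≤ 2 := by
            rw [Real.rpow_neg_one]
            norm_num

theorem dist_cableMap_le {N : ℕ} {a : ℝ} (hN : N ≠ 0) (ha : 4 ≤ a) {p q : Circle × ℂ}
    (hp : ‖p.2‖ < 2) (hq : ‖q.2‖ < 2) :
    dist (cableMap N a p) (cableMap N a q) ≤ (N + 1) * dist p q := by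
  have hu : ‖(p.1 : ℂ) - q.1‖ ≤ dist p q := by
    rw [← dist_coe_circle]
    exact le_max_left _ _
  have hw : ‖p.2 - q.2‖ ≤ dist p q := by
    rw [← dist_eq_norm]
    exact le_max_right _ _
  have hD : 0 ≤ dist p q := dist_nonneg
  set D := dist p q
  have hN1 : (1 : ℝ) ≤ N := by exact_mod_cast Nat.one_le_iff_ne_zero.2 hN
  have hpn := Circle.norm_coe p.1
  have hqn := Circle.norm_coe q.1
  have hpow : ‖(p.1 : ℂ) ^ N - (q.1 : ℂ) ^ N‖ ≤ N * D :=
    (norm_pow_sub_pow_le hpn.le hqn.le N).trans (by gcongr)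
  refine max_le ?_ ?_
  · rw [dist_coe_circle]
    simp only [cableMap, Circle.coe_pow]
    linarith
  · set x : ℂ := ((p.1 : ℂ) ^ N)⁻¹ * p.2 / 8 with hx
    set y : ℂ := ((q.1 : ℂ) ^ N)⁻¹ * q.2 / 8 with hy
    have hx1 : ‖x‖ ≤ 1 / 4 := by
      rw [hx, norm_div, norm_mul, norm_inv, norm_coe_pow]
      norm_num
      linarith
    have hy1 : ‖y‖ ≤ 1 / 4 := by
      rw [hy, norm_div, norm_mul, norm_inv, norm_coe_pow]
      norm_num
      linarith
    have hinv : ‖((p.1 : ℂ) ^ N)⁻¹ - ((q.1 : ℂ) ^ N)⁻¹‖ ≤ N * D := by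
      have h1 : (p.1 : ℂ) ^ N ≠ 0 := pow_ne_zero _ (Circle.coe_ne_zero _)
      have h2 : (q.1 : ℂ) ^ N ≠ 0 := pow_ne_zero _ (Circle.coe_ne_zero _)
      rw [inv_sub_inv h1 h2, norm_div, norm_mul, norm_coe_pow, norm_coe_pow, norm_sub_rev]
      simpa using hpow
    have hxy : ‖x - y‖ ≤ (2 * N + 1) * D / 8 := by
      have e : x - y = (((p.1 : ℂ) ^ N)⁻¹ * (p.2 - q.2) +
          (((p.1 : ℂ) ^ N)⁻¹ - ((q.1 : ℂ) ^ N)⁻¹) * q.2) / 8 := by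
        rw [hx, hy]
        ring
      rw [e, norm_div, show ‖(8 : ℂ)‖ = 8 by norm_num]
      have h1 := norm_add_le (((p.1 : ℂ) ^ N)⁻¹ * (p.2 - q.2))
        ((((p.1 : ℂ) ^ N)⁻¹ - ((q.1 : ℂ) ^ N)⁻¹) * q.2)
      rw [norm_mul, norm_mul, norm_inv, norm_coe_pow, inv_one, one_mul] at h1
      have h2 : ‖((p.1 : ℂ) ^ N)⁻¹ - ((q.1 : ℂ) ^ N)⁻¹‖ * ‖q.2‖ ≤ N * D * 2 := by gcongr
      linarith
    obtain ⟨hg, hgg⟩ := norm_root_bounds hN hx1 hy1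
    set g := (1 + x) ^ ((N : ℂ)⁻¹)
    set g' := (1 + y) ^ ((N : ℂ)⁻¹)
    rw [dist_eq_norm]
    change ‖(a : ℂ)⁻¹ * (p.1 * g) - (a : ℂ)⁻¹ * (q.1 * g')‖ ≤ _
    have e : (a : ℂ)⁻¹ * (p.1 * g) - (a : ℂ)⁻¹ * (q.1 * g') =
        (a : ℂ)⁻¹ * (((p.1 : ℂ) - q.1) * g + q.1 * (g - g')) := by ring
    have ha0 : ‖(a : ℂ)⁻¹‖ ≤ 1 / 4 := by
      rw [norm_inv, Complex.norm_real, Real.norm_of_nonneg (by linarith), one_div]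
      exact inv_anti₀ (by norm_num) ha
    rw [e, norm_mul]
    have h1 := norm_add_le (((p.1 : ℂ) - q.1) * g) (q.1 * (g - g'))
    rw [norm_mul, norm_mul, hqn, one_mul] at h1
    have h2 : ‖(p.1 : ℂ) - q.1‖ * ‖g‖ ≤ D * 2 := by gcongr
    have h3 : ‖((p.1 : ℂ) - q.1) * g + q.1 * (g - g')‖ ≤ 4 * ((N + 1) * D) := by
      nlinarith [mul_le_mul_of_nonneg_right hN1 hD]
    calc _ ≤ 1 / 4 * (4 * ((N + 1) * D)) := by gcongr
      _ = (N + 1) * D := by ring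

end Contraction

section SlotContraction

variable {d : ℕ}

theorem dist_setSlot_le (j : Fin d) (p q : SolidTorus d) (x y : Circle × ℂ) {ε : ℝ}
    (h : ∀ i ≠ j, dist (p.1 i) (q.1 i) ≤ ε) (hxy : dist x y ≤ ε) :
    dist (setSlot j p x) (setSlot j q y) ≤ ε := by
  have hε : 0 ≤ ε := dist_nonneg.trans hxy
  refine max_le ((dist_pi_le_iff hε).2 fun i => ?_) ((le_max_right _ _).trans hxy)
  simp only [setSlot]
  by_cases hi : i = j
  · subst hi
    simpa using (le_max_left _ _).trans hxy
  · simpa [hi] using h i hi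

variable {ι ι' : ℕ → Type} {E : ∀ m, ι m → OpenPartialHomeomorph (Circle × ℂ) (Circle × ℂ)}
  {L : ∀ m, ι' m → OpenPartialHomeomorph (Circle × ℂ) (Circle × ℂ)} {s : ℕ → Fin d} {δ : ℕ → ℝ}

/-- A tower of contractions, applied cyclically to all the slots, is small. -/
theorem smallTower_slotLift (hE : ∀ m, IsTubeFamily (Prod.snd : Circle × ℂ → ℂ) (E m))
    (hL : ∀ m, IsTubeFamily (Prod.snd : Circle × ℂ → ℂ) (L m))
    (hE1 : ∀ m k x y, ‖x.2‖ < 2 → ‖y.2‖ < 2 → dist (E m k x) (E m k y) ≤ dist x y)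
    (hE2 : ∀ m k x y, ‖x.2‖ < 2 → ‖y.2‖ < 2 → dist (E m k x) (E m k y) ≤ δ m)
    (hL2 : ∀ m k x y, ‖x.2‖ < 2 → ‖y.2‖ < 2 → dist (L m k x) (L m k y) ≤ δ m)
    (hδ : Filter.Tendsto δ Filter.atTop (𝓝 0))
    (hs : ∀ m i, ∃ l, m ≤ l ∧ l ≤ m + d ∧ s l = i) :
    SmallTower (Prod.snd : SolidTorus d → ℂ) (fun m k => slotLift (s m) (E m k))
      (fun m k => slotLift (s m) (L m k)) := by
  intro ε hε
  obtain ⟨m₀, hm₀⟩ := Filter.eventually_atTop.1 (hδ.eventually_lt_const (half_pos hε))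
  have hmE : ∀ m, IsTubeFamily (Prod.snd : SolidTorus d → ℂ) fun k => slotLift (s m) (E m k) :=
    fun m => (hE m).slotLift
  have hmL : ∀ m, IsTubeFamily (Prod.snd : SolidTorus d → ℂ) fun k => slotLift (s m) (L m k) :=
    fun m => (hL m).slotLift
  set E' := fun m k => slotLift (s m) (E m k) with hE'
  set L' := fun m k => slotLift (s m) (L m k) with hL'
  have hlt : ∀ n m k (x : SolidTorus d), ‖x.2‖ < 2 → ‖(towerComp E' L' n m k x).2‖ < 2 := by
    intro n m k x hx
    have := (isTubeFamily_towerComp hmE hmL n m).norm_lt (i := k) hx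
    linarith
  have hstep : ∀ n m (k : TowerIndex ι ι' (n + 1) m) (x : SolidTorus d),
      towerComp E' L' (n + 1) m k x =
        slotLift (s m) (E m k.1) (towerComp E' L' n (m + 1) k.2 x) := fun _ _ _ _ => rfl
  have h1 : ∀ n m, m₀ ≤ m → ∀ k (x y : SolidTorus d), ‖x.2‖ < 2 → ‖y.2‖ < 2 →
      dist (towerComp E' L' n m k x).2 (towerComp E' L' n m k y).2 ≤ ε / 2 ∧
      ∀ i l, m ≤ l → l ≤ m + n → s l = i →
        dist ((towerComp E' L' n m k x).1 i) ((towerComp E' L' n m k y).1 i) ≤ ε / 2 := by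
    intro n
    induction n with
    | zero =>
      intro m hm k x y hx hy
      have h := (hL2 m k.1 (slot (s m) x) (slot (s m) y) hx hy).trans (hm₀ m hm).le
      refine ⟨(le_max_right _ _).trans h, fun i l h1 h2 h3 => ?_⟩
      obtain rfl : l = m := by omega
      subst h3
      refine le_trans (le_of_eq ?_) ((le_max_left _ _).trans h)
      simp [towerComp, hL', slotLift_apply, setSlot]
    | succ n ih =>
      intro m hm k x y hx hy
      obtain ⟨h1, h2⟩ := ih (m + 1) (by omega) k.2 x y hx hy
      have hx' := hlt n (m + 1) k.2 x hx
      have hy' := hlt n (m + 1) k.2 y hy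
      rw [hstep, hstep]
      generalize towerComp E' L' n (m + 1) k.2 x = X at *
      generalize towerComp E' L' n (m + 1) k.2 y = Y at *
      have h := (hE2 m k.1 (slot (s m) X) (slot (s m) Y) hx' hy').trans (hm₀ m hm).le
      refine ⟨(le_max_right _ _).trans h, fun i l h3 h4 h5 => ?_⟩
      by_cases hi : i = s m
      · subst hi
        refine le_trans (le_of_eq ?_) ((le_max_left _ _).trans h)
        simp [slotLift_apply, setSlot]
      · have hl : l ≠ m := fun h => hi (h ▸ h5.symm)
        simpa [slotLift_apply, setSlot, hi] using h2 i l (by omega) (by omega) h5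
  have h2 : ∀ a m, m₀ ≤ m + a → ∀ n, d ≤ n → ∀ k (x y : SolidTorus d), ‖x.2‖ < 2 → ‖y.2‖ < 2 →
      dist (towerComp E' L' (n + a) m k x) (towerComp E' L' (n + a) m k y) ≤ ε / 2 := by
    intro a
    induction a with
    | zero =>
      intro m hm n hn k x y hx hy
      obtain ⟨h3, h4⟩ := h1 n m hm k x y hx hy
      refine max_le ((dist_pi_le_iff (half_pos hε).le).2 fun i => ?_) h3
      obtain ⟨l, hl1, hl2, hl3⟩ := hs m i
      exact h4 i l hl1 (by omega) hl3
    | succ a ih =>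
      intro m hm n hn k x y hx hy
      have h3 := ih (m + 1) (by omega) n hn k.2 x y hx hy
      have hx' := hlt (n + a) (m + 1) k.2 x hx
      have hy' := hlt (n + a) (m + 1) k.2 y hy
      change dist (towerComp E' L' (n + a + 1) m k x) (towerComp E' L' (n + a + 1) m k y) ≤ _
      rw [hstep, hstep]
      generalize towerComp E' L' (n + a) (m + 1) k.2 x = X at *
      generalize towerComp E' L' (n + a) (m + 1) k.2 y = Y at *
      have h4 : ∀ i, dist (X.1 i) (Y.1 i) ≤ ε / 2 := fun i =>
        (dist_le_pi_dist X.1 Y.1 i).trans ((le_max_left _ _).trans h3)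
      refine dist_setSlot_le _ _ _ _ _ (fun i _ => h4 i) ((hE1 m k.1 _ _ hx' hy').trans ?_)
      exact max_le (h4 _) ((le_max_right _ _).trans h3)
  refine ⟨m₀ + d, fun n hn k x y hx hy => ?_⟩
  obtain ⟨c, rfl⟩ : ∃ c, n = c + m₀ := ⟨n - m₀, by omega⟩
  exact (h2 m₀ 0 (by omega) c (by omega) k x y hx hy).trans_lt (half_lt_self hε)

end SlotContraction


section SolidTorusEmbedding

/-- Polar coordinates. -/
theorem isOpenEmbedding_polar (V : Type*) [TopologicalSpace V] :
    IsOpenEmbedding fun p : Circle × ℝ × V => ((Real.exp p.2.1 : ℂ) * (p.1 : ℂ), p.2.2) := by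
  have hc : Continuous fun p : Circle × ℝ => ((Real.exp p.2 : ℂ) * (p.1 : ℂ)) :=
    (Complex.continuous_ofReal.comp (Real.continuous_exp.comp continuous_snd)).mul
      (Continuous.comp (g := fun u : Circle => (u : ℂ)) continuous_subtype_val continuous_fst)
  have hn : ∀ p : Circle × ℝ, ‖(Real.exp p.2 : ℂ) * (p.1 : ℂ)‖ = Real.exp p.2 := by
    intro p
    rw [norm_mul, Circle.norm_coe, mul_one, Complex.norm_real,
      Real.norm_of_nonneg (Real.exp_pos _).le]
  have hi : Function.Injective fun p : Circle × ℝ => ((Real.exp p.2 : ℂ) * (p.1 : ℂ)) := by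
    intro p q h
    have h : (Real.exp p.2 : ℂ) * (p.1 : ℂ) = (Real.exp q.2 : ℂ) * (q.1 : ℂ) := h
    have h1 : p.2 = q.2 := by
      have := congrArg norm h
      rw [hn, hn] at this
      exact Real.exp_injective this
    have h0 : (Real.exp q.2 : ℂ) ≠ 0 := by exact_mod_cast (Real.exp_pos _).ne'
    rw [h1] at h
    exact Prod.ext (Circle.ext (mul_left_cancel₀ h0 h)) h1
  have ho : IsOpenMap fun p : Circle × ℝ => ((Real.exp p.2 : ℂ) * (p.1 : ℂ)) := by
    have he : IsOpenMap fun q : ℝ × ℝ => Complex.exp (Complex.equivRealProdCLM.symm q) :=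
      Complex.isOpenMap_exp.comp Complex.equivRealProdCLM.symm.toHomeomorph.isOpenMap
    have hs : Continuous fun q : ℝ × ℝ => ((Circle.exp q.2, q.1) : Circle × ℝ) :=
      (Circle.exp.continuous.comp continuous_snd).prodMk continuous_fst
    have hsurj : Function.Surjective fun q : ℝ × ℝ => ((Circle.exp q.2, q.1) : Circle × ℝ) :=
      fun p => ⟨(p.2, Complex.arg p.1), Prod.ext (Circle.exp_arg p.1) rfl⟩
    have heq : (fun p : Circle × ℝ => ((Real.exp p.2 : ℂ) * (p.1 : ℂ))) ∘
        (fun q : ℝ × ℝ => ((Circle.exp q.2, q.1) : Circle × ℝ)) =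
        fun q => Complex.exp (Complex.equivRealProdCLM.symm q) := by
      funext q
      simp only [Function.comp, Circle.coe_exp, Complex.ofReal_exp]
      rw [← Complex.exp_add]
      congr 1
      apply Complex.ext <;> simp
    refine fun U hU => ?_
    rw [← image_preimage_eq U hsurj, ← image_comp, heq]
    exact he _ (hU.preimage hs)
  have h1 : IsOpenEmbedding fun p : Circle × ℝ => ((Real.exp p.2 : ℂ) * (p.1 : ℂ)) :=
    .of_continuous_injective_isOpenMap hc hi ho
  have h2 := (h1.prodMap (IsOpenEmbedding.id (X := V))).comp
    (Homeomorph.prodAssoc Circle ℝ V).symm.isOpenEmbedding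
  exact h2

theorem exists_isOpenEmbedding_solidTorus (d : ℕ) {W : Type} [NormedAddCommGroup W]
    [NormedSpace ℝ W] [FiniteDimensional ℝ W] (hW : Module.finrank ℝ W = d + 2) :
    ∃ e : SolidTorus d → W, IsOpenEmbedding e := by
  induction d generalizing W with
  | zero =>
    have h : Module.finrank ℝ ℂ = Module.finrank ℝ W := by rw [hW, Complex.finrank_real_complex]
    exact ⟨_, (ContinuousLinearEquiv.ofFinrankEq h).toHomeomorph.isOpenEmbedding.comp
      (Homeomorph.uniqueProd _ _).isOpenEmbedding⟩
  | succ d ih =>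
    let V := EuclideanSpace ℝ (Fin (d + 1))
    have hV : Module.finrank ℝ V = d + 1 := by simp [V]
    obtain ⟨e, he⟩ := ih (W := ℝ × V) (by rw [Module.finrank_prod, hV, Module.finrank_self]; ring)
    have h : Module.finrank ℝ (ℂ × V) = Module.finrank ℝ W := by
      rw [hW, Module.finrank_prod, hV, Complex.finrank_real_complex]
      ring
    let H : SolidTorus (d + 1) ≃ₜ Circle × SolidTorus d :=
      { toFun := fun p => (p.1 0, (fun i => p.1 i.succ, p.2))
        invFun := fun q => (Fin.cons q.1 q.2.1, q.2.2)
        left_inv := fun p => Prod.ext (Fin.cons_self_tail p.1) rfl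
        right_inv := fun q => rfl
        continuous_toFun := ((continuous_apply _).comp continuous_fst).prodMk
          ((continuous_pi fun i => (continuous_apply _).comp continuous_fst).prodMk continuous_snd)
        continuous_invFun := (Continuous.finCons (A := fun _ : Fin (d + 1) => Circle)
          continuous_fst (continuous_fst.comp continuous_snd)).prodMk (continuous_snd.comp continuous_snd) }
    exact ⟨_, (ContinuousLinearEquiv.ofFinrankEq h).toHomeomorph.isOpenEmbedding.comp
      ((isOpenEmbedding_polar V).comp (((IsOpenEmbedding.id (X := Circle)).prodMap he).comp
        H.isOpenEmbedding))⟩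

end SolidTorusEmbedding


section Algebra

open Matrix

variable {K : Type*} [Field K]

/-- The negatives of the nontrivial unipotent elements of `GL₂`. -/
def negUnipotent (K : Type*) [Field K] : Set (GL (Fin 2) K) :=
  {g | ∃ n : Matrix (Fin 2) (Fin 2) K, n * n = 0 ∧ n ≠ 0 ∧ g.1 = -(1 + n)}

/-- The negative of a unipotent element. -/
def negUnipotentOf (n : Matrix (Fin 2) (Fin 2) K) (hn : n * n = 0) : GL (Fin 2) K where
  val := -(1 + n)
  inv := -(1 - n)
  val_inv := by
    rw [neg_mul_neg, mul_sub, mul_one, add_mul, one_mul, hn]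
    abel
  inv_val := by
    rw [neg_mul_neg, sub_mul, one_mul, mul_add, mul_one, hn]
    abel

theorem negUnipotentOf_mem {n : Matrix (Fin 2) (Fin 2) K} (hn : n * n = 0) (h0 : n ≠ 0) :
    negUnipotentOf n hn ∈ negUnipotent K := ⟨n, hn, h0, rfl⟩

theorem neg_one_add_pow {R : Type*} [Ring R] {n : R} (hn : n * n = 0) {N : ℕ} (hN : Even N) :
    (-(1 + n)) ^ N = 1 + N * n := by
  rw [hN.neg_pow]
  have : ∀ N : ℕ, (1 + n) ^ N = 1 + N * n := by
    intro N
    induction N with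
    | zero => simp
    | succ N ih =>
      rw [pow_succ, ih, mul_add, mul_one, add_mul, one_mul, mul_assoc, hn]
      push_cast
      noncomm_ring
  exact this N

theorem one_notMem_negUnipotent (h2 : (2 : K) ≠ 0) : (1 : GL (Fin 2) K) ∉ negUnipotent K := by
  rintro ⟨n, hn, -, h⟩
  have h00 : (1 : K) = -(1 + n 0 0) := congrFun (congrFun h 0) 0
  have h01 : (0 : K) = -(0 + n 0 1) := congrFun (congrFun h 0) 1
  have h3 : (n * n) 0 0 = 0 := congrFun (congrFun hn 0) 0
  rw [Matrix.mul_apply, Fin.sum_univ_two] at h3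
  have h4 : (2 : K) * 2 = 0 := by
    linear_combination h3 + (2 - n 0 0) * h00 - n 1 0 * h01
  exact h2 (by simpa using h4)

theorem exists_conj_of_sq_eq_zero {n : Matrix (Fin 2) (Fin 2) K} (hn : n * n = 0) (h0 : n ≠ 0) :
    ∃ P : GL (Fin 2) K, n * P.1 = P.1 * !![0, 1; 0, 0] := by
  obtain ⟨a, b, c, d, rfl⟩ : ∃ a b c d, n = !![a, b; c, d] := ⟨_, _, _, _, Matrix.eta_fin_two n⟩
  rw [Matrix.mul_fin_two] at hn
  have e1 : a * a + b * c = 0 := congrFun (congrFun hn 0) 0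
  have e2 : a * b + b * d = 0 := congrFun (congrFun hn 0) 1
  have e3 : c * a + d * c = 0 := congrFun (congrFun hn 1) 0
  have e4 : c * b + d * d = 0 := congrFun (congrFun hn 1) 1
  by_cases hb : b = 0
  · subst hb
    have ha : a = 0 := by simpa using e1
    have hd : d = 0 := by simpa using e4
    subst ha
    subst hd
    have hc : c ≠ 0 := by
      rintro rfl
      exact h0 (by ext i j; fin_cases i <;> fin_cases j <;> rfl)
    refine ⟨GeneralLinearGroup.mkOfDetNeZero !![0, 1; c, 0] (by simpa using hc), ?_⟩
    ext i j
    fin_cases i <;> fin_cases j <;> simp [GeneralLinearGroup.mkOfDetNeZero]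
  · have hd : d = -a := by
      have : b * (a + d) = 0 := by linear_combination e2
      have := (mul_eq_zero.1 this).resolve_left hb
      linear_combination this
    subst hd
    refine ⟨GeneralLinearGroup.mkOfDetNeZero !![b, 0; -a, 1] (by simpa using hb), ?_⟩
    have : c * b + a * a = 0 := by linear_combination e1
    simp [GeneralLinearGroup.mkOfDetNeZero]
    constructor
    · ring
    · exact this

theorem exists_conj_of_sq_eq_zero_of_sq_eq_zero {n m : Matrix (Fin 2) (Fin 2) K} (hn : n * n = 0)
    (hn0 : n ≠ 0) (hm : m * m = 0) (hm0 : m ≠ 0) :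
    ∃ P : GL (Fin 2) K, n = P.1 * m * P⁻¹.1 := by
  obtain ⟨P, hP⟩ := exists_conj_of_sq_eq_zero hn hn0
  obtain ⟨Q, hQ⟩ := exists_conj_of_sq_eq_zero hm hm0
  refine ⟨P * Q⁻¹, ?_⟩
  have h1 : n = P.1 * !![0, 1; 0, 0] * P⁻¹.1 := by
    rw [← hP, mul_assoc, Units.mul_inv, mul_one]
  have h2 : !![0, 1; 0, 0] = Q⁻¹.1 * m * Q.1 := by
    rw [mul_assoc, hQ, ← mul_assoc, Units.inv_mul, one_mul]
  rw [h1, h2, _root_.mul_inv_rev, inv_inv, Units.val_mul, Units.val_mul]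
  simp only [mul_assoc]

theorem conj_negUnipotent {n : Matrix (Fin 2) (Fin 2) K} (hn : n * n = 0) (h0 : n ≠ 0)
    (P : GL (Fin 2) K) : P * negUnipotentOf n hn * P⁻¹ ∈ negUnipotent K := by
  refine ⟨P.1 * n * P⁻¹.1, ?_, fun h => h0 ?_, ?_⟩
  · calc _ = P.1 * n * (P⁻¹.1 * P) * n * P⁻¹.1 := by
          simp only [mul_assoc]
      _ = P.1 * (n * n) * P⁻¹.1 := by
        rw [Units.inv_mul, mul_one]
        simp only [mul_assoc]
      _ = 0 := by rw [hn, mul_zero, zero_mul]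
  · calc n = P⁻¹.1 * (P * n * P⁻¹.1) * P := by
          simp only [mul_assoc]
          rw [Units.inv_mul, mul_one, ← mul_assoc, Units.inv_mul, one_mul]
      _ = 0 := by rw [h, mul_zero, zero_mul]
  · rw [Units.val_mul, Units.val_mul]
    change _ * (-(1 + n)) * _ = _
    rw [mul_neg, neg_mul, mul_add, mul_one, add_mul, Units.mul_inv]

/-- Every negative of a nontrivial unipotent element is a commutator of `N`-th powers of such
elements. -/
theorem exists_commutator_pow {i : K} (hi : i ^ 2 = -1) (h2 : (2 : K) ≠ 0) {N : ℕ} (hN : Even N)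
    (hNK : (N : K) ≠ 0) {g : GL (Fin 2) K} (hg : g ∈ negUnipotent K) :
    ∃ x ∈ negUnipotent K, ∃ y ∈ negUnipotent K,
      g = y ^ N * (x ^ N)⁻¹ * (y ^ N)⁻¹ * x ^ N := by
  obtain ⟨m, hm, hm0, hgm⟩ := hg
  obtain ⟨q, hq, hq0⟩ : ∃ q : K, q * q = -4 ∧ q ≠ 0 := by
    refine ⟨2 * i, by linear_combination 4 * hi, mul_ne_zero h2 ?_⟩
    rintro rfl
    simp at hi
  let β : Matrix (Fin 2) (Fin 2) K := !![0, 0; (N : K)⁻¹ * q, 0]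
  let γ : Matrix (Fin 2) (Fin 2) K := !![0, (N : K)⁻¹; 0, 0]
  let m₀ : Matrix (Fin 2) (Fin 2) K := !![2 + q, -q; 4, -2 - q]
  have hβ : β * β = 0 := by
    ext i j; fin_cases i <;> fin_cases j <;> simp [β]
  have hγ : γ * γ = 0 := by
    ext i j; fin_cases i <;> fin_cases j <;> simp [γ]
  have hm₀ : m₀ * m₀ = 0 := by
    ext i j
    fin_cases i <;> fin_cases j <;> simp [m₀]
    · linear_combination hq
    · ring
    · ring
    · linear_combination hq
  have hβ0 : β ≠ 0 := fun h => mul_ne_zero (inv_ne_zero hNK) hq0 (congrFun (congrFun h 1) 0)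
  have hγ0 : γ ≠ 0 := fun h => inv_ne_zero hNK (congrFun (congrFun h 0) 1)
  have hm₀0 : m₀ ≠ 0 := fun h => neg_ne_zero.2 hq0 (congrFun (congrFun h 0) 1)
  have hNβ : (N : Matrix (Fin 2) (Fin 2) K) * β = !![0, 0; q, 0] := by
    rw [← nsmul_eq_mul]
    ext i j; fin_cases i <;> fin_cases j <;> simp [β, hNK]
  have hNγ : (N : Matrix (Fin 2) (Fin 2) K) * γ = !![0, 1; 0, 0] := by
    rw [← nsmul_eq_mul]
    ext i j; fin_cases i <;> fin_cases j <;> simp [γ, hNK]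
  have hpow : ∀ n hn, ((negUnipotentOf n hn ^ N : GL (Fin 2) K) : Matrix (Fin 2) (Fin 2) K) =
      1 + N * n := by
    intro n hn
    rw [Units.val_pow_eq_pow_val]
    exact neg_one_add_pow hn hN
  have hpow' : ∀ n hn, (((negUnipotentOf n hn ^ N)⁻¹ : GL (Fin 2) K) :
      Matrix (Fin 2) (Fin 2) K) = 1 - N * n := by
    intro n hn
    rw [← inv_pow, Units.val_pow_eq_pow_val]
    have h : (-n) * (-n) = 0 := by rw [neg_mul_neg, hn]
    have := neg_one_add_pow h hN
    rw [mul_neg, ← sub_eq_add_neg, ← sub_eq_add_neg] at this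
    exact this
  have key : negUnipotentOf m₀ hm₀ = negUnipotentOf γ hγ ^ N * (negUnipotentOf β hβ ^ N)⁻¹ *
      (negUnipotentOf γ hγ ^ N)⁻¹ * negUnipotentOf β hβ ^ N := by
    refine Units.ext ?_
    rw [Units.val_mul, Units.val_mul, Units.val_mul, hpow, hpow, hpow', hpow', hNβ, hNγ]
    change -(1 + m₀) = _
    rw [Matrix.one_fin_two]
    simp only [m₀]
    ext i j
    fin_cases i <;> fin_cases j <;> simp
    · linear_combination -hq
    · linear_combination -hq
    · ring
  obtain ⟨P, hP⟩ := exists_conj_of_sq_eq_zero_of_sq_eq_zero hm hm0 hm₀ hm₀0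
  have hgP : g = P * negUnipotentOf m₀ hm₀ * P⁻¹ := by
    refine Units.ext ?_
    rw [hgm, Units.val_mul, Units.val_mul, hP]
    change _ = _ * (-(1 + m₀)) * _
    rw [mul_neg, neg_mul, mul_add, mul_one, add_mul, Units.mul_inv]
  refine ⟨_, conj_negUnipotent hβ hβ0 P, _, conj_negUnipotent hγ hγ0 P, ?_⟩
  rw [hgP, key, conj_pow, conj_pow]
  group

theorem negUnipotent_nonempty : (negUnipotent K).Nonempty := by
  have h : (!![0, 1; 0, 0] : Matrix (Fin 2) (Fin 2) K) * !![0, 1; 0, 0] = 0 := by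
    ext i j; fin_cases i <;> fin_cases j <;> simp
  exact ⟨_, negUnipotentOf_mem h fun h => one_ne_zero (congrFun (congrFun h 0) 1)⟩

end Algebra

section Primes

/-- The order of `GL₂` over the field with `p` elements. -/
def glOrder (p : ℕ) : ℕ := (p ^ 2 - 1) * (p ^ 2 - p)

theorem pow_glOrder_mul {p : ℕ} [Fact p.Prime] (g : Matrix.GeneralLinearGroup (Fin 2) (ZMod p))
    {N : ℕ} (h : glOrder p ∣ N) : g ^ N = 1 := by
  have hc : Nat.card (Matrix.GeneralLinearGroup (Fin 2) (ZMod p)) = glOrder p := by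
    rw [Matrix.card_GL_field]
    simp [Fin.prod_univ_two, glOrder]
  obtain ⟨c, rfl⟩ := h
  rw [pow_mul, ← hc, pow_card_eq_one', one_pow]

theorem glOrder_eq {p : ℕ} (hp : 0 < p) : glOrder p = p * (p - 1) ^ 2 * (p + 1) := by
  obtain ⟨q, rfl⟩ : ∃ q, p = q + 1 := ⟨p - 1, by omega⟩
  have h1 : (q + 1) ^ 2 - 1 = q * (q + 2) := by
    rw [show (q + 1) ^ 2 = q * (q + 2) + 1 by ring]
    rfl
  have h2 : (q + 1) ^ 2 - (q + 1) = q * (q + 1) := by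
    rw [show (q + 1) ^ 2 = q * (q + 1) + (q + 1) by ring, Nat.add_sub_cancel]
  rw [glOrder, h1, h2, Nat.add_sub_cancel]
  ring

theorem exists_primes : ∃ f : ℕ → ℕ, (∀ i, (f i).Prime ∧ f i % 4 = 1) ∧
    ∀ i j, i ≠ j → ¬ f i ∣ glOrder (f j) := by
  obtain ⟨f, hf, hr⟩ := exists_seq_of_forall_finset_exists (fun p : ℕ => p.Prime ∧ p % 4 = 1)
    (fun p q => q % p = 2 % p ∧ p + 1 < q) (by
      intro s hs
      set Q := ∏ p ∈ s, p with hQ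
      have hQ4 : Q % 4 = 1 := by
        refine Finset.prod_induction (fun p : ℕ => p) (fun p => p % 4 = 1) ?_ rfl
          fun p hp => (hs p hp).2
        intro a b ha hb
        rw [Nat.mul_mod, ha, hb]
      have hcop : Nat.Coprime (3 * Q + 2) (4 * Q) := by
        refine Nat.Coprime.mul_right ?_ ?_
        · have : Nat.Coprime (3 * Q + 2) 2 := by
            rw [Nat.coprime_two_right, Nat.odd_iff]
            omega
          exact Nat.Coprime.mul_right this this
        · rw [Nat.coprime_comm]
          have : Nat.Coprime Q 2 := by
            rw [Nat.coprime_two_right, Nat.odd_iff]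
            omega
          simpa [Nat.coprime_mul_left_add_right, mul_comm 3 Q] using this
      have : NeZero (4 * Q) := ⟨by omega⟩
      obtain ⟨y, hy, hyp, hyc⟩ := Nat.forall_exists_prime_gt_and_eq_mod
        ((ZMod.isUnit_iff_coprime _ _).2 hcop) (Q + 1)
      have hmod : y ≡ 3 * Q + 2 [MOD 4 * Q] := (ZMod.natCast_eq_natCast_iff _ _ _).1 hyc
      refine ⟨y, ⟨hyp, ?_⟩, fun p hp => ⟨?_, ?_⟩⟩
      · have h : y % 4 = (3 * Q + 2) % 4 := hmod.of_dvd (Nat.dvd_mul_right 4 Q)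
        omega
      · have hpQ : p ∣ Q := Finset.dvd_prod_of_mem (fun p : ℕ => p) hp
        have h : y % p = (3 * Q + 2) % p := hmod.of_dvd (hpQ.mul_left 4)
        rw [h, Nat.add_mod, Nat.mod_eq_zero_of_dvd (hpQ.mul_left 3)]
        simp
      · have hpQ : p ∣ Q := Finset.dvd_prod_of_mem (fun p : ℕ => p) hp
        have := Nat.le_of_dvd (by omega) hpQ
        omega)
  refine ⟨f, hf, fun i j hij => ?_⟩
  have h5 : ∀ i, 5 ≤ f i := by
    intro i
    have h1 := (hf i).1.two_le
    have h2 := (hf i).2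
    omega
  rw [glOrder_eq (by have := h5 j; omega)]
  intro hd
  rcases lt_or_gt_of_ne hij with h | h
  · obtain ⟨h1, h2⟩ := hr i j h
    have h1 : f j ≡ 2 [MOD f i] := h1
    have e : f j - 1 ≡ 1 [MOD f i] := by
      have : (f j - 1) + 1 ≡ 1 + 1 [MOD f i] := by
        rwa [Nat.sub_add_cancel (by have := h5 j; omega)]
      exact Nat.ModEq.add_right_cancel' 1 this
    have h3 : f j * (f j - 1) ^ 2 * (f j + 1) ≡ 2 * 1 ^ 2 * (2 + 1) [MOD f i] :=
      (h1.mul (e.pow 2)).mul (h1.add_right 1)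
    have h4 : f i ∣ 6 := (Nat.modEq_zero_iff_dvd.1 (h3.symm.trans (Nat.modEq_zero_iff_dvd.2 hd)))
    have h6 := Nat.le_of_dvd (by norm_num) h4
    have h7 := h5 i
    have h8 := (hf i).2
    have h9 : f i = 5 := by omega
    rw [h9] at h4
    norm_num at h4
  · obtain ⟨-, h2⟩ := hr j i h
    have hp := (hf i).1
    have hj := h5 j
    rcases (Nat.Prime.dvd_mul hp).1 hd with h3 | h3
    · rcases (Nat.Prime.dvd_mul hp).1 h3 with h4 | h4
      · have := Nat.le_of_dvd (by omega) h4
        omega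
      · have := Nat.le_of_dvd (by omega) (hp.dvd_of_dvd_pow h4)
        omega
    · have := Nat.le_of_dvd (by omega) h3
      omega

end Primes


section Branches

/-- The scale of the cable in each of the two disjoint cable positions. -/
noncomputable def cableScale (b : Bool) : ℝ := cond b 4 8

theorem four_le_cableScale (b : Bool) : 4 ≤ cableScale b := by
  cases b <;> norm_num [cableScale]

/-- Two disjoint cables. -/
noncomputable def cablePair {N : Bool → ℕ} (hN : ∀ b, N b ≠ 0) (b : Bool) :
    OpenPartialHomeomorph (Circle × ℂ) (Circle × ℂ) :=
  cableChart (hN b) (four_le_cableScale b)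

theorem isTubeFamily_cablePair {N : Bool → ℕ} (hN : ∀ b, N b ≠ 0) :
    IsTubeFamily (Prod.snd : Circle × ℂ → ℂ) (cablePair hN) := by
  have hdis : Disjoint (cablePair hN false).target (cablePair hN true).target := by
    refine disjoint_left.2 fun q h1 h2 => ?_
    have h3 := (cableChart_target_bounds _ _ h1).2
    have h4 := (cableChart_target_bounds _ _ h2).1
    simp only [cableScale, cond_true, cond_false] at h3 h4
    linarith
  refine ⟨fun _ => rfl, fun i j h => ?_,
    fun b => (isTubeFamily_cableChart (hN b) (four_le_cableScale b)).target ()⟩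
  cases i <;> cases j
  · exact absurd rfl h
  · exact hdis
  · exact hdis.symm
  · exact absurd rfl h

theorem IsTubeFamily.comp_injective {M ι κ : Type*} [TopologicalSpace M] {w : M → ℂ}
    {ψ : ι → OpenPartialHomeomorph M M} (h : IsTubeFamily w ψ) {f : κ → ι}
    (hf : Function.Injective f) : IsTubeFamily w fun k => ψ (f k) :=
  ⟨fun _ => h.source _, fun _ _ hij => h.disjoint _ _ (hf.ne hij), fun _ => h.target _⟩

theorem PosStep.comp_surjective {M G ι κ : Type*} [TopologicalSpace M] [Group G] {w : M → ℂ}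
    {ψ : ι → OpenPartialHomeomorph M M} {S S' : Set G} (h : PosStep w ψ S S') {f : κ → ι}
    (hf : Function.Surjective f) : PosStep w (fun k => ψ (f k)) S S' := by
  intro g hg
  obtain ⟨lab, hlab, τ, h1, h2, h3⟩ := h g hg
  refine ⟨fun k => lab (f k), fun k => hlab _, τ, ?_, h2, fun k => h3 _⟩
  rwa [hf.iUnion_comp fun i => ψ i '' {p | ‖w p‖ ≤ 1 / 2}]

variable {N : Bool → ℕ} {r : ℕ}

/-- Two disjoint cables in each tube of a chain of `2 * r` rings. -/
noncomputable def branchTube (hN : ∀ b, N b ≠ 0) (hr : 13 ≤ r) (k : Bool × (Bool × Fin r)) :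
    OpenPartialHomeomorph (Circle × ℂ) (Circle × ℂ) :=
  (cablePair hN k.1).trans (ringTube hr k.2)

theorem isTubeFamily_branchTube (hN : ∀ b, N b ≠ 0) (hr : 13 ≤ r) :
    IsTubeFamily (Prod.snd : Circle × ℂ → ℂ) (branchTube hN hr) :=
  ((isTubeFamily_ringTube hr).trans (isTubeFamily_cablePair hN)).comp_injective
    (f := fun k : Bool × (Bool × Fin r) => (k.2, k.1)) Prod.swap_injective

theorem isCompact_norm_snd_le (r : ℝ) : IsCompact {p : Circle × ℂ | ‖p.2‖ ≤ r} := by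
  have : {p : Circle × ℂ | ‖p.2‖ ≤ r} = univ ×ˢ closedBall 0 r := by
    ext p
    simp
  rw [this]
  exact isCompact_univ.prod (isCompact_closedBall _ _)

theorem posStep_branchTube {G : Type*} [Group G] (hN : ∀ b, N b ≠ 0) (hr : 13 ≤ r) (b : Bool)
    {S : Set G} (hS : ∀ g ∈ S, ∃ x ∈ S, ∃ y ∈ S,
      g = y ^ N b * (x ^ N b)⁻¹ * (y ^ N b)⁻¹ * x ^ N b) :
    PosStep (Prod.snd : Circle × ℂ → ℂ) (fun k => branchTube hN hr (b, k)) S S := by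
  have h := PosStep.trans continuous_snd isCompact_norm_snd_le (isTubeFamily_ringTube hr)
    (isTubeFamily_cableChart (hN b) (four_le_cableScale b))
    (posStep_ringTube hr (S := S) (S' := {g | ∃ x ∈ S, g = x ^ N b}) ?_)
    (posStep_cableChart (hN b) (four_le_cableScale b) S)
  · exact h.comp_surjective (f := fun i : Bool × Fin r => (i, ())) fun i => ⟨i.1, rfl⟩
  · intro g hg
    obtain ⟨x, hx, y, hy, h⟩ := hS g hg
    exact ⟨_, ⟨x, hx, rfl⟩, _, ⟨y, hy, rfl⟩, h⟩

theorem dist_branchTube_le (hN : ∀ b, N b ≠ 0) (hr : 13 ≤ r)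
    (hrN : ∀ b, 2 * ringGap r * (N b + 1) ≤ 1) (k : Bool × (Bool × Fin r)) {x y : Circle × ℂ}
    (hx : ‖x.2‖ < 2) (hy : ‖y.2‖ < 2) :
    dist (branchTube hN hr k x) (branchTube hN hr k y) ≤ dist x y ∧
      dist (branchTube hN hr k x) (branchTube hN hr k y) ≤ 8 * ringGap r := by
  have hg := ringGap_pos hr
  have hx' := (isTubeFamily_cablePair hN).norm_lt (i := k.1) hx
  have hy' := (isTubeFamily_cablePair hN).norm_lt (i := k.1) hy
  have hy'' : ‖(cablePair hN k.1 y).2‖ < 2 := by linarith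
  have h1 : dist (branchTube hN hr k x) (branchTube hN hr k y) ≤
      2 * ringGap r * dist (cablePair hN k.1 x) (cablePair hN k.1 y) :=
    dist_ringTube_le hr k.2 (p := cablePair hN k.1 x) (q := cablePair hN k.1 y) hy''
  constructor
  · have h2 : dist (cablePair hN k.1 x) (cablePair hN k.1 y) ≤ (N k.1 + 1) * dist x y :=
      dist_cableMap_le (hN k.1) (four_le_cableScale k.1) hx hy
    calc _ ≤ 2 * ringGap r * ((N k.1 + 1) * dist x y) := h1.trans (by gcongr)
      _ = 2 * ringGap r * (N k.1 + 1) * dist x y := by ring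
      _ ≤ 1 * dist x y := by
        gcongr
        exact hrN k.1
      _ = dist x y := one_mul _
  · have h2 : dist (cablePair hN k.1 x) (cablePair hN k.1 y) ≤ 4 := by
      refine max_le ?_ ?_
      · rw [dist_coe_circle]
        refine (norm_sub_le _ _).trans ?_
        rw [Circle.norm_coe, Circle.norm_coe]
        norm_num
      · rw [dist_eq_norm]
        refine (norm_sub_le _ _).trans ?_
        linarith
    calc _ ≤ 2 * ringGap r * 4 := h1.trans (by gcongr)
      _ = _ := by ring

end Branches


section CyclicTower

variable {d : ℕ} {N : ℕ → Bool → ℕ} {r : ℕ → ℕ} {s : ℕ → Fin d}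

/-- The tower of cables in chains of rings, where the level `m` uses the slot `s m`. -/
noncomputable def cyclicTower (hN : ∀ m b, N m b ≠ 0) (hr : ∀ m, 13 ≤ r m) (s : ℕ → Fin d) (m : ℕ)
    (k : Bool × (Bool × Fin (r m))) : OpenPartialHomeomorph (SolidTorus d) (SolidTorus d) :=
  slotLift (s m) (branchTube (hN m) (hr m) k)

variable (hN : ∀ m b, N m b ≠ 0) (hr : ∀ m, 13 ≤ r m)

include hN hr in
theorem isTubeFamily_cyclicTower (m : ℕ) :
    IsTubeFamily (Prod.snd : SolidTorus d → ℂ) (cyclicTower hN hr s m) :=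
  (isTubeFamily_branchTube (hN m) (hr m)).slotLift

theorem isCompact_solidTorus_norm_le (R : ℝ) : IsCompact {p : SolidTorus d | ‖p.2‖ ≤ R} := by
  have : {p : SolidTorus d | ‖p.2‖ ≤ R} = univ ×ˢ closedBall 0 R := by
    ext p
    simp
  rw [this]
  exact isCompact_univ.prod (isCompact_closedBall _ _)

section Small

variable (hrN : ∀ m b, 2 * ringGap (r m) * (N m b + 1) ≤ 1)
  (hr0 : Filter.Tendsto (fun m => 8 * ringGap (r m)) Filter.atTop (𝓝 0))
  (hs : ∀ m i, ∃ l, m ≤ l ∧ l ≤ m + d ∧ s l = i)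

include hrN hr0 hs

theorem smallTower_cyclicTower : SmallTower (Prod.snd : SolidTorus d → ℂ)
    (cyclicTower hN hr s) (cyclicTower hN hr s) :=
  smallTower_slotLift (fun m => isTubeFamily_branchTube (hN m) (hr m))
    (fun m => isTubeFamily_branchTube (hN m) (hr m))
    (fun m k _ _ hx hy => (dist_branchTube_le (hN m) (hr m) (hrN m) k hx hy).1)
    (fun m k _ _ hx hy => (dist_branchTube_le (hN m) (hr m) (hrN m) k hx hy).2)
    (fun m k _ _ hx hy => (dist_branchTube_le (hN m) (hr m) (hrN m) k hx hy).2) hr0 hs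

theorem smallTower_subtower (t : ℕ → Bool) : SmallTower (Prod.snd : SolidTorus d → ℂ)
    (subtower (cyclicTower hN hr s) t) (subtower (cyclicTower hN hr s) t) := by
  have h : ∀ m, IsTubeFamily (Prod.snd : Circle × ℂ → ℂ)
      fun i => branchTube (hN m) (hr m) (t m, i) := fun m =>
    (isTubeFamily_branchTube (hN m) (hr m)).comp_injective (Prod.mk_right_injective _)
  exact smallTower_slotLift h h
    (fun m k _ _ hx hy => (dist_branchTube_le (hN m) (hr m) (hrN m) (t m, k) hx hy).1)
    (fun m k _ _ hx hy => (dist_branchTube_le (hN m) (hr m) (hrN m) (t m, k) hx hy).2)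
    (fun m k _ _ hx hy => (dist_branchTube_le (hN m) (hr m) (hrN m) (t m, k) hx hy).2) hr0 hs

theorem smallTower_subtower_ringTube (t : ℕ → Bool) : SmallTower (Prod.snd : SolidTorus d → ℂ)
    (subtower (cyclicTower hN hr s) t) (fun m k => slotLift (s m) (ringTube (hr m) k)) := by
  have h : ∀ m, IsTubeFamily (Prod.snd : Circle × ℂ → ℂ)
      fun i => branchTube (hN m) (hr m) (t m, i) := fun m =>
    (isTubeFamily_branchTube (hN m) (hr m)).comp_injective (Prod.mk_right_injective _)
  refine smallTower_slotLift h (fun m => isTubeFamily_ringTube (hr m))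
    (fun m k _ _ hx hy => (dist_branchTube_le (hN m) (hr m) (hrN m) (t m, k) hx hy).1)
    (fun m k _ _ hx hy => (dist_branchTube_le (hN m) (hr m) (hrN m) (t m, k) hx hy).2)
    (fun m k x y hx hy => ?_) hr0 hs
  have hg := ringGap_pos (hr m)
  have h2 : dist x y ≤ 4 := by
    refine max_le ?_ ?_
    · rw [dist_coe_circle]
      refine (norm_sub_le _ _).trans ?_
      rw [Circle.norm_coe, Circle.norm_coe]
      norm_num
    · rw [dist_eq_norm]
      refine (norm_sub_le _ _).trans ?_
      linarith
  calc _ ≤ 2 * ringGap (r m) * 4 := (dist_ringTube_le (hr m) k hy).trans (by gcongr)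
    _ = _ := by ring

/-- A subtower has wild limit set, detected by a group in which the powers of its cables can be
unravelled. -/
theorem wildAt_subtower {G : Type*} [Group G] (t : ℕ → Bool) {S : Set G} (hSn : S.Nonempty)
    (hS1 : (1 : G) ∉ S) (hS : ∀ m, ∀ g ∈ S, ∃ x ∈ S, ∃ y ∈ S,
      g = y ^ N m (t m) * (x ^ N m (t m))⁻¹ * (y ^ N m (t m))⁻¹ * x ^ N m (t m)) {x : SolidTorus d}
    (hx : x ∈ towerCore Prod.snd (subtower (cyclicTower hN hr s) t) 0) :
    WildAt G (towerCore Prod.snd (subtower (cyclicTower hN hr s) t) 0) x := by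
  refine wildAt_towerCore continuous_snd isCompact_solidTorus_norm_le
    (isTubeFamily_subtower (isTubeFamily_cyclicTower hN hr) t)
    (fun m => (posStep_branchTube (hN m) (hr m) (t m) (hS m)).slotLift) hSn hS1
    (γ := fun b : ℝ => (1, Complex.exp (b * Complex.I))) ?_ (fun b => rfl) ?_
    fun V hV => exists_image_subset_of_mem_towerCore
      (smallTower_subtower hN hr hrN hr0 hs t) hx hV
  · fun_prop
  · simp

/-- A subtower is not wild for a group whose exponent divides infinitely many cable powers. -/
theorem not_wildAt_subtower {G : Type*} [Group G] (t : ℕ → Bool)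
    (hN2 : ∀ m b, Even (N m b)) (hexp : ∃ᶠ m in Filter.atTop, ∀ g : G, g ^ N m (t m) = 1)
    {F : Type*} [NormedAddCommGroup F] [NormedSpace ℝ F] {e : SolidTorus d → F}
    (he : IsOpenEmbedding e)
    (hthin : ThinSet (e '' towerCore Prod.snd (subtower (cyclicTower hN hr s) t) 0))
    (x : SolidTorus d) :
    ¬ WildAt G (towerCore Prod.snd (subtower (cyclicTower hN hr s) t) 0) x := by
  refine not_wildAt_towerCore (C := fun m => {q | ‖8 * cableFun (N m (t m)) (cableScale (t m))
    (slot (s m) q)‖ ≤ 1 / 2}) continuous_snd isCompact_solidTorus_norm_le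
    (isTubeFamily_subtower (isTubeFamily_cyclicTower hN hr) t)
    (fun m => (isTubeFamily_ringTube (hr m)).slotLift) ?_ ?_
    (smallTower_subtower_ringTube hN hr hrN hr0 hs t) he hthin x
  · intro m k x hx
    have h2 : ‖x.2‖ < 2 := by linarith
    refine ⟨k, slotLift (s m) (cablePair (hN m) (t m)) x, ?_, ?_, ?_⟩
    · change ‖8 * cableFun _ _ (slot (s m) (slotLift (s m) (cablePair (hN m) (t m)) x))‖ ≤ 1 / 2
      rw [slot_slotLift]
      have h3 : cableFun (N m (t m)) (cableScale (t m)) (cablePair (hN m) (t m) (slot (s m) x)) =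
        (slot (s m) x).2 / 8 := cableFun_cableMap (hN m (t m)) (four_le_cableScale (t m)) _
      rw [h3, mul_div_cancel₀ _ (by norm_num)]
      exact hx
    · exact ((isTubeFamily_cablePair (hN m)).slotLift.norm_lt (i := t m) h2).le
    · change slotLift (s m) (branchTube (hN m) (hr m) (t m, k)) x = _
      rw [slotLift_apply, slotLift_apply, slotLift_apply, slot_setSlot, setSlot_setSlot]
      rfl
  · refine hexp.mono fun m hm τ hτ => ?_
    refine exists_extension (j := s m) (hN m (t m)) (hN2 m (t m)) (four_le_cableScale (t m)) hm
      (hτ.mono ?_)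
    rintro p ⟨h1, h2⟩
    exact ⟨h1, fun h => not_lt.2 h h2⟩

end Small

end CyclicTower


section WildFamily

theorem exists_slot_sequence {d : ℕ} (hd : 0 < d) :
    ∃ s : ℕ → Fin d, ∀ m i, ∃ l, m ≤ l ∧ l ≤ m + d ∧ s l = i := by
  refine ⟨fun m => ⟨m % d, Nat.mod_lt m hd⟩, fun m i => ?_⟩
  have hi := i.2
  have h1 := Nat.div_add_mod m d
  have h2 := Nat.mod_lt m hd
  by_cases h : m % d ≤ i
  · refine ⟨d * (m / d) + i, by omega, by omega, Fin.ext ?_⟩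
    change (d * (m / d) + i) % d = i
    rw [Nat.mul_add_mod, Nat.mod_eq_of_lt hi]
  · refine ⟨d * (m / d) + d + i, by omega, by omega, Fin.ext ?_⟩
    change (d * (m / d) + d + i) % d = i
    rw [add_assoc, Nat.mul_add_mod, Nat.add_mod_left, Nat.mod_eq_of_lt hi]

theorem frequently_unpair_eq (j : ℕ) : ∃ᶠ m in Filter.atTop, (Nat.unpair m).1 = j := by
  rw [Filter.frequently_atTop]
  exact fun a => ⟨Nat.pair j a, Nat.right_le_pair j a, by rw [Nat.unpair_pair]⟩

theorem exists_ring_counts (N : ℕ → Bool → ℕ) : ∃ r : ℕ → ℕ, (∀ m, 13 ≤ r m) ∧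
    (∀ m b, 2 * ringGap (r m) * (N m b + 1) ≤ 1) ∧
    Filter.Tendsto (fun m => 8 * ringGap (r m)) Filter.atTop (𝓝 0) := by
  refine ⟨fun m => 13 + 8 * (N m false + N m true) + m, fun m => by dsimp only; omega, fun m b => ?_,
    ?_⟩
  · have hb : (N m b : ℝ) ≤ N m false + N m true := by
      cases b
      · exact le_add_of_nonneg_right (Nat.cast_nonneg _)
      · exact le_add_of_nonneg_left (Nat.cast_nonneg _)
    have hpi := Real.pi_lt_four
    have hpi0 := Real.pi_pos
    have hN0 : (0 : ℝ) ≤ N m b := Nat.cast_nonneg _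
    have hm0 : (0 : ℝ) ≤ m := Nat.cast_nonneg _
    rw [ringGap, mul_div_assoc', div_mul_eq_mul_div, div_le_one (by positivity)]
    push_cast
    nlinarith
  · have h : Filter.Tendsto (fun m : ℕ => 8 * Real.pi / ((m : ℝ))) Filter.atTop (𝓝 0) :=
      tendsto_const_div_atTop_nhds_zero_nat _
    have hpi0 := Real.pi_pos
    refine squeeze_zero' (Filter.Eventually.of_forall fun m => ?_) ?_ h
    · rw [ringGap]
      positivity
    · filter_upwards [Filter.eventually_gt_atTop 0] with m hm
      have hm' : (0 : ℝ) < m := Nat.cast_pos.2 hm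
      rw [ringGap, mul_div_assoc]
      gcongr
      have := Nat.cast_nonneg (α := ℝ) (N m false)
      have := Nat.cast_nonneg (α := ℝ) (N m true)
      linarith

theorem wildAt_image_iff {M W G : Type*} [TopologicalSpace M] [TopologicalSpace W] [Group G]
    {e : M → W} (he : IsOpenEmbedding e) {K : Set M} {x : M} :
    WildAt G (e '' K) (e x) ↔ WildAt G K x := by
  have : Nonempty M := ⟨x⟩
  constructor
  · intro h
    have h1 := h.map (L := K) (he.toOpenPartialHomeomorph e).symm (by simp) ?_
    · rwa [IsOpenEmbedding.toOpenPartialHomeomorph_left_inv] at h1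
    · intro z hz
      obtain ⟨y, rfl⟩ : z ∈ range e := by simpa using hz
      rw [IsOpenEmbedding.toOpenPartialHomeomorph_left_inv, he.injective.mem_set_image]
  · intro h
    exact h.map (L := e '' K) (he.toOpenPartialHomeomorph e) (mem_univ _)
      fun y _ => he.injective.mem_set_image.symm

/-- A Cantor set carrying a continuous family of disjoint subsets which are everywhere wild, and
which are told apart by the finite groups detecting their wildness. -/
theorem exists_wild_family {n : ℕ} (hn : 3 ≤ n) {W : Type} [NormedAddCommGroup W]
    [NormedSpace ℝ W] [FiniteDimensional ℝ W] (hW : Module.finrank ℝ W = n) :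
    ∃ (K : Set W) (code : W → ℕ → Bool) (k : ℕ → ℕ) (p : ℕ → Bool → ℕ),
      IsCompact K ∧ IsTotallyDisconnected K ∧ ContinuousOn code K ∧ Function.Surjective k ∧
      ∀ s : ℕ → Bool, {x ∈ K | code x = s ∘ k}.Nonempty ∧
        (∀ j, ∀ x ∈ {x ∈ K | code x = s ∘ k},
          WildAt (Matrix.GeneralLinearGroup (Fin 2) (ZMod (p j (s j))))
            {x ∈ K | code x = s ∘ k} x) ∧
        ∀ j x, ¬ WildAt (Matrix.GeneralLinearGroup (Fin 2) (ZMod (p j (!s j))))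
          {x ∈ K | code x = s ∘ k} x := by
  obtain ⟨d, rfl⟩ : ∃ d, n = d + 2 := ⟨n - 2, by omega⟩
  obtain ⟨e, he⟩ := exists_isOpenEmbedding_solidTorus d hW
  obtain ⟨σ, hσ⟩ := exists_slot_sequence (show 0 < d by omega)
  obtain ⟨f, hf, hfd⟩ := exists_primes
  let p : ℕ → Bool → ℕ := fun j b => f (2 * j + b.toNat)
  have hp : ∀ j b, (p j b).Prime ∧ p j b % 4 = 1 := fun j b => hf _
  have hpd : ∀ j b j' b', (j, b) ≠ (j', b') → ¬ p j b ∣ glOrder (p j' b') := by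
    intro j b j' b' h
    refine hfd _ _ fun h' => h ?_
    cases b <;> cases b' <;> simp at h' ⊢ <;> omega
  let k : ℕ → ℕ := fun m => (Nat.unpair m).1
  have hk : Function.Surjective k := fun j => ⟨Nat.pair j 0, by simp [k]⟩
  let N : ℕ → Bool → ℕ := fun m b => 2 * glOrder (p (k m) (!b))
  have hN : ∀ m b, N m b ≠ 0 := by
    intro m b
    have h2 := (hp (k m) (!b)).1.two_le
    rw [show N m b = 2 * glOrder (p (k m) (!b)) from rfl, glOrder_eq (by omega)]
    have : 0 < p (k m) (!b) - 1 := by omega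
    positivity
  have hN2 : ∀ m b, Even (N m b) := fun m b => even_two_mul _
  obtain ⟨r, hr, hrN, hr0⟩ := exists_ring_counts N
  have hA := fun m => isTubeFamily_cyclicTower (s := σ) hN hr m
  set A := cyclicTower hN hr σ with hAdef
  have hsm := smallTower_cyclicTower hN hr hrN hr0 hσ
  have hcK : IsCompact (towerCore Prod.snd A 0) := isCompact_towerCore hA
    isCompact_solidTorus_norm_le 0
  have : Nonempty (SolidTorus d) := ⟨(1, 0)⟩
  let code : W → ℕ → Bool := fun x m => towerCode A m 0 (Function.invFun e x)
  have hcode : ∀ y, code (e y) = fun m => towerCode A m 0 y := by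
    intro y
    funext m
    change towerCode A m 0 (Function.invFun e (e y)) = _
    rw [Function.leftInverse_invFun he.injective y]
  have hKd : IsTotallyDisconnected (e '' towerCore Prod.snd A 0) :=
    he.isEmbedding.isTotallyDisconnected_image.2 (isTotallyDisconnected_towerCore hA hsm)
  refine ⟨e '' towerCore Prod.snd A 0, code, k, p, hcK.image he.continuous, hKd, ?_, hk,
    fun s => ?_⟩
  · refine continuousOn_pi.2 fun m => ?_
    rintro _ ⟨y, hy, rfl⟩
    refine ContinuousAt.continuousWithinAt ?_
    have h : ∀ᶠ q in 𝓝 (e y), code q m = code (e y) m := by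
      rw [← he.map_nhds_eq, Filter.eventually_map]
      filter_upwards [eventually_towerCode_eq hA m 0 hy] with q hq
      rw [hcode, hcode]
      exact hq
    exact continuousAt_const.congr (h.mono fun q hq => hq.symm)
  have hKs : {x ∈ e '' towerCore Prod.snd A 0 | code x = s ∘ k} =
      e '' towerCore Prod.snd (subtower A (s ∘ k)) 0 := by
    ext x
    constructor
    · rintro ⟨⟨y, hy, rfl⟩, h⟩
      refine ⟨y, (mem_subtower_core hA).2 ⟨hy, fun m => ?_⟩, rfl⟩
      rw [hcode] at h
      exact congrFun h m
    · rintro ⟨y, hy, rfl⟩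
      obtain ⟨h1, h2⟩ := (mem_subtower_core hA).1 hy
      refine ⟨⟨y, h1, rfl⟩, ?_⟩
      rw [hcode]
      exact funext h2
  rw [hKs]
  have hsub := isTubeFamily_subtower hA (s ∘ k)
  refine ⟨Nonempty.image e ?_, ?_, ?_⟩
  · have : ∀ m, NeZero (r m) := fun m => ⟨by have := hr m; omega⟩
    exact towerCore_nonempty hsub isCompact_solidTorus_norm_le (x := (1, 0)) (by simp)
  · rintro j _ ⟨y, hy, rfl⟩
    rw [wildAt_image_iff he]
    have hpj := hp j (s j)
    generalize hq : p j (s j) = q at hpj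
    have : Fact q.Prime := ⟨hpj.1⟩
    have h2 : (2 : ZMod q) ≠ 0 := by
      intro h
      have h' : ((2 : ℕ) : ZMod q) = 0 := by exact_mod_cast h
      have h3 := Nat.le_of_dvd (by norm_num) ((ZMod.natCast_eq_zero_iff _ _).1 h')
      have h4 := hpj.1.two_le
      have h5 := hpj.2
      omega
    obtain ⟨i, hi⟩ : ∃ i : ZMod q, i ^ 2 = -1 := by
      obtain ⟨i, hi⟩ := ZMod.exists_sq_eq_neg_one_iff.2 (show q % 4 ≠ 3 by have := hpj.2; omega)
      exact ⟨i, by rw [hi, sq]⟩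
    refine wildAt_subtower hN hr hrN hr0 hσ (s ∘ k) negUnipotent_nonempty
      (one_notMem_negUnipotent h2) (fun m g hg => ?_) hy
    refine exists_commutator_pow hi h2 (hN2 _ _) ?_ hg
    intro h
    rw [ZMod.natCast_eq_zero_iff] at h
    rcases (Nat.Prime.dvd_mul hpj.1).1 h with h | h
    · have h3 := Nat.le_of_dvd (by norm_num) h
      have h4 := hpj.1.two_le
      have h5 := hpj.2
      omega
    · rw [← hq] at h
      refine hpd _ _ _ _ (fun h' => ?_) h
      obtain ⟨h1, h2⟩ := Prod.mk.inj h'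
      rw [h1] at h2
      revert h2
      simp
  · intro j x hx
    obtain ⟨y, hy, rfl⟩ := hx.mem
    rw [wildAt_image_iff he] at hx
    have : Fact (p j (!s j)).Prime := ⟨(hp _ _).1⟩
    refine not_wildAt_subtower hN hr hrN hr0 hσ (s ∘ k) hN2 ?_ he ?_ y hx
    · refine (frequently_unpair_eq j).mono fun m hm g => ?_
      refine pow_glOrder_mul g ?_
      have hm' : k m = j := hm
      change _ ∣ 2 * glOrder (p (k m) (!s (k m)))
      rw [hm']
      exact Nat.dvd_mul_left _ _
    · refine IsCompact.thinSet ?_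
        ((isCompact_towerCore hsub isCompact_solidTorus_norm_le 0).image he.continuous) ?_
      · rw [← Module.finrank_eq_rank, hW]
        exact_mod_cast (by omega : 1 < d + 2)
      · exact fun T hT => hKd T
          (hT.trans (image_mono fun y hy => ((mem_subtower_core hA).1 hy).1))

end WildFamily


section Polyhedra

theorem IsSimplex.exists_functional {m : ℕ} {S : Set (EuclideanSpace ℝ (Fin m))} (hS : IsSimplex S)
    (hi : interior S = ∅) :
    ∃ ℓ : EuclideanSpace ℝ (Fin m) →ₗ[ℝ] ℝ, ℓ ≠ 0 ∧ ∀ x ∈ S, ∀ y ∈ S, ℓ (x - y) = 0 := by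
  obtain ⟨d, v, -, rfl⟩ := hS
  have h1 : affineSpan ℝ (range v) ≠ ⊤ := fun h => by
    have h2 := interior_convexHull_nonempty_iff_affineSpan_eq_top.2 h
    rw [hi] at h2
    exact not_nonempty_empty h2
  have hne : ((affineSpan ℝ (range v) : AffineSubspace ℝ (EuclideanSpace ℝ (Fin m))) :
      Set (EuclideanSpace ℝ (Fin m))).Nonempty := ⟨v 0, mem_affineSpan ℝ (mem_range_self 0)⟩
  have h2 : (affineSpan ℝ (range v)).direction < ⊤ :=
    lt_top_iff_ne_top.2 fun h => h1 ((AffineSubspace.direction_eq_top_iff_of_nonempty hne).1 h)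
  obtain ⟨ℓ, hℓ, hle⟩ := Submodule.exists_le_ker_of_lt_top _ h2
  refine ⟨ℓ, hℓ, fun x hx y hy => hle ?_⟩
  exact AffineSubspace.vsub_mem_direction (convexHull_subset_affineSpan _ hx)
    (convexHull_subset_affineSpan _ hy)

theorem IsSimplex.isClosed {m : ℕ} {S : Set (EuclideanSpace ℝ (Fin m))} (hS : IsSimplex S) :
    IsClosed S := by
  obtain ⟨d, v, -, rfl⟩ := hS
  exact ((finite_range v).isClosed_convexHull ℝ)

/-- A nonempty compact subset of a nowhere dense tame polyhedron is somewhere flat. -/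
theorem exists_flatAt_of_isPolyhedron {M : Type*} [TopologicalSpace M] [T2Space M] {m : ℕ}
    (H : M ≃ₜ EuclideanSpace ℝ (Fin m)) {X K : Set M} (hP : IsPolyhedron (H '' X))
    (hXi : interior X = ∅) (hK : IsCompact K) (hKn : K.Nonempty) (hKX : K ⊆ X) :
    ∃ ℓ : EuclideanSpace ℝ (Fin m) →ₗ[ℝ] ℝ, ℓ ≠ 0 ∧ ∃ x ∈ K, FlatAt (LinearMap.ker ℓ) K x := by
  obtain ⟨k, S, hS, hPS⟩ := hP
  have hSi : ∀ i, interior (S i) = ∅ := by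
    intro i
    refine subset_empty_iff.1 ((interior_mono (t := H '' X) ?_).trans ?_)
    · rw [hPS]
      exact subset_iUnion S i
    · rw [← H.image_interior, hXi, image_empty]
  have : CompactSpace K := isCompact_iff_compactSpace.1 hK
  have : Nonempty K := hKn.to_subtype
  obtain ⟨i, x, hx⟩ := nonempty_interior_of_iUnion_of_closed
    (f := fun i => {x : K | H x ∈ S i})
    (fun i => (hS i).isClosed.preimage (H.continuous.comp continuous_subtype_val)) (by
      refine eq_univ_of_forall fun x => ?_
      have : H x ∈ ⋃ i, S i := hPS ▸ mem_image_of_mem H (hKX x.2)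
      obtain ⟨i, hi⟩ := mem_iUnion.1 this
      exact mem_iUnion.2 ⟨i, hi⟩)
  obtain ⟨T, hTS, hT, hxT⟩ := mem_interior.1 hx
  obtain ⟨O, hO, rfl⟩ := isOpen_induced_iff.1 hT
  obtain ⟨ℓ, hℓ, hℓS⟩ := (hS i).exists_functional (hSi i)
  refine ⟨ℓ, hℓ, x, x.2, ?_⟩
  obtain ⟨v, hv⟩ := LinearMap.surjective hℓ 1
  let L : EuclideanSpace ℝ (Fin m) →L[ℝ] ℝ := LinearMap.toContinuousLinearMap ℓ
  let R : ℝ →L[ℝ] EuclideanSpace ℝ (Fin m) := ContinuousLinearMap.toSpanSingleton ℝ v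
  have hR : Function.RightInverse R L := by
    intro c
    change ℓ (c • v) = c
    rw [map_smul, hv, smul_eq_mul, mul_one]
  let e : EuclideanSpace ℝ (Fin m) ≃ₜ LinearMap.ker ℓ × ℝ :=
    (ContinuousLinearEquiv.equivOfRightInverse L R hR).toHomeomorph.trans
      (Homeomorph.prodComm ℝ (LinearMap.ker ℓ))
  have he : ∀ y, (e y).2 = ℓ y := fun y => rfl
  refine ⟨((H.trans (Homeomorph.subRight (H x))).trans e).toOpenPartialHomeomorph.restrOpen O hO,
    ⟨mem_univ _, hxT⟩, fun y hy hyK => ?_⟩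
  have hyO : y ∈ O := hy.2
  change (e (H y - H x)).2 = 0
  rw [he]
  exact hℓS _ (hTS (show (⟨y, hyK⟩ : K) ∈ Subtype.val ⁻¹' O from hyO)) _ (hTS hxT)

end Polyhedra

section Fence

variable {F : Type*} [NormedAddCommGroup F] [NormedSpace ℝ F]

theorem FlatAt.notMem_interior {M : Type*} [TopologicalSpace M] {X : Set M} {x : M}
    (h : FlatAt F X x) : x ∉ interior X := by
  intro hx
  obtain ⟨φ, hxs, hφ⟩ := h
  have ho : IsOpen (φ '' (φ.source ∩ interior X)) :=
    φ.isOpen_image_of_subset_source (φ.open_source.inter isOpen_interior) inter_subset_left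
  have hi : IsOpen (Prod.snd '' (φ '' (φ.source ∩ interior X))) := isOpenMap_snd _ ho
  have hsub : Prod.snd '' (φ '' (φ.source ∩ interior X)) ⊆ {(0 : ℝ)} := by
    rintro _ ⟨_, ⟨y, hy, rfl⟩, rfl⟩
    exact hφ y hy.1 (interior_subset hy.2)
  have h0 := interior_mono hsub
  rw [hi.interior_eq, interior_singleton] at h0
  exact h0 ⟨_, ⟨x, ⟨hxs, hx⟩, rfl⟩, rfl⟩

theorem interior_eq_empty_of_flatAt {M : Type*} [TopologicalSpace M] {X K : Set M}
    (hKi : interior K = ∅) (h : ∀ x ∈ X, x ∉ K → FlatAt F X x) :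
    interior X = ∅ := by
  refine eq_empty_of_forall_notMem fun x hx => ?_
  obtain ⟨y, hy, hyK⟩ : (interior X \ K).Nonempty := by
    rw [nonempty_iff_ne_empty, Ne, sdiff_eq_empty]
    intro hs
    have := interior_mono hs
    rw [interior_interior, hKi] at this
    exact this hx
  exact (h y (interior_subset hy) hyK).notMem_interior hy

variable {G : Type*} [Group G]

/-- Two fence posts, flat away from a Cantor set `K`, are not related by an ambient embedding,
if their intersections with `K` are told apart by wildness for a group `G`. -/
theorem not_image_subset_of_wildAt [FiniteDimensional ℝ F] (hF : 1 < Module.rank ℝ F)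
    {X Y K : Set (F × ℝ)} (hKd : IsTotallyDisconnected K)
    (hXK : IsCompact (X ∩ K)) (hYK : IsCompact (Y ∩ K)) (hne : (X ∩ K).Nonempty)
    (hX : ∀ x ∈ X ∩ K, WildAt G (X ∩ K) x) (hY : ∀ x, ¬ WildAt G (Y ∩ K) x)
    (hflat : ∀ y ∈ Y, y ∉ K → FlatAt F Y y) (H : F × ℝ ≃ₜ F × ℝ) : ¬ H '' X ⊆ Y := by
  intro hH
  have : ProperSpace F := FiniteDimensional.proper ℝ F
  have hW : ∀ x ∈ X ∩ K, WildAt G (H '' (X ∩ K)) (H x) := fun x hx => (hX x hx).homeomorph H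
  have hcpt : IsCompact (H '' (X ∩ K)) := hXK.image H.continuous
  by_cases h : ∃ x ∈ X ∩ K, H x ∉ K
  · obtain ⟨x, hx, hxK⟩ := h
    have hfl : FlatAt F (H '' (X ∩ K)) (H x) :=
      (hflat _ (hH (mem_image_of_mem H hx.1)) hxK).mono
        ((image_mono inter_subset_left).trans hH)
    refine hfl.not_wildAt hF hcpt ?_ (hW x hx)
    exact H.isEmbedding.isTotallyDisconnected_image.2 fun T hT => hKd T (hT.trans inter_subset_right)
  · push Not at h
    obtain ⟨x, hx⟩ := hne
    have hsub : H '' (X ∩ K) ⊆ Y ∩ K := by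
      rintro _ ⟨y, hy, rfl⟩
      exact ⟨hH (mem_image_of_mem H hy.1), h y hy⟩
    refine hY (H x) ((hW x hx).mono hsub hcpt.isClosed (IsCompact.thinSet ?_ hYK
      fun T hT => hKd T (hT.trans inter_subset_right)))
    refine hF.trans_le ?_
    exact LinearMap.rank_le_of_injective (LinearMap.inl ℝ F ℝ) LinearMap.inl_injective

end Fence


theorem AccPt.range_of_isEmbedding {X Y : Type*} [TopologicalSpace X] [TopologicalSpace Y]
    {f : X → Y} (hf : IsEmbedding f) {x : X} (hx : AccPt x (Filter.principal univ)) :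
    AccPt (f x) (Filter.principal (range f)) := by
  rw [accPt_iff_nhds] at hx ⊢
  intro U hU
  obtain ⟨y, ⟨hy, -⟩, hne⟩ := hx (f ⁻¹' U) (hf.continuous.continuousAt hU)
  exact ⟨f y, ⟨hy, mem_range_self y⟩, fun h => hne (hf.injective h)⟩

/-- The self-map of the Cantor set induced by precomposing binary sequences with `k`. -/
noncomputable def cantorReindex (k : ℕ → ℕ) (s : ↥cantorSet) : ↥cantorSet :=
  cantorSetHomeomorphNatToBool.symm (cantorSetHomeomorphNatToBool s ∘ k)

theorem continuous_cantorReindex (k : ℕ → ℕ) : Continuous (cantorReindex k) := by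
  refine cantorSetHomeomorphNatToBool.symm.continuous.comp (continuous_pi fun i => ?_)
  exact (continuous_apply (k i)).comp cantorSetHomeomorphNatToBool.continuous

theorem injective_cantorReindex {k : ℕ → ℕ} (hk : Function.Surjective k) :
    Function.Injective (cantorReindex k) := by
  intro s t h
  have h1 := cantorSetHomeomorphNatToBool.symm.injective h
  exact cantorSetHomeomorphNatToBool.injective (hk.injective_comp_right h1)

theorem interior_cantorSet : interior cantorSet = ∅ := by
  have : TotallyDisconnectedSpace ↥cantorSet :=
    cantorSetHomeomorphNatToBool.isEmbedding.isTotallyDisconnected_range.1 fun T _ hT =>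
      isTotallyDisconnected_of_totallyDisconnectedSpace univ T (subset_univ T) hT
  exact IsTotallyDisconnected.interior_eq_empty (by simp)
    (totallyDisconnectedSpace_subtype_iff.1 this)

/-- A polyhedron nowhere contains a wild piece: every tame compactum with empty interior is
somewhere locally unlinked on each of its compact totally disconnected pieces. -/
theorem not_isPolyhedron_image_of_wildAt {G : Type*} [Group G] {n : ℕ} (hn : 3 ≤ n)
    {M : Type*} [TopologicalSpace M] [T2Space M] (H : M ≃ₜ EuclideanSpace ℝ (Fin n))
    {X K : Set M} (hXi : interior X = ∅) (hK : IsCompact K) (hKd : IsTotallyDisconnected K)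
    (hKn : K.Nonempty) (hKX : K ⊆ X) (hw : ∀ x ∈ K, WildAt G K x) :
    ¬IsPolyhedron (H '' X) := by
  intro hP
  obtain ⟨ℓ, hℓ, x, hx, hflat⟩ := exists_flatAt_of_isPolyhedron H hP hXi hK hKn hKX
  have hrank : Module.finrank ℝ (LinearMap.ker ℓ) + 1 = n := by
    simpa using Module.Dual.finrank_ker_add_one_of_ne_zero (f := ℓ) hℓ
  have : ProperSpace (LinearMap.ker ℓ) := FiniteDimensional.proper ℝ _
  refine hflat.not_wildAt ?_ hK hKd (hw x hx)
  rw [← Module.finrank_eq_rank]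
  exact_mod_cast (by omega : 1 < Module.finrank ℝ (LinearMap.ker ℓ))

/-- **Theorem 1(ii) (Frolkina).** If in addition `X` is (homeomorphic to) a polyhedron, then the
pairwise ambiently incomparable copies `𝔸(X × {s})`, `s ∈ 𝒞`, are all wild. -/
theorem wild_cantor_fence_polyhedron (n : ℕ) (hn : 3 ≤ n)
    (X : Type) [TopologicalSpace X] [CompactSpace X] [Nonempty X]
    (hperf : Perfect (Set.univ : Set X))
    (hpoly : ∃ (m : ℕ) (P : Set (EuclideanSpace ℝ (Fin m))),
      IsPolyhedron P ∧ Nonempty (X ≃ₜ ↥P))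
    (hemb : ∃ f : X → EuclideanSpace ℝ (Fin (n - 1)), Topology.IsEmbedding f) :
    ∃ 𝔸 : X × ↥cantorSet → EuclideanSpace ℝ (Fin n), Topology.IsEmbedding 𝔸 ∧
      (∀ s : ↥cantorSet, ¬ ∃ h : EuclideanSpace ℝ (Fin n) ≃ₜ EuclideanSpace ℝ (Fin n),
        IsPolyhedron (h '' Set.range (fun x : X => 𝔸 (x, s)))) ∧
      (∀ s t : ↥cantorSet, s ≠ t →
        AmbientlyIncomparable (Set.range (fun x : X => 𝔸 (x, s)))
          (Set.range (fun x : X => 𝔸 (x, t)))) := by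
  let F := EuclideanSpace ℝ (Fin (n - 1))
  obtain ⟨f, hf⟩ : ∃ f : X → F, IsEmbedding f := hemb
  have hFn : Module.finrank ℝ F = n - 1 := finrank_euclideanSpace_fin
  have hFrank : 1 < Module.rank ℝ F := by
    rw [← Module.finrank_eq_rank]
    exact_mod_cast (by omega : 1 < Module.finrank ℝ F)
  have hW : Module.finrank ℝ (F × ℝ) = n := by
    rw [Module.finrank_prod, hFn, Module.finrank_self]
    omega
  have hWrank : 0 < Module.rank ℝ (F × ℝ) := by
    rw [← Module.finrank_eq_rank]
    exact_mod_cast (by omega : 0 < Module.finrank ℝ (F × ℝ))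
  obtain ⟨K, code, k, p, hK, hKd, hcode, hk, hfam⟩ := exists_wild_family hn hW
  set θ := cantorSetHomeomorphNatToBool
  obtain ⟨Φ, hΦc, hΦi, hΦK, hΦflat⟩ := exists_fence (F := F) (X := range f) (C := cantorSet)
    (K := K) (π := fun x => (θ.symm (code x) : ℝ)) hFrank (isCompact_range hf.continuous)
    (range_nonempty f) (forall_mem_range.2 fun x =>
      AccPt.range_of_isEmbedding hf (hperf.acc x (mem_univ x)))
    isCompact_cantorSet interior_cantorSet hK hKd
    (continuous_subtype_val.comp_continuousOn (θ.symm.continuous.comp_continuousOn hcode))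
    (fun x _ => (θ.symm (code x)).2)
  set c := cantorReindex k
  let Y : ↥cantorSet → Set (F × ℝ) := fun s => Φ '' (range f ×ˢ {(c s : ℝ)})
  have hYK : ∀ s, Y s ∩ K = {x ∈ K | code x = θ s ∘ k} := by
    intro s
    ext y
    constructor
    · rintro ⟨⟨⟨a, r⟩, ⟨ha, hr⟩, rfl⟩, hy⟩
      obtain ⟨⟨b, q⟩, ⟨hb, hq⟩, hbq⟩ := hΦK _ hy
      have hr' : r = (c s : ℝ) := hr
      have hq' : q = (θ.symm (code (Φ (a, r))) : ℝ) := hq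
      have h1 := hΦi ⟨hb, by rw [hq']; exact Subtype.coe_prop _⟩
        ⟨ha, by rw [hr']; exact Subtype.coe_prop _⟩ hbq
      have h2 : q = r := congrArg Prod.snd h1
      rw [hq'] at h2
      exact ⟨hy, θ.symm.injective (Subtype.ext (h2.trans hr'))⟩
    · rintro ⟨hy, hys⟩
      refine ⟨?_, hy⟩
      have h1 := hΦK y hy
      rw [hys] at h1
      exact h1
  have hYc : ∀ s, IsCompact (Y s) := fun s =>
    ((isCompact_range hf.continuous).prod isCompact_singleton).image hΦc
  have hYKc : ∀ s, IsCompact (Y s ∩ K) := fun s => (hYc s).inter hK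
  have hYKd : ∀ s, IsTotallyDisconnected (Y s ∩ K) := fun s T hT =>
    hKd T (hT.trans inter_subset_right)
  have hYflat : ∀ s, ∀ y ∈ Y s, y ∉ K → FlatAt F (Y s) y := fun s => hΦflat _ (c s).2
  have hYi : ∀ s, interior (Y s) = ∅ := fun s =>
    interior_eq_empty_of_flatAt (hKd.interior_eq_empty hWrank) (hYflat s)
  let L : (F × ℝ) ≃L[ℝ] EuclideanSpace ℝ (Fin n) :=
    ContinuousLinearEquiv.ofFinrankEq (by rw [hW]; simp)
  have hrange : ∀ s, range (fun x : X => L (Φ (f x, (c s : ℝ)))) = L.toHomeomorph '' Y s := by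
    intro s
    ext y
    constructor
    · rintro ⟨x, rfl⟩
      exact ⟨_, ⟨(f x, _), ⟨mem_range_self x, rfl⟩, rfl⟩, rfl⟩
    · rintro ⟨_, ⟨⟨_, r⟩, ⟨⟨x, rfl⟩, hr⟩, rfl⟩, rfl⟩
      have hr' : r = (c s : ℝ) := hr
      exact ⟨x, by rw [hr']; rfl⟩
  have hnot : ∀ s t, s ≠ t →
      ¬AmbientlyEmbeds (L.toHomeomorph '' Y s) (L.toHomeomorph '' Y t) := by
    rintro s t hst ⟨h, hh⟩
    obtain ⟨j, hj⟩ := Function.ne_iff.1 (θ.injective.ne hst)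
    have hj' : (!θ t j) = θ s j := by
      revert hj
      cases θ s j <;> cases θ t j <;> simp
    have hs := hfam (θ s)
    have ht := hfam (θ t)
    simp only [← hYK] at hs ht
    have htj := ht.2.2 j
    rw [hj'] at htj
    refine not_image_subset_of_wildAt hFrank hKd (hYKc s) (hYKc t) hs.1 (hs.2.1 j) htj
      (hYflat t) ((L.toHomeomorph.trans h).trans L.toHomeomorph.symm) ?_
    rintro _ ⟨y, hy, rfl⟩
    obtain ⟨z, hz, hzy⟩ := hh (mem_image_of_mem h (mem_image_of_mem _ hy))
    change L.toHomeomorph.symm (h (L.toHomeomorph y)) ∈ Y t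
    rw [← hzy, Homeomorph.symm_apply_apply]
    exact hz
  refine ⟨fun q => L (Φ (f q.1, (c q.2 : ℝ))), ?_, fun s => ?_, fun s t hst => ?_⟩
  · have : CompactSpace ↥cantorSet := isCompact_iff_compactSpace.1 isCompact_cantorSet
    refine (Continuous.isClosedEmbedding ?_ ?_).isEmbedding
    · exact L.continuous.comp (hΦc.comp ((hf.continuous.comp continuous_fst).prodMk
        (continuous_subtype_val.comp ((continuous_cantorReindex k).comp continuous_snd))))
    · rintro ⟨x, s⟩ ⟨y, t⟩ h
      have h1 := hΦi ⟨mem_range_self x, (c s).2⟩ ⟨mem_range_self y, (c t).2⟩ (L.injective h)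
      exact Prod.ext (hf.injective (congrArg Prod.fst h1))
        (injective_cantorReindex hk (Subtype.ext (congrArg Prod.snd h1)))
  · rintro ⟨h, hh⟩
    have hs := hfam (θ s)
    simp only [← hYK] at hs
    dsimp only at hh
    rw [hrange, ← image_comp] at hh
    exact not_isPolyhedron_image_of_wildAt hn (L.toHomeomorph.trans h) (hYi s) (hYKc s) (hYKd s)
      hs.1 inter_subset_left (hs.2.1 0) hh
  · dsimp only
    rw [hrange, hrange]
    exact ⟨hnot s t hst, hnot t s hst.symm⟩

end
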